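/- Let n ≥ 2 and let μ be a non-negative Borel measure on the unit sphere S^{n−1} ⊂ ℝ^n such that ∫_{S^{n−1}} X dμ(X) = 0 (as a vector-valued integral) and the support of μ is not contained in any great subsphere of S^{n−1} (i.e., not contained in S^{n−1} ∩ H for any hyperplane H through the origin). Then there exists an open bounded convex set Ω ⊂ ℝ^n such that μ = μ_{τ,Ω}. -/

import Mathlib

open MeasureTheory Metric Set Filter Bornology
open scoped Topology Pointwise RealInnerProductSpace ENNReal NNReal BigOperators Classical

noncomputable section

/-- Euclidean `n`-space. -/
abbrev Euc (n : ℕ) : Type := EuclideanSpace ℝ (Fin n)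

variable {n : ℕ}

/-- The Laplacian of `u`, as the sum of the pure second derivatives in the coordinate
directions. -/
def lapl (u : Euc n → ℝ) (x : Euc n) : ℝ :=
  ∑ i : Fin n, iteratedFDeriv ℝ 2 u x (fun _ => EuclideanSpace.single i (1 : ℝ))

/-- `u` is the torsion function of `Ω`: the solution of `Δu = -2` in `Ω`, `u = 0` on `∂Ω`,
continuous up to the boundary and smooth inside. -/
structure IsTorsionFunction (Ω : Set (Euc n)) (u : Euc n → ℝ) : Prop where
  continuousOn : ContinuousOn u (closure Ω)
  smooth : ContDiffOn ℝ (⊤ : ℕ∞) u Ω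
  lapl_eq : ∀ x ∈ Ω, lapl u x = -2
  boundary_zero : ∀ x ∈ frontier Ω, u x = 0

/-- The torsional rigidity `τ(Ω) = ∫_Ω ‖∇u‖²` where `u` is the torsion function of `Ω`. -/
def torsionRigidity (Ω : Set (Euc n)) : ℝ :=
  if h : ∃ u, IsTorsionFunction Ω u then ∫ x in Ω, ‖gradient h.choose x‖ ^ 2 else 0

/-- The nontangential cone `Γ_α(x̄) = {x ∈ Ω : |x - x̄| ≤ (1+α) dist(x, ∂Ω)}`. -/
def ntCone (Ω : Set (Euc n)) (x : Euc n) (α : ℝ) : Set (Euc n) :=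
  {y ∈ Ω | dist y x ≤ (1 + α) * infDist y (frontier Ω)}

/-- `w` has nontangential limit `L` at the boundary point `x`. -/
def HasNTLimitAt {F : Type*} [TopologicalSpace F] (Ω : Set (Euc n)) (w : Euc n → F)
    (x : Euc n) (L : F) : Prop :=
  ∀ α > 0, Tendsto w (𝓝[ntCone Ω x α] x) (𝓝 L)

/-- The nontangential boundary values of `∇u` (junk value `0` where they do not exist). -/
def ntGradient (Ω : Set (Euc n)) (u : Euc n → ℝ) (x : Euc n) : Euc n :=
  if h : ∃ L, HasNTLimitAt Ω (gradient u) x L then h.choose else 0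

/-- `X` is an outer unit normal to `K` at `x`. -/
def IsOuterNormalAt (K : Set (Euc n)) (x X : Euc n) : Prop :=
  ‖X‖ = 1 ∧ ∀ y ∈ K, ⟪y, X⟫ ≤ ⟪x, X⟫

/-- The Gauss map of `K`: the outer unit normal at the points of `∂K` where it is unique
(i.e. where `∂K` is differentiable), junk value `0` elsewhere. -/
def gaussMap (K : Set (Euc n)) (x : Euc n) : Euc n :=
  if h : ∃! X, IsOuterNormalAt K x X then h.choose else 0

/-- The support function of a set: `h_K(X) = sup_{y ∈ K} ⟨y, X⟩`. -/
def suppFn (K : Set (Euc n)) (X : Euc n) : ℝ :=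
  sSup ((fun y => ⟪y, X⟫) '' K)

/-- The measure `μ_{τ,Ω}(η) = ∫_{ν⁻¹(η)} |∇u|² dH^{n-1}` (as a set function on Borel sets
`η ⊆ S^{n-1}`), where `ν` is the Gauss map and `∇u` is taken in the sense of nontangential
limits. -/
def torsionMeasure (Ω : Set (Euc n)) (u : Euc n → ℝ) (η : Set (Euc n)) : ℝ≥0∞ :=
  ∫⁻ x in frontier Ω ∩ gaussMap (closure Ω) ⁻¹' η,
    ENNReal.ofReal (‖ntGradient Ω u x‖ ^ 2) ∂μH[(n : ℝ) - 1]

/-- The mixed torsional rigidity `τ₁(Ω, Ω') = ∫_{∂Ω} h_{Ω'}(ν(x)) ‖∇u(x)‖² dH^{n-1}(x)`. -/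
def mixedTorsion (Ω Ω' : Set (Euc n)) : ℝ :=
  if h : ∃ u, IsTorsionFunction Ω u then
    ∫ x in frontier Ω,
      suppFn (closure Ω') (gaussMap (closure Ω) x) * ‖ntGradient Ω h.choose x‖ ^ 2
        ∂μH[(n : ℝ) - 1]
  else 0

/-- The Alexandrov body `B[g] = {x : ⟨x, X⟩ ≤ g(X) for all X ∈ S^{n-1}}` of a positive
continuous function `g` on the sphere. -/
def alexandrovBody (g : Euc n → ℝ) : Set (Euc n) :=
  {x | ∀ X ∈ sphere (0 : Euc n) 1, ⟪x, X⟫ ≤ g X}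

/-- The `i`-th standard basis vector of Euclidean space. -/
abbrev bvec (i : Fin n) : Euc n := EuclideanSpace.single i (1 : ℝ)

/-- The `i`-th partial derivative. -/
def pd (i : Fin n) (f : Euc n → ℝ) (x : Euc n) : ℝ := fderiv ℝ f x (bvec i)

lemma pd_congr {f g : Euc n → ℝ} {x : Euc n} (h : f =ᶠ[𝓝 x] g) (i : Fin n) :
    pd i f x = pd i g x := by
  unfold pd; rw [h.fderiv_eq]

lemma pd_contDiffAt {f : Euc n → ℝ} {x : Euc n} {k : ℕ∞} (hf : ContDiffAt ℝ (k + 1 : ℕ∞) f x)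
    (i : Fin n) : ContDiffAt ℝ k (pd i f) x := by
  have : ContDiffAt ℝ k (fderiv ℝ f) x := hf.fderiv_right (by norm_cast)
  exact this.clm_apply contDiffAt_const

lemma pd_contDiff {f : Euc n → ℝ} (hf : ContDiff ℝ (⊤ : ℕ∞) f) (i : Fin n) :
    ContDiff ℝ (⊤ : ℕ∞) (pd i f) := by
  have : ContDiff ℝ (⊤ : ℕ∞) (fderiv ℝ f) := hf.fderiv_right (by norm_cast)
  exact this.clm_apply contDiff_const

lemma lapl_eq_pd {f : Euc n → ℝ} {x : Euc n} (hf : ContDiffAt ℝ 2 f x) :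
    lapl f x = ∑ i, pd i (pd i f) x := by
  unfold lapl
  refine Finset.sum_congr rfl fun i _ => ?_
  rw [iteratedFDeriv_two_apply]
  have hd : DifferentiableAt ℝ (fderiv ℝ f) x :=
    (hf.fderiv_right (m := 1) (by norm_num)).differentiableAt (by norm_num)
  show _ = fderiv ℝ (fun y => fderiv ℝ f y (bvec i)) x (bvec i)
  rw [fderiv_clm_apply hd (differentiableAt_const _)]
  simp

lemma lapl_congr {f g : Euc n → ℝ} {x : Euc n} (h : f =ᶠ[𝓝 x] g) : lapl f x = lapl g x := by
  unfold lapl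
  rw [(Filter.EventuallyEq.iteratedFDeriv ℝ h 2).eq_of_nhds]

lemma pd_differentiableAt {f : Euc n → ℝ} {x : Euc n} (hf : ContDiffAt ℝ 2 f x) (i : Fin n) :
    DifferentiableAt ℝ (pd i f) x :=
  (pd_contDiffAt (k := 1) (by exact_mod_cast hf) i).differentiableAt (by norm_num)

lemma eventually_contDiffAt_two {f : Euc n → ℝ} {x : Euc n} (hf : ContDiffAt ℝ 2 f x) :
    ∀ᶠ y in 𝓝 x, ContDiffAt ℝ 2 f y :=
  hf.eventually (by norm_num)

lemma eventually_differentiableAt_of_two {f : Euc n → ℝ} {x : Euc n} (hf : ContDiffAt ℝ 2 f x) :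
    ∀ᶠ y in 𝓝 x, DifferentiableAt ℝ f y :=
  (eventually_contDiffAt_two hf).mono fun _ h => h.differentiableAt (by norm_num)

lemma pd_add {f g : Euc n → ℝ} {x : Euc n} (hf : DifferentiableAt ℝ f x)
    (hg : DifferentiableAt ℝ g x) (i : Fin n) :
    pd i (fun y => f y + g y) x = pd i f x + pd i g x := by
  unfold pd; rw [fderiv_fun_add hf hg]; rfl

lemma pd_mul {f g : Euc n → ℝ} {x : Euc n} (hf : DifferentiableAt ℝ f x)
    (hg : DifferentiableAt ℝ g x) (i : Fin n) :
    pd i (fun y => f y * g y) x = f x * pd i g x + g x * pd i f x := by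
  unfold pd; rw [fderiv_fun_mul hf hg]; rfl

lemma pd_const (c : ℝ) (i : Fin n) (x : Euc n) : pd i (fun _ => c) x = 0 := by
  unfold pd; simp

lemma pd_const_mul {f : Euc n → ℝ} {x : Euc n} (hf : DifferentiableAt ℝ f x) (c : ℝ)
    (i : Fin n) : pd i (fun y => c * f y) x = c * pd i f x := by
  rw [pd_mul (differentiableAt_const c) hf, pd_const]; ring

lemma lapl_add {f g : Euc n → ℝ} {x : Euc n} (hf : ContDiffAt ℝ 2 f x)
    (hg : ContDiffAt ℝ 2 g x) : lapl (fun y => f y + g y) x = lapl f x + lapl g x := by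
  rw [lapl_eq_pd (hf.add hg), lapl_eq_pd hf, lapl_eq_pd hg, ← Finset.sum_add_distrib]
  refine Finset.sum_congr rfl fun i _ => ?_
  rw [← pd_add (pd_differentiableAt hf i) (pd_differentiableAt hg i)]
  apply pd_congr
  filter_upwards [eventually_differentiableAt_of_two hf, eventually_differentiableAt_of_two hg]
    with y h1 h2 using pd_add h1 h2 i

lemma lapl_mul {f g : Euc n → ℝ} {x : Euc n} (hf : ContDiffAt ℝ 2 f x)
    (hg : ContDiffAt ℝ 2 g x) : lapl (fun y => f y * g y) x =
      f x * lapl g x + g x * lapl f x + 2 * ∑ i, pd i f x * pd i g x := by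
  rw [lapl_eq_pd (hf.mul hg), lapl_eq_pd hf, lapl_eq_pd hg, Finset.mul_sum, Finset.mul_sum,
    Finset.mul_sum, ← Finset.sum_add_distrib, ← Finset.sum_add_distrib]
  refine Finset.sum_congr rfl fun i _ => ?_
  have hfd := hf.differentiableAt (by norm_num)
  have hgd := hg.differentiableAt (by norm_num)
  have e : pd i (fun y => f y * g y) =ᶠ[𝓝 x] fun y => f y * pd i g y + g y * pd i f y := by
    filter_upwards [eventually_differentiableAt_of_two hf, eventually_differentiableAt_of_two hg]
      with y h1 h2 using pd_mul h1 h2 i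
  rw [pd_congr e, pd_add (hfd.fun_mul (pd_differentiableAt hg i))
    (hgd.fun_mul (pd_differentiableAt hf i)),
    pd_mul hfd (pd_differentiableAt hg i), pd_mul hgd (pd_differentiableAt hf i)]
  ring

lemma lapl_const (c : ℝ) (x : Euc n) : lapl (fun _ => c) x = 0 := by
  rw [lapl_eq_pd contDiffAt_const]
  have : ∀ i, pd i (fun _ : Euc n => c) = fun _ => 0 := fun i => funext fun y => pd_const c i y
  simp [this, pd_const]

lemma lapl_const_mul {f : Euc n → ℝ} {x : Euc n} (hf : ContDiffAt ℝ 2 f x) (c : ℝ) :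
    lapl (fun y => c * f y) x = c * lapl f x := by
  rw [lapl_mul contDiffAt_const hf, lapl_const]; simp [pd_const]

lemma lapl_sub {f g : Euc n → ℝ} {x : Euc n} (hf : ContDiffAt ℝ 2 f x)
    (hg : ContDiffAt ℝ 2 g x) : lapl (fun y => f y - g y) x = lapl f x - lapl g x := by
  have := lapl_add hf (contDiffAt_const.mul hg : ContDiffAt ℝ 2 (fun y => (-1 : ℝ) * g y) x)
  rw [lapl_const_mul hg] at this
  rw [sub_eq_add_neg, ← neg_one_mul (lapl g x), ← this]
  congr 1; ext y; ring

/-- Affine functions. -/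
lemma pd_inner (X : Euc n) (b : ℝ) (i : Fin n) (x : Euc n) :
    pd i (fun y => b - ⟪y, X⟫) x = - X i := by
  unfold pd
  have h : HasFDerivAt (fun y : Euc n => b - ⟪y, X⟫) (-(innerSL ℝ X)) x := by
    have := ((innerSL ℝ X).hasFDerivAt (x := x)).const_sub b
    refine this.congr_of_eventuallyEq (Eventually.of_forall fun y => ?_)
    simp [real_inner_comm]
  rw [h.fderiv]
  simp [EuclideanSpace.inner_single_right]

lemma contDiff_affine (X : Euc n) (b : ℝ) {k : WithTop ℕ∞} :
    ContDiff ℝ k (fun y : Euc n => b - ⟪y, X⟫) :=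
  contDiff_const.sub (contDiff_id.inner ℝ contDiff_const)

lemma contDiff_normSq_sub (p : Euc n) {k : WithTop ℕ∞} :
    ContDiff ℝ k (fun y : Euc n => ‖y - p‖ ^ 2) :=
  (contDiff_id.sub contDiff_const).norm_sq ℝ

lemma lapl_inner (X : Euc n) (b : ℝ) (x : Euc n) : lapl (fun y => b - ⟪y, X⟫) x = 0 := by
  rw [lapl_eq_pd (contDiff_affine X b).contDiffAt]
  refine Finset.sum_eq_zero fun i _ => ?_
  have : pd i (fun y => b - ⟪y, X⟫) = fun _ => - X i := funext fun y => pd_inner X b i y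
  rw [this, pd_const]

lemma sum_mul_eq_inner (x y : Euc n) : ∑ i, x i * y i = ⟪x, y⟫ := by
  rw [PiLp.inner_apply]
  exact Finset.sum_congr rfl fun i _ => by simp [mul_comm]

lemma lapl_comp {F : ℝ → ℝ} {q : Euc n → ℝ} {x : Euc n} (hF : ContDiff ℝ 2 F)
    (hq : ContDiffAt ℝ 2 q x) :
    lapl (fun y => F (q y)) x =
      deriv F (q x) * lapl q x + deriv (deriv F) (q x) * ∑ i, pd i q x ^ 2 := by
  have hFq : ContDiffAt ℝ 2 (fun y => F (q y)) x := hF.contDiffAt.comp x hq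
  have hF' : ContDiff ℝ 1 (deriv F) := hF.deriv'
  rw [lapl_eq_pd hFq, lapl_eq_pd hq, Finset.mul_sum, Finset.mul_sum, ← Finset.sum_add_distrib]
  refine Finset.sum_congr rfl fun i _ => ?_
  have comp : ∀ (G : ℝ → ℝ) (y : Euc n), DifferentiableAt ℝ G (q y) → DifferentiableAt ℝ q y →
      pd i (fun z => G (q z)) y = deriv G (q y) * pd i q y := by
    intro G y hG hqy
    unfold pd
    have := (hG.hasDerivAt.comp_hasFDerivAt y hqy.hasFDerivAt).fderiv
    simp only [Function.comp_def] at this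
    rw [this]; simp
  have hqd := hq.differentiableAt (by norm_num)
  have e : pd i (fun y => F (q y)) =ᶠ[𝓝 x] fun y => deriv F (q y) * pd i q y := by
    filter_upwards [eventually_differentiableAt_of_two hq] with y hy
    exact comp F y (hF.differentiable (by norm_num) _) hy
  have hd1 : DifferentiableAt ℝ (deriv F) (q x) := hF'.differentiable (by norm_num) _
  rw [pd_congr e, pd_mul (f := fun y => deriv F (q y)) (hd1.comp x hqd) (pd_differentiableAt hq i),
    comp _ _ hd1 hqd]
  ring

lemma pd_normSq (p : Euc n) (i : Fin n) (x : Euc n) :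
    pd i (fun y => ‖y - p‖ ^ 2) x = 2 * (x - p) i := by
  unfold pd
  have h := ((hasFDerivAt_id (𝕜 := ℝ) x).sub_const p).norm_sq
  have h2 : fderiv ℝ (fun y => ‖y - p‖ ^ 2) x = _ := h.fderiv
  rw [h2]
  simp [EuclideanSpace.inner_single_right]

lemma lapl_normSq (p x : Euc n) : lapl (fun y => ‖y - p‖ ^ 2) x = 2 * n := by
  rw [lapl_eq_pd (contDiff_normSq_sub p).contDiffAt]
  have : ∀ i, pd i (pd i (fun y : Euc n => ‖y - p‖ ^ 2)) x = 2 := by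
    intro i
    have e : pd i (fun y : Euc n => ‖y - p‖ ^ 2) =
        fun y => -2 * (p i - ⟪y, bvec i⟫) := by
      ext y; rw [pd_normSq]; simp [EuclideanSpace.inner_single_right]; ring
    rw [e, pd_const_mul ((contDiff_affine (k := 1) _ _).differentiable (by norm_num) _), pd_inner]
    simp
  simp [this, mul_comm]

/-- Second derivative test. -/
lemma deriv_deriv_nonpos_of_isLocalMax {f : ℝ → ℝ} {a : ℝ} (hf : ContDiffAt ℝ 2 f a)
    (hmax : IsLocalMax f a) : deriv (deriv f) a ≤ 0 := by
  by_contra hpos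
  push Not at hpos
  have hmin : IsLocalMin f a := isLocalMin_of_deriv_deriv_pos hpos hmax.deriv_eq_zero
    hf.continuousAt
  have hconst : f =ᶠ[𝓝 a] fun _ => f a := by
    filter_upwards [hmax, hmin] with y h1 h2 using le_antisymm h1 h2
  have h1 : deriv f =ᶠ[𝓝 a] fun _ => 0 := by
    filter_upwards [hconst.eventuallyEq_nhds] with y hy
    rw [hy.deriv_eq]; simp
  rw [h1.deriv_eq] at hpos
  simp at hpos

lemma lapl_nonpos_of_isLocalMax {f : Euc n → ℝ} {x : Euc n} (hf : ContDiffAt ℝ 2 f x)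
    (hmax : IsLocalMax f x) : lapl f x ≤ 0 := by
  rw [lapl_eq_pd hf]
  refine Finset.sum_nonpos fun i _ => ?_
  set L : ℝ → Euc n := fun t => x + t • bvec i with hL
  have hLd : ∀ t, HasDerivAt L (bvec i) t := fun t => by
    have := ((hasDerivAt_id t).smul_const (bvec i)).const_add x
    rwa [one_smul] at this
  have hL0 : L 0 = x := by simp [hL]
  have hLc : ContDiff ℝ 2 L := by fun_prop
  have hLt : Tendsto L (𝓝 0) (𝓝 x) := by
    have := (hLd 0).continuousAt.tendsto; rwa [hL0] at this
  have hline : ∀ (G : Euc n → ℝ) (t : ℝ), DifferentiableAt ℝ G (L t) →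
      deriv (fun s => G (L s)) t = pd i G (L t) := fun G t hG =>
    (hG.hasFDerivAt.comp_hasDerivAt t (hLd t)).deriv
  have e1 : deriv (fun s => f (L s)) =ᶠ[𝓝 0] fun t => pd i f (L t) := by
    filter_upwards [hLt.eventually (eventually_differentiableAt_of_two hf)] with t ht
    exact hline f t ht
  have e2 : deriv (deriv (fun s => f (L s))) 0 = pd i (pd i f) x := by
    rw [e1.deriv_eq, hline _ 0 (by rw [hL0]; exact pd_differentiableAt hf i), hL0]
  rw [← e2]
  apply deriv_deriv_nonpos_of_isLocalMax
  · exact ContDiffAt.comp 0 (by rwa [hL0]) hLc.contDiffAt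
  · have := hLt.eventually hmax
    filter_upwards [this] with t ht
    rw [hL0]; exact ht

/-- The weak maximum principle. -/
theorem weak_max_principle (hn : 0 < n) {D : Set (Euc n)} (hD : IsOpen D) (hb : IsBounded D)
    {v : Euc n → ℝ} (hc : ContinuousOn v (closure D)) (hv : ∀ x ∈ D, ContDiffAt ℝ 2 v x)
    (hl : ∀ x ∈ D, 0 ≤ lapl v x) (hbd : ∀ x ∈ frontier D, v x ≤ 0) : ∀ x ∈ D, v x ≤ 0 := by
  intro x hx
  obtain ⟨R, hR⟩ := hb.subset_closedBall 0
  have hRc : closure D ⊆ closedBall 0 R := closure_minimal hR isClosed_closedBall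
  have key : ∀ ε > 0, v x ≤ ε * R ^ 2 := by
    intro ε hε
    set w : Euc n → ℝ := fun y => v y + ε * ‖y - 0‖ ^ 2 with hw
    have hwc : ContinuousOn w (closure D) := hc.add (by fun_prop)
    have hcomp : IsCompact (closure D) := Metric.isCompact_of_isClosed_isBounded isClosed_closure
      hb.closure
    obtain ⟨z, hz, hzmax⟩ := hcomp.exists_isMaxOn ⟨x, subset_closure hx⟩ hwc
    have hzf : z ∈ frontier D := by
      rw [frontier, hD.interior_eq]
      refine ⟨hz, fun hzD => ?_⟩
      have hq : ContDiffAt ℝ 2 (fun y : Euc n => ‖y - 0‖ ^ 2) z :=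
        (contDiff_normSq_sub 0).contDiffAt
      have h1 := lapl_nonpos_of_isLocalMax ((hv z hzD).add (contDiffAt_const.mul hq))
        ((hzmax.on_subset subset_closure).isLocalMax (hD.mem_nhds hzD))
      rw [lapl_add (hv z hzD) (contDiffAt_const.mul hq), lapl_const_mul hq, lapl_normSq] at h1
      have h2 := hl z hzD
      have : 0 < ε * (2 * n) := by positivity
      linarith
    have h1 : w x ≤ w z := hzmax (subset_closure hx)
    have h2 : ‖z - 0‖ ≤ R := by simpa using hRc hz
    have h3 : ‖z - 0‖ ^ 2 ≤ R ^ 2 := by gcongr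
    have h4 := hbd z hzf
    have h5 : 0 ≤ ε * ‖x - 0‖ ^ 2 := by positivity
    simp only [hw] at h1
    nlinarith
  refine le_of_forall_pos_le_add fun δ hδ => ?_
  have := key (δ / (R ^ 2 + 1)) (by positivity)
  refine this.trans ?_
  rw [zero_add, div_mul_eq_mul_div, div_le_iff₀ (by positivity)]
  nlinarith

/-! ### The radial averaging kernel -/

/-- The radial primitive of the averaging kernel. -/
def preKer (y : Euc n) : ℝ := expNegInvGlue (1 - ‖y‖ ^ 2)

/-- The unnormalised averaging kernel, satisfying `∇ preKer y = - ker₀ y • y`. -/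
def ker₀ (y : Euc n) : ℝ := 2 * ((1 - ‖y‖ ^ 2)⁻¹ ^ 2 * expNegInvGlue (1 - ‖y‖ ^ 2))

lemma contDiff_one_sub_normSq {k : WithTop ℕ∞} : ContDiff ℝ k (fun y : Euc n => 1 - ‖y‖ ^ 2) :=
  contDiff_const.sub (contDiff_norm_sq ℝ)

lemma contDiff_preKer : ContDiff ℝ (⊤ : ℕ∞) (preKer (n := n)) :=
  expNegInvGlue.contDiff.comp contDiff_one_sub_normSq

lemma contDiff_ker₀ : ContDiff ℝ (⊤ : ℕ∞) (ker₀ (n := n)) := by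
  have h := expNegInvGlue.contDiff_polynomial_eval_inv_mul (n := ⊤) (Polynomial.X ^ 2)
  have h2 := contDiff_const (c := (2 : ℝ)).mul (h.comp (contDiff_one_sub_normSq (n := n)))
  have h3 : (ker₀ (n := n)) = fun y => 2 * ((fun t => Polynomial.eval t⁻¹ (Polynomial.X ^ 2) *
      expNegInvGlue t) ∘ fun y : Euc n => 1 - ‖y‖ ^ 2) y := by
    ext y; simp [ker₀]
  rw [h3]; exact h2

lemma preKer_nonneg (y : Euc n) : 0 ≤ preKer y := expNegInvGlue.nonneg _

lemma ker₀_nonneg (y : Euc n) : 0 ≤ ker₀ y := by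
  have := expNegInvGlue.nonneg (1 - ‖y‖ ^ 2)
  unfold ker₀; positivity

lemma preKer_eq_zero {y : Euc n} (hy : 1 < ‖y‖) : preKer y = 0 :=
  expNegInvGlue.zero_of_nonpos (by nlinarith)

lemma ker₀_eq_zero {y : Euc n} (hy : 1 < ‖y‖) : ker₀ y = 0 := by
  unfold ker₀; rw [expNegInvGlue.zero_of_nonpos (by nlinarith)]; ring

lemma hasDerivAt_expNegInvGlue (t : ℝ) :
    HasDerivAt expNegInvGlue (t⁻¹ ^ 2 * expNegInvGlue t) t := by
  have := expNegInvGlue.hasDerivAt_polynomial_eval_inv_mul 1 t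
  simpa using this

lemma pd_preKer (i : Fin n) (y : Euc n) : pd i preKer y = - (ker₀ y * y i) := by
  unfold pd
  have h1 : HasFDerivAt (fun y : Euc n => 1 - ‖y‖ ^ 2) _ y :=
    ((hasFDerivAt_id (𝕜 := ℝ) y).norm_sq).const_sub 1
  have h : HasFDerivAt (preKer (n := n)) _ y :=
    (hasDerivAt_expNegInvGlue (1 - ‖y‖ ^ 2)).comp_hasFDerivAt y h1
  rw [h.fderiv]
  simp [EuclideanSpace.inner_single_right, ker₀]
  ring

lemma integrable_of_vanish {f : Euc n → ℝ} (hf : Continuous f)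
    (hs : ∀ y, 1 < ‖y‖ → f y = 0) : Integrable f :=
  hf.integrable_of_hasCompactSupport
    (HasCompactSupport.intro (isCompact_closedBall (0 : Euc n) 1)
      fun y hy => hs y (by simpa using hy))

lemma tsupport_subset_of_vanish {f : Euc n → ℝ} (hs : ∀ y, 1 < ‖y‖ → f y = 0) :
    tsupport f ⊆ closedBall (0 : Euc n) 1 :=
  closure_minimal (fun y hy => by
    by_contra h
    exact hy (hs y (by simpa using h))) isClosed_closedBall

lemma continuous_mul_of_vanish {f g : Euc n → ℝ} (hf : Continuous f)
    (hs : ∀ y, 1 < ‖y‖ → f y = 0) (hg : ∀ y, ‖y‖ ≤ 1 → ContinuousAt g y) :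
    Continuous (fun y => f y * g y) := by
  apply continuous_of_tsupport
  intro y hy
  have : y ∈ closedBall (0 : Euc n) 1 := tsupport_subset_of_vanish
    (f := fun y => f y * g y) (fun z hz => by simp [hs z hz]) hy
  exact hf.continuousAt.mul (hg y (by simpa using this))

lemma integrable_mul_of_vanish {f g : Euc n → ℝ} (hf : Continuous f)
    (hs : ∀ y, 1 < ‖y‖ → f y = 0) (hg : ∀ y, ‖y‖ ≤ 1 → ContinuousAt g y) :
    Integrable (fun y => f y * g y) :=
  integrable_of_vanish (continuous_mul_of_vanish hf hs hg) fun y hy => by simp [hs y hy]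

lemma integral_ker₀_pos : 0 < ∫ y : Euc n, ker₀ y := by
  apply contDiff_ker₀.continuous.integral_pos_of_hasCompactSupport_nonneg_nonzero
    (HasCompactSupport.intro (isCompact_closedBall (0 : Euc n) 1)
      fun y hy => ker₀_eq_zero (by simpa using hy)) ker₀_nonneg (x := 0)
  have := expNegInvGlue.pos_of_pos (x := 1) one_pos
  simp [ker₀]

lemma integral_preKer_pos : 0 < ∫ y : Euc n, preKer y := by
  apply contDiff_preKer.continuous.integral_pos_of_hasCompactSupport_nonneg_nonzero
    (HasCompactSupport.intro (isCompact_closedBall (0 : Euc n) 1)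
      fun y hy => preKer_eq_zero (by simpa using hy)) preKer_nonneg (x := 0)
  simp [preKer]

/-- The normalised averaging kernel. -/
def mker (y : Euc n) : ℝ := ker₀ y / ∫ z : Euc n, ker₀ z

/-- Its normalised radial primitive. -/
def pker (y : Euc n) : ℝ := preKer y / ∫ z : Euc n, ker₀ z

/-- The second-order constant of the averaging kernel. -/
def kap (n : ℕ) : ℝ := ∫ y : Euc n, pker y

lemma contDiff_ker : ContDiff ℝ (⊤ : ℕ∞) (mker (n := n)) := contDiff_ker₀.div_const _
lemma contDiff_pker : ContDiff ℝ (⊤ : ℕ∞) (pker (n := n)) := contDiff_preKer.div_const _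
lemma ker_nonneg (y : Euc n) : 0 ≤ mker y := div_nonneg (ker₀_nonneg y) integral_ker₀_pos.le
lemma pker_nonneg (y : Euc n) : 0 ≤ pker y := div_nonneg (preKer_nonneg y) integral_ker₀_pos.le
lemma ker_eq_zero {y : Euc n} (hy : 1 < ‖y‖) : mker y = 0 := by simp [mker, ker₀_eq_zero hy]
lemma pker_eq_zero {y : Euc n} (hy : 1 < ‖y‖) : pker y = 0 := by simp [pker, preKer_eq_zero hy]
lemma ker_neg (y : Euc n) : mker (-y) = mker y := by simp [mker, ker₀]
lemma integral_ker : ∫ y : Euc n, mker y = 1 := by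
  simp only [mker]; rw [integral_div, div_self integral_ker₀_pos.ne']
lemma kap_pos : 0 < kap n := by
  simp only [kap, pker]; rw [integral_div]; exact div_pos integral_preKer_pos integral_ker₀_pos
lemma integrable_ker : Integrable (mker (n := n)) :=
  integrable_of_vanish contDiff_ker.continuous fun _ => ker_eq_zero
lemma integrable_pker : Integrable (pker (n := n)) :=
  integrable_of_vanish contDiff_pker.continuous fun _ => pker_eq_zero

lemma pd_pker (i : Fin n) (y : Euc n) : pd i pker y = - (mker y * y i) := by
  have : pker (n := n) = fun y => (∫ z : Euc n, ker₀ z)⁻¹ * preKer y := by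
    ext y; rw [pker, div_eq_inv_mul]
  rw [this, pd_const_mul (contDiff_preKer.differentiable (by simp) y), pd_preKer, mker]
  ring

/-- The average of `w` at scale `s`. -/
def avg (s : ℝ) (w : Euc n → ℝ) (x : Euc n) : ℝ := ∫ y, mker y * w (x + s • y)

lemma avg_zero (w : Euc n → ℝ) (x : Euc n) : avg 0 w x = w x := by
  simp [avg, integral_mul_const, integral_ker]

lemma fderiv_apply_eq_sum (f : Euc n → ℝ) (x y : Euc n) :
    fderiv ℝ f x y = ∑ i, y i * pd i f x := by
  conv_lhs => rw [← (EuclideanSpace.basisFun (Fin n) ℝ).sum_repr y]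
  simp [pd]

lemma pd_comp_affine {f : Euc n → ℝ} {x y : Euc n} {s : ℝ}
    (hf : DifferentiableAt ℝ f (x + s • y)) (i : Fin n) :
    pd i (fun z => f (x + s • z)) y = s * pd i f (x + s • y) := by
  have h1 : HasFDerivAt (fun z : Euc n => x + s • z) (s • ContinuousLinearMap.id ℝ (Euc n)) y :=
    ((hasFDerivAt_id y).const_smul s).const_add x
  have := hf.hasFDerivAt.comp y h1
  unfold pd
  simp only [Function.comp_def] at this
  rw [this.fderiv]; simp

lemma norm_smul_lt {r s : ℝ} (hs : |s| < r) {y : Euc n} (hy : ‖y‖ ≤ 1) : ‖s • y‖ < r := by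
  rw [norm_smul, Real.norm_eq_abs]
  calc |s| * ‖y‖ ≤ |s| * 1 := by gcongr
    _ < r := by linarith

lemma add_smul_mem_ball {x : Euc n} {r s : ℝ} (hs : |s| < r) {y : Euc n} (hy : ‖y‖ ≤ 1) :
    x + s • y ∈ ball x r := by
  rw [mem_ball_iff_norm, add_sub_cancel_left]; exact norm_smul_lt hs hy

lemma integral_ker_fderiv {w : Euc n → ℝ} {x : Euc n} {r s : ℝ}
    (hw : ∀ z ∈ ball x r, ContDiffAt ℝ 2 w z) (hs : |s| < r) :
    ∫ y, mker y * fderiv ℝ w (x + s • y) y = s * ∫ y, pker y * lapl w (x + s • y) := by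
  have hz : ∀ y : Euc n, ‖y‖ ≤ 1 → ContDiffAt ℝ 2 w (x + s • y) := fun y hy =>
    hw _ (add_smul_mem_ball hs hy)
  have hpc : ∀ i (y : Euc n), ‖y‖ ≤ 1 → ContDiffAt ℝ 1 (fun y => pd i w (x + s • y)) y := by
    intro i y hy
    have := pd_contDiffAt (k := 1) (f := w) (x := x + s • y) (by exact_mod_cast hz y hy) i
    exact ContDiffAt.comp (f := fun y : Euc n => x + s • y) y this (by fun_prop)
  have hpc0 : ∀ i (y : Euc n), ‖y‖ ≤ 1 → ContinuousAt (fun y => pd i w (x + s • y)) y :=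
    fun i y hy => (hpc i y hy).continuousAt
  have hpp : ∀ i (y : Euc n), ‖y‖ ≤ 1 → ContinuousAt (fun y => pd i (pd i w) (x + s • y)) y := by
    intro i y hy
    have h1 := pd_contDiffAt (k := 1) (f := w) (x := x + s • y) (by exact_mod_cast hz y hy) i
    have h2 := (pd_contDiffAt (k := 0) (f := pd i w) (by simpa using h1) i).continuousAt
    exact ContinuousAt.comp (f := fun y : Euc n => x + s • y) h2 (by fun_prop)
  have hkc : ∀ i, Continuous (fun y : Euc n => mker y * y i) := fun i =>
    contDiff_ker.continuous.mul (by fun_prop)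
  have hkv : ∀ i, ∀ y : Euc n, 1 < ‖y‖ → mker y * y i = 0 := fun i y hy => by simp [ker_eq_zero hy]
  have hI1 : ∀ i, Integrable (fun y : Euc n => mker y * y i * pd i w (x + s • y)) := fun i =>
    integrable_mul_of_vanish (hkc i) (hkv i) (hpc0 i)
  have hI2 : ∀ i, Integrable (fun y : Euc n => pker y * pd i (pd i w) (x + s • y)) := fun i =>
    integrable_mul_of_vanish contDiff_pker.continuous (fun _ => pker_eq_zero) (hpp i)
  have e1 : ∀ y : Euc n, mker y * fderiv ℝ w (x + s • y) y =
      ∑ i, mker y * y i * pd i w (x + s • y) := fun y => by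
    rw [fderiv_apply_eq_sum, Finset.mul_sum]
    exact Finset.sum_congr rfl fun i _ => by ring
  have e2 : ∀ y : Euc n, pker y * lapl w (x + s • y) =
      ∑ i, pker y * pd i (pd i w) (x + s • y) := fun y => by
    by_cases hy : ‖y‖ ≤ 1
    · rw [lapl_eq_pd (hz y hy), Finset.mul_sum]
    · simp [pker_eq_zero (not_le.1 hy)]
  simp only [e1, e2]
  rw [integral_finsetSum _ fun i _ => hI1 i, integral_finsetSum _ fun i _ => hI2 i,
    Finset.mul_sum]
  refine Finset.sum_congr rfl fun i _ => ?_
  have hder : ∀ y : Euc n, pker y * fderiv ℝ (fun y => pd i w (x + s • y)) y (bvec i) =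
      s * (pker y * pd i (pd i w) (x + s • y)) := fun y => by
    by_cases hy : ‖y‖ ≤ 1
    · have := pd_comp_affine (pd_differentiableAt (hz y hy) i) i
      unfold pd at this ⊢
      rw [this]; ring
    · simp [pker_eq_zero (not_le.1 hy)]
  have hder2 : ∀ y : Euc n, fderiv ℝ pker y (bvec i) * pd i w (x + s • y) =
      - (mker y * y i * pd i w (x + s • y)) := fun y => by
    have := pd_pker i y
    unfold pd at this ⊢
    rw [this]; ring
  have := integral_mul_fderiv_eq_neg_fderiv_mul_of_integrable (μ := (volume : Measure (Euc n)))
    (f := pker) (g := fun y => pd i w (x + s • y)) (v := bvec i)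
    (by simp only [hder2]; exact (hI1 i).neg) (by simp only [hder]; exact (hI2 i).const_mul s)
    (integrable_mul_of_vanish contDiff_pker.continuous (fun _ => pker_eq_zero) (hpc0 i))
    (fun y _ => contDiff_pker.differentiable (by simp) y)
    (fun y hy => (hpc i y (by
      simpa using tsupport_subset_of_vanish (fun _ => pker_eq_zero) hy)).differentiableAt
        (by norm_num))
  simp only [hder, hder2] at this
  rw [integral_neg, neg_neg, integral_const_mul] at this
  exact this.symm

lemma hasDerivAt_avg {w : Euc n → ℝ} {x : Euc n} {r s : ℝ}
    (hw : ∀ z ∈ ball x r, ContDiffAt ℝ 2 w z) (hs : |s| < r) :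
    HasDerivAt (fun t => avg t w x) (s * ∫ y, pker y * lapl w (x + s • y)) s := by
  rw [← integral_ker_fderiv hw hs]
  obtain ⟨r', hsr', hr'⟩ := exists_between hs
  have hr'0 : 0 < r' := (abs_nonneg s).trans_lt hsr'
  have hfc : ContinuousOn (fderiv ℝ w) (closedBall x r') := fun z hz =>
    (((hw z (closedBall_subset_ball hr' hz)).fderiv_right (m := 1)
      (by norm_num)).continuousAt).continuousWithinAt
  obtain ⟨C, hC⟩ := (isCompact_closedBall x r').exists_bound_of_continuousOn hfc
  have hwc : ∀ t : ℝ, |t| < r → ∀ y : Euc n, ‖y‖ ≤ 1 →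
      ContinuousAt (fun y => w (x + t • y)) y := fun t ht y hy =>
    ContinuousAt.comp (f := fun y : Euc n => x + t • y)
      (hw _ (add_smul_mem_ball ht hy)).continuousAt (by fun_prop)
  have hU : {t : ℝ | |t| < r'} ∈ 𝓝 s := (isOpen_lt continuous_abs continuous_const).mem_nhds hsr'
  refine (hasDerivAt_integral_of_dominated_loc_of_deriv_le (𝕜 := ℝ)
    (F := fun t (y : Euc n) => mker y * w (x + t • y))
    (F' := fun t (y : Euc n) => mker y * fderiv ℝ w (x + t • y) y) (bound := fun y => mker y * C)
    hU ?_ ?_ ?_ ?_ (integrable_ker.mul_const C) ?_).2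
  · filter_upwards [hU] with t ht
    exact (continuous_mul_of_vanish contDiff_ker.continuous (fun _ => ker_eq_zero)
      (hwc t (lt_trans ht hr'))).aestronglyMeasurable
  · exact integrable_mul_of_vanish contDiff_ker.continuous (fun _ => ker_eq_zero) (hwc s hs)
  · refine (continuous_mul_of_vanish contDiff_ker.continuous (fun _ => ker_eq_zero)
      fun y hy => ?_).aestronglyMeasurable
    have h1 : ContinuousAt (fderiv ℝ w) (x + s • y) :=
      ((hw _ (add_smul_mem_ball hs hy)).fderiv_right (m := 1) (by norm_num)).continuousAt
    exact (ContinuousAt.comp (f := fun y : Euc n => x + s • y) h1 (by fun_prop)).clm_apply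
      continuousAt_id
  · refine Eventually.of_forall fun y t ht => ?_
    by_cases hy : ‖y‖ ≤ 1
    · rw [norm_mul, Real.norm_of_nonneg (ker_nonneg y)]
      have hb := hC _ (ball_subset_closedBall (add_smul_mem_ball (x := x) ht hy))
      refine mul_le_mul_of_nonneg_left ?_ (ker_nonneg y)
      calc _ ≤ ‖fderiv ℝ w (x + t • y)‖ * ‖y‖ := ContinuousLinearMap.le_opNorm _ _
        _ ≤ C * 1 := mul_le_mul hb hy (norm_nonneg _) ((norm_nonneg _).trans hb)
        _ = C := mul_one C
    · simp [ker_eq_zero (not_le.1 hy)]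
  · refine Eventually.of_forall fun y t ht => ?_
    by_cases hy : ‖y‖ ≤ 1
    · have h1 : HasDerivAt (fun t : ℝ => x + t • y) y t := by
        have := ((hasDerivAt_id t).smul_const y).const_add x
        rwa [one_smul] at this
      have h2 := (hw _ (add_smul_mem_ball (lt_trans ht hr') hy)).differentiableAt (by norm_num)
      exact (h2.hasFDerivAt.comp_hasDerivAt t h1).const_mul (mker y)
    · simpa [ker_eq_zero (not_le.1 hy)] using hasDerivAt_const t (0 : ℝ)

lemma continuousAt_lapl {w : Euc n → ℝ} {x : Euc n} (hw : ContDiffAt ℝ 2 w x) :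
    ContinuousAt (lapl w) x := by
  have e : lapl w =ᶠ[𝓝 x] fun y => ∑ i, pd i (pd i w) y :=
    (eventually_contDiffAt_two hw).mono fun y hy => lapl_eq_pd hy
  refine ContinuousAt.congr ?_ e.symm
  refine tendsto_finsetSum _ fun i _ => ?_
  have h1 := pd_contDiffAt (k := 1) (f := w) (by exact_mod_cast hw) i
  exact (pd_contDiffAt (k := 0) (f := pd i w) (by simpa using h1) i).continuousAt

/-- Estimate for the averages in terms of a bound for the Laplacian. -/
lemma abs_avg_sub_le {w : Euc n → ℝ} {x : Euc n} {r s c δ : ℝ}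
    (hw : ∀ z ∈ ball x r, ContDiffAt ℝ 2 w z) (hs0 : 0 ≤ s) (hs : s < r)
    (hl : ∀ z ∈ ball x r, |lapl w z - c| ≤ δ) :
    |avg s w x - w x - c * kap n * s ^ 2 / 2| ≤ δ * kap n * s ^ 2 / 2 := by
  have hδ : 0 ≤ δ := (abs_nonneg _).trans (hl x (mem_ball_self (hs0.trans_lt hs)))
  have hc : ∀ t, |t| < r → ∀ y : Euc n, ‖y‖ ≤ 1 →
      ContinuousAt (fun y => lapl w (x + t • y)) y := fun t ht y hy =>
    ContinuousAt.comp (f := fun y : Euc n => x + t • y)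
      (continuousAt_lapl (hw _ (add_smul_mem_ball ht hy))) (by fun_prop)
  have key : ∀ t, |t| < r → |(∫ y, pker y * lapl w (x + t • y)) - c * kap n| ≤ δ * kap n := by
    intro t ht
    have hI := integrable_mul_of_vanish contDiff_pker.continuous (fun _ => pker_eq_zero) (hc t ht)
    have e : (∫ y, pker y * lapl w (x + t • y)) - c * kap n =
        ∫ y, pker y * (lapl w (x + t • y) - c) := by
      have : ∀ y : Euc n, pker y * (lapl w (x + t • y) - c) =
        pker y * lapl w (x + t • y) - c * pker y := fun y => by ring
      simp only [this]
      rw [integral_sub hI (integrable_pker.const_mul c), integral_const_mul, kap]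
    rw [e, ← Real.norm_eq_abs, kap, ← integral_const_mul]
    refine norm_integral_le_of_norm_le (integrable_pker.const_mul δ)
      (Eventually.of_forall fun y => ?_)
    by_cases hy : ‖y‖ ≤ 1
    · rw [norm_mul, Real.norm_of_nonneg (pker_nonneg y), mul_comm]
      exact mul_le_mul_of_nonneg_right (hl _ (add_smul_mem_ball ht hy)) (pker_nonneg y)
    · simp [pker_eq_zero (not_le.1 hy)]
  have hsub : ∀ t ∈ Set.Icc 0 s, |t| < r := fun t ht => by
    rw [abs_of_nonneg ht.1]; exact ht.2.trans_lt hs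
  have hd : ∀ t ∈ Set.Icc 0 s, HasDerivAt (fun t => avg t w x - w x - c * kap n * t ^ 2 / 2)
      (t * ((∫ y, pker y * lapl w (x + t • y)) - c * kap n)) t := by
    intro t ht
    have h1 := ((hasDerivAt_avg hw (hsub t ht)).sub_const (w x)).sub
      (((hasDerivAt_pow 2 t).const_mul (c * kap n)).div_const 2)
    refine h1.congr_deriv ?_
    simp; ring
  have hB : ∀ t, HasDerivAt (fun t : ℝ => δ * kap n * t ^ 2 / 2) (t * (δ * kap n)) t := by
    intro t
    refine (((hasDerivAt_pow 2 t).const_mul (δ * kap n)).div_const 2).congr_deriv ?_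
    simp; ring
  have := image_norm_le_of_norm_deriv_right_le_deriv_boundary'
    (f := fun t => avg t w x - w x - c * kap n * t ^ 2 / 2) (a := 0) (b := s)
    (fun t ht => (hd t ht).continuousAt.continuousWithinAt)
    (fun t ht => (hd t (Ico_subset_Icc_self ht)).hasDerivWithinAt)
    (by simp [avg_zero]) (fun t _ => (hB t).continuousAt.continuousWithinAt)
    (fun t _ => (hB t).hasDerivWithinAt)
    (fun t ht => by
      rw [norm_mul, Real.norm_of_nonneg ht.1]
      exact mul_le_mul_of_nonneg_left (key t (hsub t (Ico_subset_Icc_self ht))) ht.1)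
    (right_mem_Icc.2 hs0)
  simpa using this

/-- The mean value property for functions with constant Laplacian. -/
lemma avg_eq_of_lapl_eq {w : Euc n → ℝ} {x : Euc n} {r s c : ℝ}
    (hw : ∀ z ∈ ball x r, ContDiffAt ℝ 2 w z) (hs0 : 0 ≤ s) (hs : s < r)
    (hl : ∀ z ∈ ball x r, lapl w z = c) :
    avg s w x = w x + c * kap n * s ^ 2 / 2 := by
  have := abs_avg_sub_le (c := c) (δ := 0) hw hs0 hs (fun z hz => by simp [hl z hz])
  simp only [zero_mul, zero_div, abs_nonpos_iff] at this
  linarith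

lemma avg_eq_integral {s : ℝ} (hs : 0 < s) (w : Euc n → ℝ) (x : Euc n) :
    avg s w x = (s ^ n)⁻¹ * ∫ z, mker (s⁻¹ • (z - x)) * w z := by
  have h1 := integral_sub_right_eq_self (μ := (volume : Measure (Euc n)))
    (fun z => mker (s⁻¹ • z) * w (z + x)) x
  simp only [sub_add_cancel] at h1
  rw [h1]
  have h2 := Measure.integral_comp_smul (volume : Measure (Euc n))
    (fun z => mker (s⁻¹ • z) * w (z + x)) s
  rw [finrank_euclideanSpace, Fintype.card_fin, abs_of_pos (by positivity), smul_eq_mul] at h2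
  rw [← h2, avg]
  refine integral_congr_ae (Eventually.of_forall fun y => ?_)
  simp [smul_smul, inv_mul_cancel₀ hs.ne', add_comm]

lemma hasCompactSupport_mker : HasCompactSupport (mker (n := n)) :=
  HasCompactSupport.intro (isCompact_closedBall (0 : Euc n) 1)
    fun y hy => ker_eq_zero (by simpa using hy)

lemma mker_lipschitz : ∃ C : ℝ≥0, LipschitzWith C (mker (n := n)) :=
  ContDiff.lipschitzWith_of_hasCompactSupport hasCompactSupport_mker contDiff_ker (by simp)

lemma integrable_mker_comp {s : ℝ} (hs : 0 < s) {w : Euc n → ℝ} {x : Euc n}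
    (hw : ContinuousOn w (closedBall x s)) :
    Integrable fun z => mker (s⁻¹ • (z - x)) * w z := by
  have hv : ∀ z, z ∉ closedBall x s → mker (s⁻¹ • (z - x)) = 0 := by
    intro z hz
    apply ker_eq_zero
    rw [mem_closedBall, not_le, dist_eq_norm] at hz
    rw [norm_smul, norm_inv, Real.norm_of_nonneg hs.le, inv_mul_eq_div, one_lt_div hs]
    exact hz
  have h1 : IntegrableOn (fun z => mker (s⁻¹ • (z - x)) * w z) (closedBall x s) :=
    ContinuousOn.integrableOn_compact (isCompact_closedBall x s)
      (ContinuousOn.mul (contDiff_ker.continuous.comp (by fun_prop)).continuousOn hw)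
  rw [← integrableOn_univ]
  refine h1.of_forall_sdiff_eq_zero MeasurableSet.univ fun z hz => ?_
  rw [hv z hz.2, zero_mul]

/-- Interior gradient estimate for functions with constant Laplacian. -/
lemma exists_gradient_bound (n : ℕ) : ∃ C : ℝ, 0 ≤ C ∧ ∀ (w : Euc n → ℝ) (x : Euc n) (r c M : ℝ),
    0 < r → (∀ z ∈ ball x r, ContDiffAt ℝ 2 w z) → (∀ z ∈ ball x r, lapl w z = c) →
    (∀ z ∈ ball x r, |w z| ≤ M) → ‖fderiv ℝ w x‖ ≤ C * M / r := by
  obtain ⟨L, hL⟩ := mker_lipschitz (n := n)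
  set V : ℝ := (volume : Measure (Euc n)).real (ball 0 1) with hV
  refine ⟨2 ^ (n + 1) * L * V, by positivity, fun w x r c M hr hw hl hM => ?_⟩
  have hM0 : 0 ≤ M := (abs_nonneg _).trans (hM x (mem_ball_self hr))
  refine norm_fderiv_le_of_lip' ℝ (by positivity) ?_
  filter_upwards [ball_mem_nhds x (show 0 < r / 4 by positivity)] with x' hx'
  set s := r / 2 with hs
  have hs0 : 0 < s := by positivity
  have hx'r : dist x' x < r / 4 := hx'
  have hsub : ball x' (3 * r / 4) ⊆ ball x r := ball_subset_ball' (by linarith)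
  have hsub2 : closedBall x' s ⊆ ball x r := (closedBall_subset_ball (by linarith)).trans hsub
  have hsub3 : closedBall x s ⊆ ball x r := closedBall_subset_ball (by linarith)
  have e1 := avg_eq_of_lapl_eq (x := x') (s := s) (fun z hz => hw z (hsub hz)) hs0.le
    (by linarith) (fun z hz => hl z (hsub hz))
  have e2 := avg_eq_of_lapl_eq (x := x) (s := s) hw hs0.le (by linarith) hl
  have hwc : ∀ t ⊆ ball x r, ContinuousOn w t := fun t ht z hz =>
    (hw z (ht hz)).continuousAt.continuousWithinAt
  have e3 : w x' - w x = avg s w x' - avg s w x := by linarith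
  rw [e3, avg_eq_integral hs0, avg_eq_integral hs0, ← mul_sub,
    ← integral_sub (integrable_mker_comp hs0 (hwc _ hsub2))
      (integrable_mker_comp hs0 (hwc _ hsub3)), norm_mul, Real.norm_of_nonneg (by positivity)]
  have hbound : ∀ z, ‖mker (s⁻¹ • (z - x')) * w z - mker (s⁻¹ • (z - x)) * w z‖ ≤
      (ball x r).indicator (fun _ => L * s⁻¹ * ‖x' - x‖ * M) z := by
    intro z
    rw [← sub_mul, norm_mul]
    by_cases hz : z ∈ ball x r
    · rw [indicator_of_mem hz]
      have h1 := hL.norm_sub_le (s⁻¹ • (z - x')) (s⁻¹ • (z - x))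
      have h2 : s⁻¹ • (z - x') - s⁻¹ • (z - x) = s⁻¹ • (x - x') := by module
      rw [h2, norm_smul, Real.norm_of_nonneg (by positivity : 0 ≤ s⁻¹), norm_sub_rev x,
        ← mul_assoc] at h1
      exact mul_le_mul h1 (hM z hz) (norm_nonneg _) (by positivity)
    · rw [indicator_of_notMem hz]
      have hv : ∀ p, closedBall p s ⊆ ball x r → mker (s⁻¹ • (z - p)) = 0 := by
        intro p hp
        apply ker_eq_zero
        have : z ∉ closedBall p s := fun h => hz (hp h)
        rw [mem_closedBall, not_le, dist_eq_norm] at this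
        rw [norm_smul, norm_inv, Real.norm_of_nonneg hs0.le, inv_mul_eq_div, one_lt_div hs0]
        exact this
      simp [hv _ hsub2, hv _ hsub3]
  have hintg : ‖∫ z, (mker (s⁻¹ • (z - x')) * w z - mker (s⁻¹ • (z - x)) * w z)‖ ≤
      r ^ n * V * (L * s⁻¹ * ‖x' - x‖ * M) := by
    refine (norm_integral_le_of_norm_le ?_ (Eventually.of_forall hbound)).trans_eq ?_
    · exact (integrableOn_const (measure_ball_lt_top.ne)).integrable_indicator measurableSet_ball
    · rw [integral_indicator measurableSet_ball, setIntegral_const, smul_eq_mul]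
      congr 1
      rw [measureReal_def, Measure.addHaar_ball_of_pos _ _ hr, finrank_euclideanSpace,
        Fintype.card_fin,
        ENNReal.toReal_mul, ENNReal.toReal_ofReal (by positivity), hV, measureReal_def]
  calc (s ^ n)⁻¹ * _ ≤ (s ^ n)⁻¹ * (r ^ n * V * (L * s⁻¹ * ‖x' - x‖ * M)) := by gcongr
    _ = 2 ^ (n + 1) * L * V * M / r * ‖x' - x‖ := by
      rw [hs, div_pow]; field_simp; ring

/-! ### Mollification -/

lemma pd_convolution {u k : Euc n → ℝ} (hu : LocallyIntegrable u) (hk : ContDiff ℝ 1 k)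
    (hkc : HasCompactSupport k) (i : Fin n) :
    pd i (fun x => ∫ t, u t * k (x - t)) = fun x => ∫ t, u t * pd i k (x - t) := by
  ext x
  have h := hkc.hasFDerivAt_convolution_right (ContinuousLinearMap.mul ℝ ℝ) hu hk x
  have h1 := convolution_precompR_apply (L := ContinuousLinearMap.mul ℝ ℝ) (μ := volume) hu
    (hkc.fderiv ℝ) (hk.continuous_fderiv (by norm_num)) x (bvec i)
  unfold pd
  have h2 : (fun x => ∫ t, u t * k (x - t)) = convolution u k (ContinuousLinearMap.mul ℝ ℝ) := by
    ext; rfl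
  rw [h2, h.fderiv, h1]; rfl

lemma hasCompactSupport_pd {k : Euc n → ℝ} (hkc : HasCompactSupport k) (i : Fin n) :
    HasCompactSupport (pd i k) := hkc.fderiv_apply ℝ (bvec i)

lemma contDiff_mollify {u k : Euc n → ℝ} (hu : LocallyIntegrable u) (hk : ContDiff ℝ (⊤ : ℕ∞) k)
    (hkc : HasCompactSupport k) : ContDiff ℝ (⊤ : ℕ∞) (fun x => ∫ t, u t * k (x - t)) :=
  hkc.contDiff_convolution_right (ContinuousLinearMap.mul ℝ ℝ) hu hk

lemma contDiff_lapl {k : Euc n → ℝ} (hk : ContDiff ℝ (⊤ : ℕ∞) k) :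
    ContDiff ℝ (⊤ : ℕ∞) (lapl k) := by
  have : lapl k = fun x => ∑ i, pd i (pd i k) x :=
    funext fun x => lapl_eq_pd (hk.contDiffAt.of_le (by norm_cast))
  rw [this]
  exact ContDiff.sum fun i _ => pd_contDiff (pd_contDiff hk i) i

lemma lapl_mollify {u k : Euc n → ℝ} (hu : LocallyIntegrable u) (hk : ContDiff ℝ (⊤ : ℕ∞) k)
    (hkc : HasCompactSupport k) (x : Euc n) :
    lapl (fun x => ∫ t, u t * k (x - t)) x = ∫ t, u t * lapl k (x - t) := by
  have h2 : ∀ {f : Euc n → ℝ}, ContDiff ℝ (⊤ : ℕ∞) f → ∀ x, ContDiffAt ℝ 2 f x :=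
    fun hf x => hf.contDiffAt.of_le (by norm_cast)
  have h1 : ∀ {f : Euc n → ℝ}, ContDiff ℝ (⊤ : ℕ∞) f → ContDiff ℝ 1 f :=
    fun hf => hf.of_le (by norm_cast)
  rw [lapl_eq_pd (h2 (contDiff_mollify hu hk hkc) x)]
  simp only [pd_convolution hu (h1 hk) hkc,
    pd_convolution hu (h1 (pd_contDiff hk _)) (hasCompactSupport_pd hkc _)]
  rw [← integral_finsetSum]
  · refine integral_congr_ae (Eventually.of_forall fun t => ?_)
    simp only
    rw [lapl_eq_pd (h2 hk _), Finset.mul_sum]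
  · intro i _
    exact (hasCompactSupport_pd (hasCompactSupport_pd hkc i) i).convolutionExists_right
      (ContinuousLinearMap.mul ℝ ℝ) hu (pd_contDiff (pd_contDiff hk i) i).continuous x

lemma lapl_comp_affine {f : Euc n → ℝ} (hf : ContDiff ℝ (⊤ : ℕ∞) f) (x y : Euc n) (s : ℝ) :
    lapl (fun z => f (x + s • z)) y = s ^ 2 * lapl f (x + s • y) := by
  have h2 : ∀ {f : Euc n → ℝ}, ContDiff ℝ (⊤ : ℕ∞) f → ∀ x, ContDiffAt ℝ 2 f x :=
    fun hf x => hf.contDiffAt.of_le (by norm_cast)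
  have hd : ∀ {f : Euc n → ℝ}, ContDiff ℝ (⊤ : ℕ∞) f → Differentiable ℝ f :=
    fun hf => hf.differentiable (by simp)
  have hfs : ContDiff ℝ (⊤ : ℕ∞) fun z => f (x + s • z) := hf.comp (by fun_prop)
  rw [lapl_eq_pd (h2 hfs _), lapl_eq_pd (h2 hf _), Finset.mul_sum]
  refine Finset.sum_congr rfl fun i _ => ?_
  have e : pd i (fun z => f (x + s • z)) = fun z => s * pd i f (x + s • z) :=
    funext fun z => pd_comp_affine (hd hf _) i
  have hp : Differentiable ℝ (fun z => pd i f (x + s • z)) :=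
    hd ((pd_contDiff hf i).comp (by fun_prop : ContDiff ℝ (⊤ : ℕ∞) fun z => x + s • z))
  rw [e, pd_const_mul (hp y), pd_comp_affine (hd (pd_contDiff hf i) _)]
  ring

/-- The kernel of the averaging operator at scale `s`. -/
def sker (s : ℝ) (y : Euc n) : ℝ := (s ^ n)⁻¹ * mker (s⁻¹ • y)

lemma contDiff_sker (s : ℝ) : ContDiff ℝ (⊤ : ℕ∞) (sker (n := n) s) :=
  contDiff_const.mul (contDiff_ker.comp (contDiff_const_smul s⁻¹))

lemma sker_eq_zero {s : ℝ} (hs : 0 < s) {y : Euc n} (hy : s < ‖y‖) : sker s y = 0 := by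
  rw [sker, ker_eq_zero, mul_zero]
  rwa [norm_smul, norm_inv, Real.norm_of_nonneg hs.le, inv_mul_eq_div, one_lt_div hs]

lemma hasCompactSupport_sker {s : ℝ} (hs : 0 < s) : HasCompactSupport (sker (n := n) s) :=
  HasCompactSupport.intro (isCompact_closedBall (0 : Euc n) s)
    fun y hy => sker_eq_zero hs (by simpa using hy)

lemma sker_neg (s : ℝ) (y : Euc n) : sker s (-y) = sker s y := by
  rw [sker, smul_neg, ker_neg, sker]

lemma avg_eq_conv {s : ℝ} (hs : 0 < s) (w : Euc n → ℝ) (x : Euc n) :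
    avg s w x = ∫ t, w t * sker s (x - t) := by
  rw [avg_eq_integral hs, ← integral_const_mul]
  refine integral_congr_ae (Eventually.of_forall fun z => ?_)
  simp only
  rw [← sker_neg, neg_sub, sker]; ring

lemma integral_sker {s : ℝ} (hs : 0 < s) : ∫ y : Euc n, sker s y = 1 := by
  have := avg_eq_conv hs (fun _ => (1 : ℝ)) (0 : Euc n)
  simp only [avg, mul_one, one_mul, integral_ker, zero_sub, sker_neg] at this
  exact this.symm

/-! ### Slabs and barriers -/

/-- `Ω` lies in the slab `a ≤ ⟨x, X⟩ ≤ b`. -/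
def IsSlab (Ω : Set (Euc n)) (p : Euc n × ℝ × ℝ) : Prop :=
  ‖p.1‖ = 1 ∧ ∀ x ∈ Ω, p.2.1 ≤ ⟪x, p.1⟫ ∧ ⟪x, p.1⟫ ≤ p.2.2

/-- The torsion function of a slab. -/
def slabQ (p : Euc n × ℝ × ℝ) (x : Euc n) : ℝ := (p.2.2 - ⟪x, p.1⟫) * (⟪x, p.1⟫ - p.2.1)

lemma contDiff_slabQ (p : Euc n × ℝ × ℝ) {k : WithTop ℕ∞} : ContDiff ℝ k (slabQ p) :=
  (contDiff_affine p.1 p.2.2).mul ((contDiff_id.inner ℝ contDiff_const).sub contDiff_const)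

lemma lapl_slabQ {p : Euc n × ℝ × ℝ} (hp : ‖p.1‖ = 1) (x : Euc n) : lapl (slabQ p) x = -2 := by
  have e : slabQ p = fun x => (p.2.2 - ⟪x, p.1⟫) * ((-p.2.1) - ⟪x, -p.1⟫) := by
    ext x; simp [slabQ, inner_neg_right]; ring_nf; simp
  rw [e, lapl_mul (contDiff_affine _ _).contDiffAt (contDiff_affine _ _).contDiffAt, lapl_inner,
    lapl_inner]
  simp only [pd_inner]
  have : ∑ i, -p.1 i * -((-p.1) i) = - ‖p.1‖ ^ 2 := by
    rw [EuclideanSpace.real_norm_sq_eq, ← Finset.sum_neg_distrib]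
    exact Finset.sum_congr rfl fun i _ => by simp; ring
  rw [this, hp]; norm_num

lemma slabQ_nonneg {Ω : Set (Euc n)} {p : Euc n × ℝ × ℝ} (hp : IsSlab Ω p) {x : Euc n}
    (hx : x ∈ Ω) : 0 ≤ slabQ p x :=
  mul_nonneg (sub_nonneg.2 (hp.2 x hx).2) (sub_nonneg.2 (hp.2 x hx).1)

/-- The infimum of the torsion functions of the slabs containing `Ω`. -/
def slabBar (Ω : Set (Euc n)) : Euc n → ℝ :=
  Ω.indicator fun x => ⨅ p : {p : Euc n × ℝ × ℝ // IsSlab Ω p}, max (slabQ p.1 x) 0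

lemma measurable_slabBar {Ω : Set (Euc n)} (hΩ : IsOpen Ω) : Measurable (slabBar Ω) := by
  refine Measurable.indicator ?_ hΩ.measurableSet
  refine UpperSemicontinuous.measurable (upperSemicontinuous_ciInf (fun x => ?_) fun p => ?_)
  · exact ⟨0, by rintro _ ⟨p, rfl⟩; exact le_max_right _ _⟩
  · exact ((contDiff_slabQ (k := 0) p.1).continuous.max continuous_const).upperSemicontinuous

lemma slabBar_nonneg (Ω : Set (Euc n)) (x : Euc n) : 0 ≤ slabBar Ω x := by
  refine indicator_nonneg (fun x _ => ?_) x
  exact Real.iInf_nonneg fun p => le_max_right _ _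

lemma slabBar_le {Ω : Set (Euc n)} {p : Euc n × ℝ × ℝ} (hp : IsSlab Ω p) (x : Euc n) :
    slabBar Ω x ≤ max (slabQ p x) 0 := by
  by_cases hx : x ∈ Ω
  · rw [slabBar, indicator_of_mem hx]
    exact ciInf_le (f := fun p : {p : Euc n × ℝ × ℝ // IsSlab Ω p} => max (slabQ p.1 x) 0)
      ⟨0, by rintro _ ⟨p, rfl⟩; exact le_max_right _ _⟩ ⟨p, hp⟩
  · rw [slabBar, indicator_of_notMem hx]; exact le_max_right _ _

lemma slabBar_le_of_mem {Ω : Set (Euc n)} {p : Euc n × ℝ × ℝ} (hp : IsSlab Ω p) {x : Euc n}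
    (hx : x ∈ Ω) : slabBar Ω x ≤ slabQ p x := by
  simpa [slabQ_nonneg hp hx] using slabBar_le hp x

lemma exists_isSlab (hn : 0 < n) {Ω : Set (Euc n)} (hb : IsBounded Ω) : ∃ p, IsSlab Ω p := by
  obtain ⟨R, hR⟩ := hb.subset_closedBall 0
  refine ⟨(bvec ⟨0, hn⟩, -R, R), by simp, fun x hx => ?_⟩
  have h1 : ‖x‖ ≤ R := by simpa using hR hx
  have h2 := abs_real_inner_le_norm x (bvec (⟨0, hn⟩ : Fin n))
  simp only [PiLp.norm_single, norm_one, mul_one] at h2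
  exact abs_le.1 (h2.trans h1)

lemma slabQ_le (p : Euc n × ℝ × ℝ) (x : Euc n) : slabQ p x ≤ (p.2.2 - p.2.1) ^ 2 := by
  unfold slabQ
  nlinarith [sq_nonneg (p.2.2 - ⟪x, p.1⟫ - (⟪x, p.1⟫ - p.2.1)), sq_nonneg (p.2.2 - p.2.1)]

/-- Supersolutions for the averaging operators. -/
structure IsBarrier (Ω : Set (Euc n)) (bar : Euc n → ℝ) : Prop where
  meas : Measurable bar
  nonneg : ∀ x, 0 ≤ bar x
  bdd : ∃ B, ∀ x, bar x ≤ B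
  off : ∀ x, x ∉ Ω → bar x = 0
  avg_le : ∀ x s, 0 < s → closedBall x s ⊆ Ω → avg s bar x ≤ bar x - kap n * s ^ 2

lemma isBarrier_slabBar (hn : 0 < n) {Ω : Set (Euc n)} (hΩ : IsOpen Ω) (hb : IsBounded Ω) :
    IsBarrier Ω (slabBar Ω) where
  meas := measurable_slabBar hΩ
  nonneg := slabBar_nonneg Ω
  bdd := by
    obtain ⟨p, hp⟩ := exists_isSlab hn hb
    exact ⟨(p.2.2 - p.2.1) ^ 2, fun x => (slabBar_le hp x).trans
      (max_le (slabQ_le p x) (sq_nonneg _))⟩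
  off x hx := indicator_of_notMem hx _
  avg_le x s hs hsub := by
    have hx : x ∈ Ω := hsub (mem_closedBall_self hs.le)
    obtain ⟨p₀, hp₀⟩ := exists_isSlab hn hb
    have : Nonempty {p : Euc n × ℝ × ℝ // IsSlab Ω p} := ⟨⟨p₀, hp₀⟩⟩
    have key : avg s (slabBar Ω) x + kap n * s ^ 2 ≤ slabBar Ω x := by
      conv_rhs => rw [slabBar, indicator_of_mem hx]
      refine le_ciInf fun p => ?_
      refine le_trans ?_ (le_max_left _ _)
      have h1 := avg_eq_of_lapl_eq (w := slabQ p.1) (x := x) (r := s + 1) (s := s) (c := -2)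
        (fun z _ => (contDiff_slabQ p.1).contDiffAt) hs.le (by linarith)
        (fun z _ => lapl_slabQ p.2.1 z)
      have h2 : avg s (slabBar Ω) x ≤ avg s (slabQ p.1) x := by
        refine integral_mono_of_nonneg (Eventually.of_forall fun y =>
          mul_nonneg (ker_nonneg y) (slabBar_nonneg _ _))
          (integrable_mul_of_vanish contDiff_ker.continuous (fun _ => ker_eq_zero) fun y _ =>
            ((contDiff_slabQ (k := 0) p.1).continuous.comp (by fun_prop)).continuousAt)
          (Eventually.of_forall fun y => ?_)
        by_cases hy : ‖y‖ ≤ 1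
        · refine mul_le_mul_of_nonneg_left (slabBar_le_of_mem p.2 (hsub ?_)) (ker_nonneg y)
          rw [mem_closedBall_iff_norm, add_sub_cancel_left, norm_smul, Real.norm_of_nonneg hs.le]
          nlinarith
        · simp [ker_eq_zero (not_le.1 hy)]
      linarith
    linarith

lemma IsBarrier.integrable {Ω : Set (Euc n)} {bar : Euc n → ℝ} (hbar : IsBarrier Ω bar)
    (hb : IsBounded Ω) : Integrable bar := by
  obtain ⟨B, hB⟩ := hbar.bdd
  obtain ⟨R, hR⟩ := hb.subset_closedBall 0
  rw [← integrableOn_univ]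
  have : IntegrableOn bar (closedBall 0 R) :=
    Measure.integrableOn_of_bounded (measure_closedBall_lt_top.ne)
      hbar.meas.aestronglyMeasurable (M := B) (Eventually.of_forall fun x => by
        rw [Real.norm_of_nonneg (hbar.nonneg x)]; exact hB x)
  exact this.of_forall_sdiff_eq_zero MeasurableSet.univ fun z hz =>
    hbar.off z fun h => hz.2 (hR h)

lemma avg_symm {s : ℝ} (hs : 0 < s) {f g : Euc n → ℝ} (hf : Integrable f) (hg : Integrable g) :
    ∫ x, avg s f x * g x = ∫ x, f x * avg s g x := by
  simp only [avg_eq_conv hs]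
  have e1 : ∀ x : Euc n, (∫ t, f t * sker s (x - t)) * g x =
      ∫ t, f t * sker s (x - t) * g x := fun x => (integral_mul_const _ _).symm
  have e2 : ∀ t : Euc n, f t * (∫ x, g x * sker s (t - x)) =
      ∫ x, f t * sker s (x - t) * g x := fun t => by
    rw [← integral_const_mul]
    refine integral_congr_ae (Eventually.of_forall fun x => ?_)
    simp only
    rw [← sker_neg, neg_sub]; ring
  simp only [e1, e2]
  apply integral_integral_swap
  obtain ⟨C, hC⟩ := (contDiff_sker (n := n) s).continuous.bounded_above_of_compact_support
    (hasCompactSupport_sker hs)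
  have h1 : Integrable (fun z : Euc n × Euc n => g z.1 * f z.2) (volume.prod volume) :=
    hg.mul_prod hf
  have h2 := h1.bdd_mul (c := C) (f := fun z : Euc n × Euc n => sker s (z.1 - z.2))
    ((contDiff_sker s).continuous.comp (by fun_prop)).aestronglyMeasurable
    (Eventually.of_forall fun z => hC _)
  refine h2.congr (Eventually.of_forall fun z => ?_)
  simp only [Function.uncurry]; ring

lemma lapl_eq_zero_of_notMem_tsupport {f : Euc n → ℝ} {x : Euc n} (hx : x ∉ tsupport f) :
    lapl f x = 0 := by
  have : f =ᶠ[𝓝 x] fun _ => 0 := notMem_tsupport_iff_eventuallyEq.1 hx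
  rw [lapl_congr this, lapl_const]

lemma hasCompactSupport_lapl {f : Euc n → ℝ} (hf : HasCompactSupport f) :
    HasCompactSupport (lapl f) :=
  HasCompactSupport.intro hf fun _ hx => lapl_eq_zero_of_notMem_tsupport hx

lemma continuous_avg {s : ℝ} (hs : 0 < s) {u : Euc n → ℝ} (hu : Integrable u) :
    ContDiff ℝ (⊤ : ℕ∞) (avg s u) := by
  have : avg s u = fun x => ∫ t, u t * sker s (x - t) := funext fun x => avg_eq_conv hs u x
  rw [this]
  exact contDiff_mollify hu.locallyIntegrable (contDiff_sker s) (hasCompactSupport_sker hs)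

lemma integral_test_le {Ω : Set (Euc n)} (hΩ : IsOpen Ω) (hb : IsBounded Ω) {bar : Euc n → ℝ}
    (hbar : IsBarrier Ω bar) {φ : Euc n → ℝ} (hφ : ContDiff ℝ (⊤ : ℕ∞) φ)
    (hφc : HasCompactSupport φ) (hφs : tsupport φ ⊆ Ω) :
    2 * ∫ x, φ x ≤ ∫ x, bar x * max (-lapl φ x) 0 := by
  have hbi := hbar.integrable hb
  set ψ : Euc n → ℝ := fun x => max (φ x) 0 with hψ
  have hψcont : Continuous ψ := hφ.continuous.max continuous_const
  have hψc : HasCompactSupport ψ := hφc.comp_left (g := fun t : ℝ => max t 0) (by simp)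
  have hψi : Integrable ψ := hψcont.integrable_of_hasCompactSupport hψc
  have hlc : Continuous (lapl φ) := (contDiff_lapl hφ).continuous
  have hli : Integrable fun x => bar x * max (-lapl φ x) 0 := by
    obtain ⟨C, hC⟩ := hlc.bounded_above_of_compact_support (hasCompactSupport_lapl hφc)
    refine hbi.mul_bdd (c := C) (hlc.neg.max continuous_const).aestronglyMeasurable
      (Eventually.of_forall fun x => ?_)
    rw [Real.norm_of_nonneg (le_max_right _ _)]
    have := hC x
    exact max_le ((neg_le_abs _).trans this) ((norm_nonneg _).trans this)
  have hmain : ∀ δ > 0, 2 * ∫ x, φ x ≤ (∫ x, bar x * max (-lapl φ x) 0) + δ * ∫ x, bar x := by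
    intro δ hδ
    obtain ⟨r, hr, hrl⟩ := Metric.uniformContinuous_iff.1
      ((hasCompactSupport_lapl hφc).uniformContinuous_of_continuous hlc) δ hδ
    obtain ⟨r', hr', hrΩ⟩ := hφc.exists_cthickening_subset_open hΩ hφs
    obtain ⟨s, hs0, hs⟩ := exists_between (lt_min hr hr')
    have hk := kap_pos (n := n)
    have hA : ∀ x, kap n * s ^ 2 * ψ x ≤ ψ x * bar x - ψ x * avg s bar x := by
      intro x
      by_cases hx : x ∈ tsupport φ
      · have := hbar.avg_le x s hs0 ((closedBall_subset_cthickening hx s).trans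
          ((cthickening_mono (hs.trans_le (min_le_right _ _)).le _).trans hrΩ))
        have h0 : 0 ≤ ψ x := le_max_right _ _
        nlinarith
      · have : ψ x = 0 := by simp [hψ, image_eq_zero_of_notMem_tsupport hx]
        simp [this]
    have hB : ∀ x, (ψ x - avg s ψ x) * bar x ≤
        kap n * s ^ 2 / 2 * (bar x * max (-lapl φ x) 0 + δ * bar x) := by
      intro x
      have h1 := abs_avg_sub_le (w := φ) (x := x) (r := r) (s := s) (c := lapl φ x) (δ := δ)
        (fun z _ => hφ.contDiffAt.of_le (by norm_cast)) hs0.le (hs.trans_le (min_le_left _ _))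
        (fun z hz => (hrl hz).le)
      have hintg : ∀ {f : Euc n → ℝ}, Continuous f → Integrable fun y => mker y * f (x + s • y) :=
        fun hf => integrable_mul_of_vanish contDiff_ker.continuous (fun _ => ker_eq_zero)
          fun y _ => (hf.comp (by fun_prop)).continuousAt
      have h2 : avg s φ x ≤ avg s ψ x := integral_mono (hintg hφ.continuous) (hintg hψcont)
        fun y => mul_le_mul_of_nonneg_left (le_max_left _ _) (ker_nonneg y)
      have h3 : 0 ≤ avg s ψ x := integral_nonneg
        fun y => mul_nonneg (ker_nonneg y) (le_max_right _ _)
      have h4 : ψ x - avg s ψ x ≤ kap n * s ^ 2 / 2 * (max (-lapl φ x) 0 + δ) := by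
        have h5 : 0 ≤ kap n * s ^ 2 / 2 := by positivity
        have h6 : 0 ≤ max (-lapl φ x) 0 := le_max_right _ _
        have h7 : -lapl φ x ≤ max (-lapl φ x) 0 := le_max_left _ _
        rcases le_total (φ x) 0 with h | h
        · have : ψ x = 0 := max_eq_right h
          rw [this]
          have : 0 ≤ kap n * s ^ 2 / 2 * (max (-lapl φ x) 0 + δ) := by positivity
          linarith
        · have : ψ x = φ x := max_eq_left h
          have h8 := mul_le_mul_of_nonneg_left h7 h5
          have h9 := (abs_le.1 h1).1
          nlinarith
      calc _ ≤ kap n * s ^ 2 / 2 * (max (-lapl φ x) 0 + δ) * bar x :=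
            mul_le_mul_of_nonneg_right h4 (hbar.nonneg x)
        _ = _ := by ring
    have hbd : ∀ {f : Euc n → ℝ}, Continuous f → HasCompactSupport f →
        Integrable (fun x => f x * bar x) := by
      intro f hf hfc
      obtain ⟨C, hC⟩ := hf.bounded_above_of_compact_support hfc
      exact hbi.bdd_mul (c := C) hf.aestronglyMeasurable (Eventually.of_forall hC)
    have hψavg : Integrable (fun x => ψ x * avg s bar x) :=
      (hψcont.mul (continuous_avg hs0 hbi).continuous).integrable_of_hasCompactSupport
        hψc.mul_right
    have havgψ : Integrable (fun x => avg s ψ x * bar x) := by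
      obtain ⟨C, hC⟩ := hψcont.bounded_above_of_compact_support hψc
      refine hbi.bdd_mul (c := C) (continuous_avg hs0 hψi).continuous.aestronglyMeasurable
        (Eventually.of_forall fun x => ?_)
      refine (norm_integral_le_of_norm_le (integrable_ker.mul_const C)
        (Eventually.of_forall fun y => ?_)).trans_eq ?_
      · rw [norm_mul, Real.norm_of_nonneg (ker_nonneg y)]
        exact mul_le_mul_of_nonneg_left (hC _) (ker_nonneg y)
      · rw [integral_mul_const, integral_ker, one_mul]
    have e1 : kap n * s ^ 2 * ∫ x, ψ x ≤ (∫ x, ψ x * bar x) - ∫ x, ψ x * avg s bar x := by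
      rw [← integral_const_mul, ← integral_sub (hbd hψcont hψc) hψavg]
      exact integral_mono (hψi.const_mul _) ((hbd hψcont hψc).sub hψavg) hA
    have e2 : (∫ x, ψ x * bar x) - ∫ x, ψ x * avg s bar x = ∫ x, (ψ x - avg s ψ x) * bar x := by
      rw [← avg_symm hs0 hψi hbi, ← integral_sub (hbd hψcont hψc) havgψ]
      exact integral_congr_ae (Eventually.of_forall fun x => (sub_mul _ _ _).symm)
    have e3 : ∫ x, (ψ x - avg s ψ x) * bar x ≤
        kap n * s ^ 2 / 2 * ((∫ x, bar x * max (-lapl φ x) 0) + δ * ∫ x, bar x) := by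
      rw [← integral_const_mul δ, ← integral_add hli (hbi.const_mul δ), ← integral_const_mul]
      refine integral_mono ?_ ((hli.add (hbi.const_mul δ)).const_mul _) hB
      exact ((hbd hψcont hψc).sub havgψ).congr
        (Eventually.of_forall fun x => (sub_mul _ _ _).symm)
    have e4 : ∫ x, φ x ≤ ∫ x, ψ x :=
      integral_mono (hφ.continuous.integrable_of_hasCompactSupport hφc) hψi
        fun x => le_max_left _ _
    have e5 := e1.trans (e2.trans_le e3)
    have hpos : 0 < kap n * s ^ 2 / 2 := by positivity
    have e6 : kap n * s ^ 2 / 2 * (2 * ∫ x, ψ x) ≤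
      kap n * s ^ 2 / 2 * ((∫ x, bar x * max (-lapl φ x) 0) + δ * ∫ x, bar x) := by linarith
    have := le_of_mul_le_mul_left e6 hpos
    linarith
  refine le_of_forall_pos_le_add fun η hη => ?_
  have hI : 0 ≤ ∫ x, bar x := integral_nonneg hbar.nonneg
  refine (hmain (η / ((∫ x, bar x) + 1)) (by positivity)).trans ?_
  have : η / ((∫ x, bar x) + 1) * ∫ x, bar x ≤ η := by
    rw [div_mul_eq_mul_div, div_le_iff₀ (by positivity)]; nlinarith
  linarith

/-! ### Existence of a weak solution -/

/-- Test functions on `Ω`. -/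
def testSpace (Ω : Set (Euc n)) : Submodule ℝ (Euc n → ℝ) where
  carrier := {φ | ContDiff ℝ (⊤ : ℕ∞) φ ∧ HasCompactSupport φ ∧ tsupport φ ⊆ Ω}
  zero_mem' := ⟨contDiff_const, HasCompactSupport.zero, by simp [tsupport]⟩
  add_mem' {f g} hf hg := ⟨hf.1.add hg.1, hf.2.1.add hg.2.1,
    (tsupport_add f g).trans (union_subset hf.2.2 hg.2.2)⟩
  smul_mem' c f hf := ⟨contDiff_const.smul hf.1, hf.2.1.smul_left (f := fun _ => c),
    (tsupport_smul_subset_right (fun _ => c) f).trans hf.2.2⟩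

lemma contDiffAt_two_of_top {f : Euc n → ℝ} (hf : ContDiff ℝ (⊤ : ℕ∞) f) (x : Euc n) :
    ContDiffAt ℝ 2 f x := hf.contDiffAt.of_le (by norm_cast)

lemma memLp_lapl_test {Ω : Set (Euc n)} (φ : testSpace Ω) :
    MemLp (lapl φ.1) 2 (volume.restrict Ω) :=
  (((contDiff_lapl φ.2.1).continuous.memLp_of_hasCompactSupport
    (hasCompactSupport_lapl φ.2.2.1)) : MemLp (lapl φ.1) 2 volume).restrict Ω

/-- The Laplacian, from test functions to `L²`. -/
def laplLp (Ω : Set (Euc n)) : testSpace Ω →ₗ[ℝ] Lp ℝ 2 (volume.restrict Ω) where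
  toFun φ := (memLp_lapl_test φ).toLp _
  map_add' φ ψ := by
    rw [← MemLp.toLp_add]
    congr 1
    ext x
    exact lapl_add (contDiffAt_two_of_top φ.2.1 x) (contDiffAt_two_of_top ψ.2.1 x)
  map_smul' c φ := by
    rw [RingHom.id_apply, ← MemLp.toLp_const_smul]
    congr 1
    ext x
    exact lapl_const_mul (contDiffAt_two_of_top φ.2.1 x) c

/-- The load functional. -/
def loadFn (Ω : Set (Euc n)) : testSpace Ω →ₗ[ℝ] ℝ where
  toFun φ := 2 * ∫ x, φ.1 x
  map_add' φ ψ := by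
    rw [← mul_add, ← integral_add
      (φ.2.1.continuous.integrable_of_hasCompactSupport φ.2.2.1)
      (ψ.2.1.continuous.integrable_of_hasCompactSupport ψ.2.2.1)]; rfl
  map_smul' c φ := by
    change 2 * ∫ x, c * φ.1 x = c * (2 * ∫ x, φ.1 x)
    rw [integral_const_mul]; ring

theorem exists_weak_solution {Ω : Set (Euc n)} (hΩ : IsOpen Ω) (hb : IsBounded Ω)
    {bar : Euc n → ℝ} (hbar : IsBarrier Ω bar) :
    ∃ u : Euc n → ℝ, Integrable u ∧ (∀ᵐ x, 0 ≤ u x ∧ u x ≤ bar x) ∧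
      ∀ φ ∈ testSpace Ω, ∫ x, u x * lapl φ x = -2 * ∫ x, φ x := by
  set ν : Measure (Euc n) := volume.restrict Ω with hν
  have : IsFiniteMeasure ν := ⟨by rw [hν, Measure.restrict_apply_univ]; exact hb.measure_lt_top⟩
  obtain ⟨B, hB⟩ := hbar.bdd
  have hbarm : MemLp bar 2 ν := MemLp.of_bound hbar.meas.aestronglyMeasurable B
    (Eventually.of_forall fun x => by rw [Real.norm_of_nonneg (hbar.nonneg x)]; exact hB x)
  have hintg : ∀ ψ : Lp ℝ 2 ν, Integrable ψ ν := fun ψ => (Lp.memLp ψ).integrable (by norm_num)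
  have hbi : ∀ {f : Euc n → ℝ}, Integrable f ν → Integrable (fun x => bar x * f x) ν :=
    fun hf => hf.bdd_mul (c := B) hbar.meas.aestronglyMeasurable
      (Eventually.of_forall fun x => by rw [Real.norm_of_nonneg (hbar.nonneg x)]; exact hB x)
  set N : Lp ℝ 2 ν → ℝ := fun ψ => ∫ x, bar x * max (-ψ x) 0 ∂ν with hN
  have hNi : ∀ ψ : Lp ℝ 2 ν, Integrable (fun x => bar x * max (-ψ x) 0) ν := fun ψ =>
    hbi (hintg ψ).neg_part
  have N_hom : ∀ c : ℝ, 0 < c → ∀ x, N (c • x) = c * N x := by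
    intro c hc ψ
    simp only [hN]
    rw [← integral_const_mul]
    refine integral_congr_ae ?_
    filter_upwards [Lp.coeFn_smul c ψ] with x hx
    rw [hx, Pi.smul_apply, smul_eq_mul, ← mul_neg, mul_left_comm, mul_max_of_nonneg _ _ hc.le,
      mul_zero]
  have N_add : ∀ x y, N (x + y) ≤ N x + N y := by
    intro ψ χ
    simp only [hN]
    rw [← integral_add (hNi ψ) (hNi χ)]
    refine integral_mono_ae (hNi _) ((hNi ψ).add (hNi χ)) ?_
    filter_upwards [Lp.coeFn_add ψ χ] with x hx
    rw [hx, Pi.add_apply]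
    change _ ≤ bar x * max (-ψ x) 0 + bar x * max (-χ x) 0
    rw [← mul_add]
    refine mul_le_mul_of_nonneg_left (max_le ?_ ?_) (hbar.nonneg x)
    · have := le_max_left (-ψ x) 0
      have := le_max_left (-χ x) 0
      linarith
    · exact add_nonneg (le_max_right _ _) (le_max_right _ _)
  have hNl : ∀ φ : testSpace Ω, loadFn Ω φ ≤ N (laplLp Ω φ) := by
    intro φ
    have h1 := integral_test_le hΩ hb hbar φ.2.1 φ.2.2.1 φ.2.2.2
    refine h1.trans_eq ?_
    rw [hN]
    have h2 : ∫ x, bar x * max (-(laplLp Ω φ) x) 0 ∂ν =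
        ∫ x, bar x * max (-lapl φ.1 x) 0 ∂ν := by
      refine integral_congr_ae ?_
      filter_upwards [(memLp_lapl_test φ).coeFn_toLp] with x hx
      show _ * max (-((memLp_lapl_test φ).toLp _ x)) 0 = _
      rw [hx]
    simp only
    rw [h2, hν]
    refine (setIntegral_eq_integral_of_forall_compl_eq_zero fun x hx => ?_).symm
    rw [hbar.off x hx, zero_mul]
  have hker : ∀ φ : testSpace Ω, laplLp Ω φ = 0 → loadFn Ω φ = 0 := by
    intro φ hφ
    have h0 : N 0 = 0 := by
      have := N_hom 2 (by norm_num) 0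
      rw [smul_zero] at this; linarith
    have h1 := hNl φ
    have h2 := hNl (-φ)
    rw [map_neg, map_neg, hφ, neg_zero, h0] at h2
    rw [hφ, h0] at h1
    linarith
  have : Module.Free ℝ (LinearMap.range (laplLp Ω)) := Module.Free.of_divisionRing _ _
  have : Module.Projective ℝ (LinearMap.range (laplLp Ω)) := Module.Projective.of_free
  obtain ⟨sec, hsec⟩ := LinearMap.exists_rightInverse_of_surjective
    (laplLp Ω).rangeRestrict (LinearMap.range_rangeRestrict _)
  have hsec' : ∀ y, laplLp Ω (sec y) = y := fun y => by
    have := congrArg (fun f => ((f y : LinearMap.range (laplLp Ω)) : Lp ℝ 2 ν)) hsec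
    simpa using this
  set f : Lp ℝ 2 ν →ₗ.[ℝ] ℝ := ⟨LinearMap.range (laplLp Ω), loadFn Ω ∘ₗ sec⟩ with hf
  obtain ⟨g, hg1, hg2⟩ := exists_extension_of_le_sublinear f N N_hom N_add (fun y => by
    have := hNl (sec y)
    rw [hsec' y] at this
    exact this)
  have hgl : ∀ φ : testSpace Ω, g (laplLp Ω φ) = loadFn Ω φ := by
    intro φ
    have h1 := hg1 ⟨laplLp Ω φ, LinearMap.mem_range_self _ φ⟩
    rw [h1]
    have h2 := hker (sec ⟨laplLp Ω φ, LinearMap.mem_range_self _ φ⟩ - φ)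
      (by rw [map_sub, hsec', sub_self])
    rw [map_sub, sub_eq_zero] at h2
    exact h2
  have hNb : ∀ ψ, N ψ ≤ ‖hbarm.toLp bar‖ * ‖ψ‖ := by
    intro ψ
    have h1 : N ψ ≤ ⟪hbarm.toLp bar, |ψ|⟫ := by
      rw [L2.inner_def]
      refine integral_mono_ae (hNi ψ) (L2.integrable_inner _ _) ?_
      filter_upwards [hbarm.coeFn_toLp, Lp.coeFn_abs ψ] with x h1 h2
      rw [h1, h2]
      simp only [RCLike.inner_apply, conj_trivial]
      rw [mul_comm]
      exact mul_le_mul_of_nonneg_right (max_le (neg_le_abs _) (abs_nonneg _)) (hbar.nonneg x)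
    have h2 := (le_abs_self _).trans (abs_real_inner_le_norm (hbarm.toLp bar) |ψ|)
    rw [norm_abs_eq_norm] at h2
    exact h1.trans h2
  set G : Lp ℝ 2 ν →L[ℝ] ℝ := g.mkContinuous ‖hbarm.toLp bar‖ (fun ψ => by
    rw [Real.norm_eq_abs, abs_le]
    constructor
    · have h1 := (hg2 (-ψ)).trans (hNb (-ψ))
      rw [map_neg, norm_neg] at h1; linarith
    · exact (hg2 ψ).trans (hNb ψ)) with hG
  set v : Lp ℝ 2 ν := -(InnerProductSpace.toDual ℝ (Lp ℝ 2 ν)).symm G with hv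
  have hvg : ∀ ψ : Lp ℝ 2 ν, ∫ x, v x * ψ x ∂ν = - g ψ := by
    intro ψ
    have h1 : ⟪v, ψ⟫ = - g ψ := by
      rw [hv, inner_neg_left, InnerProductSpace.toDual_symm_apply]; rfl
    rw [← h1, L2.inner_def]
    refine integral_congr_ae (Eventually.of_forall fun x => ?_)
    simp [mul_comm]
  have hset : ∀ S : Set (Euc n), MeasurableSet S → ∀ c : ℝ,
      c * ∫ x in S, v x ∂ν ≥ - ∫ x, bar x * max (-(S.indicator (fun _ => c) x)) 0 ∂ν := by
    intro S hS c
    have hm := memLp_indicator_const (μ := ν) 2 hS c (Or.inr (measure_ne_top ν S))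
    have h1 := hg2 (hm.toLp _)
    have h2 := hvg (hm.toLp _)
    have e1 : ∫ x, v x * (hm.toLp _) x ∂ν = c * ∫ x in S, v x ∂ν := by
      rw [← integral_const_mul, ← integral_indicator hS]
      refine integral_congr_ae ?_
      filter_upwards [hm.coeFn_toLp] with x hx
      rw [hx]
      by_cases hxS : x ∈ S <;> simp [hxS, mul_comm]
    have e2 : N (hm.toLp _) = ∫ x, bar x * max (-(S.indicator (fun _ => c) x)) 0 ∂ν := by
      refine integral_congr_ae ?_
      filter_upwards [hm.coeFn_toLp] with x hx
      rw [hx]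
    rw [← e1, h2, ← e2]
    linarith
  have hv0 : ∀ᵐ x ∂ν, 0 ≤ v x := by
    refine ae_nonneg_of_forall_setIntegral_nonneg (hintg v) fun S hS _ => ?_
    have := hset S hS 1
    rw [one_mul] at this
    refine le_trans (le_of_eq ?_) this
    rw [eq_comm, neg_eq_zero]
    refine integral_eq_zero_of_ae (Eventually.of_forall fun x => ?_)
    by_cases hxS : x ∈ S <;> simp [hxS]
  have hvb : ∀ᵐ x ∂ν, v x ≤ bar x := by
    have hbarI : Integrable bar ν := hbarm.integrable (by norm_num)
    refine ae_le_of_forall_setIntegral_le (hintg v) hbarI fun S hS _ => ?_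
    have := hset S hS (-1)
    have e : ∫ x, bar x * max (-(S.indicator (fun _ => (-1 : ℝ)) x)) 0 ∂ν = ∫ x in S, bar x ∂ν := by
      rw [← integral_indicator hS]
      refine integral_congr_ae (Eventually.of_forall fun x => ?_)
      by_cases hxS : x ∈ S <;> simp [hxS]
    rw [e] at this
    linarith
  refine ⟨Ω.indicator v, (integrable_indicator_iff hΩ.measurableSet).2 (hintg v), ?_,
    fun φ hφ => ?_⟩
  · have h1 := (ae_restrict_iff' hΩ.measurableSet).1 (hv0.and hvb)
    filter_upwards [h1] with x hx
    by_cases hxΩ : x ∈ Ω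
    · rw [indicator_of_mem hxΩ]; exact hx hxΩ
    · rw [indicator_of_notMem hxΩ, hbar.off x hxΩ]; simp
  · have h1 := hvg (laplLp Ω ⟨φ, hφ⟩)
    rw [hgl] at h1
    have h2 : ∫ x, Ω.indicator v x * lapl φ x = ∫ x, v x * (laplLp Ω ⟨φ, hφ⟩) x ∂ν := by
      have : (fun x => Ω.indicator v x * lapl φ x) = Ω.indicator (fun x => v x * lapl φ x) := by
        ext x; by_cases hx : x ∈ Ω <;> simp [hx]
      rw [this, integral_indicator hΩ.measurableSet]
      refine integral_congr_ae ?_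
      filter_upwards [(memLp_lapl_test ⟨φ, hφ⟩).coeFn_toLp] with x hx
      show _ = _ * ((memLp_lapl_test ⟨φ, hφ⟩).toLp _ x)
      rw [hx]
    rw [h2, h1]
    change -(2 * ∫ x, φ x) = -2 * ∫ x, φ x
    ring

/-! ### Weyl's lemma and existence of the torsion function -/

lemma avg_comm {u : Euc n → ℝ} (hu : Integrable u) {s t : ℝ} (hs : 0 < s) (ht : 0 < t)
    (x : Euc n) : avg s (avg t u) x = avg t (avg s u) x := by
  have key : ∀ {s t : ℝ}, 0 < s → 0 < t → avg s (avg t u) x =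
      ∫ r, u r * ∫ z, sker s (x - z) * sker t (r - z) := by
    intro s t hs ht
    have hi : Integrable fun z : Euc n => sker s (x - z) :=
      ((contDiff_sker s).continuous.integrable_of_hasCompactSupport
        (hasCompactSupport_sker hs)).comp_sub_left x
    rw [avg_eq_conv hs, avg_symm ht hu hi]
    refine integral_congr_ae (Eventually.of_forall fun r => ?_)
    simp only [avg_eq_conv ht]
  rw [key hs ht, key ht hs]
  refine integral_congr_ae (Eventually.of_forall fun r => ?_)
  simp only
  congr 1
  rw [← integral_sub_left_eq_self (fun z => sker t (x - z) * sker s (r - z)) _ (x + r)]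
  refine integral_congr_ae (Eventually.of_forall fun z => ?_)
  simp only
  rw [show x - (x + r - z) = -(r - z) by abel, show r - (x + r - z) = -(x - z) by abel,
    sker_neg, sker_neg, mul_comm]

lemma lapl_avg_of_weak {Ω : Set (Euc n)} {u : Euc n → ℝ} (hu : Integrable u)
    (hw : ∀ φ ∈ testSpace Ω, ∫ x, u x * lapl φ x = -2 * ∫ x, φ x) {x : Euc n} {s : ℝ}
    (hs : 0 < s) (hx : closedBall x s ⊆ Ω) : lapl (avg s u) x = -2 := by
  have e : avg s u = fun x => ∫ t, u t * sker s (x - t) := funext fun x => avg_eq_conv hs u x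
  rw [e, lapl_mollify hu.locallyIntegrable (contDiff_sker s) (hasCompactSupport_sker hs)]
  have hts : tsupport (fun t : Euc n => sker s (x - t)) ⊆ closedBall x s := by
    refine closure_minimal (fun t ht => ?_) isClosed_closedBall
    by_contra hc
    refine ht (sker_eq_zero hs ?_)
    rwa [mem_closedBall, not_le, dist_comm, dist_eq_norm] at hc
  have h1 := hw (fun t => sker s (x - t)) ⟨(contDiff_sker s).comp (by fun_prop),
    HasCompactSupport.of_support_subset_isCompact (isCompact_closedBall x s)
      ((subset_tsupport _).trans hts), hts.trans hx⟩
  have h2 : ∫ t, sker s (x - t) = 1 := by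
    rw [integral_sub_left_eq_self (sker s) _ x, integral_sker hs]
  rw [h2] at h1
  rw [show (-2 : ℝ) = -2 * 1 by ring, ← h1]
  refine integral_congr_ae (Eventually.of_forall fun t => ?_)
  have := lapl_comp_affine (contDiff_sker s) x t (-1)
  simp only [neg_one_smul, ← sub_eq_add_neg] at this
  simp only [this]; ring

/-- The torsion function, extended by zero, with its basic bounds. -/
structure IsTorsion (Ω : Set (Euc n)) (u : Euc n → ℝ) : Prop where
  off : ∀ x, x ∉ Ω → u x = 0
  smooth : ∀ x ∈ Ω, ContDiffAt ℝ (⊤ : ℕ∞) u x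
  lapl_eq : ∀ x ∈ Ω, lapl u x = -2
  pos : ∀ x ∈ Ω, 0 < u x
  le_slab : ∀ p, IsSlab Ω p → ∀ x ∈ Ω, u x ≤ slabQ p x

lemma avg_mono_ae {s : ℝ} (hs : 0 < s) {v w : Euc n → ℝ} {x : Euc n}
    (hv : LocallyIntegrable v) (hw : LocallyIntegrable w)
    (h : ∀ᵐ y, y ∈ closedBall x s → v y ≤ w y) : avg s v x ≤ avg s w x := by
  rw [avg_eq_conv hs, avg_eq_conv hs]
  have hi : ∀ v : Euc n → ℝ, LocallyIntegrable v → Integrable fun t => v t * sker s (x - t) := by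
    intro v hv
    have h1 : HasCompactSupport fun t => sker s (x - t) := by
      refine HasCompactSupport.intro (isCompact_closedBall x s) fun t ht => sker_eq_zero hs ?_
      rwa [mem_closedBall, not_le, dist_comm, dist_eq_norm] at ht
    have := hv.integrable_smul_right_of_hasCompactSupport (g := fun t => sker s (x - t))
      ((contDiff_sker s).continuous.comp (by fun_prop)) h1
    exact this
  refine integral_mono_ae (hi v hv) (hi w hw) ?_
  filter_upwards [h] with y hy
  by_cases hc : y ∈ closedBall x s
  · exact mul_le_mul_of_nonneg_right (hy hc)
      (mul_nonneg (by positivity) (ker_nonneg _))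
  · rw [mem_closedBall, not_le, dist_comm, dist_eq_norm] at hc
    simp [sker_eq_zero hs hc]

theorem exists_isTorsion (hn : 0 < n) {Ω : Set (Euc n)} (hΩ : IsOpen Ω) (hb : IsBounded Ω) :
    ∃ u, IsTorsion Ω u := by
  have : Nonempty (Fin n) := ⟨⟨0, hn⟩⟩
  obtain ⟨u, hu, hub, hw⟩ := exists_weak_solution hΩ hb (isBarrier_slabBar hn hΩ hb)
  have hne : (Ωᶜ).Nonempty := by
    by_contra hc
    rw [not_nonempty_iff_eq_empty, compl_empty_iff] at hc
    exact NormedSpace.unbounded_univ ℝ (Euc n) (hc ▸ hb)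
  set d : Euc n → ℝ := fun x => infDist x Ωᶜ with hd
  have hdc : Continuous d := continuous_infDist_pt _
  have hdpos : ∀ x ∈ Ω, 0 < d x := fun x hx =>
    (hΩ.isClosed_compl.notMem_iff_infDist_pos hne).1 (fun h => h hx)
  have hdball : ∀ x r, r < d x → closedBall x r ⊆ Ω := fun x r hr y hy => by
    by_contra hc
    have h1 := infDist_le_dist_of_mem (x := x) (s := Ωᶜ) hc
    rw [mem_closedBall, dist_comm] at hy
    exact absurd (hr.trans_le (h1.trans hy)) (lt_irrefl _)
  have key : ∀ x ∈ Ω, ∀ s t, 0 < s → 0 < t → s + t < d x →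
      avg t u x + kap n * t ^ 2 = avg s u x + kap n * s ^ 2 := by
    have k1 : ∀ x ∈ Ω, ∀ s t, 0 < s → 0 < t → s + t < d x →
        avg s (avg t u) x = avg t u x - kap n * s ^ 2 := by
      intro x hx s t hs ht hst
      rw [avg_eq_of_lapl_eq (r := d x - t) (c := -2)
        (fun z _ => contDiffAt_two_of_top (continuous_avg ht hu) z) hs.le (by linarith)]
      · ring
      · intro z hz
        refine lapl_avg_of_weak hu hw ht ((closedBall_subset_closedBall' (ε₂ := t + dist z x)
          le_rfl).trans (hdball x _ ?_))
        rw [mem_ball] at hz; linarith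
    intro x hx s t hs ht hst
    have h1 := k1 x hx s t hs ht hst
    have h2 := k1 x hx t s ht hs (by linarith)
    rw [avg_comm hu hs ht] at h1
    linarith
  set v : Euc n → ℝ := fun x => if x ∈ Ω then avg (d x / 4) u x + kap n * (d x / 4) ^ 2 else 0
    with hv
  have hvx : ∀ x ∈ Ω, ∀ s, 0 < s → s < d x / 2 → v x = avg s u x + kap n * s ^ 2 := by
    intro x hx s hs h
    simp only [hv, if_pos hx]
    exact key x hx _ _ hs (by linarith [hdpos x hx]) (by linarith)
  have hloc : ∀ x ∈ Ω, ∃ s, 0 < s ∧ v =ᶠ[𝓝 x] fun y => avg s u y + kap n * s ^ 2 := by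
    intro x hx
    refine ⟨d x / 4, by linarith [hdpos x hx], ?_⟩
    have h1 : ∀ᶠ y in 𝓝 x, d x / 2 < d y :=
      hdc.continuousAt.eventually_const_lt (by linarith [hdpos x hx])
    filter_upwards [h1, hΩ.mem_nhds hx] with y hy hyΩ
    exact hvx y hyΩ _ (by linarith [hdpos x hx]) (by linarith)
  refine ⟨v, fun x hx => if_neg hx, fun x hx => ?_, fun x hx => ?_, fun x hx => ?_,
    fun p hp x hx => ?_⟩
  · obtain ⟨s, hs, h⟩ := hloc x hx
    exact ((continuous_avg hs hu).contDiffAt.add contDiffAt_const).congr_of_eventuallyEq h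
  · obtain ⟨s, hs, h⟩ := hloc x hx
    have h2 : closedBall x (d x / 4) ⊆ Ω := hdball x _ (by linarith [hdpos x hx])
    have hs' : 0 < d x / 4 := by linarith [hdpos x hx]
    have h1 : v =ᶠ[𝓝 x] fun y => avg (d x / 4) u y + kap n * (d x / 4) ^ 2 := by
      have h1 : ∀ᶠ y in 𝓝 x, d x / 2 < d y :=
        hdc.continuousAt.eventually_const_lt (by linarith [hdpos x hx])
      filter_upwards [h1, hΩ.mem_nhds hx] with y hy hyΩ
      exact hvx y hyΩ _ (by linarith [hdpos x hx]) (by linarith)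
    rw [lapl_congr h1, lapl_add (contDiffAt_two_of_top (continuous_avg hs' hu) x)
      contDiffAt_const, lapl_avg_of_weak hu hw hs' h2, lapl_const, add_zero]
  · have hs' : 0 < d x / 4 := by linarith [hdpos x hx]
    rw [hvx x hx _ hs' (by linarith)]
    have h1 : avg (d x / 4) (fun _ => 0) x ≤ avg (d x / 4) u x :=
      avg_mono_ae hs' (locallyIntegrable_const _) hu.locallyIntegrable
        (hub.mono fun y hy _ => hy.1)
    have h2 : avg (d x / 4) (fun _ => 0) x = 0 := by simp [avg]
    have := kap_pos (n := n)
    have : 0 < kap n * (d x / 4) ^ 2 := by positivity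
    linarith
  · have hs' : 0 < d x / 4 := by linarith [hdpos x hx]
    rw [hvx x hx _ hs' (by linarith)]
    have h1 : avg (d x / 4) u x ≤ avg (d x / 4) (slabQ p) x := by
      refine avg_mono_ae hs' hu.locallyIntegrable
        (contDiff_slabQ p (k := 0)).continuous.locallyIntegrable (hub.mono fun y hy hyb => ?_)
      exact hy.2.trans (slabBar_le_of_mem hp (hdball x _ (by linarith [hdpos x hx]) hyb))
    rw [avg_eq_of_lapl_eq (r := d x) (c := -2) (fun z _ => (contDiff_slabQ p).contDiffAt) hs'.le
      (by linarith [hdpos x hx]) (fun z _ => lapl_slabQ hp.1 z)] at h1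
    linarith

/-- At a boundary point of a convex set there is an outer unit normal. -/
lemma exists_outerNormal {Ω : Set (Euc n)} (hΩ : IsOpen Ω) (hc : Convex ℝ Ω) (hne : Ω.Nonempty)
    {x : Euc n} (hx : x ∉ Ω) : ∃ X : Euc n, ‖X‖ = 1 ∧ ∀ y ∈ Ω, ⟪y, X⟫ < ⟪x, X⟫ := by
  obtain ⟨f, hf⟩ := geometric_hahn_banach_open_point hc hΩ hx
  set w := (InnerProductSpace.toDual ℝ (Euc n)).symm f with hw
  have hfw : ∀ y, f y = ⟪y, w⟫ := fun y => by
    rw [real_inner_comm, hw, InnerProductSpace.toDual_symm_apply]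
  obtain ⟨y0, hy0⟩ := hne
  have hw0 : w ≠ 0 := by
    rintro h0
    have := hf y0 hy0
    rw [hfw, hfw, h0] at this
    simp at this
  have hnw : 0 < ‖w‖ := norm_pos_iff.2 hw0
  refine ⟨‖w‖⁻¹ • w, by rw [norm_smul, norm_inv, norm_norm, inv_mul_cancel₀ hnw.ne'],
    fun y hy => ?_⟩
  rw [inner_smul_right, inner_smul_right, ← hfw, ← hfw]
  exact mul_lt_mul_of_pos_left (hf y hy) (by positivity)

lemma IsTorsion.nonneg {Ω : Set (Euc n)} {u : Euc n → ℝ} (hu : IsTorsion Ω u) (x : Euc n) :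
    0 ≤ u x := by
  by_cases hx : x ∈ Ω
  · exact (hu.pos x hx).le
  · exact (hu.off x hx).ge

lemma IsTorsion.continuous {Ω : Set (Euc n)} (hΩ : IsOpen Ω) (hb : IsBounded Ω)
    (hc : Convex ℝ Ω) {u : Euc n → ℝ} (hu : IsTorsion Ω u) :
    Continuous u := by
  rw [continuous_iff_continuousAt]
  intro x
  by_cases hx : x ∈ Ω
  · exact (hu.smooth x hx).continuousAt
  rcases Ω.eq_empty_or_nonempty with he | hne
  · have : u = fun _ => 0 := funext fun y => hu.off y (by simp [he])
    rw [this]; exact continuousAt_const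
  obtain ⟨X, hX, hXx⟩ := exists_outerNormal hΩ hc hne hx
  obtain ⟨R, hR⟩ := hb.subset_closedBall 0
  have hp : IsSlab Ω (X, -R, ⟪x, X⟫) := by
    refine ⟨hX, fun y hy => ⟨?_, (hXx y hy).le⟩⟩
    have h1 : ‖y‖ ≤ R := by simpa using hR hy
    have h2 := abs_real_inner_le_norm y X
    rw [hX, mul_one] at h2
    exact (abs_le.1 (h2.trans h1)).1
  have h0 : slabQ (X, -R, ⟪x, X⟫) x = 0 := by simp [slabQ]
  have hcont : Tendsto (fun y => max (slabQ (X, -R, ⟪x, X⟫) y) 0) (𝓝 x) (𝓝 0) := by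
    have := ((contDiff_slabQ (X, -R, ⟪x, X⟫) (k := 0)).continuous.max
      (continuous_const (y := (0:ℝ)))).tendsto x
    rwa [h0, max_self] at this
  rw [ContinuousAt, hu.off x hx]
  refine squeeze_zero hu.nonneg (fun y => ?_) hcont
  by_cases hy : y ∈ Ω
  · exact le_max_of_le_left (hu.le_slab _ hp y hy)
  · rw [hu.off y hy]; exact le_max_right _ _

lemma IsTorsion.isTorsionFunction {Ω : Set (Euc n)} (hΩ : IsOpen Ω) (hb : IsBounded Ω)
    (hc : Convex ℝ Ω) {u : Euc n → ℝ} (hu : IsTorsion Ω u) : IsTorsionFunction Ω u where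
  continuousOn := (hu.continuous hΩ hb hc).continuousOn
  smooth := fun x hx => (hu.smooth x hx).contDiffWithinAt
  lapl_eq := hu.lapl_eq
  boundary_zero := fun x hx => hu.off x fun h => by
    rw [hΩ.frontier_eq] at hx; exact hx.2 h

/-! ### Lipschitz regularity and the weak formulation -/

lemma gradient_apply_eq_pd (f : Euc n → ℝ) (x : Euc n) (i : Fin n) :
    gradient f x i = pd i f x := by
  have h := inner_gradient_left (𝕜 := ℝ) (f := f) (x := x) (y := bvec i)
  rw [EuclideanSpace.inner_single_right] at h
  simpa [pd] using h

lemma inner_gradient_eq_sum (f g : Euc n → ℝ) (x : Euc n) :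
    ⟪gradient f x, gradient g x⟫ = ∑ i, pd i f x * pd i g x := by
  rw [PiLp.inner_apply]
  refine Finset.sum_congr rfl fun i _ => ?_
  rw [gradient_apply_eq_pd, gradient_apply_eq_pd]
  simp [mul_comm]

lemma gradient_eventuallyEq {f g : Euc n → ℝ} {x : Euc n} (h : f =ᶠ[𝓝 x] g) :
    gradient f x = gradient g x := by
  ext i; rw [gradient_apply_eq_pd, gradient_apply_eq_pd, pd_congr h]

lemma norm_gradient_eq (f : Euc n → ℝ) (x : Euc n) : ‖gradient f x‖ = ‖fderiv ℝ f x‖ :=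
  LinearIsometryEquiv.norm_map _ _

lemma norm_gradient_le {f : Euc n → ℝ} {C : ℝ≥0} (hf : LipschitzWith C f) (x : Euc n) :
    ‖gradient f x‖ ≤ C := by
  rw [norm_gradient_eq]; exact norm_fderiv_le_of_lipschitz ℝ hf

lemma gradient_eq_zero_of_notMem {K : Set (Euc n)} (hK : IsClosed K) {v : Euc n → ℝ}
    (h0 : ∀ x, x ∉ K → v x = 0) {x : Euc n} (hx : x ∉ K) : gradient v x = 0 := by
  have : v =ᶠ[𝓝 x] fun _ => 0 := by
    filter_upwards [hK.isOpen_compl.mem_nhds hx] with y hy using h0 y hy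
  rw [gradient_eventuallyEq this]
  exact gradient_const ..

lemma exists_cutoff {K U : Set (Euc n)} (hK : IsCompact K) (hU : IsOpen U) (hKU : K ⊆ U) :
    ∃ χ : Euc n → ℝ, ContDiff ℝ (⊤ : ℕ∞) χ ∧ HasCompactSupport χ ∧ tsupport χ ⊆ U ∧
      ∃ V, IsOpen V ∧ K ⊆ V ∧ ∀ x ∈ V, χ x = 1 := by
  obtain ⟨δ, hδ, hδU⟩ := hK.exists_cthickening_subset_open hU hKU
  obtain ⟨f, hf1, -, hf3, hf4⟩ := exists_contMDiff_support_eq_eq_one_iff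
    (modelWithCornersSelf ℝ (Euc n)) (n := ⊤) (isOpen_thickening (δ := δ) (E := K))
    (isClosed_cthickening (δ := δ / 2) (E := K))
    (cthickening_subset_thickening' hδ (by linarith) K)
  have ht : tsupport f ⊆ cthickening δ K := by
    rw [tsupport, hf3]
    exact closure_minimal (thickening_subset_cthickening _ _) isClosed_cthickening
  exact ⟨f, hf1.contDiff, hK.cthickening.of_isClosed_subset (isClosed_tsupport f) ht,
    ht.trans hδU, thickening (δ / 2) K, isOpen_thickening,
    self_subset_thickening (by linarith) K, fun x hx =>
      (hf4 x).1 (thickening_subset_cthickening _ _ hx)⟩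

lemma lipschitzWith_of_hasCompactSupport {f : Euc n → ℝ} (hf : ContDiff ℝ 1 f)
    (hc : HasCompactSupport f) : ∃ C, LipschitzWith C f :=
  ⟨_, (hf.lipschitzWith_of_hasCompactSupport hc (by norm_num)).choose_spec⟩

lemma ibp_compact {G v : Euc n → ℝ} (hG : ContDiff ℝ (⊤ : ℕ∞) G) (hGc : HasCompactSupport G)
    {C : ℝ≥0} (hv : LipschitzWith C v) :
    ∫ x, ⟪gradient v x, gradient G x⟫ = - ∫ x, v x * lapl G x := by
  have hpd : ∀ i, ContDiff ℝ (⊤ : ℕ∞) (pd i G) := fun i => pd_contDiff hG i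
  have hpc : ∀ i, HasCompactSupport (pd i G) := hasCompactSupport_pd hGc
  have h1 : ∀ i : Fin n, ∫ x, lineDeriv ℝ v x (bvec i) * pd i G x =
      - ∫ x, v x * pd i (pd i G) x := by
    intro i
    obtain ⟨D, hD⟩ := lipschitzWith_of_hasCompactSupport ((hpd i).of_le (by norm_cast)) (hpc i)
    rw [hv.integral_lineDeriv_mul_eq hD (hpc i), ← integral_neg]
    refine integral_congr_ae (Eventually.of_forall fun x => ?_)
    simp only
    have : DifferentiableAt ℝ (pd i G) x := ((hpd i).differentiable (by simp)) x
    rw [lineDeriv_neg, this.lineDeriv_eq_fderiv]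
    simp only [pd]; ring
  have hint1 : ∀ i : Fin n, Integrable fun x => lineDeriv ℝ v x (bvec i) * pd i G x := by
    intro i
    exact ((hpd i).continuous.integrable_of_hasCompactSupport (hpc i)).bdd_mul
      (c := C * ‖bvec i‖) (hv.memLp_lineDeriv (μ := volume) _).aestronglyMeasurable
      (Eventually.of_forall fun x => norm_lineDeriv_le_of_lipschitz ℝ hv)
  have hint2 : ∀ i : Fin n, Integrable fun x => v x * pd i (pd i G) x := by
    intro i
    exact (hv.continuous.mul (pd_contDiff (hpd i) i).continuous).integrable_of_hasCompactSupport
      ((hasCompactSupport_pd (hpc i) i).mul_left)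
  have e1 : ∫ x, ⟪gradient v x, gradient G x⟫ =
      ∫ x, ∑ i, lineDeriv ℝ v x (bvec i) * pd i G x := by
    refine integral_congr_ae ?_
    filter_upwards [hv.ae_differentiableAt] with x hx
    rw [inner_gradient_eq_sum]
    refine Finset.sum_congr rfl fun i _ => ?_
    rw [hx.lineDeriv_eq_fderiv]; rfl
  have e2 : ∫ x, v x * lapl G x = ∫ x, ∑ i, v x * pd i (pd i G) x := by
    refine integral_congr_ae (Eventually.of_forall fun x => ?_)
    simp only
    rw [lapl_eq_pd (contDiffAt_two_of_top hG x), Finset.mul_sum]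
  rw [e1, e2, integral_finsetSum _ (fun i _ => hint1 i), integral_finsetSum _ (fun i _ => hint2 i),
    ← Finset.sum_neg_distrib]
  exact Finset.sum_congr rfl fun i _ => h1 i

/-- Integration by parts against a function smooth near the support. -/
lemma ibp {K U : Set (Euc n)} (hK : IsCompact K) (hU : IsOpen U) (hKU : K ⊆ U)
    {G v : Euc n → ℝ} (hG : ∀ x ∈ U, ContDiffAt ℝ (⊤ : ℕ∞) G x)
    {C : ℝ≥0} (hv : LipschitzWith C v) (h0 : ∀ x, x ∉ K → v x = 0) :
    ∫ x, ⟪gradient v x, gradient G x⟫ = - ∫ x, v x * lapl G x := by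
  obtain ⟨χ, hχ, hχc, hχU, V, hV, hKV, hχ1⟩ := exists_cutoff hK hU hKU
  have hG' : ContDiff ℝ (⊤ : ℕ∞) (fun x => χ x * G x) := by
    rw [contDiff_iff_contDiffAt]
    intro x
    by_cases hx : x ∈ tsupport χ
    · exact hχ.contDiffAt.mul (hG x (hχU hx))
    · have : (fun x => χ x * G x) =ᶠ[𝓝 x] fun _ => 0 := by
        filter_upwards [notMem_tsupport_iff_eventuallyEq.1 hx] with y hy
        rw [hy]; simp
      exact contDiffAt_const.congr_of_eventuallyEq this
  have hEq : ∀ x ∈ K, (fun x => χ x * G x) =ᶠ[𝓝 x] G := fun x hx => by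
    filter_upwards [hV.mem_nhds (hKV hx)] with y hy
    rw [hχ1 y hy, one_mul]
  have := ibp_compact hG' (hχc.mul_right) hv
  have e1 : ∀ x, ⟪gradient v x, gradient G x⟫ =
      ⟪gradient v x, gradient (fun x => χ x * G x) x⟫ := by
    intro x
    by_cases hx : x ∈ K
    · rw [gradient_eventuallyEq (hEq x hx)]
    · rw [gradient_eq_zero_of_notMem hK.isClosed h0 hx, inner_zero_left, inner_zero_left]
  have e2 : ∀ x, v x * lapl G x = v x * lapl (fun x => χ x * G x) x := by
    intro x
    by_cases hx : x ∈ K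
    · rw [lapl_congr (hEq x hx)]
    · rw [h0 x hx, zero_mul, zero_mul]
  simp only [e1, e2]
  exact this

section
variable {Ω : Set (Euc n)} {u : Euc n → ℝ}

lemma IsTorsion.le_linear (hu : IsTorsion Ω u) {R : ℝ} (hR : Ω ⊆ closedBall 0 R) {X : Euc n}
    (hX : ‖X‖ = 1) {b : ℝ} (hb : ∀ y ∈ Ω, ⟪y, X⟫ ≤ b) {x : Euc n} (hx : x ∈ Ω) :
    u x ≤ 2 * R * (b - ⟪x, X⟫) := by
  have hin : ∀ y ∈ Ω, |⟪y, X⟫| ≤ R := fun y hy => by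
    have h1 : ‖y‖ ≤ R := by simpa using hR hy
    have h2 := abs_real_inner_le_norm y X
    rw [hX, mul_one] at h2
    exact h2.trans h1
  have hp : IsSlab Ω (X, -R, b) := ⟨hX, fun y hy => ⟨(abs_le.1 (hin y hy)).1, hb y hy⟩⟩
  have h1 := hu.le_slab _ hp x hx
  simp only [slabQ] at h1
  have h2 := abs_le.1 (hin x hx)
  nlinarith [hb x hx]

lemma IsTorsion.le_dist (hu : IsTorsion Ω u) (hΩ : IsOpen Ω) (hc : Convex ℝ Ω) {R : ℝ}
    (hR0 : 0 ≤ R) (hR : Ω ⊆ closedBall 0 R) {x y : Euc n} (hy : y ∉ Ω) :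
    u x ≤ 2 * R * dist x y := by
  by_cases hx : x ∈ Ω
  · obtain ⟨X, hX, hXy⟩ := exists_outerNormal hΩ hc ⟨x, hx⟩ hy
    refine (hu.le_linear hR hX (fun z hz => (hXy z hz).le) hx).trans ?_
    refine mul_le_mul_of_nonneg_left ?_ (by positivity)
    rw [← inner_sub_left, dist_comm, dist_eq_norm]
    have := real_inner_le_norm (y - x) X
    rwa [hX, mul_one] at this
  · rw [hu.off x hx]
    positivity

lemma compl_nonempty_of_isBounded (hn : 0 < n) (hb : IsBounded Ω) : (Ωᶜ).Nonempty := by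
  have : Nonempty (Fin n) := ⟨⟨0, hn⟩⟩
  by_contra hc
  rw [not_nonempty_iff_eq_empty, compl_empty_iff] at hc
  exact NormedSpace.unbounded_univ ℝ (Euc n) (hc ▸ hb)

lemma ball_infDist_subset (x : Euc n) : ball x (infDist x Ωᶜ) ⊆ Ω := by
  intro y hy
  by_contra hc
  have h1 := infDist_le_dist_of_mem (x := x) (s := Ωᶜ) hc
  rw [mem_ball, dist_comm] at hy
  linarith

lemma infDist_compl_pos (hn : 0 < n) (hΩ : IsOpen Ω) (hb : IsBounded Ω) {x : Euc n}
    (hx : x ∈ Ω) : 0 < infDist x Ωᶜ :=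
  (hΩ.isClosed_compl.notMem_iff_infDist_pos (compl_nonempty_of_isBounded hn hb)).1
    (fun h => h hx)

theorem IsTorsion.exists_lipschitz (hu : IsTorsion Ω u) (hn : 0 < n) (hΩ : IsOpen Ω)
    (hb : IsBounded Ω) (hc : Convex ℝ Ω) : ∃ L : ℝ≥0, LipschitzWith L u := by
  obtain ⟨C, hC0, hC⟩ := exists_gradient_bound n
  obtain ⟨R, hR0, hR⟩ := hb.subset_ball_lt 0 0
  have hR' := hR.trans ball_subset_closedBall
  have hne := compl_nonempty_of_isBounded hn hb
  have hgrad : ∀ x ∈ Ω, ‖fderiv ℝ u x‖ ≤ 4 * R * C := by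
    intro x hx
    set d := infDist x Ωᶜ with hd
    have hdp : 0 < d := infDist_compl_pos hn hΩ hb hx
    have hsub : ball x d ⊆ Ω := ball_infDist_subset x
    have h1 := hC u x d (-2) (4 * R * d) hdp
      (fun z hz => (hu.smooth z (hsub hz)).of_le (by norm_cast))
      (fun z hz => hu.lapl_eq z (hsub hz)) (fun z hz => by
        rw [abs_of_nonneg (hu.nonneg z)]
        have h2 : (2 * R)⁻¹ * u z ≤ infDist z Ωᶜ := by
          rw [le_infDist hne]
          intro y hy
          rw [inv_mul_le_iff₀ (by positivity)]
          exact hu.le_dist hΩ hc hR0.le hR' hy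
        rw [inv_mul_le_iff₀ (by positivity)] at h2
        have h3 : infDist z Ωᶜ ≤ d + dist z x := by
          have := infDist_le_infDist_add_dist (s := Ωᶜ) (x := z) (y := x)
          linarith
        rw [mem_ball] at hz
        nlinarith)
    refine h1.trans (le_of_eq ?_)
    field_simp
  obtain ⟨L, hL⟩ : ∃ L : ℝ≥0, (L : ℝ) = 4 * R * C + 2 * R := ⟨⟨_, by positivity⟩, rfl⟩
  have hon : LipschitzOnWith L u Ω := by
    refine hc.lipschitzOnWith_of_nnnorm_fderiv_le (𝕜 := ℝ)
      (fun x hx => (hu.smooth x hx).differentiableAt (by simp)) fun x hx => ?_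
    rw [← NNReal.coe_le_coe, coe_nnnorm]
    refine (hgrad x hx).trans ?_
    rw [hL]; linarith
  refine ⟨L, LipschitzWith.of_dist_le_mul fun x y => ?_⟩
  have key : ∀ x y, y ∉ Ω → dist (u x) (u y) ≤ L * dist x y := by
    intro x y hy
    rw [hu.off y hy, Real.dist_eq, sub_zero, abs_of_nonneg (hu.nonneg x)]
    refine (hu.le_dist hΩ hc hR0.le hR' hy).trans ?_
    refine mul_le_mul_of_nonneg_right ?_ dist_nonneg
    rw [hL]
    have : 0 ≤ 4 * R * C := by positivity
    linarith
  by_cases hy : y ∈ Ω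
  · by_cases hx : x ∈ Ω
    · exact hon.dist_le_mul x hx y hy
    · rw [dist_comm, dist_comm x]; exact key y x hx
  · exact key x y hy

lemma gradient_comp_smul (u : Euc n → ℝ) {s : ℝ} {x : Euc n}
    (h : DifferentiableAt ℝ u (s • x)) :
    gradient (fun y => u (s • y)) x = s • gradient u (s • x) := by
  ext i
  rw [gradient_apply_eq_pd, PiLp.smul_apply, gradient_apply_eq_pd, smul_eq_mul]
  have := pd_comp_affine (f := u) (x := 0) (y := x) (s := s) (by rwa [zero_add]) i
  simpa only [zero_add] using this

lemma lapl_comp_smul {u : Euc n → ℝ} {s : ℝ} {x : Euc n}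
    (h : ContDiffAt ℝ 2 u (s • x)) :
    lapl (fun y => u (s • y)) x = s ^ 2 * lapl u (s • x) := by
  have hc : ContDiffAt ℝ 2 (fun y => u (s • y)) x :=
    ContDiffAt.comp (g := u) (f := fun y => s • y) x h (contDiff_const_smul s).contDiffAt
  rw [lapl_eq_pd hc, lapl_eq_pd h, Finset.mul_sum]
  refine Finset.sum_congr rfl fun i _ => ?_
  have h1 : pd i (fun y => u (s • y)) =ᶠ[𝓝 x] fun y => s * pd i u (s • y) := by
    have h2 : ∀ᶠ y in 𝓝 x, DifferentiableAt ℝ u (s • y) :=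
      ((continuous_const_smul s).tendsto x).eventually (eventually_differentiableAt_of_two h)
    filter_upwards [h2] with y hy
    have := pd_comp_affine (f := u) (x := 0) (y := y) (s := s) (by rwa [zero_add]) i
    simpa only [zero_add] using this
  have hd : DifferentiableAt ℝ (pd i u) (s • x) := pd_differentiableAt h i
  have h3 := pd_comp_affine (f := pd i u) (x := 0) (y := x) (s := s) (by rwa [zero_add]) i
  simp only [zero_add] at h3
  have hd' : DifferentiableAt ℝ (fun y => pd i u (s • y)) x :=
    DifferentiableAt.comp (g := pd i u) (f := fun y => s • y) x hd
      ((differentiable_id.const_smul s) x)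
  rw [pd_congr h1, pd_const_mul hd', h3]; ring

lemma smul_mem_of_mem_closure (hΩ : IsOpen Ω) (hc : Convex ℝ Ω) (h0 : (0 : Euc n) ∈ Ω)
    {s : ℝ} (hs0 : 0 ≤ s) (hs1 : s < 1) {x : Euc n} (hx : x ∈ closure Ω) : s • x ∈ Ω := by
  have h0' : (0 : Euc n) ∈ interior Ω := by rwa [hΩ.interior_eq]
  have := hc.combo_interior_closure_mem_interior h0' hx (a := 1 - s) (b := s) (by linarith) hs0
    (by ring)
  rw [smul_zero, zero_add, hΩ.interior_eq] at this
  exact this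

lemma continuousAt_gradient {x : Euc n} (h : ContDiffAt ℝ 1 u x) :
    ContinuousAt (gradient u) x := by
  have h1 : ContinuousAt (fderiv ℝ u) x := (h.fderiv_right (m := 0) (by simp)).continuousAt
  exact ((InnerProductSpace.toDual ℝ (Euc n)).symm.continuous.continuousAt).comp h1

lemma measurable_gradient (u : Euc n → ℝ) : Measurable (gradient u) :=
  (InnerProductSpace.toDual ℝ (Euc n)).symm.continuous.measurable.comp (measurable_fderiv ℝ u)

lemma LipschitzWith.integrable_of_off {v : Euc n → ℝ} {C : ℝ≥0} (hv : LipschitzWith C v)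
    (hb : IsBounded Ω) (h0 : ∀ x, x ∉ Ω → v x = 0) : Integrable v :=
  hv.continuous.integrable_of_hasCompactSupport
    (HasCompactSupport.intro hb.isCompact_closure fun x hx => h0 x fun h => hx (subset_closure h))

lemma integrable_inner_gradient {v : Euc n → ℝ} {C : ℝ≥0} (hv : LipschitzWith C v)
    (hb : IsBounded Ω) (h0 : ∀ x, x ∉ Ω → v x = 0) {Y : Euc n → Euc n} (hY : Measurable Y)
    {M : ℝ} (hM : ∀ x, ‖Y x‖ ≤ M) : Integrable fun x => ⟪gradient v x, Y x⟫ := by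
  have h1 : IntegrableOn (fun x => ⟪gradient v x, Y x⟫) (closure Ω) := by
    refine Measure.integrableOn_of_bounded (M := C * M) hb.isCompact_closure.measure_lt_top.ne
      ((measurable_gradient v).inner hY).aestronglyMeasurable (Eventually.of_forall fun x => ?_)
    exact (norm_inner_le_norm _ _).trans (mul_le_mul (norm_gradient_le hv x) (hM x)
      (norm_nonneg _) C.2)
  refine h1.integrable_of_forall_notMem_eq_zero fun x hx => ?_
  rw [gradient_eq_zero_of_notMem isClosed_closure
    (fun x hx => h0 x fun h => hx (subset_closure h)) hx, inner_zero_left]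

/-- The weak formulation of `Δu = -2`. -/
theorem IsTorsion.weak_form (hu : IsTorsion Ω u) (hn : 0 < n) (hΩ : IsOpen Ω)
    (hb : IsBounded Ω) (hc : Convex ℝ Ω) (h0 : (0 : Euc n) ∈ Ω) {v : Euc n → ℝ} {C : ℝ≥0}
    (hv : LipschitzWith C v) (hv0 : ∀ x, x ∉ Ω → v x = 0) :
    ∫ x, ⟪gradient v x, gradient u x⟫ = 2 * ∫ x, v x := by
  obtain ⟨L, hL⟩ := hu.exists_lipschitz hn hΩ hb hc
  set s : ℕ → ℝ := fun k => 1 - 1 / ((k : ℝ) + 2) with hs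
  have hs0 : ∀ k, 0 < s k := fun k => by
    have : 1 / ((k : ℝ) + 2) < 1 := by
      rw [div_lt_one (by positivity)]; linarith [(Nat.cast_nonneg k : (0:ℝ) ≤ k)]
    simp only [hs]; linarith
  have hs1 : ∀ k, s k < 1 := fun k => by
    have : 0 < 1 / ((k : ℝ) + 2) := by positivity
    simp only [hs]; linarith
  have hst : Tendsto s atTop (𝓝 1) := by
    have h1 : Tendsto (fun k : ℕ => 1 / ((k : ℝ) + 2)) atTop (𝓝 0) :=
      tendsto_const_nhds.div_atTop (tendsto_atTop_add_const_right _ _ tendsto_natCast_atTop_atTop)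
    simpa [hs] using tendsto_const_nhds (x := (1:ℝ)).sub h1
  have key : ∀ k, ∫ x, ⟪gradient v x, s k • gradient u (s k • x)⟫ =
      2 * (s k) ^ 2 * ∫ x, v x := by
    intro k
    have h1 := ibp (U := (fun x => s k • x) ⁻¹' Ω) hb.isCompact_closure
      (hΩ.preimage (continuous_const_smul _))
      (fun x hx => smul_mem_of_mem_closure hΩ hc h0 (hs0 k).le (hs1 k) hx)
      (G := fun y => u (s k • y))
      (fun x hx => ContDiffAt.comp (g := u) (f := fun y => s k • y) x (hu.smooth _ hx)
        (contDiff_const_smul (s k)).contDiffAt) hv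
      (fun x hx => hv0 x fun h => hx (subset_closure h))
    have e1 : ∀ x, ⟪gradient v x, gradient (fun y => u (s k • y)) x⟫ =
        ⟪gradient v x, s k • gradient u (s k • x)⟫ := by
      intro x
      by_cases hx : x ∈ closure Ω
      · rw [gradient_comp_smul]
        exact (hu.smooth _ (smul_mem_of_mem_closure hΩ hc h0 (hs0 k).le (hs1 k)
          hx)).differentiableAt (by simp)
      · rw [gradient_eq_zero_of_notMem isClosed_closure
          (fun x hx => hv0 x fun h => hx (subset_closure h)) hx, inner_zero_left, inner_zero_left]
    have e2 : ∀ x, v x * lapl (fun y => u (s k • y)) x = (-2 * (s k) ^ 2) * v x := by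
      intro x
      by_cases hx : x ∈ Ω
      · have hx' := smul_mem_of_mem_closure hΩ hc h0 (hs0 k).le (hs1 k) (subset_closure hx)
        rw [lapl_comp_smul ((hu.smooth _ hx').of_le (by norm_cast)),
          hu.lapl_eq _ hx']; ring
      · rw [hv0 x hx, zero_mul, mul_zero]
    simp only [e1, e2] at h1
    rw [h1, integral_const_mul]; ring
  have hlim1 : Tendsto (fun k => ∫ x, ⟪gradient v x, s k • gradient u (s k • x)⟫) atTop
      (𝓝 (∫ x, ⟪gradient v x, gradient u x⟫)) := by
    have hbound : Integrable fun x => L * ‖gradient v x‖ := by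
      refine Integrable.const_mul ?_ _
      have h1 : IntegrableOn (fun x => ‖gradient v x‖) (closure Ω) := by
        refine Measure.integrableOn_of_bounded (M := C) hb.isCompact_closure.measure_lt_top.ne
          (measurable_gradient v).norm.aestronglyMeasurable (Eventually.of_forall fun x => ?_)
        rw [norm_norm]; exact norm_gradient_le hv x
      refine h1.integrable_of_forall_notMem_eq_zero fun x hx => ?_
      rw [gradient_eq_zero_of_notMem isClosed_closure
        (fun x hx => hv0 x fun h => hx (subset_closure h)) hx, norm_zero]
    refine tendsto_integral_of_dominated_convergence _ (fun k => ?_) hbound (fun k => ?_) ?_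
    · exact ((measurable_gradient v).inner (((measurable_gradient u).comp
        (measurable_const_smul (s k))).const_smul (s k))).aestronglyMeasurable
    · refine Eventually.of_forall fun x => ?_
      refine (norm_inner_le_norm _ _).trans ?_
      rw [mul_comm]
      refine mul_le_mul_of_nonneg_right ?_ (norm_nonneg _)
      rw [norm_smul, Real.norm_of_nonneg (hs0 k).le]
      have := norm_gradient_le hL (s k • x)
      nlinarith [hs0 k, hs1 k, norm_nonneg (gradient u (s k • x))]
    · have hnull : ∀ᵐ x : Euc n, x ∉ frontier Ω := by
        rw [ae_iff]; simpa using hc.addHaar_frontier volume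
      filter_upwards [hnull] with x hx
      by_cases hxΩ : x ∈ Ω
      · have hcont := continuousAt_gradient ((hu.smooth x hxΩ).of_le (m := 1) (by norm_cast))
        have hx1 : Tendsto (fun k => s k • x) atTop (𝓝 x) := by
          simpa using hst.smul_const x
        have := hst.smul (hcont.tendsto.comp hx1)
        rw [one_smul] at this
        exact tendsto_const_nhds.inner this
      · have hxc : x ∉ closure Ω := fun h => hx ⟨h, by rwa [hΩ.interior_eq]⟩
        rw [gradient_eq_zero_of_notMem isClosed_closure
          (fun x hx => hv0 x fun h => hx (subset_closure h)) hxc]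
        simp
  have hlim2 : Tendsto (fun k => ∫ x, ⟪gradient v x, s k • gradient u (s k • x)⟫) atTop
      (𝓝 (2 * 1 ^ 2 * ∫ x, v x)) := by
    simp only [key]
    exact ((hst.pow 2).const_mul 2).mul_const _
  have := tendsto_nhds_unique hlim1 hlim2
  rw [this]; ring

end

/-! ### The torsion energy -/

/-- The torsion energy of a function. -/
def energy (v : Euc n → ℝ) : ℝ := ∫ x, (4 * v x - ‖gradient v x‖ ^ 2)

/-- Lipschitz functions vanishing off `K`. -/
def IsTest (K : Set (Euc n)) (v : Euc n → ℝ) : Prop :=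
  (∃ C : ℝ≥0, LipschitzWith C v) ∧ ∀ x, x ∉ K → v x = 0

/-- The variational torsional rigidity. -/
def tor (K : Set (Euc n)) : ℝ := sSup (energy '' {v | IsTest K v})

lemma IsTest.mono {K K' : Set (Euc n)} (h : K ⊆ K') {v : Euc n → ℝ} (hv : IsTest K v) :
    IsTest K' v := ⟨hv.1, fun x hx => hv.2 x fun h' => hx (h h')⟩

lemma IsTest.eq_zero_of_notMem_interior {K : Set (Euc n)} {v : Euc n → ℝ} (hv : IsTest K v)
    {x : Euc n} (hx : x ∉ interior K) : v x = 0 := by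
  obtain ⟨⟨C, hC⟩, h0⟩ := hv
  have h1 : x ∈ closure Kᶜ := by rwa [closure_compl]
  have h2 : IsClosed {y | v y = 0} := isClosed_eq hC.continuous continuous_const
  exact closure_minimal (s := Kᶜ) (fun y hy => h0 y hy) h2 h1

lemma IsTest.interior {K : Set (Euc n)} {v : Euc n → ℝ} (hv : IsTest K v) :
    IsTest (interior K) v := ⟨hv.1, fun _ hx => hv.eq_zero_of_notMem_interior hx⟩

lemma isTest_zero (K : Set (Euc n)) : IsTest K fun _ => 0 :=
  ⟨⟨0, LipschitzWith.const 0⟩, fun _ _ => rfl⟩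

lemma energy_zero : energy (fun _ : Euc n => 0) = 0 := by
  have : ∀ x : Euc n, gradient (fun _ : Euc n => (0 : ℝ)) x = 0 := fun x => gradient_const ..
  simp [energy, this]

lemma gradient_sub' {f g : Euc n → ℝ} {x : Euc n} (hf : DifferentiableAt ℝ f x)
    (hg : DifferentiableAt ℝ g x) :
    gradient (fun y => f y - g y) x = gradient f x - gradient g x := by
  unfold gradient
  rw [fderiv_fun_sub hf hg, map_sub]

lemma integrable_norm_gradient_sq {Ω : Set (Euc n)} {v : Euc n → ℝ} {C : ℝ≥0}
    (hv : LipschitzWith C v) (hb : IsBounded Ω) (h0 : ∀ x, x ∉ Ω → v x = 0) :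
    Integrable fun x => ‖gradient v x‖ ^ 2 := by
  have := integrable_inner_gradient hv hb h0 (measurable_gradient v) (norm_gradient_le hv)
  simpa only [real_inner_self_eq_norm_sq] using this

section
variable {Ω : Set (Euc n)} {u : Euc n → ℝ}

lemma IsTorsion.isTest (hu : IsTorsion Ω u) (hn : 0 < n) (hΩ : IsOpen Ω)
    (hb : IsBounded Ω) (hc : Convex ℝ Ω) : IsTest Ω u :=
  ⟨hu.exists_lipschitz hn hΩ hb hc, hu.off⟩

lemma IsTorsion.energy_eq (hu : IsTorsion Ω u) (hn : 0 < n) (hΩ : IsOpen Ω)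
    (hb : IsBounded Ω) (hc : Convex ℝ Ω) (h0 : (0 : Euc n) ∈ Ω) {v : Euc n → ℝ}
    (hv : IsTest Ω v) :
    energy v = 2 * (∫ x, u x) - ∫ x, ‖gradient (fun y => u y - v y) x‖ ^ 2 := by
  obtain ⟨⟨C, hC⟩, hv0⟩ := hv
  obtain ⟨L, hL⟩ := hu.exists_lipschitz hn hΩ hb hc
  have hw : LipschitzWith (L + C) (fun y => u y - v y) := hL.sub hC
  have hw0 : ∀ x, x ∉ Ω → u x - v x = 0 := fun x hx => by rw [hu.off x hx, hv0 x hx, sub_zero]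
  have h1 := hu.weak_form hn hΩ hb hc h0 hC hv0
  have h2 := hu.weak_form hn hΩ hb hc h0 hL hu.off
  have i1 := integrable_inner_gradient hC hb hv0 (measurable_gradient u) (norm_gradient_le hL)
  have i2 := integrable_norm_gradient_sq hC hb hv0
  have i3 := integrable_norm_gradient_sq hL hb hu.off
  have i4 := LipschitzWith.integrable_of_off hC hb hv0
  simp only [real_inner_self_eq_norm_sq] at h2
  have e : ∫ x, ‖gradient (fun y => u y - v y) x‖ ^ 2 =
      ∫ x, (‖gradient u x‖ ^ 2 - 2 * ⟪gradient v x, gradient u x⟫ + ‖gradient v x‖ ^ 2) := by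
    refine integral_congr_ae ?_
    filter_upwards [hL.ae_differentiableAt, hC.ae_differentiableAt] with x hx hx'
    rw [gradient_sub' hx hx', norm_sub_sq_real, real_inner_comm]
  have i5 : Integrable fun x => ‖gradient u x‖ ^ 2 - 2 * ⟪gradient v x, gradient u x⟫ :=
    i3.sub (i1.const_mul 2)
  rw [e, integral_add i5 i2, integral_sub i3 (i1.const_mul 2),
    integral_const_mul, h1, h2, energy, integral_sub (i4.const_mul 4) i2, integral_const_mul]
  ring

lemma IsTorsion.energy_le (hu : IsTorsion Ω u) (hn : 0 < n) (hΩ : IsOpen Ω)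
    (hb : IsBounded Ω) (hc : Convex ℝ Ω) (h0 : (0 : Euc n) ∈ Ω) {v : Euc n → ℝ}
    (hv : IsTest Ω v) : energy v ≤ 2 * ∫ x, u x := by
  rw [hu.energy_eq hn hΩ hb hc h0 hv]
  have : 0 ≤ ∫ x, ‖gradient (fun y => u y - v y) x‖ ^ 2 :=
    integral_nonneg fun x => by positivity
  linarith

lemma IsTorsion.energy_self (hu : IsTorsion Ω u) (hn : 0 < n) (hΩ : IsOpen Ω)
    (hb : IsBounded Ω) (hc : Convex ℝ Ω) (h0 : (0 : Euc n) ∈ Ω) : energy u = 2 * ∫ x, u x := by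
  rw [hu.energy_eq hn hΩ hb hc h0 (hu.isTest hn hΩ hb hc)]
  have : ∀ x : Euc n, gradient (fun _ : Euc n => (0 : ℝ)) x = 0 := fun x => gradient_const ..
  simp [this]

theorem IsTorsion.tor_eq (hu : IsTorsion Ω u) (hn : 0 < n) (hΩ : IsOpen Ω)
    (hb : IsBounded Ω) (hc : Convex ℝ Ω) (h0 : (0 : Euc n) ∈ Ω) : tor Ω = 2 * ∫ x, u x := by
  refine IsGreatest.csSup_eq ⟨⟨u, hu.isTest hn hΩ hb hc, hu.energy_self hn hΩ hb hc h0⟩, ?_⟩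
  rintro _ ⟨v, hv, rfl⟩
  exact hu.energy_le hn hΩ hb hc h0 hv

lemma tor_interior (K : Set (Euc n)) : tor (interior K) = tor K := by
  unfold tor
  congr 2
  ext v
  exact ⟨fun h => h.mono interior_subset, fun h => h.interior⟩

lemma bddAbove_energy (hn : 0 < n) {K : Set (Euc n)} (hK : IsBounded K) :
    BddAbove (energy '' {v | IsTest K v}) := by
  obtain ⟨R, hR, hKR⟩ := hK.subset_ball_lt 0 0
  obtain ⟨w, hw⟩ := exists_isTorsion hn (isOpen_ball (x := (0 : Euc n)) (ε := R)) isBounded_ball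
  refine ⟨2 * ∫ x, w x, ?_⟩
  rintro _ ⟨v, hv, rfl⟩
  exact hw.energy_le hn isOpen_ball isBounded_ball (convex_ball _ _) (mem_ball_self hR)
    (hv.mono hKR)

lemma le_tor (hn : 0 < n) {K : Set (Euc n)} (hK : IsBounded K) {v : Euc n → ℝ}
    (hv : IsTest K v) : energy v ≤ tor K :=
  le_csSup (bddAbove_energy hn hK) ⟨v, hv, rfl⟩

lemma tor_le {K : Set (Euc n)} {c : ℝ} (h : ∀ v, IsTest K v → energy v ≤ c) : tor K ≤ c := by
  refine csSup_le ⟨_, _, isTest_zero K, rfl⟩ ?_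
  rintro _ ⟨v, hv, rfl⟩
  exact h v hv

lemma tor_mono (hn : 0 < n) {K K' : Set (Euc n)} (h : K ⊆ K') (hK : IsBounded K') :
    tor K ≤ tor K' := tor_le fun _ hv => le_tor hn hK (hv.mono h)

lemma tor_nonneg (hn : 0 < n) {K : Set (Euc n)} (hK : IsBounded K) : 0 ≤ tor K := by
  rw [← energy_zero (n := n)]; exact le_tor hn hK (isTest_zero K)

lemma energy_comp_affine {v : Euc n → ℝ} (hv : ∃ C : ℝ≥0, LipschitzWith C v) {a : ℝ} (ha : 0 < a)
    (z : Euc n) : energy (fun x => (a ^ 2)⁻¹ * v (z + a • x)) = (a ^ (n + 2))⁻¹ * energy v := by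
  obtain ⟨C, hC⟩ := hv
  have h1 : ∀ᵐ y : Euc n, DifferentiableAt ℝ v y := hC.ae_differentiableAt
  have h2 : ∀ᵐ x : Euc n, DifferentiableAt ℝ v (z + a • x) := by
    have q : Measure.QuasiMeasurePreserving (fun x : Euc n => z + a • x) volume volume :=
      (measurePreserving_add_left volume z).quasiMeasurePreserving.comp
        (Measure.quasiMeasurePreserving_smul volume ha.ne')
    exact q.ae h1
  have h3 : energy (fun x => (a ^ 2)⁻¹ * v (z + a • x)) =
      ∫ x, (a ^ 2)⁻¹ * (4 * v (z + a • x) - ‖gradient v (z + a • x)‖ ^ 2) := by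
    refine integral_congr_ae ?_
    filter_upwards [h2] with x hx
    have e : gradient (fun x => (a ^ 2)⁻¹ * v (z + a • x)) x =
        ((a ^ 2)⁻¹ * a) • gradient v (z + a • x) := by
      ext i
      rw [gradient_apply_eq_pd, PiLp.smul_apply, gradient_apply_eq_pd, smul_eq_mul, mul_assoc,
        ← pd_comp_affine hx, pd_const_mul]
      exact DifferentiableAt.comp (g := v) (f := fun y => z + a • y) x hx (by fun_prop)
    rw [e, norm_smul, mul_pow, mul_sub, Real.norm_eq_abs, sq_abs]
    have : ((a ^ 2)⁻¹ * a) ^ 2 = (a ^ 2)⁻¹ := by field_simp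
    rw [this]; ring
  rw [h3, integral_const_mul]
  have h4 := Measure.integral_comp_smul (μ := (volume : Measure (Euc n)))
    (fun y => 4 * v (z + y) - ‖gradient v (z + y)‖ ^ 2) a
  rw [h4, integral_add_left_eq_self (fun y => 4 * v y - ‖gradient v y‖ ^ 2) z]
  simp only [finrank_euclideanSpace, Fintype.card_fin, smul_eq_mul]
  rw [abs_of_pos (by positivity), energy, ← mul_assoc, ← mul_inv, ← pow_add, add_comm]

lemma tor_affine_le (hn : 0 < n) {K : Set (Euc n)} (hK : IsBounded K) {a : ℝ} (ha : 0 < a)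
    (z : Euc n) : tor ((fun x => z + a • x) '' K) ≤ a ^ (n + 2) * tor K := by
  refine tor_le fun v hv => ?_
  have h1 := energy_comp_affine hv.1 ha z
  have h2 : IsTest K (fun x => (a ^ 2)⁻¹ * v (z + a • x)) := by
    obtain ⟨⟨C, hC⟩, h0⟩ := hv
    refine ⟨?_, fun x hx => ?_⟩
    · refine ⟨_, ((lipschitzWith_smul ((a ^ 2)⁻¹ : ℝ)).comp (hC.comp
        ((LipschitzWith.const z).add (lipschitzWith_smul a))))⟩
    · change (a ^ 2)⁻¹ * v (z + a • x) = 0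
      rw [h0, mul_zero]
      rintro ⟨y, hy, hyx⟩
      have : y = x := by
        have h3 := add_left_cancel hyx
        exact smul_right_injective _ ha.ne' h3
      exact hx (this ▸ hy)
  have h3 := le_tor hn hK h2
  rw [h1, inv_mul_le_iff₀ (by positivity)] at h3
  exact h3

lemma tor_affine (hn : 0 < n) {K : Set (Euc n)} (hK : IsBounded K) {a : ℝ} (ha : 0 < a)
    (z : Euc n) : tor ((fun x => z + a • x) '' K) = a ^ (n + 2) * tor K := by
  refine le_antisymm (tor_affine_le hn hK ha z) ?_
  have hK' : IsBounded ((fun x => z + a • x) '' K) :=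
    ((LipschitzWith.const z).add (lipschitzWith_smul a)).isBounded_image hK
  have h := tor_affine_le hn hK' (inv_pos.2 ha) (-(a⁻¹ • z))
  have e : (fun x => -(a⁻¹ • z) + a⁻¹ • x) '' ((fun x => z + a • x) '' K) = K := by
    rw [image_image]
    convert image_id K using 2
    ext1 x
    simp [smul_smul, ha.ne']
  rw [e, inv_pow, le_inv_mul_iff₀ (by positivity)] at h
  exact h

lemma tor_pos (hn : 0 < n) {K : Set (Euc n)} (hK : IsBounded K) (hne : (interior K).Nonempty) :
    0 < tor K := by
  obtain ⟨z, hz⟩ := hne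
  obtain ⟨r, hr, hzr⟩ := Metric.isOpen_iff.1 isOpen_interior z hz
  have h1 : (fun x => z + r • x) '' ball (0 : Euc n) 1 ⊆ K := by
    rintro _ ⟨x, hx, rfl⟩
    refine interior_subset (hzr ?_)
    rw [mem_ball_zero_iff] at hx
    rw [mem_ball, dist_eq_norm, add_sub_cancel_left, norm_smul, Real.norm_of_nonneg hr.le]
    nlinarith
  refine lt_of_lt_of_le ?_ (tor_mono hn h1 hK)
  rw [tor_affine hn isBounded_ball hr]
  refine mul_pos (by positivity) ?_
  obtain ⟨w, hw⟩ := exists_isTorsion hn (isOpen_ball (x := (0 : Euc n)) (ε := 1)) isBounded_ball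
  rw [hw.tor_eq hn isOpen_ball isBounded_ball (convex_ball _ _) (mem_ball_self one_pos)]
  obtain ⟨L, hL⟩ := hw.exists_lipschitz hn isOpen_ball isBounded_ball (convex_ball _ _)
  have hi := hL.integrable_of_off isBounded_ball hw.off
  refine mul_pos two_pos ((integral_pos_iff_support_of_nonneg hw.nonneg hi).2 ?_)
  refine (measure_ball_pos volume (0 : Euc n) one_pos).trans_le (measure_mono fun x hx => ?_)
  exact (hw.pos x hx).ne'

/-- Thin bodies have small torsional rigidity. -/
lemma tor_thin_le (hn : 0 < n) {R ε : ℝ} (hR : 0 < R) (hε : 0 < ε) {X : Euc n} (hX : ‖X‖ = 1) :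
    tor {x : Euc n | |⟪x, X⟫| < ε ∧ ‖x‖ < R} ≤
      8 * ε ^ 2 * (volume (ball (0 : Euc n) R)).toReal := by
  set D : Set (Euc n) := {x : Euc n | |⟪x, X⟫| < ε ∧ ‖x‖ < R} with hD
  have hDb : D ⊆ ball 0 R := fun x hx => by simpa using hx.2
  have hb : IsBounded D := isBounded_ball.subset hDb
  have ho : IsOpen D := by
    have e1 : IsOpen {x : Euc n | |⟪x, X⟫| < ε} :=
      isOpen_lt (continuous_id.inner continuous_const).abs continuous_const
    have e2 : IsOpen {x : Euc n | ‖x‖ < R} := isOpen_lt (by fun_prop) continuous_const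
    exact e1.inter e2
  have hc : Convex ℝ D := by
    have e : D = (innerSL ℝ X) ⁻¹' (ball 0 ε) ∩ ball 0 R := by
      ext x
      simp [hD, real_inner_comm]
    rw [e]
    exact ((convex_ball _ _).linear_preimage (innerSL ℝ X).toLinearMap).inter (convex_ball _ _)
  have h0 : (0 : Euc n) ∈ D := by simp [hD, hε, hR]
  obtain ⟨w, hw⟩ := exists_isTorsion hn ho hb
  rw [hw.tor_eq hn ho hb hc h0]
  have hp : IsSlab D (X, -ε, ε) := ⟨hX, fun y hy => ⟨(abs_lt.1 hy.1).1.le, (abs_lt.1 hy.1).2.le⟩⟩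
  have hle : ∀ x, w x ≤ (ball (0 : Euc n) R).indicator (fun _ => 4 * ε ^ 2) x := by
    intro x
    by_cases hx : x ∈ D
    · rw [indicator_of_mem (hDb hx)]
      refine (hw.le_slab _ hp x hx).trans ((slabQ_le _ _).trans (le_of_eq ?_))
      simp only; ring
    · rw [hw.off x hx]
      exact indicator_nonneg (fun _ _ => by positivity) x
  obtain ⟨L, hL⟩ := hw.exists_lipschitz hn ho hb hc
  have : IsFiniteMeasure (volume.restrict (ball (0 : Euc n) R)) :=
    ⟨by rw [Measure.restrict_apply_univ]; exact measure_ball_lt_top⟩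
  have h1 := integral_mono (hL.integrable_of_off hb hw.off)
    ((integrable_indicator_iff measurableSet_ball).2
      (integrable_const (μ := volume.restrict (ball (0 : Euc n) R)) (4 * ε ^ 2))) hle
  rw [integral_indicator measurableSet_ball, integral_const, smul_eq_mul, Measure.real,
    Measure.restrict_apply_univ] at h1
  linarith

end

/-! ### Nontangential limits of the gradient -/

/-- A torsion function on a bounded open convex set containing the origin. -/
structure TorsionData (Ω : Set (Euc n)) (u : Euc n → ℝ) : Prop where
  dim : 0 < n
  isOpen : IsOpen Ω
  bdd : IsBounded Ω
  conv : Convex ℝ Ω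
  zero_mem : (0 : Euc n) ∈ Ω
  tor : IsTorsion Ω u

lemma TorsionData.exists_lipschitz {Ω : Set (Euc n)} {u : Euc n → ℝ} (T : TorsionData Ω u) :
    ∃ L : ℝ≥0, LipschitzWith L u := T.tor.exists_lipschitz T.dim T.isOpen T.bdd T.conv

lemma lapl_barrier_nonneg {X p y : Euc n} {b A k : ℝ} (hA : 0 ≤ A) (hy : 0 ≤ b - ⟪y, X⟫)
    (hp : 0 ≤ b - ⟪p, X⟫) (hq : n + 2 ≤ 2 * A * ‖y - p‖ ^ 2) :
    0 ≤ lapl (fun y => (b - ⟪y, X⟫) * (Real.exp (-(A * ‖y - p‖ ^ 2)) - k)) y := by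
  have hF : ContDiff ℝ 2 (fun t : ℝ => Real.exp (-(A * t)) - k) := by fun_prop
  have hq2 : ContDiffAt ℝ 2 (fun y : Euc n => ‖y - p‖ ^ 2) y :=
    (contDiff_normSq_sub p).contDiffAt
  have hE : ContDiffAt ℝ 2 (fun y : Euc n => Real.exp (-(A * ‖y - p‖ ^ 2)) - k) y :=
    hF.contDiffAt.comp y hq2
  have hd0 : ∀ t, HasDerivAt (fun t : ℝ => Real.exp (-(A * t))) (-A * Real.exp (-(A * t))) t :=
    fun t => by
      have h1 : HasDerivAt (fun t : ℝ => -(A * t)) (-(A * 1)) t :=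
        ((hasDerivAt_id' t).const_mul A).fun_neg
      have h2 := h1.exp
      rwa [mul_one, mul_comm] at h2
  have hd : ∀ t, HasDerivAt (fun t : ℝ => Real.exp (-(A * t)) - k)
      (-A * Real.exp (-(A * t))) t := fun t => (hd0 t).sub_const k
  have hd1 : deriv (fun t : ℝ => Real.exp (-(A * t)) - k) = fun t => -A * Real.exp (-(A * t)) :=
    funext fun t => (hd t).deriv
  have hd2 : ∀ t, deriv (fun t => -A * Real.exp (-(A * t))) t = A ^ 2 * Real.exp (-(A * t)) := by
    intro t
    rw [((hd0 t).const_mul (-A)).deriv]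
    ring
  have hpd : ∀ i, pd i (fun y : Euc n => Real.exp (-(A * ‖y - p‖ ^ 2)) - k) y =
      -A * Real.exp (-(A * ‖y - p‖ ^ 2)) * (2 * (y - p) i) := by
    intro i
    rw [← pd_normSq p i y]
    unfold pd
    have h := (hd (‖y - p‖ ^ 2)).comp_hasFDerivAt y (hq2.differentiableAt (by norm_num)).hasFDerivAt
    have h' : fderiv ℝ (fun y : Euc n => Real.exp (-(A * ‖y - p‖ ^ 2)) - k) y = _ := h.fderiv
    rw [h']; rfl
  rw [lapl_mul (contDiff_affine X b).contDiffAt hE, lapl_inner,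
    lapl_comp (F := fun t : ℝ => Real.exp (-(A * t)) - k) hF hq2, lapl_normSq, hd1, hd2]
  simp only [pd_normSq, pd_inner, hpd]
  set e := Real.exp (-(A * ‖y - p‖ ^ 2)) with he
  have he0 : 0 < e := Real.exp_pos _
  have s1 : ∑ i, (2 * (y - p) i) ^ 2 = 4 * ‖y - p‖ ^ 2 := by
    rw [← real_inner_self_eq_norm_sq, ← sum_mul_eq_inner, Finset.mul_sum]
    exact Finset.sum_congr rfl fun i _ => by ring
  have s2 : ∑ i, -X i * (-A * e * (2 * (y - p) i)) = 2 * A * e * ⟪y - p, X⟫ := by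
    rw [← sum_mul_eq_inner, Finset.mul_sum]
    exact Finset.sum_congr rfl fun i _ => by ring
  rw [s1, s2, inner_sub_left]
  have : 0 ≤ e * (2 * A * ((b - ⟪y, X⟫) * (2 * A * ‖y - p‖ ^ 2 - (n + 2)) + 2 * (b - ⟪p, X⟫))) := by
    have := mul_nonneg hy (sub_nonneg.2 hq)
    positivity
  refine this.trans (le_of_eq ?_)
  ring

section
variable {Ω : Set (Euc n)} {u : Euc n → ℝ}

set_option maxHeartbeats 1000000 in
lemma TorsionData.improve (T : TorsionData Ω u) {X : Euc n} (hX : ‖X‖ = 1) {c δ : ℝ} (hc : 0 < c)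
    (hδ : 0 < δ) : ∃ η > 0, ∃ s₀ > 0, ∀ x₀ p : Euc n, (∀ y ∈ closure Ω, ⟪y, X⟫ ≤ ⟪x₀, X⟫) →
      ∀ s, 0 < s → s < s₀ → p ∈ Ω → ‖p - x₀‖ = s →
      (∀ y ∈ Ω, ‖y - x₀‖ < 6 * s → u y + (⟪x₀, X⟫ - ⟪y, X⟫) ^ 2 ≤ (c + η) * (⟪x₀, X⟫ - ⟪y, X⟫)) →
      u p + (⟪x₀, X⟫ - ⟪p, X⟫) ^ 2 ≤ c * (⟪x₀, X⟫ - ⟪p, X⟫) - δ * s →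
      ∀ y ∈ Ω, ‖y - x₀‖ < s → u y ≤ (c - η) * (⟪x₀, X⟫ - ⟪y, X⟫) := by
  obtain ⟨L, hL⟩ := T.exists_lipschitz
  have hL0 : (0 : ℝ) ≤ L := L.2
  set M : ℝ := c + 2 + L with hM
  have hM0 : 0 < M := by positivity
  set κ : ℝ := min 1 (δ / (2 * M)) with hκ
  have hκ0 : 0 < κ := lt_min one_pos (by positivity)
  have hκ1 : κ ≤ 1 := min_le_left _ _
  have hκM : M * κ ≤ δ / 2 := by
    have := min_le_right 1 (δ / (2 * M))
    rw [← hκ, le_div_iff₀ (by positivity)] at this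
    linarith
  set A' : ℝ := (n + 2) / (2 * κ ^ 2) with hA'
  have hA'0 : 0 < A' := by positivity
  set e₀ : ℝ := Real.exp (-(A' * 4)) - Real.exp (-(A' * 16)) with he₀
  have he0 : 0 < e₀ := by
    rw [he₀, sub_pos, Real.exp_lt_exp]; linarith
  have he1 : e₀ ≤ 1 := by
    have h1 : Real.exp (-(A' * 4)) ≤ 1 := Real.exp_le_one_iff.2 (by linarith)
    have h2 := Real.exp_pos (-(A' * 16))
    linarith
  set m : ℝ := min (δ / 4) (c / 2) with hm
  have hm0 : 0 < m := lt_min (by positivity) (by positivity)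
  have hm1 : m ≤ δ / 4 := min_le_left _ _
  have hm2 : m ≤ c / 2 := min_le_right _ _
  obtain ⟨η, hη0, hη1, hη2⟩ : ∃ η : ℝ, 0 < η ∧ η ≤ 1 ∧ η ≤ m * e₀ / 2 :=
    ⟨min 1 (m * e₀ / 2), lt_min one_pos (by positivity), min_le_left _ _, min_le_right _ _⟩
  refine ⟨η, hη0, min (1 / 4) (c / 10), lt_min (by norm_num) (by positivity), ?_⟩
  intro x₀ p hx₀ s hs hs₀ hp hps hup hbad
  have hs1 : s < 1 / 4 := hs₀.trans_le (min_le_left _ _)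
  have hs2 : s < c / 10 := hs₀.trans_le (min_le_right _ _)
  have hκs : κ * s ≤ s := mul_le_of_le_one_left hs.le hκ1
  have hδs : 0 < δ * s := mul_pos hδ hs
  set b := ⟪x₀, X⟫ with hb
  have hl : ∀ y, |b - ⟪y, X⟫| ≤ ‖y - x₀‖ := fun y => by
    rw [hb, ← inner_sub_left]
    have := abs_real_inner_le_norm (x₀ - y) X
    rwa [hX, mul_one, norm_sub_rev] at this
  have hlp : ∀ y, |⟪p, X⟫ - ⟪y, X⟫| ≤ ‖y - p‖ := fun y => by
    rw [← inner_sub_left]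
    have := abs_real_inner_le_norm (p - y) X
    rwa [hX, mul_one, norm_sub_rev] at this
  have hl0 : ∀ y ∈ closure Ω, 0 ≤ b - ⟪y, X⟫ := fun y hy => sub_nonneg.2 (hx₀ y hy)
  have hux : ∀ y, ‖y - p‖ ≤ κ * s →
      δ * s / 2 ≤ (c + η) * (b - ⟪y, X⟫) - u y - (b - ⟪y, X⟫) ^ 2 := by
    intro y hy
    have h1 : |u y - u p| ≤ L * ‖y - p‖ := by
      have := hL.dist_le_mul y p
      rwa [Real.dist_eq, dist_eq_norm] at this
    have h2 := hlp y
    have hys : ‖y - p‖ ≤ s := hy.trans hκs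
    have h3 := hl p
    rw [hps] at h3
    have h4 : |b - ⟪y, X⟫| ≤ 2 * s := (hl y).trans (by
      have := norm_add_le (y - p) (p - x₀)
      rw [sub_add_sub_cancel] at this
      linarith)
    have hp0 := hl0 p (subset_closure hp)
    rw [abs_le] at h1 h2 h3 h4
    have h5 : (b - ⟪y, X⟫) ^ 2 - (b - ⟪p, X⟫) ^ 2 ≤ ‖y - p‖ := by
      have e : (b - ⟪y, X⟫) ^ 2 - (b - ⟪p, X⟫) ^ 2 =
        (⟪p, X⟫ - ⟪y, X⟫) * ((b - ⟪y, X⟫) + (b - ⟪p, X⟫)) := by ring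
      rw [e]
      have h6 : |⟪p, X⟫ - ⟪y, X⟫| * |(b - ⟪y, X⟫) + (b - ⟪p, X⟫)| ≤ ‖y - p‖ * 1 :=
        mul_le_mul (hlp y) (abs_le.2 ⟨by linarith, by linarith⟩) (abs_nonneg _) (norm_nonneg _)
      rw [← abs_mul, mul_one] at h6
      exact (le_abs_self _).trans h6
    have h7 : (c + η) * (⟪y, X⟫ - ⟪p, X⟫) ≤ (c + 1) * ‖y - p‖ :=
      (mul_le_mul_of_nonneg_left (by linarith : ⟪y, X⟫ - ⟪p, X⟫ ≤ ‖y - p‖)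
        (by positivity)).trans (by gcongr)
    have h8 : M * ‖y - p‖ ≤ δ / 2 * s := by
      calc M * ‖y - p‖ ≤ M * (κ * s) := by gcongr
        _ = (M * κ) * s := by ring
        _ ≤ _ := by gcongr
    have h9 : 0 ≤ η * (b - ⟪p, X⟫) := by positivity
    rw [hM] at h8
    linarith
  set D : Set (Euc n) := Ω ∩ (ball p (4 * s) ∩ (closedBall p (κ * s))ᶜ) with hD
  have hDo : IsOpen D := T.isOpen.inter (isOpen_ball.inter isClosed_closedBall.isOpen_compl)
  obtain ⟨A, hA0, hAs⟩ : ∃ A : ℝ, 0 < A ∧ A * s ^ 2 = A' :=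
    ⟨A' / s ^ 2, by positivity, by field_simp⟩
  have hA16 : ∀ y, ‖y - p‖ = 4 * s → A * ‖y - p‖ ^ 2 = A' * 16 := fun y hy => by
    rw [hy, ← hAs]; ring
  set β : Euc n → ℝ := fun y =>
    (b - ⟪y, X⟫) * (Real.exp (-(A * ‖y - p‖ ^ 2)) - Real.exp (-(A' * 16)))
    with hβ
  have hβl : ∀ y ∈ closure Ω, β y ≤ b - ⟪y, X⟫ := fun y hy => by
    have h1 : Real.exp (-(A * ‖y - p‖ ^ 2)) ≤ 1 := Real.exp_le_one_iff.2 (by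
      have : 0 ≤ A * ‖y - p‖ ^ 2 := by positivity
      linarith)
    have h2 := Real.exp_pos (-(A' * 16))
    simp only [hβ]
    exact mul_le_of_le_one_right (hl0 y hy) (by linarith)
  have hβs : ContDiff ℝ (⊤ : ℕ∞) β := (contDiff_affine X b).mul
    ((Real.contDiff_exp.comp ((contDiff_const.mul (contDiff_normSq_sub p)).neg)).sub contDiff_const)
  have hls : ContDiff ℝ (⊤ : ℕ∞) (fun y : Euc n => (c + η) * (b - ⟪y, X⟫) - (b - ⟪y, X⟫) ^ 2) :=
    (contDiff_const.mul (contDiff_affine X b)).sub ((contDiff_affine X b).pow 2)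
  set v : Euc n → ℝ := fun y =>
    (m * β y - ((c + η) * (b - ⟪y, X⟫) - (b - ⟪y, X⟫) ^ 2)) + u y with hv
  have hllap : ∀ y, lapl (fun y : Euc n => (c + η) * (b - ⟪y, X⟫) - (b - ⟪y, X⟫) ^ 2) y = -2 := by
    intro y
    have e : (fun y : Euc n => (b - ⟪y, X⟫) ^ 2) = fun y => (b - ⟪y, X⟫) * (b - ⟪y, X⟫) := by
      ext y; ring
    rw [lapl_sub (contDiff_const.mul (contDiff_affine X b)).contDiffAt
      ((contDiff_affine X b).pow 2).contDiffAt, lapl_const_mul (contDiff_affine X b).contDiffAt,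
      lapl_inner, e, lapl_mul (contDiff_affine X b).contDiffAt (contDiff_affine X b).contDiffAt,
      lapl_inner]
    simp only [pd_inner]
    have : ∑ i, -X i * -X i = 1 := by
      rw [← one_pow 2, ← hX, ← real_inner_self_eq_norm_sq, ← sum_mul_eq_inner]
      exact Finset.sum_congr rfl fun i _ => by ring
    rw [this]; ring
  have hβ2 : ContDiff ℝ 2 β := hβs.of_le (by norm_cast)
  have hls2 := hls.of_le (m := 2) (by norm_cast)
  have key := weak_max_principle T.dim (D := D) hDo (T.bdd.subset inter_subset_left) (v := v)
    (((((continuous_const.mul hβs.continuous).sub hls.continuous).add hL.continuous)).continuousOn)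
    (fun y hy => (((contDiff_const.mul hβ2).sub hls2).contDiffAt).add
      ((T.tor.smooth y hy.1).of_le (by norm_cast)))
    (fun y hy => by
      have h1 := lapl_barrier_nonneg (X := X) (p := p) (y := y) (b := b) (A := A)
        (k := Real.exp (-(A' * 16))) hA0.le (hl0 y (subset_closure hy.1))
        (hl0 p (subset_closure hp))
        (by
          have h2 : κ * s < ‖y - p‖ := by simpa [dist_eq_norm] using hy.2.2
          have h3 : (κ * s) ^ 2 ≤ ‖y - p‖ ^ 2 := by gcongr
          have h4 : 2 * A * (κ * s) ^ 2 = n + 2 := by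
            have : 2 * A * (κ * s) ^ 2 = 2 * κ ^ 2 * (A * s ^ 2) := by ring
            rw [this, hAs, hA']; field_simp
          rw [← h4]; gcongr)
      rw [hv, lapl_add ((contDiff_const.mul hβ2).sub hls2).contDiffAt
        ((T.tor.smooth y hy.1).of_le (by norm_cast)),
        lapl_sub (contDiff_const.mul hβ2).contDiffAt hls2.contDiffAt,
        lapl_const_mul hβ2.contDiffAt, hllap, T.tor.lapl_eq y hy.1]
      have : 0 ≤ m * lapl β y := mul_nonneg hm0.le h1
      linarith)
    (fun y hy => by
      have hyc : y ∈ closure Ω := closure_mono inter_subset_left hy.1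
      have hyD : y ∉ D := by
        have := hy.2; rwa [hDo.interior_eq] at this
      have h4s : ‖y - p‖ ≤ 4 * s := by
        have h1 : D ⊆ closedBall p (4 * s) := fun z hz => ball_subset_closedBall hz.2.1
        have := closure_minimal h1 isClosed_closedBall hy.1
        rwa [mem_closedBall, dist_eq_norm] at this
      have h5s : ‖y - x₀‖ ≤ 5 * s := by
        have := norm_add_le (y - p) (p - x₀)
        rw [sub_add_sub_cancel] at this
        linarith
      have hly := hl0 y hyc
      have hly5 := (le_abs_self _).trans ((hl y).trans h5s)
      simp only [hv]
      by_cases hyΩ : y ∈ Ω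
      · by_cases hk : ‖y - p‖ ≤ κ * s
        · have h1 := hux y hk
          have h2 := hβl y hyc
          have h3 : b - ⟪y, X⟫ ≤ 2 * s := (le_abs_self _).trans ((hl y).trans (by
            have := norm_add_le (y - p) (p - x₀)
            rw [sub_add_sub_cancel] at this
            linarith))
          have h4 : m * β y ≤ δ / 4 * (2 * s) :=
            (mul_le_mul_of_nonneg_left (h2.trans h3) hm0.le).trans (by gcongr)
          linarith
        · have h1 : ‖y - p‖ = 4 * s := by
            refine le_antisymm h4s (not_lt.1 fun hlt => hyD ⟨hyΩ, ?_, ?_⟩)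
            · rwa [mem_ball, dist_eq_norm]
            · rw [mem_compl_iff, mem_closedBall, dist_eq_norm]; exact hk
          have h2 : β y = 0 := by simp only [hβ]; rw [hA16 y h1, sub_self, mul_zero]
          have h3 := hup y hyΩ (by linarith)
          rw [h2, mul_zero]
          linarith
      · rw [T.tor.off y hyΩ, add_zero]
        have h1 : m * β y ≤ c / 2 * (b - ⟪y, X⟫) :=
          (mul_le_mul_of_nonneg_left (hβl y hyc) hm0.le).trans (by gcongr)
        have h2 : (b - ⟪y, X⟫) * (b - ⟪y, X⟫) ≤ c / 2 * (b - ⟪y, X⟫) :=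
          mul_le_mul_of_nonneg_right (by linarith) hly
        have h3 : 0 ≤ η * (b - ⟪y, X⟫) := by positivity
        linarith)
  intro y hy hys
  have hly := hl0 y (subset_closure hy)
  have hyp : ‖y - p‖ ≤ 2 * s := by
    have := norm_add_le (y - x₀) (x₀ - p)
    rw [sub_add_sub_cancel, norm_sub_rev x₀ p] at this
    linarith
  have hbase : m * e₀ * (b - ⟪y, X⟫) ≤ (c + η) * (b - ⟪y, X⟫) - u y - (b - ⟪y, X⟫) ^ 2 := by
    by_cases hk : ‖y - p‖ ≤ κ * s
    · have h1 := hux y hk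
      have h2 := (le_abs_self _).trans (hl y)
      have h3 : m * e₀ * (b - ⟪y, X⟫) ≤ δ / 4 * 1 * s := by
        gcongr
        linarith
      linarith
    · have h1 := key y ⟨hy, by rw [mem_ball, dist_eq_norm]; linarith,
        by rw [mem_compl_iff, mem_closedBall, dist_eq_norm]; exact hk⟩
      simp only [hv] at h1
      have h2 : e₀ * (b - ⟪y, X⟫) ≤ β y := by
        simp only [hβ]
        rw [mul_comm]
        refine mul_le_mul_of_nonneg_left ?_ hly
        have h3 : A * ‖y - p‖ ^ 2 ≤ A' * 4 := by
          have : A * ‖y - p‖ ^ 2 ≤ A * (2 * s) ^ 2 := by gcongr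
          rw [← hAs]; linarith
        have := Real.exp_le_exp.2 (neg_le_neg h3)
        linarith
      have h3 := mul_le_mul_of_nonneg_left h2 hm0.le
      linarith
  have hη := mul_le_mul_of_nonneg_right hη2 hly
  linarith [sq_nonneg (b - ⟪y, X⟫)]

end

section
variable {Ω : Set (Euc n)} {u : Euc n → ℝ}

lemma TorsionData.exists_slope (T : TorsionData Ω u) {X x₀ : Euc n} (hX : ‖X‖ = 1)
    (hx₀ : ∀ y ∈ closure Ω, ⟪y, X⟫ ≤ ⟪x₀, X⟫) :
    ∃ c, 0 ≤ c ∧ ∀ δ > 0, ∃ r > 0, ∀ y ∈ Ω, ‖y - x₀‖ < r →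
      u y ≤ (c + δ) * (⟪x₀, X⟫ - ⟪y, X⟫) ∧
      c * (⟪x₀, X⟫ - ⟪y, X⟫) - δ * ‖y - x₀‖ ≤ u y := by
  have hl0 : ∀ y ∈ Ω, 0 ≤ ⟪x₀, X⟫ - ⟪y, X⟫ := fun y hy => sub_nonneg.2 (hx₀ y (subset_closure hy))
  have hl : ∀ y, |⟪x₀, X⟫ - ⟪y, X⟫| ≤ ‖y - x₀‖ := fun y => by
    rw [← inner_sub_left]
    have := abs_real_inner_le_norm (x₀ - y) X
    rwa [hX, mul_one, norm_sub_rev] at this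
  set S : Set ℝ := {C | 0 ≤ C ∧ ∃ r > 0, ∀ y ∈ Ω, ‖y - x₀‖ < r →
    u y ≤ C * (⟪x₀, X⟫ - ⟪y, X⟫)} with hS
  obtain ⟨R, hR0, hR⟩ := T.bdd.subset_ball_lt 0 0
  have hne : S.Nonempty := ⟨2 * R, by positivity, 1, one_pos, fun y hy _ =>
    T.tor.le_linear (hR.trans ball_subset_closedBall) hX (fun z hz => hx₀ z (subset_closure hz)) hy⟩
  have hbd : BddBelow S := ⟨0, fun C hC => hC.1⟩
  set c := sInf S with hc
  have hc0 : 0 ≤ c := le_csInf hne fun C hC => hC.1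
  have hup : ∀ δ > 0, ∃ r > 0, ∀ y ∈ Ω, ‖y - x₀‖ < r → u y ≤ (c + δ) * (⟪x₀, X⟫ - ⟪y, X⟫) := by
    intro δ hδ
    obtain ⟨C, ⟨-, r, hr, h⟩, hlt⟩ := exists_lt_of_csInf_lt hne (lt_add_of_pos_right c hδ)
    exact ⟨r, hr, fun y hy hyr => (h y hy hyr).trans
      (mul_le_mul_of_nonneg_right hlt.le (hl0 y hy))⟩
  have hlow : ∀ δ > 0, ∃ r > 0, ∀ y ∈ Ω, ‖y - x₀‖ < r →
      c * (⟪x₀, X⟫ - ⟪y, X⟫) - δ * ‖y - x₀‖ ≤ u y := by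
    intro δ hδ
    rcases hc0.eq_or_lt with h0 | hcp
    · refine ⟨1, one_pos, fun y hy _ => ?_⟩
      rw [← h0, zero_mul, zero_sub]
      have := T.tor.nonneg y
      have : 0 ≤ δ * ‖y - x₀‖ := by positivity
      linarith
    by_contra! hcon
    obtain ⟨η, hη, s₀, hs₀, himp⟩ := T.improve hX hcp (half_pos hδ)
    obtain ⟨r, hr, hur⟩ := hup (η / 2) (half_pos hη)
    obtain ⟨p, hp, hpr, hpu⟩ := hcon (min (min s₀ (r / 6)) (min (δ / 2) (η / 12)))
      (by positivity)
    rw [lt_min_iff, lt_min_iff, lt_min_iff] at hpr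
    obtain ⟨⟨hp1, hp2⟩, hp3, hp4⟩ := hpr
    have hs : 0 < ‖p - x₀‖ := by
      refine lt_of_le_of_ne (norm_nonneg _) fun h => ?_
      have h1 := hl p
      rw [← h] at h1 hpu
      have h2 := T.tor.nonneg p
      have h3 := abs_nonpos_iff.1 h1
      rw [h3] at hpu
      simp at hpu
      linarith
    have hfin := himp x₀ p hx₀ ‖p - x₀‖ hs hp1 hp rfl
      (fun y hy hys => by
        have h1 := hur y hy (by linarith)
        have h2 := (le_abs_self _).trans (hl y)
        have h3 : (⟪x₀, X⟫ - ⟪y, X⟫) * (⟪x₀, X⟫ - ⟪y, X⟫) ≤ η / 2 * (⟪x₀, X⟫ - ⟪y, X⟫) :=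
          mul_le_mul_of_nonneg_right (by linarith) (hl0 y hy)
        linarith)
      (by
        have h2 := (le_abs_self _).trans (hl p)
        have h3 : (⟪x₀, X⟫ - ⟪p, X⟫) * (⟪x₀, X⟫ - ⟪p, X⟫) ≤ δ / 2 * ‖p - x₀‖ :=
          mul_le_mul (h2.trans hp3.le) h2 (hl0 p hp) (by positivity)
        linarith)
    have hmem : max (c - η) 0 ∈ S := ⟨le_max_right _ _, _, hs, fun y hy hys =>
      (hfin y hy hys).trans (mul_le_mul_of_nonneg_right (le_max_left _ _) (hl0 y hy))⟩
    have := csInf_le hbd hmem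
    rw [← hc] at this
    rcases le_max_iff.1 this with h | h <;> linarith
  refine ⟨c, hc0, fun δ hδ => ?_⟩
  obtain ⟨r₁, h1, h1'⟩ := hup δ hδ
  obtain ⟨r₂, h2, h2'⟩ := hlow δ hδ
  exact ⟨min r₁ r₂, lt_min h1 h2, fun y hy hyr => ⟨h1' y hy (hyr.trans_le (min_le_left _ _)),
    h2' y hy (hyr.trans_le (min_le_right _ _))⟩⟩

lemma ball_infDist_frontier_subset {x : Euc n} (hx : x ∈ Ω) :
    ball x (infDist x (frontier Ω)) ⊆ Ω := by
  intro y hy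
  by_contra hyΩ
  have hconn : IsPreconnected (ball x (infDist x (frontier Ω))) := (convex_ball _ _).isPreconnected
  have hd : ∀ z ∈ ball x (infDist x (frontier Ω)), z ∉ frontier Ω := fun z hz hzf => by
    have := infDist_le_dist_of_mem (x := x) hzf
    rw [mem_ball, dist_comm] at hz
    linarith
  obtain ⟨z, -, hz1, hz2⟩ := hconn (interior Ω) (closure Ω)ᶜ isOpen_interior
    isClosed_closure.isOpen_compl (fun z hz => by
      by_contra h
      rw [mem_union, not_or, notMem_compl_iff] at h
      exact hd z hz ⟨h.2, h.1⟩)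
    ⟨x, mem_ball_self (dist_nonneg.trans_lt hy), by
      by_contra h
      exact hd x (mem_ball_self (dist_nonneg.trans_lt hy)) ⟨subset_closure hx, h⟩⟩
    ⟨y, hy, fun h => hd y hy ⟨h, fun h' => hyΩ (interior_subset h')⟩⟩
  exact hz2 (subset_closure (interior_subset hz1))

lemma TorsionData.hasNTLimitAt (T : TorsionData Ω u) {X x₀ : Euc n} (hX : ‖X‖ = 1)
    (hxf : x₀ ∈ frontier Ω) {c : ℝ}
    (hc : ∀ δ > 0, ∃ r > 0, ∀ y ∈ Ω, ‖y - x₀‖ < r →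
      |u y - c * (⟪x₀, X⟫ - ⟪y, X⟫)| ≤ δ * ‖y - x₀‖) :
    HasNTLimitAt Ω (gradient u) x₀ (-(c • X)) := by
  intro α hα
  obtain ⟨C, hC0, hC⟩ := exists_gradient_bound n
  rw [Metric.tendsto_nhdsWithin_nhds]
  intro ε hε
  set b := ⟪x₀, X⟫ with hb
  have hl : ∀ y, |b - ⟪y, X⟫| ≤ ‖y - x₀‖ := fun y => by
    rw [hb, ← inner_sub_left]
    have := abs_real_inner_le_norm (x₀ - y) X
    rwa [hX, mul_one, norm_sub_rev] at this
  obtain ⟨δ, hδ, hδε⟩ : ∃ δ > 0, C * (3 * δ) * (1 + α) ≤ ε / 2 := by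
    refine ⟨ε / (6 * (C + 1) * (1 + α)), by positivity, ?_⟩
    have : C * (3 * (ε / (6 * (C + 1) * (1 + α)))) * (1 + α) = ε / 2 * (C / (C + 1)) := by
      field_simp; ring
    rw [this]
    refine mul_le_of_le_one_right (by positivity) ?_
    rw [div_le_one (by positivity)]; linarith
  obtain ⟨r, hr, hcr⟩ := hc δ hδ
  refine ⟨min (r / 2) (min (δ / 4) (ε / 4)), by positivity, fun p hp hpx => ?_⟩
  obtain ⟨hpΩ, hpd⟩ := hp
  rw [lt_min_iff, lt_min_iff, dist_eq_norm] at hpx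
  obtain ⟨h1, h2, h3⟩ := hpx
  rw [dist_eq_norm] at hpd
  set s := ‖p - x₀‖ with hs
  have hs0 : 0 < s := by
    rw [hs, norm_sub_pos_iff]
    rintro rfl
    rw [T.isOpen.frontier_eq] at hxf
    exact hxf.2 hpΩ
  set κ : ℝ := (1 + α)⁻¹ with hκ
  have hκ0 : 0 < κ := by positivity
  have hκ1 : κ ≤ 1 := inv_le_one_of_one_le₀ (by linarith)
  have hκs : κ * s ≤ s := mul_le_of_le_one_left hs0.le hκ1
  have hsub : ball p (κ * s) ⊆ Ω := by
    refine (ball_subset_ball ?_).trans (ball_infDist_frontier_subset hpΩ)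
    rw [hκ, inv_mul_le_iff₀ (by positivity)]
    exact hpd
  set q : Euc n → ℝ := fun y => (b - ⟪y, X⟫) * (b - ⟪y, X⟫ - c) with hq
  have hqe : q = fun y => (b - ⟪y, X⟫) * ((b - c) - ⟪y, X⟫) := by
    ext y; simp only [hq]; ring
  have hqs : ContDiff ℝ (⊤ : ℕ∞) q := by
    rw [hqe]; exact (contDiff_affine X b).mul (contDiff_affine X (b - c))
  have hq2 : ContDiff ℝ 2 q := hqs.of_le (by norm_cast)
  have hX1 : ∑ i, -X i * -X i = 1 := by
    rw [← one_pow 2, ← hX, ← real_inner_self_eq_norm_sq, ← sum_mul_eq_inner]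
    exact Finset.sum_congr rfl fun i _ => by ring
  have hql : ∀ y, lapl q y = 2 := by
    intro y
    rw [hqe, lapl_mul (contDiff_affine X b).contDiffAt (contDiff_affine X (b - c)).contDiffAt,
      lapl_inner, lapl_inner]
    simp only [pd_inner]
    rw [hX1]; ring
  have hu2 : ∀ y ∈ Ω, ContDiffAt ℝ 2 u y := fun y hy => (T.tor.smooth y hy).of_le (by norm_cast)
  have key := hC (fun y => u y + q y) p (κ * s) 0 (3 * δ * s) (by positivity)
    (fun z hz => (hu2 z (hsub hz)).add hq2.contDiffAt)
    (fun z hz => by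
      rw [lapl_add (hu2 z (hsub hz)) hq2.contDiffAt, hql, T.tor.lapl_eq z (hsub hz)]; norm_num)
    (fun z hz => by
      have hz1 : ‖z - x₀‖ ≤ 2 * s := by
        have h4 := norm_add_le (z - p) (p - x₀)
        rw [sub_add_sub_cancel] at h4
        rw [mem_ball, dist_eq_norm] at hz
        linarith
      have h5 := hcr z (hsub hz) (by linarith)
      have h6 : |(b - ⟪z, X⟫) * (b - ⟪z, X⟫)| ≤ δ * s := by
        rw [abs_mul]
        have h7 := (hl z).trans hz1
        calc _ ≤ (2 * s) * (2 * s) := by gcongr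
          _ = (4 * s) * s := by ring
          _ ≤ _ := by gcongr; linarith
      have h8 : δ * ‖z - x₀‖ ≤ δ * (2 * s) := by gcongr
      have e : u z + q z = (u z - c * (b - ⟪z, X⟫)) + (b - ⟪z, X⟫) * (b - ⟪z, X⟫) := by
        simp only [hq]; ring
      rw [e]
      exact (abs_add_le _ _).trans (by linarith))
  have hgrad : gradient (fun y => u y + q y) p = gradient u p + (c - 2 * (b - ⟪p, X⟫)) • X := by
    ext i
    rw [gradient_apply_eq_pd, pd_add ((hu2 p hpΩ).differentiableAt (by norm_num))
      (hq2.differentiable (by norm_num) p), PiLp.add_apply, gradient_apply_eq_pd, hqe,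
      pd_mul ((contDiff_affine X b).differentiable one_ne_zero p)
      ((contDiff_affine X (b - c)).differentiable one_ne_zero p), pd_inner, pd_inner,
      PiLp.smul_apply]
    simp only [smul_eq_mul]; ring
  rw [← norm_gradient_eq, hgrad] at key
  have hk : C * (3 * δ * s) / (κ * s) = C * (3 * δ) * (1 + α) := by
    rw [hκ]; field_simp
  rw [hk] at key
  rw [dist_eq_norm, sub_neg_eq_add]
  have e : gradient u p + c • X = (gradient u p + (c - 2 * (b - ⟪p, X⟫)) • X) +
      (2 * (b - ⟪p, X⟫)) • X := by rw [add_assoc, ← add_smul]; congr 2; ring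
  rw [e]
  refine (norm_add_le _ _).trans_lt ?_
  rw [norm_smul (2 * (b - ⟪p, X⟫)), hX, mul_one, Real.norm_eq_abs, abs_mul, abs_two]
  have := hl p
  linarith

end

section
variable {Ω : Set (Euc n)} {u : Euc n → ℝ}

lemma ball_smul_subset (hΩ : IsOpen Ω) (hc : Convex ℝ Ω) {ρ t : ℝ} (hρ : ball 0 ρ ⊆ Ω)
    (ht0 : 0 ≤ t) (ht1 : t < 1) {x : Euc n} (hx : x ∈ closure Ω) :
    ball (t • x) ((1 - t) * ρ) ⊆ Ω := by
  intro z hz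
  have h1 : 0 < 1 - t := by linarith
  have hw : (1 - t)⁻¹ • (z - t • x) ∈ interior Ω := by
    rw [hΩ.interior_eq]
    refine hρ ?_
    rw [mem_ball_zero_iff, norm_smul, Real.norm_of_nonneg (by positivity), inv_mul_lt_iff₀ h1]
    rwa [mem_ball, dist_eq_norm] at hz
  have := hc.combo_closure_interior_mem_interior hx hw ht0 h1 (by ring)
  rw [smul_inv_smul₀ h1.ne', add_sub_cancel] at this
  exact interior_subset this

lemma TorsionData.exists_radial_cone (T : TorsionData Ω u) {x₀ : Euc n} (hx : x₀ ∈ frontier Ω) :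
    ∃ α > 0, ∀ t : ℝ, 0 ≤ t → t < 1 → t • x₀ ∈ ntCone Ω x₀ α := by
  obtain ⟨ρ, hρ0, hρ⟩ := Metric.isOpen_iff.1 T.isOpen 0 T.zero_mem
  refine ⟨‖x₀‖ / ρ + 1, by positivity, fun t ht0 ht1 => ?_⟩
  have hsub := ball_smul_subset T.isOpen T.conv hρ ht0 ht1 (frontier_subset_closure hx)
  refine ⟨hsub (mem_ball_self (mul_pos (by linarith) hρ0)), ?_⟩
  have h1 : (1 - t) * ρ ≤ infDist (t • x₀) (frontier Ω) := by
    rw [le_infDist ⟨x₀, hx⟩]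
    intro z hz
    by_contra h
    rw [T.isOpen.frontier_eq] at hz
    refine hz.2 (hsub ?_)
    rw [mem_ball, dist_comm]; exact not_le.1 h
  have h2 : dist (t • x₀) x₀ = (1 - t) * ‖x₀‖ := by
    rw [dist_comm, dist_eq_norm]
    have : x₀ - t • x₀ = (1 - t) • x₀ := by rw [sub_smul, one_smul]
    rw [this, norm_smul, Real.norm_of_nonneg (by linarith)]
  rw [h2]
  have ht : 0 ≤ 1 - t := by linarith
  calc (1 - t) * ‖x₀‖ = (‖x₀‖ / ρ) * ((1 - t) * ρ) := by field_simp
    _ ≤ (1 + (‖x₀‖ / ρ + 1)) * ((1 - t) * ρ) := by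
        refine mul_le_mul_of_nonneg_right (by linarith) (by positivity)
    _ ≤ _ := by gcongr

lemma TorsionData.tendsto_radial (T : TorsionData Ω u) {x₀ G : Euc n} (hx : x₀ ∈ frontier Ω)
    (hG : HasNTLimitAt Ω (gradient u) x₀ G) :
    Tendsto (fun t : ℝ => gradient u (t • x₀)) (𝓝[<] 1) (𝓝 G) := by
  obtain ⟨α, hα, h⟩ := T.exists_radial_cone hx
  refine (hG α hα).comp (tendsto_nhdsWithin_iff.2 ⟨?_, ?_⟩)
  · have : Tendsto (fun t : ℝ => t • x₀) (𝓝 1) (𝓝 ((1 : ℝ) • x₀)) :=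
      (continuous_id.smul continuous_const).tendsto _
    rw [one_smul] at this
    exact this.mono_left nhdsWithin_le_nhds
  · have : Ico (0 : ℝ) 1 ∈ 𝓝[<] (1 : ℝ) := Ico_mem_nhdsLT one_pos
    filter_upwards [this] with t ht using h t ht.1 ht.2

/-- The modulus of the nontangential boundary gradient. -/
def ntSlope (Ω : Set (Euc n)) (u : Euc n → ℝ) (x : Euc n) : ℝ := ‖ntGradient Ω u x‖

lemma ntSlope_nonneg (x : Euc n) : 0 ≤ ntSlope Ω u x := norm_nonneg _

lemma TorsionData.ntGradient_eq_of (T : TorsionData Ω u) {x₀ G : Euc n} (hx : x₀ ∈ frontier Ω)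
    (hG : HasNTLimitAt Ω (gradient u) x₀ G) : ntGradient Ω u x₀ = G := by
  have h : ∃ L, HasNTLimitAt Ω (gradient u) x₀ L := ⟨G, hG⟩
  rw [ntGradient, dif_pos h]
  exact tendsto_nhds_unique (T.tendsto_radial hx h.choose_spec) (T.tendsto_radial hx hG)

lemma TorsionData.ntGradient_spec (T : TorsionData Ω u) {x₀ X : Euc n} (hx : x₀ ∈ frontier Ω)
    (hX : IsOuterNormalAt (closure Ω) x₀ X) :
    HasNTLimitAt Ω (gradient u) x₀ (ntGradient Ω u x₀) ∧
    ntGradient Ω u x₀ = -(ntSlope Ω u x₀ • X) ∧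
    ∀ δ > 0, ∃ r > 0, ∀ y ∈ Ω, ‖y - x₀‖ < r →
      u y ≤ (ntSlope Ω u x₀ + δ) * (⟪x₀, X⟫ - ⟪y, X⟫) := by
  obtain ⟨c, hc0, hc⟩ := T.exists_slope hX.1 hX.2
  have hNT : HasNTLimitAt Ω (gradient u) x₀ (-(c • X)) := by
    refine T.hasNTLimitAt hX.1 hx fun δ hδ => ?_
    obtain ⟨r, hr, h⟩ := hc δ hδ
    refine ⟨r, hr, fun y hy hyr => ?_⟩
    obtain ⟨h1, h2⟩ := h y hy hyr
    have h3 : ⟪x₀, X⟫ - ⟪y, X⟫ ≤ ‖y - x₀‖ := by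
      rw [← inner_sub_left]
      have := real_inner_le_norm (x₀ - y) X
      rwa [hX.1, mul_one, norm_sub_rev] at this
    have h4 := mul_le_mul_of_nonneg_left h3 hδ.le
    rw [abs_le]
    constructor <;> linarith
  have e := T.ntGradient_eq_of hx hNT
  have e2 : ntSlope Ω u x₀ = c := by
    rw [ntSlope, e, norm_neg, norm_smul, hX.1, mul_one, Real.norm_of_nonneg hc0]
  rw [e2, e]
  exact ⟨hNT, rfl, fun δ hδ => (hc δ hδ).imp fun r hr => ⟨hr.1, fun y hy hyr => (hr.2 y hy hyr).1⟩⟩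

lemma TorsionData.exists_isOuterNormalAt (T : TorsionData Ω u) {x₀ : Euc n} (hx : x₀ ∈ frontier Ω) :
    ∃ X, IsOuterNormalAt (closure Ω) x₀ X := by
  rw [T.isOpen.frontier_eq] at hx
  obtain ⟨X, h1, h2⟩ := exists_outerNormal T.isOpen T.conv ⟨0, T.zero_mem⟩ hx.2
  refine ⟨X, h1, fun y hy => ?_⟩
  have hcl : IsClosed {y : Euc n | ⟪y, X⟫ ≤ ⟪x₀, X⟫} :=
    isClosed_le (continuous_id.inner continuous_const) continuous_const
  exact closure_minimal (fun z hz => (h2 z hz).le) hcl hy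

lemma TorsionData.ntGradient_eq_zero (T : TorsionData Ω u) {x₀ X Y : Euc n}
    (hx : x₀ ∈ frontier Ω) (hX : IsOuterNormalAt (closure Ω) x₀ X)
    (hY : IsOuterNormalAt (closure Ω) x₀ Y) (hne : X ≠ Y) : ntSlope Ω u x₀ = 0 := by
  have h1 := (T.ntGradient_spec hx hX).2.1
  rw [(T.ntGradient_spec hx hY).2.1, neg_inj] at h1
  by_contra h
  exact hne (smul_right_injective _ h h1.symm)

lemma TorsionData.tendsto_ntGradient (T : TorsionData Ω u) {x₀ : Euc n} (hx : x₀ ∈ frontier Ω) :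
    Tendsto (fun t : ℝ => gradient u (t • x₀)) (𝓝[<] 1) (𝓝 (ntGradient Ω u x₀)) := by
  obtain ⟨X, hX⟩ := T.exists_isOuterNormalAt hx
  exact T.tendsto_radial hx (T.ntGradient_spec hx hX).1

lemma TorsionData.ntSlope_le (T : TorsionData Ω u) {L : ℝ≥0} (hL : LipschitzWith L u) {x₀ : Euc n}
    (hx : x₀ ∈ frontier Ω) : ntSlope Ω u x₀ ≤ L :=
  le_of_tendsto (T.tendsto_ntGradient hx).norm (Eventually.of_forall fun _ => norm_gradient_le hL _)

lemma bddAbove_inner {K : Set (Euc n)} (hK : IsBounded K) (X : Euc n) :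
    BddAbove ((fun y => ⟪y, X⟫) '' K) := by
  obtain ⟨R, hR⟩ := hK.subset_closedBall 0
  refine ⟨R * ‖X‖, ?_⟩
  rintro _ ⟨y, hy, rfl⟩
  refine (real_inner_le_norm y X).trans ?_
  have : ‖y‖ ≤ R := by simpa using hR hy
  gcongr

lemma inner_le_suppFn {K : Set (Euc n)} (hK : IsBounded K) {y : Euc n} (hy : y ∈ K) (X : Euc n) :
    ⟪y, X⟫ ≤ suppFn K X := le_csSup (bddAbove_inner hK X) ⟨y, hy, rfl⟩

lemma suppFn_le {K : Set (Euc n)} (hK : K.Nonempty) {X : Euc n} {c : ℝ}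
    (h : ∀ y ∈ K, ⟪y, X⟫ ≤ c) : suppFn K X ≤ c := by
  refine csSup_le (hK.image _) ?_
  rintro _ ⟨y, hy, rfl⟩
  exact h y hy

lemma suppFn_sub_le {K : Set (Euc n)} (hK : K.Nonempty) {R : ℝ} (hR : ∀ y ∈ K, ‖y‖ ≤ R)
    (X Y : Euc n) : suppFn K X - suppFn K Y ≤ R * ‖X - Y‖ := by
  have hb : IsBounded K := isBounded_iff_forall_norm_le.2 ⟨R, hR⟩
  rw [sub_le_iff_le_add]
  refine suppFn_le hK fun y hy => ?_
  have h1 := inner_le_suppFn hb hy Y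
  have h2 := (real_inner_le_norm y (X - Y)).trans
    (mul_le_mul_of_nonneg_right (hR y hy) (norm_nonneg _))
  rw [inner_sub_right] at h2
  linarith

lemma IsOuterNormalAt.suppFn_eq {K : Set (Euc n)} {x X : Euc n} (hX : IsOuterNormalAt K x X)
    (hx : x ∈ K) : suppFn K X = ⟪x, X⟫ := by
  refine IsGreatest.csSup_eq ⟨⟨x, hx, rfl⟩, ?_⟩
  rintro _ ⟨y, hy, rfl⟩
  exact hX.2 y hy

end

/-! ### Upper semicontinuity of the boundary slope -/

lemma lapl_barrier_quadratic {u : Euc n → ℝ} {X p y : Euc n} {b α β γ : ℝ} (hX : ‖X‖ = 1)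
    (hu : ContDiffAt ℝ 2 u y) :
    lapl (fun y => u y + α * ((b - ⟪y, X⟫) * (b - ⟪y, X⟫)) + (β * (b - ⟪y, X⟫) +
      γ * ‖y - p‖ ^ 2)) y = lapl u y + 2 * α + 2 * n * γ := by
  have h1 : ContDiffAt ℝ 2 (fun y : Euc n => b - ⟪y, X⟫) y := (contDiff_affine X b).contDiffAt
  have h2 : ContDiffAt ℝ 2 (fun y : Euc n => ‖y - p‖ ^ 2) y := (contDiff_normSq_sub p).contDiffAt
  have h3 : ContDiffAt ℝ 2 (fun y : Euc n => (b - ⟪y, X⟫) * (b - ⟪y, X⟫)) y := h1.mul h1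
  have h4 : ContDiffAt ℝ 2 (fun y : Euc n => α * ((b - ⟪y, X⟫) * (b - ⟪y, X⟫))) y :=
    contDiffAt_const.mul h3
  have h5 : ContDiffAt ℝ 2 (fun y : Euc n => β * (b - ⟪y, X⟫)) y := contDiffAt_const.mul h1
  have h6 : ContDiffAt ℝ 2 (fun y : Euc n => γ * ‖y - p‖ ^ 2) y := contDiffAt_const.mul h2
  rw [lapl_add (hu.add h4) (h5.add h6), lapl_add hu h4, lapl_add h5 h6, lapl_const_mul h3,
    lapl_const_mul h1, lapl_const_mul h2, lapl_mul h1 h1, lapl_inner, lapl_normSq]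
  have : ∑ i, pd i (fun y : Euc n => b - ⟪y, X⟫) y * pd i (fun y : Euc n => b - ⟪y, X⟫) y = 1 := by
    simp_rw [pd_inner, neg_mul_neg, sum_mul_eq_inner]
    rw [real_inner_self_eq_norm_sq, hX, one_pow]
  rw [this]; ring

section
variable {Ω : Set (Euc n)} {u : Euc n → ℝ}

lemma TorsionData.barrier_le (T : TorsionData Ω u) {X y : Euc n} {b C ε M ρ : ℝ} (hX : ‖X‖ = 1)
    (hy : y ∈ Ω) (hb : ∀ x ∈ closure Ω, ⟪x, X⟫ ≤ b) (hC : 0 ≤ C) (hM : 0 ≤ M) (hρ : 0 < ρ)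
    (hρε : ρ ≤ ε) (hMε : M * n ≤ ε * ρ) (hl : b - ⟪y, X⟫ < ρ)
    (hu : ∀ x ∈ Ω, ‖x - y‖ ≤ ρ + (b - ⟪y, X⟫) → u x ≤ C * (b - ⟪x, X⟫) + M) :
    u y ≤ (C + 2 * ε) * (b - ⟪y, X⟫) := by
  have hl0 : 0 ≤ b - ⟪y, X⟫ := sub_nonneg.2 (hb y (subset_closure hy))
  obtain ⟨l, hle⟩ : ∃ l, l = b - ⟪y, X⟫ := ⟨_, rfl⟩
  rw [← hle] at hl hu hl0 ⊢
  obtain ⟨p, hp⟩ : ∃ p, p = y + l • X := ⟨_, rfl⟩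
  have hyp : ‖y - p‖ = l := by
    rw [hp, sub_add_cancel_left, norm_neg, norm_smul, hX, mul_one, Real.norm_of_nonneg hl0]
  have hpX : b - ⟪p, X⟫ = 0 := by
    rw [hp, inner_add_left, real_inner_smul_left, real_inner_self_eq_norm_sq, hX]; linarith
  have hD : IsOpen (Ω ∩ ball p ρ) := T.isOpen.inter isOpen_ball
  have hlx : ∀ x : Euc n, ‖x - p‖ ≤ ρ → b - ⟪x, X⟫ ≤ ρ := by
    intro x hx
    have := (real_inner_le_norm (p - x) X)
    rw [hX, mul_one, inner_sub_left, norm_sub_rev] at this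
    linarith
  have hn1 : (1 : ℝ) ≤ n := by exact_mod_cast T.dim
  have key := weak_max_principle T.dim hD (T.bdd.subset inter_subset_left)
    (v := fun x => u x + (1 + M * n / ρ ^ 2) * ((b - ⟪x, X⟫) * (b - ⟪x, X⟫)) +
      ((-(C + ε + M * n / ρ)) * (b - ⟪x, X⟫) + (-(M / ρ ^ 2)) * ‖x - p‖ ^ 2)) ?_ ?_ ?_ ?_ y
      ⟨hy, by rw [mem_ball, dist_eq_norm, hyp]; exact hl⟩
  · simp only [← hle, hyp] at key
    have h1 : M * n / ρ ^ 2 * (l * l) = (M * n) * (l * l) / ρ ^ 2 := by ring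
    have h2 : M / ρ ^ 2 * l ^ 2 ≤ M * n / ρ ^ 2 * (l * l) := by
      have : M / ρ ^ 2 * l ^ 2 = (M / ρ ^ 2 * (l * l)) * 1 := by ring
      rw [this]
      have h3 : M * n / ρ ^ 2 * (l * l) = (M / ρ ^ 2 * (l * l)) * n := by ring
      rw [h3]
      exact mul_le_mul_of_nonneg_left hn1 (mul_nonneg (by positivity) (mul_nonneg hl0 hl0))
    have h4 : M * n / ρ * l ≤ ε * l :=
      mul_le_mul_of_nonneg_right (by rwa [div_le_iff₀ hρ]) hl0
    have h5 := mul_self_nonneg l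
    linarith
  · refine Continuous.continuousOn ?_
    have h1 : Continuous fun x : Euc n => b - ⟪x, X⟫ := (contDiff_affine (k := 0) X b).continuous
    have h2 := T.tor.continuous T.isOpen T.bdd T.conv
    fun_prop
  · intro x hx
    have h1 : ContDiffAt ℝ 2 (fun y : Euc n => b - ⟪y, X⟫) x := (contDiff_affine X b).contDiffAt
    have h2 : ContDiffAt ℝ 2 (fun y : Euc n => ‖y - p‖ ^ 2) x :=
      (contDiff_normSq_sub p).contDiffAt
    have h3 : ContDiffAt ℝ 2 u x :=
      (T.tor.smooth x hx.1).of_le (by norm_cast)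
    exact (h3.add (contDiffAt_const.mul (h1.mul h1))).add
      ((contDiffAt_const.mul h1).add (contDiffAt_const.mul h2))
  · intro x hx
    have h3 : ContDiffAt ℝ 2 u x :=
      (T.tor.smooth x hx.1).of_le (by norm_cast)
    rw [lapl_barrier_quadratic hX h3, T.tor.lapl_eq x hx.1]
    apply le_of_eq
    field_simp
    ring
  · intro x hx
    have hxc : x ∈ closure Ω := closure_mono inter_subset_left (frontier_subset_closure hx)
    have hxρ : ‖x - p‖ ≤ ρ := by
      have : x ∈ closedBall p ρ := closure_ball_subset_closedBall
        (closure_mono inter_subset_right (frontier_subset_closure hx))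
      rwa [mem_closedBall, dist_eq_norm] at this
    obtain ⟨m, hm⟩ : ∃ m, m = b - ⟪x, X⟫ := ⟨_, rfl⟩
    have hm0 : 0 ≤ m := hm ▸ sub_nonneg.2 (hb x hxc)
    have hmρ : m ≤ ρ := hm ▸ hlx x hxρ
    rw [← hm]
    have h1 : m * m ≤ ε * m := mul_le_mul_of_nonneg_right (hmρ.trans hρε) hm0
    have h2 : M * n / ρ ^ 2 * (m * m) ≤ M * n / ρ * m := by
      have e : M * n / ρ * m = M * n / ρ ^ 2 * (ρ * m) := by field_simp
      rw [e]
      exact mul_le_mul_of_nonneg_left (mul_le_mul_of_nonneg_right hmρ hm0) (by positivity)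
    have h3 : u x ≤ C * m + M / ρ ^ 2 * ‖x - p‖ ^ 2 := by
      by_cases hxΩ : x ∈ Ω
      · have hxb : x ∉ ball p ρ := fun h => by
          rw [hD.frontier_eq] at hx
          exact hx.2 ⟨hxΩ, h⟩
        have hxe : ‖x - p‖ = ρ := by
          refine le_antisymm hxρ ?_
          rw [mem_ball, dist_eq_norm] at hxb
          exact not_lt.1 hxb
        have e : M / ρ ^ 2 * ρ ^ 2 = M := by field_simp
        rw [hxe, e, hm]
        refine hu x hxΩ ?_
        calc ‖x - y‖ = ‖(x - p) - (y - p)‖ := by rw [sub_sub_sub_cancel_right]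
          _ ≤ ‖x - p‖ + ‖y - p‖ := norm_sub_le _ _
          _ = ρ + l := by rw [hxe, hyp]
      · rw [T.tor.off x hxΩ]; positivity
    linarith

theorem TorsionData.slope_usc (T : TorsionData Ω u) {x₀ X₀ : Euc n} (hx : x₀ ∈ frontier Ω)
    (hX₀ : IsOuterNormalAt (closure Ω) x₀ X₀) {ε : ℝ} (hε : 0 < ε) :
    ∃ r > 0, ∀ X : Euc n, ‖X‖ = 1 → ‖X - X₀‖ < r → ∀ y ∈ Ω, ‖y - x₀‖ < r →
      u y ≤ (ntSlope Ω u x₀ + ε) * (suppFn (closure Ω) X - ⟪y, X⟫) := by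
  obtain ⟨ρ₀, hρ₀, h⟩ := (T.ntGradient_spec hx hX₀).2.2 (ε / 3) (by positivity)
  have hxc := frontier_subset_closure hx
  have hbc : IsBounded (closure Ω) := T.bdd.closure
  obtain ⟨R, hR0, hR⟩ := hbc.exists_pos_norm_le
  have hs := ntSlope_nonneg (Ω := Ω) (u := u) x₀
  have hCp : 0 < ntSlope Ω u x₀ + ε / 3 := by positivity
  obtain ⟨C, hC⟩ : ∃ C, C = ntSlope Ω u x₀ + ε / 3 := ⟨_, rfl⟩
  rw [← hC] at hCp h
  obtain ⟨ρ, hρ⟩ : ∃ ρ, ρ = min (ρ₀ / 4) (ε / 3) := ⟨_, rfl⟩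
  have hρ1 : ρ ≤ ρ₀ / 4 := hρ ▸ min_le_left _ _
  have hρ2 : ρ ≤ ε / 3 := hρ ▸ min_le_right _ _
  have hρ0 : 0 < ρ := hρ ▸ lt_min (by positivity) (by positivity)
  have hn1 : (1 : ℝ) ≤ n := by exact_mod_cast T.dim
  refine ⟨min (ρ / 4) (min (ρ / (8 * R)) (ε / 3 * ρ / (2 * R * C * n))), by positivity,
    fun X hX hXX y hy hyx => ?_⟩
  obtain ⟨hX1, hX2⟩ := lt_min_iff.1 (hXX.trans_le (min_le_right _ _))
  have hy1 := hyx.trans_le (min_le_left _ _)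
  rw [lt_div_iff₀ (by positivity)] at hX1 hX2
  have hcmp : ∀ x ∈ closure Ω, |(⟪x₀, X₀⟫ - ⟪x, X₀⟫) - (suppFn (closure Ω) X - ⟪x, X⟫)| ≤
      2 * R * ‖X - X₀‖ := by
    intro x hxΩ
    rw [← hX₀.suppFn_eq hxc]
    have h1 := suppFn_sub_le ⟨x₀, hxc⟩ hR X X₀
    have h2 := suppFn_sub_le ⟨x₀, hxc⟩ hR X₀ X
    have h3 := (abs_real_inner_le_norm x (X - X₀)).trans
      (mul_le_mul_of_nonneg_right (hR x hxΩ) (norm_nonneg _))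
    rw [norm_sub_rev] at h2
    rw [inner_sub_right, abs_le] at h3
    rw [abs_le]
    constructor <;> linarith
  have hlin : ⟪x₀, X₀⟫ - ⟪y, X₀⟫ ≤ ‖y - x₀‖ := by
    rw [← inner_sub_left]
    have := real_inner_le_norm (x₀ - y) X₀
    rwa [hX₀.1, mul_one, norm_sub_rev] at this
  have hly : suppFn (closure Ω) X - ⟪y, X⟫ < ρ := by
    have := (abs_le.1 (hcmp y (subset_closure hy))).1
    linarith
  have := T.barrier_le (b := suppFn (closure Ω) X) (C := C) (ε := ε / 3)
    (M := C * (2 * R * ‖X - X₀‖)) (ρ := ρ) hX hy (fun x hx => inner_le_suppFn hbc hx X) hCp.le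
    (by positivity) hρ0 hρ2 (by linarith) hly ?_
  · rw [hC] at this
    linarith
  · intro x hxΩ hxy
    have hx2 : ‖x - x₀‖ < ρ₀ := by
      have := norm_add_le (x - y) (y - x₀)
      rw [sub_add_sub_cancel] at this
      linarith
    refine (h x hxΩ hx2).trans ?_
    rw [← mul_add]
    refine mul_le_mul_of_nonneg_left ?_ hCp.le
    have := (abs_le.1 (hcmp x (subset_closure hxΩ))).2
    linarith

end

/-! ### Radial projection and polar decomposition of Lebesgue measure -/

/-- The radial projection onto `∂Ω`. -/
def rad (Ω : Set (Euc n)) (y : Euc n) : Euc n := (gauge Ω y)⁻¹ • y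

section
variable {Ω : Set (Euc n)} {u : Euc n → ℝ}

lemma TorsionData.nhds_zero (T : TorsionData Ω u) : Ω ∈ 𝓝 (0 : Euc n) :=
  T.isOpen.mem_nhds T.zero_mem

lemma TorsionData.gauge_pos (T : TorsionData Ω u) {y : Euc n} (hy : y ≠ 0) : 0 < gauge Ω y :=
  (_root_.gauge_pos (absorbent_nhds_zero T.nhds_zero)
    ((NormedSpace.isVonNBounded_iff ℝ).2 T.bdd)).2 hy

lemma TorsionData.gauge_lt_one (T : TorsionData Ω u) {y : Euc n} : gauge Ω y < 1 ↔ y ∈ Ω := by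
  rw [gauge_lt_one_iff_mem_interior T.conv T.nhds_zero, T.isOpen.interior_eq]

lemma TorsionData.gauge_continuous (T : TorsionData Ω u) : Continuous (gauge Ω) :=
  continuous_gauge T.conv T.nhds_zero

lemma gauge_smul' (Ω : Set (Euc n)) {t : ℝ} (ht : 0 ≤ t) (y : Euc n) :
    gauge Ω (t • y) = t * gauge Ω y := by
  rw [gauge_smul_of_nonneg ht, smul_eq_mul]

lemma TorsionData.gauge_smul_rad (T : TorsionData Ω u) (y : Euc n) :
    gauge Ω y • rad Ω y = y := by
  rcases eq_or_ne y 0 with rfl | hy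
  · simp [rad]
  · rw [rad, smul_inv_smul₀ (T.gauge_pos hy).ne']

lemma TorsionData.gauge_rad (T : TorsionData Ω u) {y : Euc n} (hy : y ≠ 0) :
    gauge Ω (rad Ω y) = 1 := by
  have := T.gauge_pos hy
  rw [rad, gauge_smul' Ω (inv_nonneg.2 this.le), inv_mul_cancel₀ this.ne']

lemma TorsionData.rad_mem (T : TorsionData Ω u) {y : Euc n} (hy : y ≠ 0) :
    rad Ω y ∈ frontier Ω :=
  (gauge_eq_one_iff_mem_frontier T.conv T.nhds_zero).1 (T.gauge_rad hy)

lemma TorsionData.gauge_eq_one (T : TorsionData Ω u) {y : Euc n} (hy : y ∈ frontier Ω) :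
    gauge Ω y = 1 := (gauge_eq_one_iff_mem_frontier T.conv T.nhds_zero).2 hy

lemma rad_smul (Ω : Set (Euc n)) {t : ℝ} (ht : 0 < t) (y : Euc n) :
    rad Ω (t • y) = rad Ω y := by
  rw [rad, rad, gauge_smul' Ω ht.le, smul_smul, mul_inv, mul_right_comm, inv_mul_cancel₀ ht.ne',
    one_mul]

lemma TorsionData.measurable_rad (T : TorsionData Ω u) : Measurable (rad Ω) :=
  T.gauge_continuous.measurable.inv.smul measurable_id

/-- The cone over a set of boundary points has a volume scaling like the `n`-th power. -/
lemma TorsionData.volume_cone (T : TorsionData Ω u) {A : Set (Euc n)} {r : ℝ} (hr0 : 0 < r)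
    (hr1 : r ≤ 1) :
    volume ((Ω ∩ rad Ω ⁻¹' A) ∩ {y | gauge Ω y < r}) =
      ENNReal.ofReal (r ^ n) * volume (Ω ∩ rad Ω ⁻¹' A) := by
  have : (Ω ∩ rad Ω ⁻¹' A) ∩ {y | gauge Ω y < r} = r • (Ω ∩ rad Ω ⁻¹' A) := by
    ext y
    rw [mem_smul_set_iff_inv_smul_mem₀ hr0.ne']
    simp only [mem_inter_iff, mem_preimage, mem_ofPred_eq, ← T.gauge_lt_one,
      rad_smul Ω (inv_pos.2 hr0),
      gauge_smul' Ω (inv_nonneg.2 hr0.le), inv_mul_lt_iff₀ hr0, mul_one]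
    constructor
    · rintro ⟨⟨-, h1⟩, h2⟩; exact ⟨h2, h1⟩
    · rintro ⟨h2, h1⟩; exact ⟨⟨h2.trans_le hr1, h1⟩, h2⟩
  rw [this, Measure.addHaar_smul, finrank_euclideanSpace_fin, abs_of_nonneg (by positivity)]

/-- Polar decomposition: `gauge ^ n` and the radial projection are independent. -/
theorem TorsionData.map_polar (T : TorsionData Ω u) :
    (volume.restrict Ω).map (fun y => (gauge Ω y ^ n, rad Ω y)) =
      (volume.restrict (Ioo (0 : ℝ) 1)).prod ((volume.restrict Ω).map (rad Ω)) := by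
  have hfin : IsFiniteMeasure (volume.restrict Ω) :=
    ⟨by rw [Measure.restrict_apply_univ]; exact T.bdd.measure_lt_top⟩
  have hm1 : Measurable fun y => gauge Ω y ^ n := T.gauge_continuous.measurable.pow_const n
  have hm : Measurable fun y => (gauge Ω y ^ n, rad Ω y) := hm1.prodMk T.measurable_rad
  have hfin2 : IsFiniteMeasure ((volume.restrict Ω).map (rad Ω)) :=
    Measure.isFiniteMeasure_map _ _
  symm
  refine Measure.prod_eq fun s A hs hA => ?_
  rw [Measure.map_apply hm (hs.prod hA), Measure.map_apply T.measurable_rad hA,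
    Measure.restrict_apply (hm (hs.prod hA)), Measure.restrict_apply (T.measurable_rad hA)]
  obtain ⟨c, hc⟩ : ∃ c, c = volume (rad Ω ⁻¹' A ∩ Ω) := ⟨_, rfl⟩
  have hcfin : c ≠ ∞ := hc ▸ (T.bdd.subset inter_subset_right).measure_lt_top.ne
  have hmeas : MeasurableSet (Ω ∩ rad Ω ⁻¹' A) :=
    T.isOpen.measurableSet.inter (T.measurable_rad hA)
  have key : ((volume.restrict (Ω ∩ rad Ω ⁻¹' A)).map (fun y => gauge Ω y ^ n)) =
      c • volume.restrict (Ioo (0 : ℝ) 1) := by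
    have hfin3 : IsFiniteMeasure (volume.restrict (Ω ∩ rad Ω ⁻¹' A)) :=
      ⟨by rw [Measure.restrict_apply_univ, inter_comm, ← hc]; exact hcfin.lt_top⟩
    have hfin4 : IsFiniteMeasure
        ((volume.restrict (Ω ∩ rad Ω ⁻¹' A)).map (fun y => gauge Ω y ^ n)) :=
      Measure.isFiniteMeasure_map _ _
    have huniv : ((volume.restrict (Ω ∩ rad Ω ⁻¹' A)).map (fun y => gauge Ω y ^ n)) univ =
        (c • volume.restrict (Ioo (0 : ℝ) 1)) univ := by
      rw [Measure.map_apply hm1 MeasurableSet.univ, preimage_univ, Measure.restrict_apply_univ,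
        Measure.smul_apply, Measure.restrict_apply_univ, Real.volume_Ioo, hc, inter_comm]
      simp
    have hIio : ∀ a : ℝ, ((volume.restrict (Ω ∩ rad Ω ⁻¹' A)).map (fun y => gauge Ω y ^ n))
        (Iio a) = (c • volume.restrict (Ioo (0 : ℝ) 1)) (Iio a) := by
      intro a
      rw [Measure.map_apply hm1 measurableSet_Iio, Measure.restrict_apply (hm1 measurableSet_Iio),
        Measure.smul_apply, Measure.restrict_apply measurableSet_Iio, smul_eq_mul, hc,
        inter_comm (rad Ω ⁻¹' A), inter_comm _ (Ω ∩ rad Ω ⁻¹' A)]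
      rcases le_or_gt a 0 with ha | ha
      · have e1 : (Ω ∩ rad Ω ⁻¹' A) ∩ (fun y => gauge Ω y ^ n) ⁻¹' Iio a = ∅ := by
          ext y
          have := pow_nonneg (gauge_nonneg (s := Ω) y) n
          simp only [mem_inter_iff, mem_preimage, mem_Iio, mem_empty_iff_false, iff_false]
          rintro ⟨-, h⟩; linarith
        have e2 : Iio a ∩ Ioo (0 : ℝ) 1 = ∅ := by
          ext y
          simp only [mem_inter_iff, mem_Iio, mem_Ioo, mem_empty_iff_false, iff_false]
          rintro ⟨h, h', -⟩; linarith
        rw [e1, e2]; simp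
      · obtain ⟨r, hr⟩ : ∃ r, r = min a 1 := ⟨_, rfl⟩
        have hr0 : 0 < r := hr ▸ lt_min ha one_pos
        have hr1 : r ≤ 1 := hr ▸ min_le_right _ _
        obtain ⟨q, hq0, hqr⟩ : ∃ q : ℝ, 0 < q ∧ q ^ n = r :=
          ⟨r ^ (n : ℝ)⁻¹, Real.rpow_pos_of_pos hr0 _, Real.rpow_inv_natCast_pow hr0.le T.dim.ne'⟩
        have hq1 : q ≤ 1 := by
          rw [← hqr] at hr1
          exact (pow_le_one_iff_of_nonneg hq0.le T.dim.ne').1 hr1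
        have e1 : (Ω ∩ rad Ω ⁻¹' A) ∩ (fun y => gauge Ω y ^ n) ⁻¹' Iio a =
            (Ω ∩ rad Ω ⁻¹' A) ∩ {y | gauge Ω y < q} := by
          ext y
          simp only [mem_inter_iff, mem_preimage, mem_Iio, mem_ofPred_eq]
          refine and_congr_right fun h => ?_
          have h1 : gauge Ω y ^ n < 1 :=
            pow_lt_one₀ (gauge_nonneg y) (T.gauge_lt_one.2 h.1) T.dim.ne'
          rw [← pow_lt_pow_iff_left₀ (gauge_nonneg y) hq0.le T.dim.ne', hqr, hr, lt_min_iff]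
          exact ⟨fun h => ⟨h, h1⟩, fun h => h.1⟩
        have e2 : Iio a ∩ Ioo (0 : ℝ) 1 = Ioo 0 r := by
          ext y
          simp only [mem_inter_iff, mem_Iio, mem_Ioo, hr, lt_min_iff]
          tauto
        rw [e1, e2, T.volume_cone hq0 hq1, hqr, Real.volume_Ioo, sub_zero, mul_comm]
    refine Measure.ext_of_Ici _ _ fun a => ?_
    have hfin5 : IsFiniteMeasure (c • volume.restrict (Ioo (0 : ℝ) 1)) :=
      ⟨by rw [← huniv]; exact measure_lt_top _ _⟩
    rw [← compl_Iio, measure_compl measurableSet_Iio (measure_ne_top _ _),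
      measure_compl measurableSet_Iio (measure_ne_top _ _), hIio, huniv]
  have := congrArg (fun m => m s) key
  simp only [Measure.smul_apply, smul_eq_mul] at this
  rw [Measure.map_apply hm1 hs, Measure.restrict_apply (hm1 hs)] at this
  rw [← hc, mul_comm, ← this]
  congr 1
  ext y; simp; tauto

end

section
variable {Ω : Set (Euc n)} {u : Euc n → ℝ}

lemma TorsionData.isFiniteMeasure_restrict (T : TorsionData Ω u) :
    IsFiniteMeasure (volume.restrict Ω) :=
  ⟨by rw [Measure.restrict_apply_univ]; exact T.bdd.measure_lt_top⟩

lemma TorsionData.integral_shell (T : TorsionData Ω u) {F : Euc n → ℝ} (hF : Measurable F) {M : ℝ}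
    (hM : ∀ y, |F y| ≤ M) {δ : ℝ} (hδ0 : 0 < δ) (hδ1 : δ ≤ 1) :
    ∫ y in Ω ∩ {y | 1 - δ < gauge Ω y ^ n}, F y =
      δ * ∫ p, F ((1 - δ * p.2) ^ (n : ℝ)⁻¹ • rad Ω p.1)
        ∂((volume.restrict Ω).prod (volume.restrict (Ioo (0 : ℝ) 1))) := by
  have hfin := T.isFiniteMeasure_restrict
  have hm1 : Measurable fun y => gauge Ω y ^ n := T.gauge_continuous.measurable.pow_const n
  have hm : Measurable fun y => (gauge Ω y ^ n, rad Ω y) := hm1.prodMk T.measurable_rad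
  have hfin2 : IsFiniteMeasure ((volume.restrict Ω).map (rad Ω)) :=
    Measure.isFiniteMeasure_map _ _
  obtain ⟨G, hGdef⟩ : ∃ G : ℝ × Euc n → ℝ,
      G = (Ioi (1 - δ) ×ˢ univ).indicator fun p => F (p.1 ^ (n : ℝ)⁻¹ • p.2) := ⟨_, rfl⟩
  have hFm : Measurable fun p : ℝ × Euc n => F (p.1 ^ (n : ℝ)⁻¹ • p.2) :=
    hF.comp ((measurable_fst.pow_const _).smul measurable_snd)
  have hG : Measurable G := hGdef ▸ hFm.indicator (measurableSet_Ioi.prod MeasurableSet.univ)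
  have hGM : ∀ p, ‖G p‖ ≤ M := fun p => by
    rw [hGdef, Real.norm_eq_abs]
    by_cases hp : p ∈ Ioi (1 - δ) ×ˢ (univ : Set (Euc n))
    · rw [indicator_of_mem hp]; exact hM _
    · rw [indicator_of_notMem hp, abs_zero]; exact (abs_nonneg _).trans (hM 0)
  have hS : MeasurableSet {y : Euc n | 1 - δ < gauge Ω y ^ n} :=
    measurableSet_lt measurable_const hm1
  have e1 : ∫ y in Ω ∩ {y | 1 - δ < gauge Ω y ^ n}, F y =
      ∫ y in Ω, G (gauge Ω y ^ n, rad Ω y) := by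
    rw [inter_comm, ← Measure.restrict_restrict hS, ← integral_indicator hS]
    congr 1
    ext y
    rw [hGdef]
    by_cases hy : 1 - δ < gauge Ω y ^ n
    · rw [indicator_of_mem (show y ∈ {y : Euc n | 1 - δ < gauge Ω y ^ n} from hy),
        indicator_of_mem (show (gauge Ω y ^ n, rad Ω y) ∈ Ioi (1 - δ) ×ˢ (univ : Set (Euc n)) from
          ⟨hy, mem_univ _⟩)]
      simp only
      rw [Real.pow_rpow_inv_natCast (gauge_nonneg y) T.dim.ne', T.gauge_smul_rad]
    · rw [indicator_of_notMem (show y ∉ {y : Euc n | 1 - δ < gauge Ω y ^ n} from hy),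
        indicator_of_notMem (show (gauge Ω y ^ n, rad Ω y) ∉
          Ioi (1 - δ) ×ˢ (univ : Set (Euc n)) from
          fun h => hy h.1)]
  have e2 : ∀ z : Euc n, ∫ v in Ioo (0 : ℝ) 1, G (v, z) =
      δ * ∫ t in Ioo (0 : ℝ) 1, F ((1 - δ * t) ^ (n : ℝ)⁻¹ • z) := by
    intro z
    have h1 : ∫ v in Ioo (0 : ℝ) 1, G (v, z) = ∫ v in Ioc (1 - δ) 1, F (v ^ (n : ℝ)⁻¹ • z) := by
      rw [hGdef]
      have : (fun v => ((Ioi (1 - δ) ×ˢ univ).indicator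
          (fun p : ℝ × Euc n => F (p.1 ^ (n : ℝ)⁻¹ • p.2))) (v, z)) =
          (Ioi (1 - δ)).indicator fun v => F (v ^ (n : ℝ)⁻¹ • z) := by
        ext v
        by_cases hv : v ∈ Ioi (1 - δ)
        · rw [indicator_of_mem hv, indicator_of_mem (show (v, z) ∈
            Ioi (1 - δ) ×ˢ (univ : Set (Euc n)) from
            ⟨hv, mem_univ _⟩)]
        · rw [indicator_of_notMem hv, indicator_of_notMem (show (v, z) ∉
            Ioi (1 - δ) ×ˢ (univ : Set (Euc n)) from
            fun h => hv h.1)]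
      rw [this, integral_indicator measurableSet_Ioi, Measure.restrict_restrict measurableSet_Ioi,
        integral_Ioc_eq_integral_Ioo]
      congr 2
      ext v
      simp only [mem_inter_iff, mem_Ioi, mem_Ioo]
      constructor
      · rintro ⟨h1, -, h2⟩; exact ⟨h1, h2⟩
      · rintro ⟨h1, h2⟩; exact ⟨h1, by linarith, h2⟩
    rw [h1, ← integral_Ioc_eq_integral_Ioo, ← intervalIntegral.integral_of_le (by linarith),
      ← intervalIntegral.integral_of_le zero_le_one,
      intervalIntegral.integral_comp_sub_mul (fun v => F (v ^ (n : ℝ)⁻¹ • z)) hδ0.ne' 1]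
    simp only [smul_eq_mul, mul_zero, mul_one, sub_zero]
    rw [mul_inv_cancel_left₀ hδ0.ne']
  have hFm2 : Measurable fun p : Euc n × ℝ => F ((1 - δ * p.2) ^ (n : ℝ)⁻¹ • rad Ω p.1) :=
    hF.comp (((measurable_const.sub (measurable_const.mul measurable_snd)).pow_const _).smul
      (T.measurable_rad.comp measurable_fst))
  have hI2 : Integrable (fun p : Euc n × ℝ => F ((1 - δ * p.2) ^ (n : ℝ)⁻¹ • rad Ω p.1))
      ((volume.restrict Ω).prod (volume.restrict (Ioo (0 : ℝ) 1))) :=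
    Integrable.of_bound hFm2.aestronglyMeasurable M
      (Eventually.of_forall fun p => hM _)
  have hI1 : Integrable G ((volume.restrict (Ioo (0 : ℝ) 1)).prod
      ((volume.restrict Ω).map (rad Ω))) :=
    Integrable.of_bound hG.aestronglyMeasurable M (Eventually.of_forall hGM)
  have hG1 : AEStronglyMeasurable (fun z => ∫ v in Ioo (0 : ℝ) 1, G (v, z))
      ((volume.restrict Ω).map (rad Ω)) := hI1.integral_prod_right.aestronglyMeasurable
  rw [e1, ← integral_map hm.aemeasurable hG.aestronglyMeasurable, T.map_polar,
    integral_prod_symm _ hI1, integral_map T.measurable_rad.aemeasurable hG1,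
    integral_prod _ hI2, ← integral_const_mul]
  simp_rw [e2]

lemma tendsto_mul_one_sub_pow (n : ℕ) :
    Tendsto (fun k : ℕ => (k : ℝ) * (1 - (1 - (k : ℝ)⁻¹) ^ n)) atTop (𝓝 n) := by
  have h1 : HasDerivAt (fun x : ℝ => x ^ n) (n * 1 ^ (n - 1)) 1 := hasDerivAt_pow n 1
  have h2 := hasDerivAt_iff_tendsto_slope_zero.1 h1
  have h3 : Tendsto (fun k : ℕ => -((k : ℝ)⁻¹)) atTop (𝓝[≠] 0) := by
    refine tendsto_nhdsWithin_iff.2 ⟨?_, ?_⟩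
    · simpa using (tendsto_inv_atTop_nhds_zero_nat (𝕜 := ℝ)).neg
    · filter_upwards [eventually_gt_atTop 0] with k hk
      have : (0 : ℝ) < k := by exact_mod_cast hk
      simp [this.ne']
  have h4 := h2.comp h3
  simp only [one_pow, mul_one] at h4
  refine h4.congr fun k => ?_
  simp only [Function.comp, smul_eq_mul, inv_neg, inv_inv]
  ring

theorem TorsionData.tendsto_shell (T : TorsionData Ω u) {F : Euc n → ℝ} (hF : Measurable F) {M : ℝ}
    (hM : ∀ y, |F y| ≤ M) {L : Euc n → ℝ}
    (hL : ∀ᵐ y ∂volume.restrict Ω, Tendsto (fun r : ℝ => F (r • rad Ω y)) (𝓝[<] 1) (𝓝 (L y))) :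
    Tendsto (fun k : ℕ => (k : ℝ) * ∫ y in Ω ∩ {y | 1 - (k : ℝ)⁻¹ < gauge Ω y}, F y) atTop
      (𝓝 (n * ∫ y in Ω, L y)) := by
  have hfin := T.isFiniteMeasure_restrict
  obtain ⟨d, hd⟩ : ∃ d : ℕ → ℝ, ∀ k : ℕ, d k = 1 - (1 - (k : ℝ)⁻¹) ^ n := ⟨_, fun _ => rfl⟩
  have hk : ∀ k : ℕ, 0 < k → 0 < d k ∧ d k ≤ 1 ∧
      {y | 1 - (k : ℝ)⁻¹ < gauge Ω y} = {y | 1 - d k < gauge Ω y ^ n} := by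
    intro k hk
    have h1 : (1 : ℝ) ≤ k := by exact_mod_cast hk
    have h2 : (k : ℝ)⁻¹ ≤ 1 := inv_le_one_of_one_le₀ h1
    have h3 : 0 < (k : ℝ)⁻¹ := by positivity
    have h4 : (1 - (k : ℝ)⁻¹) ^ n < 1 := pow_lt_one₀ (by linarith) (by linarith) T.dim.ne'
    have h5 : 0 ≤ (1 - (k : ℝ)⁻¹) ^ n := pow_nonneg (by linarith) _
    refine ⟨by rw [hd]; linarith, by rw [hd]; linarith, ?_⟩
    ext y
    simp only [hd, sub_sub_cancel, mem_ofPred_eq]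
    exact (pow_lt_pow_iff_left₀ (sub_nonneg.2 h2) (gauge_nonneg y) T.dim.ne').symm
  have hmain : Tendsto (fun k : ℕ => ∫ p, F ((1 - d k * p.2) ^ (n : ℝ)⁻¹ • rad Ω p.1)
      ∂((volume.restrict Ω).prod (volume.restrict (Ioo (0 : ℝ) 1)))) atTop
      (𝓝 (∫ p, L p.1 ∂((volume.restrict Ω).prod (volume.restrict (Ioo (0 : ℝ) 1))))) := by
    refine tendsto_integral_of_dominated_convergence (fun _ => M) (fun k => ?_)
      (integrable_const M) (fun k => Eventually.of_forall fun p => hM _) ?_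
    · exact (hF.comp
        (((measurable_const.sub (measurable_const.mul measurable_snd)).pow_const _).smul
        (T.measurable_rad.comp measurable_fst))).aestronglyMeasurable
    · have h1 := (Measure.quasiMeasurePreserving_fst (μ := volume.restrict Ω)
        (ν := volume.restrict (Ioo (0 : ℝ) 1))).ae hL
      have h2 := (Measure.quasiMeasurePreserving_snd (μ := volume.restrict Ω)
        (ν := volume.restrict (Ioo (0 : ℝ) 1))).ae (ae_restrict_mem measurableSet_Ioo)
      have hd0 : Tendsto d atTop (𝓝 0) := by
        have h3 : Tendsto (fun k : ℕ => 1 - (1 - (k : ℝ)⁻¹) ^ n) atTop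
            (𝓝 (1 - (1 - 0) ^ n)) :=
          ((tendsto_const_nhds.sub tendsto_inv_atTop_nhds_zero_nat).pow n).const_sub 1
        rw [funext hd]
        simpa using h3
      filter_upwards [h1, h2] with p hp hp2
      refine hp.comp (tendsto_nhdsWithin_iff.2 ⟨?_, ?_⟩)
      · have h3 : Tendsto (fun k => 1 - d k * p.2) atTop (𝓝 (1 - 0 * p.2)) :=
          (hd0.mul_const _).const_sub 1
        have h4 := h3.rpow_const (p := (n : ℝ)⁻¹) (Or.inl (by simp))
        simpa using h4
      · filter_upwards [eventually_gt_atTop 0] with k hk0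
        obtain ⟨h3, h4, -⟩ := hk k hk0
        have h5 : 0 < d k * p.2 := mul_pos h3 hp2.1
        have h6 : d k * p.2 ≤ 1 := mul_le_one₀ h4 hp2.1.le hp2.2.le
        have hn0 : (0 : ℝ) < n := by exact_mod_cast T.dim
        exact Real.rpow_lt_one (by linarith) (by linarith) (by positivity)
  have hlim : ∫ p, L p.1 ∂((volume.restrict Ω).prod (volume.restrict (Ioo (0 : ℝ) 1))) =
      ∫ y in Ω, L y := by
    have := integral_prod_mul (μ := volume.restrict Ω) (ν := volume.restrict (Ioo (0 : ℝ) 1))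
      L (fun _ => (1 : ℝ))
    simpa using this
  rw [hlim] at hmain
  have h := (tendsto_mul_one_sub_pow n).mul hmain
  refine h.congr' ?_
  filter_upwards [eventually_gt_atTop 0] with k hk0
  obtain ⟨h3, h4, h5⟩ := hk k hk0
  rw [h5, T.integral_shell hF hM h3 h4]
  simp only [hd]
  ring

end

section

variable {Ω : Set (Euc n)} {u : Euc n → ℝ}

lemma TorsionData.gauge_lipschitz (T : TorsionData Ω u) : ∃ L : ℝ≥0, LipschitzWith L (gauge Ω) :=
  T.conv.lipschitz_gauge T.nhds_zero

lemma TorsionData.inner_le_gauge (T : TorsionData Ω u) {x X : Euc n}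
    (hX : IsOuterNormalAt (closure Ω) x X) (z : Euc n) : ⟪z, X⟫ ≤ ⟪x, X⟫ * gauge Ω z := by
  by_cases hz : z = 0
  · subst hz; simp
  · have h1 := hX.2 _ (frontier_subset_closure (T.rad_mem hz))
    have h2 := mul_le_mul_of_nonneg_right h1 (gauge_nonneg (s := Ω) z)
    rwa [mul_comm, ← real_inner_smul_left, T.gauge_smul_rad] at h2

lemma TorsionData.inner_normal_pos (T : TorsionData Ω u) {x X : Euc n}
    (hX : IsOuterNormalAt (closure Ω) x X) : 0 < ⟪x, X⟫ := by
  have hX0 : X ≠ 0 := fun h => by have := hX.1; rw [h, norm_zero] at this; norm_num at this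
  have h := T.inner_le_gauge hX X
  rw [real_inner_self_eq_norm_sq, hX.1] at h
  have := T.gauge_pos hX0
  by_contra hc
  nlinarith

lemma TorsionData.gradient_gauge (T : TorsionData Ω u) {y X : Euc n}
    (hd : DifferentiableAt ℝ (gauge Ω) y) (hX : IsOuterNormalAt (closure Ω) (rad Ω y) X) :
    gradient (gauge Ω) y = ⟪rad Ω y, X⟫⁻¹ • X := by
  have hpos := T.inner_normal_pos hX
  have hmin : IsLocalMin (fun z => ⟪rad Ω y, X⟫ * gauge Ω z - ⟪z, X⟫) y := by
    refine Eventually.of_forall fun z => ?_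
    have h1 := T.inner_le_gauge hX z
    have h2 : ⟪rad Ω y, X⟫ * gauge Ω y - ⟪y, X⟫ = 0 := by
      rw [mul_comm, ← real_inner_smul_left, T.gauge_smul_rad, sub_self]
    change ⟪rad Ω y, X⟫ * gauge Ω y - ⟪y, X⟫ ≤ _
    rw [h2]; linarith
  have h1 : HasGradientAt (gauge Ω) (gradient (gauge Ω) y) y := hd.hasGradientAt
  have h2 : HasFDerivAt (fun z => ⟪rad Ω y, X⟫ * gauge Ω z - ⟪z, X⟫)
      (⟪rad Ω y, X⟫ • (InnerProductSpace.toDual ℝ (Euc n) (gradient (gauge Ω) y)) -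
        InnerProductSpace.toDual ℝ (Euc n) X) y := by
    refine (h1.hasFDerivAt.const_mul _).sub ?_
    have h3 := (InnerProductSpace.toDual ℝ (Euc n) X).hasFDerivAt (x := y)
    refine h3.congr_of_eventuallyEq (Eventually.of_forall fun z => ?_)
    rw [InnerProductSpace.toDual_apply_apply, real_inner_comm]
  have h3 := hmin.hasFDerivAt_eq_zero h2
  rw [← (InnerProductSpace.toDual ℝ (Euc n)).map_smul, ← map_sub,
    LinearIsometryEquiv.map_eq_zero_iff, sub_eq_zero] at h3
  exact (eq_inv_smul_iff₀ hpos.ne').2 h3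

lemma TorsionData.differentiableAt_gauge_smul (_T : TorsionData Ω u) {y : Euc n} {t : ℝ}
    (ht : 0 < t) (hd : DifferentiableAt ℝ (gauge Ω) y) : DifferentiableAt ℝ (gauge Ω) (t • y) := by
  have h1 : gauge Ω = fun z => t * gauge Ω (t⁻¹ • z) := by
    funext z
    rw [gauge_smul' Ω (inv_nonneg.2 ht.le), mul_inv_cancel_left₀ ht.ne']
  rw [h1]
  refine DifferentiableAt.const_mul (DifferentiableAt.comp (g := gauge Ω)
    (f := fun z => t⁻¹ • z) _ ?_ ((differentiableAt_id).const_smul _)) _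
  change DifferentiableAt ℝ (gauge Ω) (t⁻¹ • t • y)
  rwa [inv_smul_smul₀ ht.ne']

/-- `x` is a boundary point with a unique outer normal, namely the value of the Gauss map. -/
def IsReg (Ω : Set (Euc n)) (x : Euc n) : Prop :=
  ∃ X, IsOuterNormalAt (closure Ω) x X ∧ ∀ Y, IsOuterNormalAt (closure Ω) x Y → Y = X

lemma IsReg.gaussMap_spec {x : Euc n} (h : IsReg Ω x) :
    IsOuterNormalAt (closure Ω) x (gaussMap (closure Ω) x) := by
  have h' : ∃! X, IsOuterNormalAt (closure Ω) x X := h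
  unfold gaussMap
  rw [dif_pos h']
  exact h'.choose_spec.1

lemma IsReg.eq_gaussMap {x X : Euc n} (h : IsReg Ω x) (hX : IsOuterNormalAt (closure Ω) x X) :
    X = gaussMap (closure Ω) x := by
  have hs := h.gaussMap_spec
  obtain ⟨Y, -, hY⟩ := h
  exact (hY _ hX).trans (hY _ hs).symm

lemma TorsionData.isReg_of_differentiableAt (T : TorsionData Ω u) {y : Euc n} (hy : y ≠ 0)
    (hd : DifferentiableAt ℝ (gauge Ω) y) : IsReg Ω (rad Ω y) := by
  obtain ⟨X, hX⟩ := T.exists_isOuterNormalAt (T.rad_mem hy)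
  refine ⟨X, hX, fun Y hY => ?_⟩
  have h1 := T.gradient_gauge hd hX
  rw [T.gradient_gauge hd hY] at h1
  have hp := T.inner_normal_pos hX
  have hq := T.inner_normal_pos hY
  have h2 := congrArg norm h1
  rw [norm_smul, norm_smul, hX.1, hY.1, mul_one, mul_one, Real.norm_of_nonneg (inv_pos.2 hp).le,
    Real.norm_of_nonneg (inv_pos.2 hq).le] at h2
  rw [h2] at h1
  exact smul_right_injective _ (inv_pos.2 hp).ne' h1

/-- The weight `1 / ⟨x, ν(x)⟩` at the radial projection of a point. -/
def invSupp (Ω : Set (Euc n)) (x : Euc n) : ℝ := ⟪x, gaussMap (closure Ω) x⟫⁻¹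

lemma TorsionData.ae_reg (T : TorsionData Ω u) : ∀ᵐ y : Euc n, y ≠ 0 ∧ IsReg Ω (rad Ω y) ∧
    ∀ r : ℝ, 0 < r → gradient (gauge Ω) (r • rad Ω y) =
      invSupp Ω (rad Ω y) • gaussMap (closure Ω) (rad Ω y) := by
  obtain ⟨L, hL⟩ := T.gauge_lipschitz
  have : Nonempty (Fin n) := ⟨⟨0, T.dim⟩⟩
  have h0 : ∀ᵐ y : Euc n, y ≠ 0 := by
    rw [ae_iff]; simp
  filter_upwards [hL.ae_differentiableAt (μ := volume), h0] with y hd hy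
  have hr := T.isReg_of_differentiableAt hy hd
  refine ⟨hy, hr, fun r hr0 => ?_⟩
  have hg := T.gauge_pos hy
  have h1 : r • rad Ω y = (r * (gauge Ω y)⁻¹) • y := by rw [rad, smul_smul]
  have h2 : 0 < r * (gauge Ω y)⁻¹ := by positivity
  have h3 : rad Ω (r • rad Ω y) = rad Ω y := by rw [h1, rad_smul Ω h2]
  have h4 := T.gradient_gauge (y := r • rad Ω y) (X := gaussMap (closure Ω) (rad Ω y))
    (by rw [h1]; exact T.differentiableAt_gauge_smul h2 hd) (by rw [h3]; exact hr.gaussMap_spec)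
  rw [h4, h3, invSupp]

lemma TorsionData.invSupp_pos (T : TorsionData Ω u) {x : Euc n} (h : IsReg Ω x) :
    0 < invSupp Ω x := inv_pos.2 (T.inner_normal_pos h.gaussMap_spec)

lemma lipschitz_mul {f g : Euc n → ℝ} {A B : ℝ≥0} {M N : ℝ≥0} (hf : LipschitzWith A f)
    (hg : LipschitzWith B g) (hM : ∀ x, |f x| ≤ M) (hN : ∀ x, |g x| ≤ N) :
    LipschitzWith (M * B + N * A) fun x => f x * g x := by
  refine LipschitzWith.of_dist_le_mul fun x y => ?_
  have h1 := hf.dist_le_mul x y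
  have h2 := hg.dist_le_mul x y
  rw [Real.dist_eq] at h1 h2 ⊢
  have : f x * g x - f y * g y = f x * (g x - g y) + g y * (f x - f y) := by ring
  rw [this]
  refine (abs_add_le _ _).trans ?_
  rw [abs_mul, abs_mul]
  have h3 := mul_le_mul (hM x) h2 (abs_nonneg _) M.2
  have h4 := mul_le_mul (hN y) h1 (abs_nonneg _) N.2
  push_cast
  linarith

lemma gradient_mul' {f g : Euc n → ℝ} {x : Euc n} (hf : DifferentiableAt ℝ f x)
    (hg : DifferentiableAt ℝ g x) :
    gradient (fun y => f y * g y) x = f x • gradient g x + g x • gradient f x := by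
  have h := (hf.hasFDerivAt.mul hg.hasFDerivAt).fderiv
  have h' : fderiv ℝ (fun y => f y * g y) x = f x • fderiv ℝ g x + g x • fderiv ℝ f x := h
  simp only [gradient, h', map_add, map_smulₛₗ]
  rfl

/-- A radial cutoff: `1` where the gauge is at most `1 - 1/k`, and `0` off `Ω`. -/
def gcut (Ω : Set (Euc n)) (k : ℕ) (y : Euc n) : ℝ := max 0 (min 1 (k * (1 - gauge Ω y)))

lemma gcut_nonneg (k : ℕ) (y : Euc n) : 0 ≤ gcut Ω k y := le_max_left _ _

lemma gcut_le_one (k : ℕ) (y : Euc n) : gcut Ω k y ≤ 1 := max_le zero_le_one (min_le_left _ _)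

lemma TorsionData.gcut_lipschitz (T : TorsionData Ω u) (k : ℕ) :
    ∃ L : ℝ≥0, LipschitzWith L (gcut Ω k) := by
  obtain ⟨L, hL⟩ := T.gauge_lipschitz
  have h1 : LipschitzWith (k * L) fun y => (k : ℝ) * (1 - gauge Ω y) := by
    refine LipschitzWith.of_dist_le_mul fun x y => ?_
    have h := hL.dist_le_mul x y
    rw [Real.dist_eq] at h ⊢
    have e : (k : ℝ) * (1 - gauge Ω x) - k * (1 - gauge Ω y) = k * -(gauge Ω x - gauge Ω y) := by
      ring
    rw [e, abs_mul, abs_neg, Nat.abs_cast]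
    push_cast
    rw [mul_assoc]
    exact mul_le_mul_of_nonneg_left h (Nat.cast_nonneg k)
  exact ⟨_, (h1.const_min 1).const_max 0⟩

lemma TorsionData.gcut_off (T : TorsionData Ω u) (k : ℕ) {y : Euc n} (hy : y ∉ Ω) :
    gcut Ω k y = 0 := by
  refine max_eq_left ((min_le_right _ _).trans ?_)
  have : ¬ gauge Ω y < 1 := fun h => hy (T.gauge_lt_one.1 h)
  exact mul_nonpos_of_nonneg_of_nonpos (Nat.cast_nonneg k) (by linarith)

lemma TorsionData.gradient_gcut (T : TorsionData Ω u) {k : ℕ} (hk : 0 < k) {y : Euc n}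
    (hy : y ∈ Ω) (hd : DifferentiableAt ℝ (gauge Ω) y) :
    gradient (gcut Ω k) y =
      ({y | 1 - (k : ℝ)⁻¹ < gauge Ω y}.indicator (fun y => -(k : ℝ) • gradient (gauge Ω) y) y) := by
  have hk0 : (0 : ℝ) < k := Nat.cast_pos.2 hk
  have hy1 := T.gauge_lt_one.2 hy
  by_cases h : 1 - (k : ℝ)⁻¹ < gauge Ω y
  · rw [indicator_of_mem (show y ∈ {y | 1 - (k : ℝ)⁻¹ < gauge Ω y} from h)]
    have h1 : gcut Ω k =ᶠ[𝓝 y] fun y => (k : ℝ) * (1 - gauge Ω y) := by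
      have e1 := T.gauge_continuous.continuousAt.eventually (lt_mem_nhds h)
      have e2 := T.gauge_continuous.continuousAt.eventually (gt_mem_nhds hy1)
      filter_upwards [e1, e2] with z h1 h2
      have h3 : (k : ℝ) * (1 - gauge Ω z) ≤ 1 := by
        have := mul_le_mul_of_nonneg_left (show 1 - gauge Ω z ≤ (k : ℝ)⁻¹ by linarith) hk0.le
        rwa [mul_inv_cancel₀ hk0.ne'] at this
      rw [gcut, min_eq_right h3, max_eq_right (mul_nonneg hk0.le (by linarith))]
    rw [gradient_eventuallyEq h1]
    have h2 := ((hd.hasFDerivAt.const_sub 1).const_mul (k : ℝ)).fderiv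
    simp only [gradient, h2, map_smulₛₗ, map_neg, smul_neg, neg_smul]
    rfl
  · rw [indicator_of_notMem (show y ∉ {y | 1 - (k : ℝ)⁻¹ < gauge Ω y} from h)]
    have hmax : IsLocalMax (gcut Ω k) y := by
      refine Eventually.of_forall fun z => (gcut_le_one k z).trans ?_
      have : 1 ≤ (k : ℝ) * (1 - gauge Ω y) := by
        have := mul_le_mul_of_nonneg_left (show (k : ℝ)⁻¹ ≤ 1 - gauge Ω y by linarith) hk0.le
        rwa [mul_inv_cancel₀ hk0.ne'] at this
      rw [gcut, min_eq_left this]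
      exact le_max_right _ _
    rw [gradient, hmax.fderiv_eq_zero, map_zero]

lemma TorsionData.tendsto_gcut (T : TorsionData Ω u) {y : Euc n} (hy : y ∈ Ω) :
    Tendsto (fun k : ℕ => gcut Ω k y) atTop (𝓝 1) := by
  have hy1 := T.gauge_lt_one.2 hy
  refine tendsto_const_nhds.congr' ?_
  obtain ⟨N, hN⟩ := exists_nat_gt (1 - gauge Ω y)⁻¹
  filter_upwards [eventually_ge_atTop N] with k hk
  have h0 : 0 < 1 - gauge Ω y := by linarith
  have : 1 ≤ (k : ℝ) * (1 - gauge Ω y) := by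
    have h1 : (1 - gauge Ω y)⁻¹ ≤ k := hN.le.trans (Nat.cast_le.2 hk)
    have := mul_le_mul_of_nonneg_right h1 h0.le
    rwa [inv_mul_cancel₀ h0.ne'] at this
  rw [gcut, min_eq_left this, max_eq_right zero_le_one]

/-- The derivative functional of the torsional rigidity. -/
def torDeriv (Ω : Set (Euc n)) (u g : Euc n → ℝ) : ℝ :=
  ∫ y in Ω, (2 * g y - ⟪gradient g y, gradient u y⟫)

set_option maxHeartbeats 1000000 in
theorem TorsionData.torDeriv_eq (T : TorsionData Ω u) {g : Euc n → ℝ} {C : ℝ≥0}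
    (hg : LipschitzWith C g) {M : ℝ≥0} (hM : ∀ x, |g x| ≤ M) :
    torDeriv Ω u g =
      n * ∫ y in Ω, g (rad Ω y) * (ntSlope Ω u (rad Ω y) * invSupp Ω (rad Ω y)) := by
  obtain ⟨Lu, hLu⟩ := T.exists_lipschitz
  obtain ⟨Lγ, hLγ⟩ := T.gauge_lipschitz
  have := T.isFiniteMeasure_restrict
  have hgm := hg.continuous.measurable
  have hgu := measurable_gradient u
  have hgg := measurable_gradient g
  have hgγ := measurable_gradient (gauge Ω)
  obtain ⟨F, hF⟩ : ∃ F : Euc n → ℝ,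
    ∀ y, F y = g y * ⟪gradient (gauge Ω) y, gradient u y⟫ := ⟨_, fun _ => rfl⟩
  have hFm : Measurable F := by
    rw [funext hF]; exact hgm.mul (hgγ.inner hgu)
  have hFb : ∀ y, |F y| ≤ M * (Lγ * Lu) := fun y => by
    rw [hF, abs_mul]
    refine mul_le_mul (hM y) ((abs_real_inner_le_norm _ _).trans ?_) (abs_nonneg _) M.2
    exact mul_le_mul (norm_gradient_le hLγ y) (norm_gradient_le hLu y) (norm_nonneg _) Lγ.2
  have hlim := T.tendsto_shell hFm hFb
    (L := fun y => -(g (rad Ω y) * (ntSlope Ω u (rad Ω y) * invSupp Ω (rad Ω y)))) (by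
      filter_upwards [ae_restrict_of_ae T.ae_reg] with y hy
      obtain ⟨hy0, hr, hgr⟩ := hy
      have hx := T.rad_mem hy0
      have h1 := T.tendsto_ntGradient hx
      rw [(T.ntGradient_spec hx hr.gaussMap_spec).2.1] at h1
      have h2 : Tendsto (fun r : ℝ => g (r • rad Ω y)) (𝓝[<] 1) (𝓝 (g (rad Ω y))) := by
        have : ContinuousAt (fun r : ℝ => g (r • rad Ω y)) 1 :=
          (hg.continuous.comp (continuous_id.smul continuous_const)).continuousAt
        have h3 := this.tendsto.mono_left (nhdsWithin_le_nhds (s := Iio (1 : ℝ)))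
        rwa [one_smul] at h3
      have h3 := h2.mul ((tendsto_const_nhds (x := invSupp Ω (rad Ω y) •
        gaussMap (closure Ω) (rad Ω y))).inner h1)
      have h4 : g (rad Ω y) * ⟪invSupp Ω (rad Ω y) • gaussMap (closure Ω) (rad Ω y),
          -(ntSlope Ω u (rad Ω y) • gaussMap (closure Ω) (rad Ω y))⟫ =
          -(g (rad Ω y) * (ntSlope Ω u (rad Ω y) * invSupp Ω (rad Ω y))) := by
        rw [inner_neg_right, real_inner_smul_left, real_inner_smul_right,
          real_inner_self_eq_norm_sq, hr.gaussMap_spec.1]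
        ring
      rw [h4] at h3
      refine h3.congr' ?_
      have h5 : ∀ᶠ r : ℝ in 𝓝[<] 1, 0 < r :=
        mem_nhdsWithin_of_mem_nhds (lt_mem_nhds zero_lt_one)
      filter_upwards [h5] with r hr0
      rw [hF, hgr r hr0])
  rw [integral_neg, mul_neg] at hlim
  have hdγ : ∀ᵐ y : Euc n, DifferentiableAt ℝ (gauge Ω) y := hLγ.ae_differentiableAt
  have hdg : ∀ᵐ y : Euc n, DifferentiableAt ℝ g y := hg.ae_differentiableAt
  have key : ∀ k : ℕ, 0 < k →
      ∫ y in Ω, gcut Ω k y * (2 * g y - ⟪gradient g y, gradient u y⟫) =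
        -((k : ℝ) * ∫ y in Ω ∩ {y | 1 - (k : ℝ)⁻¹ < gauge Ω y}, F y) := by
    intro k hk
    obtain ⟨Lc, hLc⟩ := T.gcut_lipschitz k
    have hdc : ∀ᵐ y : Euc n, DifferentiableAt ℝ (gcut Ω k) y := hLc.ae_differentiableAt
    have hcb : ∀ y, |gcut Ω k y| ≤ (1 : ℝ≥0) := fun y => by
      rw [abs_of_nonneg (gcut_nonneg k y)]; exact gcut_le_one k y
    have hv := lipschitz_mul hg hLc hM hcb
    have hv0 : ∀ y, y ∉ Ω → g y * gcut Ω k y = 0 := fun y hy => by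
      rw [T.gcut_off k hy, mul_zero]
    have hw := T.tor.weak_form T.dim T.isOpen T.bdd T.conv T.zero_mem hv hv0
    have hi1 : Integrable fun y => ⟪gradient (fun y => g y * gcut Ω k y) y, gradient u y⟫ :=
      integrable_inner_gradient hv T.bdd hv0 hgu (norm_gradient_le hLu)
    have hi2 : Integrable fun y => g y * gcut Ω k y := hv.integrable_of_off T.bdd hv0
    have e1 : ∫ y in Ω, ⟪gradient (fun y => g y * gcut Ω k y) y, gradient u y⟫ =
        ∫ y, ⟪gradient (fun y => g y * gcut Ω k y) y, gradient u y⟫ := by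
      refine setIntegral_eq_integral_of_ae_compl_eq_zero ?_
      have hfr := T.conv.addHaar_frontier volume
      have : ∀ᵐ y : Euc n, y ∉ frontier Ω := by rw [ae_iff]; simpa using hfr
      filter_upwards [this] with y hy1 hy2
      have : y ∉ closure Ω := fun h => hy1 ⟨h, by rwa [T.isOpen.interior_eq]⟩
      rw [gradient_eq_zero_of_notMem isClosed_closure (fun x hx => hv0 x fun h =>
        hx (subset_closure h)) this, inner_zero_left]
    have e2 : ∫ y in Ω, g y * gcut Ω k y = ∫ y, g y * gcut Ω k y :=
      setIntegral_eq_integral_of_forall_compl_eq_zero hv0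
    rw [← e1, ← e2] at hw
    have e3 : (k : ℝ) * ∫ y in Ω ∩ {y | 1 - (k : ℝ)⁻¹ < gauge Ω y}, F y =
        ∫ y in Ω, k * {y | 1 - (k : ℝ)⁻¹ < gauge Ω y}.indicator F y := by
      rw [integral_const_mul, setIntegral_indicator
        (measurableSet_lt measurable_const T.gauge_continuous.measurable)]
    have hi3 : IntegrableOn (fun y => k * {y | 1 - (k : ℝ)⁻¹ < gauge Ω y}.indicator F y) Ω := by
      refine Integrable.const_mul ?_ _
      refine Integrable.indicator (Integrable.of_bound (C := M * (Lγ * Lu))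
        hFm.aestronglyMeasurable (Eventually.of_forall hFb))
        (measurableSet_lt measurable_const T.gauge_continuous.measurable)
    rw [e3]
    have e4 : ∫ y in Ω, gcut Ω k y * (2 * g y - ⟪gradient g y, gradient u y⟫) =
        ∫ y in Ω, (2 * (g y * gcut Ω k y) -
          ⟪gradient (fun y => g y * gcut Ω k y) y, gradient u y⟫ -
          k * {y | 1 - (k : ℝ)⁻¹ < gauge Ω y}.indicator F y) := by
      refine setIntegral_congr_ae T.isOpen.measurableSet ?_
      filter_upwards [hdγ, hdg, hdc] with y h1 h2 h3 hy
      rw [gradient_mul' h2 h3, T.gradient_gcut hk hy h1, inner_add_left, real_inner_smul_left,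
        real_inner_smul_left]
      by_cases h : y ∈ {y | 1 - (k : ℝ)⁻¹ < gauge Ω y}
      · rw [indicator_of_mem h, indicator_of_mem h, real_inner_smul_left, hF]; ring
      · rw [indicator_of_notMem h, indicator_of_notMem h, inner_zero_left]; ring
    have hi4 : IntegrableOn (fun y => 2 * (g y * gcut Ω k y) -
        ⟪gradient (fun y => g y * gcut Ω k y) y, gradient u y⟫) Ω :=
      (hi2.integrableOn.const_mul 2).sub hi1.integrableOn
    rw [e4, integral_sub hi4 hi3,
      integral_sub (hi2.integrableOn.const_mul 2) hi1.integrableOn, integral_const_mul, hw]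
    ring
  have hlim2 : Tendsto (fun k : ℕ =>
      ∫ y in Ω, gcut Ω k y * (2 * g y - ⟪gradient g y, gradient u y⟫)) atTop
      (𝓝 (torDeriv Ω u g)) := by
    refine tendsto_integral_of_dominated_convergence (fun _ => 2 * M + C * Lu) (fun k => ?_)
      (integrable_const _) (fun k => ?_) ?_
    · obtain ⟨Lc, hLc⟩ := T.gcut_lipschitz k
      exact (hLc.continuous.measurable.mul ((hgm.const_mul 2).sub
        (hgg.inner hgu))).aestronglyMeasurable
    · refine Eventually.of_forall fun y => ?_
      rw [norm_mul, Real.norm_of_nonneg (gcut_nonneg k y), Real.norm_eq_abs]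
      refine (mul_le_of_le_one_left (abs_nonneg _) (gcut_le_one k y)).trans ?_
      refine (abs_sub _ _).trans (add_le_add ?_ ((abs_real_inner_le_norm _ _).trans ?_))
      · rw [abs_mul, abs_two]; exact mul_le_mul_of_nonneg_left (hM y) zero_le_two
      · exact mul_le_mul (norm_gradient_le hg y) (norm_gradient_le hLu y) (norm_nonneg _) C.2
    · filter_upwards [ae_restrict_mem T.isOpen.measurableSet] with y hy
      have := (T.tendsto_gcut hy).mul_const (2 * g y - ⟪gradient g y, gradient u y⟫)
      rwa [one_mul] at this
  refine tendsto_nhds_unique hlim2 ?_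
  rw [← neg_neg ((n : ℝ) * _)]
  refine hlim.neg.congr' ?_
  filter_upwards [eventually_gt_atTop 0] with k hk
  exact (key k hk).symm

lemma TorsionData.exists_invSupp_le (T : TorsionData Ω u) :
    ∃ B : ℝ≥0, ∀ x, IsReg Ω x → invSupp Ω x ≤ B := by
  obtain ⟨L, hL⟩ := T.gauge_lipschitz
  refine ⟨L, fun x hx => ?_⟩
  have hs := hx.gaussMap_spec
  have h1 := T.inner_le_gauge hs (gaussMap (closure Ω) x)
  rw [real_inner_self_eq_norm_sq, hs.1] at h1
  have h2 := hL.dist_le_mul (gaussMap (closure Ω) x) 0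
  rw [gauge_zero, dist_zero_right, dist_zero_right, hs.1, mul_one] at h2
  have hp := T.inner_normal_pos hs
  rw [invSupp, inv_le_iff_one_le_mul₀ hp, mul_comm]
  calc (1 : ℝ) ≤ _ := by simpa using h1
    _ ≤ _ := mul_le_mul_of_nonneg_left ((le_abs_self _).trans h2) hp.le

lemma TorsionData.measurable_gradient_rad (T : TorsionData Ω u) (f : Euc n → ℝ) (r : ℝ) :
    Measurable fun y => gradient f (r • rad Ω y) :=
  (measurable_gradient f).comp ((continuous_const_smul r).measurable.comp T.measurable_rad)

lemma TorsionData.aemeasurable_ntSlope_rad (T : TorsionData Ω u) :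
    AEMeasurable (fun y => ntSlope Ω u (rad Ω y)) := by
  have h : AEMeasurable fun y => ntGradient Ω u (rad Ω y) := by
    refine aemeasurable_of_tendsto_metrizable_ae atTop
      (f := fun (k : ℕ) y => gradient u ((1 - (k : ℝ)⁻¹) • rad Ω y)) (fun k => ?_) ?_
    · exact (T.measurable_gradient_rad u _).aemeasurable
    · filter_upwards [T.ae_reg] with y hy
      refine (T.tendsto_ntGradient (T.rad_mem hy.1)).comp (f := fun k : ℕ => 1 - (k : ℝ)⁻¹) ?_
      refine tendsto_nhdsWithin_iff.2 ⟨?_, ?_⟩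
      · simpa using (tendsto_inv_atTop_nhds_zero_nat (𝕜 := ℝ)).const_sub 1
      · filter_upwards [eventually_gt_atTop 0] with k hk
        have : (0 : ℝ) < (k : ℝ)⁻¹ := inv_pos.2 (Nat.cast_pos.2 hk)
        change 1 - (k : ℝ)⁻¹ < 1
        linarith
  exact h.norm

lemma TorsionData.aemeasurable_invSupp_rad (T : TorsionData Ω u) :
    AEMeasurable (fun y => invSupp Ω (rad Ω y)) := by
  have h : Measurable fun y => ‖gradient (gauge Ω) ((1 : ℝ) • rad Ω y)‖ :=
    (T.measurable_gradient_rad _ 1).norm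
  refine ⟨_, h, ?_⟩
  filter_upwards [T.ae_reg] with y hy
  rw [hy.2.2 1 zero_lt_one, norm_smul, hy.2.1.gaussMap_spec.1, mul_one,
    Real.norm_of_nonneg (T.invSupp_pos hy.2.1).le]

lemma TorsionData.aemeasurable_gaussMap_rad (T : TorsionData Ω u) :
    AEMeasurable (fun y => gaussMap (closure Ω) (rad Ω y)) := by
  have h : Measurable fun y => gradient (gauge Ω) ((1 : ℝ) • rad Ω y) :=
    T.measurable_gradient_rad _ 1
  refine (T.aemeasurable_invSupp_rad.inv.smul h.aemeasurable).congr ?_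
  filter_upwards [T.ae_reg] with y hy
  change (invSupp Ω (rad Ω y))⁻¹ • gradient (gauge Ω) ((1 : ℝ) • rad Ω y) = _
  rw [hy.2.2 1 zero_lt_one, inv_smul_smul₀ (T.invSupp_pos hy.2.1).ne']

lemma tendsto_of_hasDerivWithinAt_one {φ : ℝ → ℝ} {e : ℝ} (h : HasDerivWithinAt φ e (Iic 1) 1) :
    Tendsto (fun k : ℕ => (k : ℝ) * (φ (1 - (k : ℝ)⁻¹) - φ 1)) atTop (𝓝 (-e)) := by
  rw [hasDerivWithinAt_iff_tendsto_slope] at h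
  have h1 : Tendsto (fun k : ℕ => 1 - (k : ℝ)⁻¹) atTop (𝓝[Iic 1 \ {1}] 1) := by
    refine tendsto_nhdsWithin_iff.2 ⟨?_, ?_⟩
    · simpa using (tendsto_inv_atTop_nhds_zero_nat (𝕜 := ℝ)).const_sub 1
    · filter_upwards [eventually_gt_atTop 0] with k hk
      have : (0 : ℝ) < (k : ℝ)⁻¹ := inv_pos.2 (Nat.cast_pos.2 hk)
      exact ⟨by change 1 - (k : ℝ)⁻¹ ≤ 1; linarith, by simp [this.ne']⟩
  refine (h.comp h1).neg.congr' ?_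
  filter_upwards [eventually_gt_atTop 0] with k hk
  have hk0 : (k : ℝ) ≠ 0 := (Nat.cast_pos.2 hk).ne'
  simp only [Function.comp, slope, vsub_eq_sub, smul_eq_mul]
  have : (1 - (k : ℝ)⁻¹ - 1)⁻¹ = -k := by
    rw [show (1 - (k : ℝ)⁻¹ - 1) = -(k : ℝ)⁻¹ by ring, inv_neg, inv_inv]
  rw [this]; ring

/-- The parabolic rescaling of the torsion function, which still satisfies `Δw = -2`. -/
def scaleFn (u : Euc n → ℝ) (s : ℝ) (x : Euc n) : ℝ := (s ^ 2)⁻¹ * u (s • x)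

lemma hasDerivWithinAt_scaleFn {x : Euc n} {e : ℝ}
    (h : HasDerivWithinAt (fun s : ℝ => u (s • x)) e (Iic 1) 1) :
    HasDerivWithinAt (fun s => scaleFn u s x) (e - 2 * u x) (Iic 1) 1 := by
  have h1 : HasDerivWithinAt (fun s : ℝ => (s ^ 2)⁻¹) (-2) (Iic 1) 1 := by
    have := ((hasDerivAt_pow 2 (1 : ℝ)).fun_inv (by norm_num)).hasDerivWithinAt (s := Iic 1)
    exact this.congr_deriv (by norm_num)
  refine (h1.mul h).congr_deriv ?_
  simp only [one_pow, inv_one, one_mul, one_smul]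
  ring

lemma TorsionData.hasDerivAt_ray (T : TorsionData Ω u) {x : Euc n} {s : ℝ} (hx : s • x ∈ Ω) :
    HasDerivAt (fun s : ℝ => u (s • x)) ⟪x, gradient u (s • x)⟫ s := by
  have h1 : HasFDerivAt u (fderiv ℝ u (s • x)) (s • x) :=
    ((T.tor.smooth _ hx).differentiableAt (by simp)).hasFDerivAt
  have h2 : HasDerivAt (fun s : ℝ => s • x) x s := by
    simpa using (hasDerivAt_id s).smul_const x
  have h3 := h1.comp_hasDerivAt s h2
  rwa [← inner_gradient_left (𝕜 := ℝ), real_inner_comm] at h3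

lemma TorsionData.hasDerivWithinAt_boundary (T : TorsionData Ω u) {x : Euc n}
    (hx : x ∈ frontier Ω) (hr : IsReg Ω x) :
    HasDerivWithinAt (fun s => scaleFn u s x)
      (-(ntSlope Ω u x * ⟪x, gaussMap (closure Ω) x⟫)) (Iic 1) 1 := by
  have hmem : ∀ s ∈ Ioo (0 : ℝ) 1, s • x ∈ Ω := fun s hs =>
    smul_mem_of_mem_closure T.isOpen T.conv T.zero_mem hs.1.le hs.2 (frontier_subset_closure hx)
  have hu0 : u x = 0 := T.tor.off x fun h => hx.2 (by rwa [T.isOpen.interior_eq])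
  have hI : Ioo (0 : ℝ) 1 ∈ 𝓝[<] (1 : ℝ) := Ioo_mem_nhdsLT zero_lt_one
  have hc : Continuous u := T.exists_lipschitz.choose_spec.continuous
  have h := hasDerivWithinAt_Iic_of_tendsto_deriv (f := fun s : ℝ => u (s • x)) (a := 1)
    (s := Ioo 0 1) (e := ⟪x, ntGradient Ω u x⟫)
    (fun s hs => (T.hasDerivAt_ray (hmem s hs)).differentiableAt.differentiableWithinAt)
    (hc.comp (continuous_id.smul continuous_const)).continuousWithinAt hI (by
      refine (tendsto_const_nhds.inner (T.tendsto_ntGradient hx)).congr' ?_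
      filter_upwards [hI] with s hs
      exact (T.hasDerivAt_ray (hmem s hs)).deriv.symm)
  have h2 := hasDerivWithinAt_scaleFn h
  rwa [hu0, mul_zero, sub_zero, (T.ntGradient_spec hx hr.gaussMap_spec).2.1, inner_neg_right,
    real_inner_smul_right] at h2

lemma TorsionData.hasDerivWithinAt_interior (T : TorsionData Ω u) {x : Euc n} (hx : x ∈ Ω) :
    HasDerivWithinAt (fun s => scaleFn u s x) (⟪x, gradient u x⟫ - 2 * u x) (Iic 1) 1 := by
  have h1 := T.hasDerivAt_ray (x := x) (s := 1) (by rwa [one_smul])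
  rw [one_smul] at h1
  exact hasDerivWithinAt_scaleFn h1.hasDerivWithinAt

lemma TorsionData.setIntegral_inner_gradient (T : TorsionData Ω u) (Y : Euc n → Euc n) :
    ∫ y in Ω, ⟪Y y, gradient u y⟫ = ∫ y, ⟪Y y, gradient u y⟫ := by
  refine setIntegral_eq_integral_of_ae_compl_eq_zero ?_
  have hfr := T.conv.addHaar_frontier volume
  have : ∀ᵐ y : Euc n, y ∉ frontier Ω := by rw [ae_iff]; simpa using hfr
  filter_upwards [this] with y hy1 hy2
  have : y ∉ closure Ω := fun h => hy1 ⟨h, by rwa [T.isOpen.interior_eq]⟩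
  rw [gradient_eq_zero_of_notMem isClosed_closure (fun x hx => T.tor.off x fun h =>
    hx (subset_closure h)) this, inner_zero_right]

lemma TorsionData.integral_inner_gradient (T : TorsionData Ω u) :
    ∫ y in Ω, ⟪y, gradient u y⟫ = -(n * ∫ y in Ω, u y) := by
  obtain ⟨L, hL⟩ := T.exists_lipschitz
  have hq : ContDiff ℝ (⊤ : ℕ∞) fun y : Euc n => ‖y‖ ^ 2 := contDiff_norm_sq ℝ
  have h := ibp T.bdd.isCompact_closure isOpen_univ (subset_univ _)
    (G := fun y : Euc n => ‖y‖ ^ 2) (fun x _ => hq.contDiffAt) hL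
    (fun x hx => T.tor.off x fun h => hx (subset_closure h))
  have h1 : ∀ y : Euc n, gradient (fun y : Euc n => ‖y‖ ^ 2) y = (2 : ℝ) • y := fun y => by
    ext i
    rw [gradient_apply_eq_pd]
    simpa using pd_normSq (0 : Euc n) i y
  have h2 : ∀ y : Euc n, lapl (fun y : Euc n => ‖y‖ ^ 2) y = 2 * n := fun y => by
    simpa using lapl_normSq (0 : Euc n) y
  simp only [h1, h2, real_inner_smul_right] at h
  rw [integral_const_mul, integral_mul_const] at h
  rw [T.setIntegral_inner_gradient, setIntegral_eq_integral_of_forall_compl_eq_zero T.tor.off]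
  simp only [real_inner_comm] at h ⊢
  linarith

set_option maxHeartbeats 1000000 in
lemma TorsionData.torDeriv_scaleFn (T : TorsionData Ω u) {s : ℝ} (hs0 : 0 < s) (hs1 : s < 1) :
    (∃ C : ℝ≥0, LipschitzWith C (scaleFn u s)) ∧
    torDeriv Ω u (scaleFn u s) = 2 * ∫ y in Ω, (scaleFn u s y - u y) := by
  obtain ⟨L, hL⟩ := T.exists_lipschitz
  have := T.isFiniteMeasure_restrict
  have hC : LipschitzWith (L * ⟨s⁻¹, (inv_pos.2 hs0).le⟩) (scaleFn u s) := by
    refine LipschitzWith.of_dist_le_mul fun x y => ?_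
    have h := hL.dist_le_mul (s • x) (s • y)
    rw [dist_smul₀, Real.norm_of_nonneg hs0.le, Real.dist_eq] at h
    rw [Real.dist_eq, scaleFn, scaleFn, ← mul_sub, abs_mul, abs_of_pos (by positivity)]
    refine (mul_le_mul_of_nonneg_left h (by positivity)).trans (le_of_eq ?_)
    change (s ^ 2)⁻¹ * (L * (s * dist x y)) = L * s⁻¹ * dist x y
    field_simp
  refine ⟨⟨_, hC⟩, ?_⟩
  have hU : IsOpen {x : Euc n | s • x ∈ Ω} := T.isOpen.preimage (continuous_const_smul s)
  have hKU : closure Ω ⊆ {x : Euc n | s • x ∈ Ω} := fun x hx =>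
    smul_mem_of_mem_closure T.isOpen T.conv T.zero_mem hs0.le hs1 hx
  have hsm : ∀ x ∈ {x : Euc n | s • x ∈ Ω}, ContDiffAt ℝ (⊤ : ℕ∞) (fun y => u (s • y)) x :=
    fun x hx => ContDiffAt.comp (g := u) (f := fun y => s • y) x (T.tor.smooth _ hx)
      (contDiff_const_smul s).contDiffAt
  have h := ibp T.bdd.isCompact_closure hU hKU (G := scaleFn u s)
    (fun x hx => contDiffAt_const.mul (hsm x hx)) hL
    (fun x hx => T.tor.off x fun h => hx (subset_closure h))
  have h2 : ∀ x, u x * lapl (scaleFn u s) x = -2 * u x := fun x => by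
    by_cases hx : x ∈ Ω
    · have hx' := hKU (subset_closure hx)
      have e : lapl (scaleFn u s) x = (s ^ 2)⁻¹ * lapl (fun y => u (s • y)) x :=
        lapl_const_mul ((hsm x hx').of_le (by norm_cast)) _
      rw [e, lapl_comp_smul ((T.tor.smooth _ hx').of_le (by norm_cast)), T.tor.lapl_eq _ hx']
      field_simp
    · rw [T.tor.off x hx]; ring
  simp only [h2] at h
  rw [integral_const_mul] at h
  have hwi : IntegrableOn (scaleFn u s) Ω :=
    (hC.continuous.continuousOn.integrableOn_compact T.bdd.isCompact_closure).mono_set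
      subset_closure
  have hui : IntegrableOn u Ω := (hL.integrable_of_off T.bdd T.tor.off).integrableOn
  have hgi : IntegrableOn (fun y => ⟪gradient (scaleFn u s) y, gradient u y⟫) Ω := by
    refine Integrable.of_bound (C := (L * s⁻¹) * L)
      ((measurable_gradient _).inner (measurable_gradient u)).aestronglyMeasurable
      (Eventually.of_forall fun y => (norm_inner_le_norm _ _).trans ?_)
    exact mul_le_mul (norm_gradient_le hC y) (norm_gradient_le hL y) (norm_nonneg _)
      (by positivity)
  rw [torDeriv, integral_sub (hwi.const_mul 2) hgi, T.setIntegral_inner_gradient,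
    integral_const_mul, integral_sub hwi hui,
    setIntegral_eq_integral_of_forall_compl_eq_zero T.tor.off]
  simp only [real_inner_comm] at h ⊢
  linarith

lemma TorsionData.exists_bound (T : TorsionData Ω u) : ∃ M : ℝ≥0, ∀ x, |u x| ≤ M := by
  obtain ⟨L, hL⟩ := T.exists_lipschitz
  obtain ⟨M, hM⟩ := hL.continuous.bounded_above_of_compact_support
    (HasCompactSupport.intro T.bdd.isCompact_closure fun x hx =>
      T.tor.off x fun h => hx (subset_closure h))
  exact ⟨M.toNNReal, fun x => (hM x).trans (Real.le_coe_toNNReal M)⟩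

set_option maxHeartbeats 1000000 in
/-- The Pohozaev identity on a convex domain. -/
theorem TorsionData.pohozaev (T : TorsionData Ω u) :
    (n + 2) * _root_.tor Ω = n * ∫ y in Ω, ntSlope Ω u (rad Ω y) ^ 2 := by
  obtain ⟨L, hL⟩ := T.exists_lipschitz
  obtain ⟨M, hM⟩ := T.exists_bound
  obtain ⟨B, hB⟩ := T.exists_invSupp_le
  obtain ⟨R, hR0, hR⟩ := T.bdd.subset_closedBall_lt 0 0
  have hRc : ∀ x ∈ closure Ω, ‖x‖ ≤ R := fun x hx => by
    simpa using (closure_minimal hR isClosed_closedBall) hx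
  have := T.isFiniteMeasure_restrict
  obtain ⟨s, hs⟩ : ∃ s : ℕ → ℝ, ∀ k, s k = 1 - (k : ℝ)⁻¹ := ⟨_, fun _ => rfl⟩
  have hsk : ∀ k : ℕ, 2 ≤ k → 1 / 2 ≤ s k ∧ s k < 1 := fun k hk => by
    have h2 : (2 : ℝ) ≤ k := by exact_mod_cast hk
    have h3 : (k : ℝ)⁻¹ ≤ 2⁻¹ := inv_anti₀ two_pos h2
    have h4 : (0 : ℝ) < (k : ℝ)⁻¹ := inv_pos.2 (by linarith)
    rw [hs]; constructor <;> linarith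
  have hscale1 : ∀ x, scaleFn u 1 x = u x := fun x => by simp [scaleFn]
  have hlip : ∀ k : ℕ, 2 ≤ k → ∀ x ∈ closure Ω,
      |(k : ℝ) * (scaleFn u (s k) x - scaleFn u 1 x)| ≤ 8 * M + L * R := by
    intro k hk x hx
    obtain ⟨h1, h2⟩ := hsk k hk
    have hk0 : (0 : ℝ) < k := by exact_mod_cast (by omega : 0 < k)
    have e1 : (k : ℝ) * (1 - s k) = 1 := by
      rw [hs, sub_sub_cancel, mul_inv_cancel₀ hk0.ne']
    have e2 : (k : ℝ) * (scaleFn u (s k) x - scaleFn u 1 x) =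
        (k * ((s k ^ 2)⁻¹ - 1)) * u (s k • x) + k * (u (s k • x) - u x) := by
      rw [hscale1, scaleFn]; ring
    have hs2 : 0 < s k ^ 2 := by positivity
    have e3 : k * ((s k ^ 2)⁻¹ - 1) = (1 + s k) * (s k ^ 2)⁻¹ := by
      have : k * ((s k ^ 2)⁻¹ - 1) = (k * (1 - s k)) * (1 + s k) * (s k ^ 2)⁻¹ := by
        field_simp; ring
      rw [this, e1, one_mul]
    have h3 : |k * ((s k ^ 2)⁻¹ - 1)| ≤ 8 := by
      have h4 : (s k ^ 2)⁻¹ ≤ 4 := by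
        rw [inv_le_comm₀ hs2 (by norm_num)]; nlinarith
      have h5 : 0 < (s k ^ 2)⁻¹ := inv_pos.2 hs2
      rw [e3, abs_of_nonneg (by positivity)]
      nlinarith
    have h4 : |k * (u (s k • x) - u x)| ≤ L * R := by
      have h5 := hL.dist_le_mul (s k • x) x
      rw [Real.dist_eq, dist_eq_norm, show s k • x - x = (s k - 1) • x by rw [sub_smul, one_smul],
        norm_smul, Real.norm_eq_abs, abs_sub_comm (s k), abs_of_pos (sub_pos.2 h2)] at h5
      rw [abs_mul, Nat.abs_cast]
      have h6 : (k : ℝ) * (L * ((1 - s k) * ‖x‖)) = L * ‖x‖ := by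
        rw [show (k : ℝ) * (L * ((1 - s k) * ‖x‖)) = (k * (1 - s k)) * (L * ‖x‖) by ring, e1,
          one_mul]
      refine (mul_le_mul_of_nonneg_left h5 hk0.le).trans ?_
      rw [h6]
      exact mul_le_mul_of_nonneg_left (hRc x hx) L.2
    rw [e2]
    refine (abs_add_le _ _).trans (add_le_add ?_ h4)
    rw [abs_mul]
    exact mul_le_mul h3 (hM _) (abs_nonneg _) (by norm_num)
  have hu0 : ∀ x ∈ frontier Ω, u x = 0 := fun x hx =>
    T.tor.off x fun h => hx.2 (by rwa [T.isOpen.interior_eq])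
  have key : ∀ k : ℕ, 2 ≤ k →
      n * ∫ y in Ω, (k * (scaleFn u (s k) (rad Ω y) - scaleFn u 1 (rad Ω y))) *
        (ntSlope Ω u (rad Ω y) * invSupp Ω (rad Ω y)) =
      2 * ∫ y in Ω, k * (scaleFn u (s k) y - scaleFn u 1 y) := by
    intro k hk
    obtain ⟨h1, h2⟩ := hsk k hk
    have hs0 : 0 < s k := by linarith
    obtain ⟨⟨C, hC⟩, h3⟩ := T.torDeriv_scaleFn hs0 h2
    have hbd : ∀ x, |scaleFn u (s k) x| ≤ ((s k ^ 2)⁻¹.toNNReal * M : ℝ≥0) := fun x => by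
      have : 0 ≤ (s k ^ 2)⁻¹ := by positivity
      rw [scaleFn, abs_mul, abs_of_nonneg this, NNReal.coe_mul, Real.coe_toNNReal _ this]
      exact mul_le_mul_of_nonneg_left (hM _) this
    have h4 := T.torDeriv_eq hC hbd
    rw [h3] at h4
    simp only [hscale1]
    have h5 : ∫ y in Ω, (k * (scaleFn u (s k) (rad Ω y) - u (rad Ω y))) *
        (ntSlope Ω u (rad Ω y) * invSupp Ω (rad Ω y)) = k * ∫ y in Ω, scaleFn u (s k) (rad Ω y) *
        (ntSlope Ω u (rad Ω y) * invSupp Ω (rad Ω y)) := by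
      rw [← integral_const_mul]
      refine setIntegral_congr_ae T.isOpen.measurableSet ?_
      filter_upwards [T.ae_reg] with y hy _
      rw [hu0 _ (T.rad_mem hy.1)]
      ring
    rw [h5, integral_const_mul]
    linear_combination -(k : ℝ) * h4
  have hwm : ∀ k : ℕ, 2 ≤ k →
      Measurable fun y => (k : ℝ) * (scaleFn u (s k) y - scaleFn u 1 y) := by
    intro k hk
    obtain ⟨h1, h2⟩ := hsk k hk
    obtain ⟨⟨C, hC⟩, -⟩ := T.torDeriv_scaleFn (by linarith) h2
    have hum : Measurable (scaleFn u 1) := by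
      rw [funext hscale1]; exact hL.continuous.measurable
    exact (hC.continuous.measurable.sub hum).const_mul _
  have lim1 : Tendsto (fun k : ℕ => ∫ y in Ω, (k : ℝ) * (scaleFn u (s k) y - scaleFn u 1 y)) atTop
      (𝓝 (∫ y in Ω, -(⟪y, gradient u y⟫ - 2 * u y))) := by
    refine tendsto_integral_filter_of_dominated_convergence (fun _ => 8 * M + L * R) ?_ ?_
      (integrable_const _) ?_
    · filter_upwards [eventually_ge_atTop 2] with k hk using (hwm k hk).aestronglyMeasurable
    · filter_upwards [eventually_ge_atTop 2] with k hk
      filter_upwards [ae_restrict_mem T.isOpen.measurableSet] with y hy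
      exact hlip k hk y (subset_closure hy)
    · filter_upwards [ae_restrict_mem T.isOpen.measurableSet] with y hy
      simp only [hs]
      exact tendsto_of_hasDerivWithinAt_one (T.hasDerivWithinAt_interior hy)
  have lim2 : Tendsto (fun k : ℕ => ∫ y in Ω, (k * (scaleFn u (s k) (rad Ω y) -
      scaleFn u 1 (rad Ω y))) * (ntSlope Ω u (rad Ω y) * invSupp Ω (rad Ω y))) atTop
      (𝓝 (∫ y in Ω, ntSlope Ω u (rad Ω y) ^ 2)) := by
    refine tendsto_integral_filter_of_dominated_convergence
      (fun _ => (8 * M + L * R) * (L * B)) ?_ ?_ (integrable_const _) ?_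
    · filter_upwards [eventually_ge_atTop 2] with k hk
      exact (((hwm k hk).comp T.measurable_rad).aemeasurable.mul
        (T.aemeasurable_ntSlope_rad.mul
          T.aemeasurable_invSupp_rad).restrict).aestronglyMeasurable
    · filter_upwards [eventually_ge_atTop 2] with k hk
      filter_upwards [ae_restrict_of_ae T.ae_reg] with y hy
      have hx := T.rad_mem hy.1
      rw [norm_mul, norm_mul (ntSlope Ω u (rad Ω y)), Real.norm_of_nonneg (ntSlope_nonneg _),
        Real.norm_of_nonneg (T.invSupp_pos hy.2.1).le]
      refine mul_le_mul (hlip k hk _ (frontier_subset_closure hx)) ?_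
        (mul_nonneg (ntSlope_nonneg _) (T.invSupp_pos hy.2.1).le) (by positivity)
      exact mul_le_mul (T.ntSlope_le hL hx) (hB _ hy.2.1) (T.invSupp_pos hy.2.1).le L.2
    · filter_upwards [ae_restrict_of_ae T.ae_reg] with y hy
      have hx := T.rad_mem hy.1
      have hp := T.inner_normal_pos hy.2.1.gaussMap_spec
      have h1 := (tendsto_of_hasDerivWithinAt_one
        (T.hasDerivWithinAt_boundary hx hy.2.1)).mul_const
          (ntSlope Ω u (rad Ω y) * invSupp Ω (rad Ω y))
      simp only [hs]
      have e : -(-(ntSlope Ω u (rad Ω y) * ⟪rad Ω y, gaussMap (closure Ω) (rad Ω y)⟫)) *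
          (ntSlope Ω u (rad Ω y) * invSupp Ω (rad Ω y)) = ntSlope Ω u (rad Ω y) ^ 2 := by
        rw [invSupp]; field_simp; try ring
      rwa [e] at h1
  have h := tendsto_nhds_unique_of_eventuallyEq (lim2.const_mul (n : ℝ)) (lim1.const_mul 2)
    ((eventually_ge_atTop 2).mono key)
  have hui : IntegrableOn u Ω := (hL.integrable_of_off T.bdd T.tor.off).integrableOn
  have hgi : IntegrableOn (fun y => ⟪y, gradient u y⟫) Ω := by
    refine Integrable.of_bound (C := R * L)
      (measurable_id.inner (measurable_gradient u)).aestronglyMeasurable ?_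
    filter_upwards [ae_restrict_mem T.isOpen.measurableSet] with y hy
    exact (norm_inner_le_norm _ _).trans (mul_le_mul (hRc y (subset_closure hy))
      (norm_gradient_le hL y) (norm_nonneg _) hR0.le)
  rw [integral_neg, integral_sub hgi (hui.const_mul 2), T.integral_inner_gradient,
    integral_const_mul] at h
  rw [h, T.tor.tor_eq T.dim T.isOpen T.bdd T.conv T.zero_mem,
    ← setIntegral_eq_integral_of_forall_compl_eq_zero T.tor.off]
  ring

lemma isOuterNormalAt_of_tendsto {K : Set (Euc n)} {z X : ℕ → Euc n} {x Y : Euc n}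
    (hz : Tendsto z atTop (𝓝 x)) (hX : Tendsto X atTop (𝓝 Y))
    (h : ∀ j, IsOuterNormalAt K (z j) (X j)) : IsOuterNormalAt K x Y :=
  ⟨tendsto_nhds_unique hX.norm (by simp [(h _).1]), fun y hy =>
    le_of_tendsto_of_tendsto' (tendsto_const_nhds.inner hX) (hz.inner hX) fun j => (h j).2 y hy⟩

lemma IsReg.exists_near {x : Euc n} (hx : IsReg Ω x) {r : ℝ} (hr : 0 < r) :
    ∃ δ > 0, ∀ z, dist z x < δ → ∀ X, IsOuterNormalAt (closure Ω) z X →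
      ‖X - gaussMap (closure Ω) x‖ < r := by
  by_contra hcon
  push Not at hcon
  choose z hz X hX hXr using fun j : ℕ => hcon (1 / ((j : ℝ) + 1)) (by positivity)
  have hzx : Tendsto z atTop (𝓝 x) := by
    rw [tendsto_iff_dist_tendsto_zero]
    exact squeeze_zero (fun _ => dist_nonneg) (fun j => (hz j).le)
      tendsto_one_div_add_atTop_nhds_zero_nat
  obtain ⟨Y, -, φ, hφ, hY⟩ := (isCompact_sphere (0 : Euc n) 1).tendsto_subseq (x := X)
    fun j => by simpa using (hX j).1
  have hn := isOuterNormalAt_of_tendsto (hzx.comp hφ.tendsto_atTop) hY fun j => hX (φ j)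
  have h1 := ge_of_tendsto' ((hY.sub_const (gaussMap (closure Ω) x)).norm) fun j => hXr (φ j)
  rw [hx.eq_gaussMap hn, sub_self, norm_zero] at h1
  linarith

lemma TorsionData.ntSlope_usc (T : TorsionData Ω u) {x : Euc n} (hxf : x ∈ frontier Ω)
    (hx : IsReg Ω x) {ε : ℝ} (hε : 0 < ε) :
    ∃ δ > 0, ∀ z ∈ frontier Ω, dist z x < δ → ntSlope Ω u z ≤ ntSlope Ω u x + ε := by
  obtain ⟨r, hr, hu⟩ := T.slope_usc hxf hx.gaussMap_spec hε
  obtain ⟨δ, hδ, hn⟩ := hx.exists_near hr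
  refine ⟨min δ r, lt_min hδ hr, fun z hz hzx => ?_⟩
  by_cases hreg : IsReg Ω z
  · have hs := hreg.gaussMap_spec
    set Y := gaussMap (closure Ω) z with hY
    have hp := T.inner_normal_pos hs
    have h1 := tendsto_of_hasDerivWithinAt_one (T.hasDerivWithinAt_boundary hz hreg)
    have hu0 : u z = 0 := T.tor.off z fun h => hz.2 (by rwa [T.isOpen.interior_eq])
    have hsf := hs.suppFn_eq (frontier_subset_closure hz)
    have h0 : Tendsto (fun k : ℕ => 1 - (k : ℝ)⁻¹) atTop (𝓝 1) := by
      simpa using (tendsto_inv_atTop_nhds_zero_nat (𝕜 := ℝ)).const_sub 1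
    have h2 : Tendsto (fun k : ℕ => ((1 - (k : ℝ)⁻¹) ^ 2)⁻¹ *
        ((ntSlope Ω u x + ε) * ⟪z, Y⟫)) atTop (𝓝 ((ntSlope Ω u x + ε) * ⟪z, Y⟫)) := by
      have := ((h0.pow 2).inv₀ (by norm_num)).mul_const ((ntSlope Ω u x + ε) * ⟪z, Y⟫)
      simpa using this
    have h3 : -(-(ntSlope Ω u z * ⟪z, Y⟫)) ≤ (ntSlope Ω u x + ε) * ⟪z, Y⟫ := by
      refine le_of_tendsto_of_tendsto h1 h2 ?_
      have h4 : ∀ᶠ k : ℕ in atTop, dist ((1 - (k : ℝ)⁻¹) • z) x < r := by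
        have : Tendsto (fun k : ℕ => (1 - (k : ℝ)⁻¹) • z) atTop (𝓝 z) := by
          simpa using h0.smul_const z
        exact (this.dist tendsto_const_nhds).eventually
          (gt_mem_nhds (hzx.trans_le (min_le_right _ _)))
      filter_upwards [h4, eventually_ge_atTop 2] with k hk hk2
      have hk0 : (0 : ℝ) < k := by exact_mod_cast (by omega : 0 < k)
      have hki : 0 < (k : ℝ)⁻¹ := inv_pos.2 hk0
      have hki2 : (k : ℝ)⁻¹ ≤ 2⁻¹ := inv_anti₀ two_pos (by exact_mod_cast hk2)
      have hmem := smul_mem_of_mem_closure T.isOpen T.conv T.zero_mem (s := 1 - (k : ℝ)⁻¹)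
        (by linarith) (by linarith) (frontier_subset_closure hz)
      have h5 := hu Y hs.1 (hn z (hzx.trans_le (min_le_left _ _)) Y hs) _ hmem
        (by rwa [dist_eq_norm] at hk)
      rw [hsf, real_inner_smul_left] at h5
      simp only [scaleFn, one_smul, hu0, mul_zero, sub_zero]
      rw [mul_left_comm]
      refine mul_le_mul_of_nonneg_left ?_ (by positivity)
      have h6 := mul_le_mul_of_nonneg_left h5 hk0.le
      have h7 : (k : ℝ) * ((ntSlope Ω u x + ε) * (⟪z, Y⟫ - (1 - (k : ℝ)⁻¹) * ⟪z, Y⟫)) =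
          (ntSlope Ω u x + ε) * ⟪z, Y⟫ := by field_simp; ring
      rwa [h7] at h6
    rw [neg_neg] at h3
    exact le_of_mul_le_mul_right h3 hp
  · obtain ⟨X, hX⟩ := T.exists_isOuterNormalAt hz
    have : ∃ Y, IsOuterNormalAt (closure Ω) z Y ∧ X ≠ Y := by
      by_contra hc
      push Not at hc
      exact hreg ⟨X, hX, fun Y hY => (hc Y hY).symm⟩
    obtain ⟨Y, hY, hne⟩ := this
    rw [T.ntGradient_eq_zero hz hX hY hne]
    linarith [ntSlope_nonneg (Ω := Ω) (u := u) x]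

lemma TorsionData.ntSlope_of_not_isReg (T : TorsionData Ω u) {z : Euc n} (hz : z ∈ frontier Ω)
    (hreg : ¬ IsReg Ω z) : ntSlope Ω u z = 0 := by
  obtain ⟨X, hX⟩ := T.exists_isOuterNormalAt hz
  have : ∃ Y, IsOuterNormalAt (closure Ω) z Y ∧ X ≠ Y := by
    by_contra hc
    push Not at hc
    exact hreg ⟨X, hX, fun Y hY => (hc Y hY).symm⟩
  obtain ⟨Y, hY, hne⟩ := this
  exact T.ntGradient_eq_zero hz hX hY hne

/-- The Lipschitz sup-convolution of a function on the frontier. -/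
def supConv (Ω : Set (Euc n)) (ψ : Euc n → ℝ) (k : ℕ) (x : Euc n) : ℝ :=
  (⨆ z : frontier Ω, max 0 (ψ z - k * dist x z)) + (k : ℝ)⁻¹

section supConv

variable {ψ : Euc n → ℝ} {M : ℝ≥0}

lemma supConv_bdd (hM : ∀ z ∈ frontier Ω, ψ z ≤ M) (k : ℕ) (x : Euc n) :
    BddAbove (range fun z : frontier Ω => max 0 (ψ z - k * dist x z)) := by
  refine ⟨M, ?_⟩
  rintro _ ⟨z, rfl⟩
  have : 0 ≤ (k : ℝ) * dist x z := by positivity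
  exact max_le M.2 (by linarith [hM z z.2])

lemma supConv_nonneg (k : ℕ) (x : Euc n) : (k : ℝ)⁻¹ ≤ supConv Ω ψ k x := by
  have : 0 ≤ ⨆ z : frontier Ω, max 0 (ψ z - k * dist x z) :=
    Real.iSup_nonneg fun z => le_max_left _ _
  unfold supConv; linarith

lemma supConv_le [Nonempty (frontier Ω)] (hM : ∀ z ∈ frontier Ω, ψ z ≤ M) (k : ℕ) (x : Euc n) :
    supConv Ω ψ k x ≤ M + 1 := by
  have h1 : ⨆ z : frontier Ω, max 0 (ψ z - k * dist x z) ≤ M := ciSup_le fun z => by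
    have : 0 ≤ (k : ℝ) * dist x z := by positivity
    exact max_le M.2 (by linarith [hM z z.2])
  have h2 : (k : ℝ)⁻¹ ≤ 1 := Nat.cast_inv_le_one k
  unfold supConv; linarith

lemma le_supConv (hM : ∀ z ∈ frontier Ω, ψ z ≤ M) (k : ℕ) {x : Euc n} (hx : x ∈ frontier Ω) :
    ψ x + (k : ℝ)⁻¹ ≤ supConv Ω ψ k x := by
  have h := le_ciSup (supConv_bdd hM k x) ⟨x, hx⟩
  simp only [dist_self, mul_zero, sub_zero] at h
  have := (le_max_right 0 (ψ x)).trans h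
  unfold supConv; linarith

lemma supConv_lipschitz [Nonempty (frontier Ω)] (hM : ∀ z ∈ frontier Ω, ψ z ≤ M) (k : ℕ) :
    LipschitzWith k (supConv Ω ψ k) := by
  refine LipschitzWith.of_le_add_mul _ fun x y => ?_
  have : ⨆ z : frontier Ω, max 0 (ψ z - k * dist x z) ≤
      (⨆ z : frontier Ω, max 0 (ψ z - k * dist y z)) + k * dist x y := by
    refine ciSup_le fun z => ?_
    have h1 := le_ciSup (supConv_bdd hM k y) z
    have h2 : (k : ℝ) * dist y z ≤ k * (dist x y + dist x z) :=
      mul_le_mul_of_nonneg_left (dist_triangle_left _ _ _) (Nat.cast_nonneg k)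
    have h3 : 0 ≤ (k : ℝ) * dist x y := by positivity
    refine max_le ?_ ?_
    · linarith [(le_max_left 0 (ψ z - k * dist y z)).trans h1]
    · linarith [(le_max_right 0 (ψ z - k * dist y z)).trans h1]
  unfold supConv
  simp only [NNReal.coe_natCast]
  linarith

lemma tendsto_supConv [Nonempty (frontier Ω)] (hM : ∀ z ∈ frontier Ω, ψ z ≤ M) {x : Euc n}
    (hx : x ∈ frontier Ω) (h0 : 0 ≤ ψ x)
    (husc : ∀ ε > 0, ∃ δ > 0, ∀ z ∈ frontier Ω, dist z x < δ → ψ z ≤ ψ x + ε) :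
    Tendsto (fun k => supConv Ω ψ k x) atTop (𝓝 (ψ x)) := by
  rw [Metric.tendsto_atTop]
  intro ε hε
  obtain ⟨δ, hδ, hz⟩ := husc (ε / 3) (by positivity)
  obtain ⟨N, hN⟩ := exists_nat_gt (max (M / δ) (3 / ε))
  refine ⟨N, fun k hk => ?_⟩
  have hkN : (N : ℝ) ≤ k := by exact_mod_cast hk
  have hk1 : M / δ < k := (le_max_left _ _).trans_lt (hN.trans_le hkN)
  have hk2 : 3 / ε < k := (le_max_right _ _).trans_lt (hN.trans_le hkN)
  have hk0 : (0 : ℝ) < k := lt_trans (by positivity) hk2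
  have h1 : (k : ℝ)⁻¹ ≤ ε / 3 := by
    rw [inv_le_comm₀ hk0 (by positivity), inv_div]; exact hk2.le
  have h2 : ⨆ z : frontier Ω, max 0 (ψ z - k * dist x z) ≤ ψ x + ε / 3 := by
    refine ciSup_le fun z => max_le (by linarith) ?_
    by_cases hd : dist (z : Euc n) x < δ
    · have : 0 ≤ (k : ℝ) * dist x z := by positivity
      linarith [hz z z.2 hd]
    · rw [dist_comm] at hd
      have h3 : (k : ℝ) * δ ≤ k * dist x z := mul_le_mul_of_nonneg_left (not_lt.1 hd) hk0.le
      rw [div_lt_iff₀ hδ] at hk1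
      linarith [hM z z.2]
  have h3 := le_supConv hM k hx
  have h4 : 0 < (k : ℝ)⁻¹ := inv_pos.2 hk0
  rw [Real.dist_eq, abs_of_nonneg (by linarith)]
  unfold supConv
  linarith

end supConv

end

/-! ### One-sided variation of the torsional rigidity -/

section
variable {Ω : Set (Euc n)} {u : Euc n → ℝ}

/-- The part of `closure Ω` obtained by moving the support half-spaces inward by `t * f`. -/
def shrink (Ω : Set (Euc n)) (f : Euc n → ℝ) (t : ℝ) : Set (Euc n) :=
  {x ∈ closure Ω | ∀ X : Euc n, ‖X‖ = 1 → ⟪x, X⟫ ≤ suppFn (closure Ω) X - t * f X}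

lemma TorsionData.mem_frontier_of_normal (T : TorsionData Ω u) {x X : Euc n}
    (hx : x ∈ closure Ω) (hX : IsOuterNormalAt (closure Ω) x X) : x ∈ frontier Ω := by
  rw [T.isOpen.frontier_eq]
  refine ⟨hx, fun h => ?_⟩
  obtain ⟨ε, hε, hb⟩ := Metric.isOpen_iff.1 T.isOpen x h
  have hmem : x + (ε / 2) • X ∈ closure Ω := by
    refine subset_closure (hb ?_)
    rw [mem_ball, dist_eq_norm, add_sub_cancel_left, norm_smul, hX.1, mul_one,
      Real.norm_of_nonneg (by positivity)]
    linarith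
  have := hX.2 _ hmem
  rw [inner_add_left, real_inner_smul_left, real_inner_self_eq_norm_sq, hX.1] at this
  linarith

lemma TorsionData.eventually_le_mul (T : TorsionData Ω u) {f g : Euc n → ℝ} (hf : Continuous f)
    (hg : Continuous g) (hf0 : ∀ X, 0 ≤ f X)
    (hlt : ∀ x ∈ frontier Ω, ∀ X, IsOuterNormalAt (closure Ω) x X → ntSlope Ω u x * f X < g x) :
    ∀ᶠ t in 𝓝[>] (0 : ℝ), ∀ y ∈ Ω, y ∉ shrink Ω f t → u y ≤ t * g y := by
  by_contra hcon
  rw [not_eventually] at hcon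
  obtain ⟨t, ht, hP⟩ := exists_seq_forall_of_frequently hcon
  obtain ⟨ht0, htpos⟩ := tendsto_nhdsWithin_iff.1 ht
  push Not at hP
  choose y hyΩ hyS hyu using hP
  have hX : ∀ k, ∃ X : Euc n, ‖X‖ = 1 ∧ suppFn (closure Ω) X - t k * f X < ⟪y k, X⟫ := by
    intro k
    have := hyS k
    simp only [shrink, mem_ofPred_eq, not_and, not_forall, not_le] at this
    obtain ⟨X, h1, h2⟩ := this (subset_closure (hyΩ k))
    exact ⟨X, h1, h2⟩
  choose X hX1 hX2 using hX
  have hcomp : IsCompact (closure Ω ×ˢ sphere (0 : Euc n) 1) :=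
    T.bdd.isCompact_closure.prod (isCompact_sphere _ _)
  obtain ⟨⟨x₀, X₀⟩, hmem, φ, hφ, hlim⟩ := hcomp.tendsto_subseq (x := fun k => (y k, X k))
    fun k => ⟨subset_closure (hyΩ k), by simp [hX1 k]⟩
  have hly : Tendsto (fun k => y (φ k)) atTop (𝓝 x₀) := (continuous_fst.tendsto _).comp hlim
  have hlX : Tendsto (fun k => X (φ k)) atTop (𝓝 X₀) := (continuous_snd.tendsto _).comp hlim
  have hlt0 : Tendsto (fun k => t (φ k)) atTop (𝓝 0) := ht0.comp hφ.tendsto_atTop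
  have hfX : Tendsto (fun k => f (X (φ k))) atTop (𝓝 (f X₀)) := (hf.tendsto _).comp hlX
  have hnX : ‖X₀‖ = 1 := by simpa using hmem.2
  have hN : IsOuterNormalAt (closure Ω) x₀ X₀ := by
    refine ⟨hnX, fun z hz => ?_⟩
    have h1 : Tendsto (fun k => ⟪z, X (φ k)⟫) atTop (𝓝 ⟪z, X₀⟫) := tendsto_const_nhds.inner hlX
    have h2 : Tendsto (fun k => ⟪y (φ k), X (φ k)⟫ + t (φ k) * f (X (φ k))) atTop
        (𝓝 (⟪x₀, X₀⟫ + 0 * f X₀)) := (hly.inner hlX).add (hlt0.mul hfX)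
    rw [zero_mul, add_zero] at h2
    refine le_of_tendsto_of_tendsto' h1 h2 fun k => ?_
    linarith [inner_le_suppFn T.bdd.closure hz (X (φ k)), hX2 (φ k)]
  have hxf := T.mem_frontier_of_normal hmem.1 hN
  have hs := hlt x₀ hxf X₀ hN
  obtain ⟨ε, hε, hεlt⟩ : ∃ ε > 0, (ntSlope Ω u x₀ + ε) * f X₀ < g x₀ := by
    refine ⟨(g x₀ - ntSlope Ω u x₀ * f X₀) / (2 * (f X₀ + 1)), ?_, ?_⟩
    · have := hf0 X₀
      exact div_pos (by linarith) (by linarith)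
    · have h0 := hf0 X₀
      have h1 : (g x₀ - ntSlope Ω u x₀ * f X₀) / (2 * (f X₀ + 1)) * f X₀ ≤
          (g x₀ - ntSlope Ω u x₀ * f X₀) / 2 := by
        rw [div_mul_eq_mul_div, div_le_div_iff₀ (by linarith) two_pos]
        nlinarith
      linarith
  obtain ⟨r, hr, hus⟩ := T.slope_usc hxf hN hε
  have hle : g x₀ ≤ (ntSlope Ω u x₀ + ε) * f X₀ := by
    refine le_of_tendsto_of_tendsto ((hg.tendsto _).comp hly) (hfX.const_mul _) ?_
    filter_upwards [Metric.tendsto_nhds.1 hly r hr, Metric.tendsto_nhds.1 hlX r hr,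
      hφ.tendsto_atTop.eventually htpos] with k h1 h2 htp
    rw [dist_eq_norm] at h1 h2
    have h3 := hus _ (hX1 (φ k)) h2 _ (hyΩ (φ k)) h1
    have h4 := hyu (φ k)
    have htp : 0 < t (φ k) := htp
    have h5 : (ntSlope Ω u x₀ + ε) * (suppFn (closure Ω) (X (φ k)) - ⟪y (φ k), X (φ k)⟫) ≤
        (ntSlope Ω u x₀ + ε) * (t (φ k) * f (X (φ k))) :=
      mul_le_mul_of_nonneg_left (by linarith [hX2 (φ k)])
        (add_nonneg (ntSlope_nonneg _) hε.le)
    change g (y (φ k)) ≤ _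
    refine le_of_mul_le_mul_left ?_ htp
    linarith
  linarith

lemma TorsionData.ae_gradient_eq_zero (T : TorsionData Ω u) {w : Euc n → ℝ}
    (hw : ∀ y, y ∉ Ω → w y = 0) : ∀ᵐ y : Euc n, y ∉ Ω → gradient w y = 0 := by
  filter_upwards [measure_eq_zero_iff_ae_notMem.1 (T.conv.addHaar_frontier volume)] with y hy hyΩ
  refine gradient_eq_zero_of_notMem isClosed_closure
    (fun z hz => hw z fun hh => hz (subset_closure hh)) fun hc => hy ?_
  rw [T.isOpen.frontier_eq]; exact ⟨hc, hyΩ⟩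

lemma TorsionData.tor_sub_le (T : TorsionData Ω u) {g : Euc n → ℝ} {C : ℝ≥0}
    (hg : LipschitzWith C g) (hg0 : ∀ x, 0 ≤ g x) {K : Set (Euc n)} (hK : IsBounded K) {t : ℝ}
    (ht : 0 < t) (h : ∀ y ∈ Ω, y ∉ K → u y ≤ t * g y) :
    _root_.tor Ω - _root_.tor K ≤ t * (2 * (∫ y in Ω, g y) -
      (∫ y in Ω, {y | t * g y < u y}.indicator (fun y => ⟪gradient g y, gradient u y⟫) y) +
        t * (C ^ 2 * volume.real Ω)) := by
  obtain ⟨L, hL⟩ := T.exists_lipschitz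
  have hΩm := T.isOpen.measurableSet
  obtain ⟨v, hv⟩ : ∃ v : Euc n → ℝ, ∀ y, v y = max (u y - t * g y) 0 := ⟨_, fun _ => rfl⟩
  obtain ⟨A, hA⟩ : ∃ A : ℝ≥0, LipschitzWith A v := by
    have h1 : LipschitzWith (L + t.toNNReal * C) fun y => u y - t * g y := by
      refine LipschitzWith.of_dist_le_mul fun x y => ?_
      have h1 := hL.dist_le_mul x y
      have h2 := mul_le_mul_of_nonneg_left (hg.dist_le_mul x y) ht.le
      rw [Real.dist_eq] at h1 h2 ⊢
      have e : u x - t * g x - (u y - t * g y) = (u x - u y) - t * (g x - g y) := by ring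
      rw [e]
      refine (abs_sub _ _).trans ?_
      rw [abs_mul, abs_of_pos ht]
      push_cast
      rw [Real.coe_toNNReal _ ht.le]
      linarith
    exact ⟨_, by rw [funext hv]; exact h1.max_const 0⟩
  have hvΩ : ∀ y, y ∉ Ω → v y = 0 := fun y hy => by
    rw [hv, T.tor.off y hy]
    exact max_eq_right (by linarith [mul_nonneg ht.le (hg0 y)])
  have hvK : ∀ y, y ∉ K → v y = 0 := fun y hy => by
    by_cases hyΩ : y ∈ Ω
    · rw [hv]; exact max_eq_right (by linarith [h y hyΩ hy])
    · exact hvΩ y hyΩ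
  have e1 := T.tor.energy_eq T.dim T.isOpen T.bdd T.conv T.zero_mem ⟨⟨A, hA⟩, hvΩ⟩
  have e2 := T.tor.tor_eq T.dim T.isOpen T.bdd T.conv T.zero_mem
  have e3 := le_tor T.dim hK ⟨⟨A, hA⟩, hvK⟩
  have e4 := T.tor.weak_form T.dim T.isOpen T.bdd T.conv T.zero_mem hA hvΩ
  have e5 := T.tor.weak_form T.dim T.isOpen T.bdd T.conv T.zero_mem hL T.tor.off
  have i1 := integrable_inner_gradient hA T.bdd hvΩ (measurable_gradient u) (norm_gradient_le hL)
  have i2 := integrable_inner_gradient hL T.bdd T.tor.off (measurable_gradient u)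
    (norm_gradient_le hL)
  have hLA : LipschitzWith (L + A) fun y => u y - v y := hL.sub hA
  have i3 := integrable_norm_gradient_sq hLA T.bdd fun y hy => by
    rw [T.tor.off y hy, hvΩ y hy, sub_zero]
  have i4 := LipschitzWith.integrable_of_off hL T.bdd T.tor.off
  have i5 := LipschitzWith.integrable_of_off hA T.bdd hvΩ
  have hE : MeasurableSet {y | t * g y < u y} :=
    (isOpen_lt (continuous_const.mul hg.continuous) hL.continuous).measurableSet
  have hfin := T.isFiniteMeasure_restrict
  have i6 : IntegrableOn (fun y => {y | t * g y < u y}.indicator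
      (fun y => ⟪gradient g y, gradient u y⟫) y) Ω := by
    refine Integrable.of_bound (((measurable_gradient g).inner
      (measurable_gradient u)).indicator hE).aestronglyMeasurable (C * L)
      (Eventually.of_forall fun y => ?_)
    refine (norm_indicator_le_norm_self _ _).trans ((norm_inner_le_norm _ _).trans ?_)
    exact mul_le_mul (norm_gradient_le hg y) (norm_gradient_le hL y) (norm_nonneg _) C.2
  have i7 : IntegrableOn g Ω :=
    (hg.continuous.continuousOn.integrableOn_compact T.bdd.isCompact_closure).mono_set
      subset_closure
  have e6 : ∫ y, ‖gradient (fun y => u y - v y) y‖ ^ 2 ≤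
      ∫ y in Ω, (⟪gradient u y, gradient u y⟫ - ⟪gradient v y, gradient u y⟫ -
        t * {y | t * g y < u y}.indicator (fun y => ⟪gradient g y, gradient u y⟫) y +
        t ^ 2 * C ^ 2) := by
    have hz : ∫ y, ‖gradient (fun y => u y - v y) y‖ ^ 2 =
        ∫ y in Ω, ‖gradient (fun y => u y - v y) y‖ ^ 2 := by
      refine (setIntegral_eq_integral_of_ae_compl_eq_zero ?_).symm
      filter_upwards [T.ae_gradient_eq_zero
        fun z hz => (by rw [T.tor.off z hz, hvΩ z hz, sub_zero] : u z - v z = 0)] with y hy hyΩ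
      rw [hy hyΩ, norm_zero, zero_pow two_ne_zero]
    rw [hz]
    refine setIntegral_mono_ae i3.integrableOn ?_ ?_
    · exact (((i2.sub i1).integrableOn.sub (i6.const_mul t)).add (integrable_const _))
    · filter_upwards [hL.ae_differentiableAt, hg.ae_differentiableAt, hA.ae_differentiableAt]
        with y d1 d2 d3
      rw [gradient_sub' d1 d3]
      have hC2 : ‖gradient g y‖ ^ 2 ≤ C ^ 2 :=
        pow_le_pow_left₀ (norm_nonneg _) (norm_gradient_le hg y) 2
      by_cases hy : t * g y < u y
      · rw [indicator_of_mem (show y ∈ {y | t * g y < u y} from hy)]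
        have hloc : v =ᶠ[𝓝 y] fun y => u y - t * g y := by
          filter_upwards [(isOpen_lt (continuous_const.mul hg.continuous)
            hL.continuous).mem_nhds hy] with z hz
          rw [hv]; exact max_eq_left (sub_nonneg.2 (le_of_lt hz))
        have hgv : gradient v y = gradient u y - t • gradient g y := by
          rw [gradient_eventuallyEq hloc, gradient_sub' d1 (d2.const_mul t)]
          congr 1
          have := (d2.hasFDerivAt.const_mul t).fderiv
          simp only [gradient, this, map_smulₛₗ]
          rfl
        rw [hgv, sub_sub_cancel, norm_smul, mul_pow, inner_sub_left, real_inner_smul_left,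
          Real.norm_eq_abs, sq_abs]
        have := mul_le_mul_of_nonneg_left hC2 (sq_nonneg t)
        linarith
      · rw [indicator_of_notMem (show y ∉ {y | t * g y < u y} from hy)]
        have hgv : gradient v y = 0 := by
          have hmin : IsLocalMin v y := Eventually.of_forall fun z => by
            have : v y = 0 := by rw [hv]; exact max_eq_right (by linarith)
            rw [this, hv]; exact le_max_right _ _
          simp only [gradient, hmin.fderiv_eq_zero, map_zero]
        rw [hgv, sub_zero, inner_zero_left, real_inner_self_eq_norm_sq]
        have : (0 : ℝ) ≤ t ^ 2 * C ^ 2 := by positivity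
        linarith
  have e7 : ∫ y in Ω, (⟪gradient u y, gradient u y⟫ - ⟪gradient v y, gradient u y⟫ -
        t * {y | t * g y < u y}.indicator (fun y => ⟪gradient g y, gradient u y⟫) y +
        t ^ 2 * C ^ 2) = (∫ y in Ω, ⟪gradient u y, gradient u y⟫) -
        (∫ y in Ω, ⟪gradient v y, gradient u y⟫) -
        t * (∫ y in Ω, {y | t * g y < u y}.indicator
          (fun y => ⟪gradient g y, gradient u y⟫) y) + t ^ 2 * C ^ 2 * volume.real Ω := by
    rw [integral_add _ (integrable_const _), integral_sub _ (i6.const_mul t),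
      integral_sub i2.integrableOn i1.integrableOn, integral_const_mul, setIntegral_const,
      smul_eq_mul, mul_comm (volume.real Ω)]
    · exact i2.integrableOn.sub i1.integrableOn
    · exact ((i2.sub i1).integrableOn.sub (i6.const_mul t))
  have hout : ∀ (w : Euc n → ℝ) , (∀ y, y ∉ Ω → w y = 0) →
      ∫ y in Ω, ⟪gradient w y, gradient u y⟫ = ∫ y, ⟪gradient w y, gradient u y⟫ := by
    intro w hw
    refine setIntegral_eq_integral_of_ae_compl_eq_zero ?_
    filter_upwards [T.ae_gradient_eq_zero hw] with y hy hyΩ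
    rw [hy hyΩ, inner_zero_left]
  have e8 : (∫ y, u y) - (∫ y, v y) ≤ t * ∫ y in Ω, g y := by
    rw [← integral_sub i4 i5, ← integral_const_mul,
      ← setIntegral_eq_integral_of_forall_compl_eq_zero
      (s := Ω) fun y hy => by rw [T.tor.off y hy, hvΩ y hy, sub_zero]]
    refine setIntegral_mono (i4.sub i5).integrableOn (i7.const_mul t) fun y => ?_
    change u y - v y ≤ t * g y
    rw [hv]; linarith [le_max_left (u y - t * g y) 0]
  rw [hout u T.tor.off, hout v hvΩ] at e7
  nlinarith

lemma TorsionData.eventually_tor_sub_le (T : TorsionData Ω u) {f g : Euc n → ℝ} {C : ℝ≥0}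
    (hf : Continuous f) (hg : LipschitzWith C g) (hf0 : ∀ X, 0 ≤ f X) (hg0 : ∀ x, 0 ≤ g x)
    (hlt : ∀ x ∈ frontier Ω, ∀ X, IsOuterNormalAt (closure Ω) x X → ntSlope Ω u x * f X < g x)
    {ε : ℝ} (hε : 0 < ε) :
    ∀ᶠ t in 𝓝[>] (0 : ℝ),
      _root_.tor Ω - _root_.tor (shrink Ω f t) ≤ t * (torDeriv Ω u g + ε) := by
  obtain ⟨L, hL⟩ := T.exists_lipschitz
  have hfin := T.isFiniteMeasure_restrict
  have hmG := (measurable_gradient g).inner (𝕜 := ℝ) (measurable_gradient u)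
  have hbd : ∀ y, ‖⟪gradient g y, gradient u y⟫‖ ≤ C * L := fun y =>
    (norm_inner_le_norm _ _).trans
      (mul_le_mul (norm_gradient_le hg y) (norm_gradient_le hL y) (norm_nonneg _) C.2)
  have hlim : Tendsto (fun t : ℝ => ∫ y in Ω, {y | t * g y < u y}.indicator
      (fun y => ⟪gradient g y, gradient u y⟫) y) (𝓝[>] 0)
      (𝓝 (∫ y in Ω, ⟪gradient g y, gradient u y⟫)) := by
    refine tendsto_integral_filter_of_dominated_convergence (fun _ => C * L) ?_ ?_
      (integrable_const _) ?_
    · refine Eventually.of_forall fun t => (hmG.indicator ?_).aestronglyMeasurable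
      exact (isOpen_lt (continuous_const.mul hg.continuous) hL.continuous).measurableSet
    · exact Eventually.of_forall fun t => Eventually.of_forall fun y =>
        (norm_indicator_le_norm_self _ _).trans (hbd y)
    · filter_upwards [ae_restrict_mem T.isOpen.measurableSet] with y hy
      have h1 : Tendsto (fun t : ℝ => t * g y) (𝓝[>] 0) (𝓝 0) := by
        have : Tendsto (fun t : ℝ => t * g y) (𝓝 0) (𝓝 (0 * g y)) := tendsto_id.mul_const _
        rw [zero_mul] at this
        exact this.mono_left nhdsWithin_le_nhds
      refine tendsto_const_nhds.congr' ?_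
      filter_upwards [h1.eventually (gt_mem_nhds (T.tor.pos y hy))] with t ht
      rw [indicator_of_mem (show y ∈ {y | t * g y < u y} from ht)]
  have hlim2 : Tendsto (fun t : ℝ => t * ((C : ℝ) ^ 2 * volume.real Ω)) (𝓝[>] 0) (𝓝 0) := by
    have : Tendsto (fun t : ℝ => t * ((C : ℝ) ^ 2 * volume.real Ω)) (𝓝 0)
      (𝓝 (0 * ((C : ℝ) ^ 2 * volume.real Ω))) := tendsto_id.mul_const _
    rw [zero_mul] at this
    exact this.mono_left nhdsWithin_le_nhds
  have hD : torDeriv Ω u g =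
      2 * (∫ y in Ω, g y) - (∫ y in Ω, ⟪gradient g y, gradient u y⟫) + 0 := by
    have i7 : IntegrableOn (fun y => 2 * g y) Ω :=
      ((hg.continuous.continuousOn.integrableOn_compact T.bdd.isCompact_closure).mono_set
        subset_closure).const_mul 2
    have i8 : IntegrableOn (fun y => ⟪gradient g y, gradient u y⟫) Ω :=
      Integrable.of_bound hmG.aestronglyMeasurable (C * L) (Eventually.of_forall hbd)
    rw [torDeriv, integral_sub i7 i8, integral_const_mul, add_zero]
  have hl := (hlim.const_sub (2 * ∫ y in Ω, g y)).add hlim2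
  rw [← hD] at hl
  filter_upwards [T.eventually_le_mul hf hg.continuous hf0 hlt,
    hl.eventually (gt_mem_nhds (show _ < torDeriv Ω u g + ε by linarith)), self_mem_nhdsWithin]
    with t h1 h2 ht
  have hK : IsBounded (shrink Ω f t) := T.bdd.closure.subset fun x hx => hx.1
  exact (T.tor_sub_le hg hg0 hK ht h1).trans (mul_le_mul_of_nonneg_left h2.le (le_of_lt ht))

/-- The pointwise upper bound for the one-sided derivative of the torsional rigidity. -/
theorem TorsionData.deriv_le (T : TorsionData Ω u) {f : Euc n → ℝ} (hf : Continuous f)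
    (hf0 : ∀ X, 0 ≤ f X) {D : ℝ}
    (hD : ∀ᶠ t in 𝓝[>] (0 : ℝ), t * D ≤ _root_.tor Ω - _root_.tor (shrink Ω f t)) :
    D ≤ n * ∫ y in Ω, ntSlope Ω u (rad Ω y) ^ 2 * f (gaussMap (closure Ω) (rad Ω y)) *
      invSupp Ω (rad Ω y) := by
  obtain ⟨L, hL⟩ := T.exists_lipschitz
  obtain ⟨B, hB⟩ := T.exists_invSupp_le
  have hfin := T.isFiniteMeasure_restrict
  obtain ⟨F, hF⟩ : ∃ F : ℝ≥0, ∀ X : Euc n, ‖X‖ = 1 → f X ≤ F := by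
    obtain ⟨F, hF⟩ := (isCompact_sphere (0 : Euc n) 1).exists_bound_of_continuousOn hf.continuousOn
    exact ⟨F.toNNReal, fun X hX => (le_abs_self _).trans
      ((hF X (by simpa using hX)).trans (Real.le_coe_toNNReal F))⟩
  obtain ⟨ψ, hψ⟩ : ∃ ψ : Euc n → ℝ, ∀ z, ψ z = ntSlope Ω u z * f (gaussMap (closure Ω) z) :=
    ⟨_, fun _ => rfl⟩
  have hψ0 : ∀ z, 0 ≤ ψ z := fun z => by
    rw [hψ]; exact mul_nonneg (ntSlope_nonneg _) (hf0 _)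
  have hψM : ∀ z ∈ frontier Ω, ψ z ≤ (L * F : ℝ≥0) := by
    intro z hz
    rw [hψ]
    by_cases hr : IsReg Ω z
    · push_cast
      exact mul_le_mul (T.ntSlope_le hL hz) (hF _ hr.gaussMap_spec.1) (hf0 _) L.2
    · rw [T.ntSlope_of_not_isReg hz hr, zero_mul]; exact NNReal.coe_nonneg _
  have hne : Nonempty (frontier Ω) := by
    have hnt : Nontrivial (Euc n) := by
      have : Nonempty (Fin n) := ⟨⟨0, T.dim⟩⟩
      infer_instance
    obtain ⟨y, hy⟩ := exists_ne (0 : Euc n)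
    exact ⟨⟨_, T.rad_mem hy⟩⟩
  have hle : ∀ k : ℕ, 0 < k → D ≤ n * ∫ y in Ω, supConv Ω ψ k (rad Ω y) *
      (ntSlope Ω u (rad Ω y) * invSupp Ω (rad Ω y)) := by
    intro k hk
    have hk0 : 0 < (k : ℝ)⁻¹ := inv_pos.2 (Nat.cast_pos.2 hk)
    have hg := supConv_lipschitz hψM k
    have hg0 : ∀ x, 0 ≤ supConv Ω ψ k x := fun x => hk0.le.trans (supConv_nonneg k x)
    rw [← T.torDeriv_eq hg (M := L * F + 1) fun x => by
      rw [abs_of_nonneg (hg0 x)]; exact_mod_cast supConv_le hψM k x]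
    have hlt : ∀ x ∈ frontier Ω, ∀ X, IsOuterNormalAt (closure Ω) x X →
        ntSlope Ω u x * f X < supConv Ω ψ k x := by
      intro x hx X hX
      by_cases hr : IsReg Ω x
      · rw [hr.eq_gaussMap hX, ← hψ]
        linarith [le_supConv hψM k hx]
      · rw [T.ntSlope_of_not_isReg hx hr, zero_mul]
        exact hk0.trans_le (supConv_nonneg k x)
    refine le_of_forall_pos_le_add fun ε hε => ?_
    obtain ⟨t, h1, h2, ht⟩ := (hD.and ((T.eventually_tor_sub_le hf hg hf0 hg0 hlt hε).and
      self_mem_nhdsWithin)).exists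
    exact le_of_mul_le_mul_left (h1.trans h2) ht
  refine ge_of_tendsto (x := atTop) (Tendsto.const_mul _ ?_)
    ((eventually_gt_atTop 0).mono hle)
  refine tendsto_integral_filter_of_dominated_convergence
    (fun _ => ((L * F : ℝ≥0) + 1) * (L * B)) ?_ ?_ (integrable_const _) ?_
  · refine Eventually.of_forall fun k => AEMeasurable.aestronglyMeasurable ?_
    exact (((supConv_lipschitz hψM k).continuous.measurable.comp T.measurable_rad).aemeasurable.mul
      (T.aemeasurable_ntSlope_rad.mul T.aemeasurable_invSupp_rad).restrict)
  · filter_upwards [eventually_gt_atTop 0] with k hk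
    filter_upwards [ae_restrict_of_ae T.ae_reg] with y hy
    have hx := T.rad_mem hy.1
    have h0 : 0 ≤ supConv Ω ψ k (rad Ω y) :=
      (inv_nonneg.2 (Nat.cast_nonneg k)).trans (supConv_nonneg k _)
    rw [Real.norm_of_nonneg
      (mul_nonneg h0 (mul_nonneg (ntSlope_nonneg _) (T.invSupp_pos hy.2.1).le))]
    exact mul_le_mul (supConv_le hψM k _) (mul_le_mul (T.ntSlope_le hL hx) (hB _ hy.2.1)
      (T.invSupp_pos hy.2.1).le L.2) (mul_nonneg (ntSlope_nonneg _) (T.invSupp_pos hy.2.1).le)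
      (by positivity)
  · filter_upwards [ae_restrict_of_ae T.ae_reg] with y hy
    have hx := T.rad_mem hy.1
    have hreg := hy.2.1
    have h1 : Tendsto (fun k => supConv Ω ψ k (rad Ω y)) atTop (𝓝 (ψ (rad Ω y))) := by
      refine tendsto_supConv hψM hx (hψ0 _) fun ε hε => ?_
      obtain ⟨c, hc⟩ : ∃ c, c = ntSlope Ω u (rad Ω y) := ⟨_, rfl⟩
      obtain ⟨a, ha⟩ : ∃ a, a = f (gaussMap (closure Ω) (rad Ω y)) := ⟨_, rfl⟩
      have hc0 : 0 ≤ c := hc ▸ ntSlope_nonneg _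
      have ha0 : 0 ≤ a := ha ▸ hf0 _
      obtain ⟨η, hη, hη1, hηε⟩ : ∃ η > 0, η ≤ 1 ∧ η * (c + a + 1) ≤ ε :=
        ⟨min 1 (ε / (c + a + 1)), by positivity, min_le_left _ _,
          (le_div_iff₀ (by positivity)).1 (min_le_right _ _)⟩
      have hcη : c * a + η * (c + a + η) ≤ c * a + ε := by
        have := mul_le_mul_of_nonneg_left (show c + a + η ≤ c + a + 1 by linarith) hη.le
        linarith
      obtain ⟨δ₁, hδ₁, h1⟩ := T.ntSlope_usc hx hreg hη
      obtain ⟨r, hr, h2⟩ := Metric.continuousAt_iff.1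
        (hf.continuousAt (x := gaussMap (closure Ω) (rad Ω y))) η hη
      obtain ⟨δ₂, hδ₂, h3⟩ := hreg.exists_near hr
      refine ⟨min δ₁ δ₂, lt_min hδ₁ hδ₂, fun z hz hd => ?_⟩
      rw [hψ, hψ, ← hc, ← ha]
      by_cases hrz : IsReg Ω z
      · have h4 := h1 z hz (hd.trans_le (min_le_left _ _))
        have h5 := h2 (by
          rw [dist_eq_norm]; exact h3 z (hd.trans_le (min_le_right _ _)) _ hrz.gaussMap_spec)
        rw [← ha, Real.dist_eq] at h5
        rw [← hc] at h4
        have h6 : f (gaussMap (closure Ω) z) ≤ a + η := by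
          linarith [le_abs_self (f (gaussMap (closure Ω) z) - a)]
        have h7 := mul_le_mul h4 h6 (hf0 _) (by linarith)
        have h8 : (c + η) * (a + η) = c * a + η * (c + a + η) := by ring
        linarith
      · rw [T.ntSlope_of_not_isReg hz hrz, zero_mul]
        positivity
    have h2 := h1.mul_const (ntSlope Ω u (rad Ω y) * invSupp Ω (rad Ω y))
    rw [hψ] at h2
    convert h2 using 2
    ring
end

/-! ### The maximisation problem -/

lemma suppFn_affine {K : Set (Euc n)} (hK : IsBounded K) (hne : K.Nonempty) {a : ℝ} (ha : 0 < a)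
    (z X : Euc n) : suppFn ((fun x => z + a • x) '' K) X = ⟪z, X⟫ + a * suppFn K X := by
  have hK' : IsBounded ((fun x => z + a • x) '' K) :=
    ((LipschitzWith.const z).add (lipschitzWith_smul a)).isBounded_image hK
  refine le_antisymm (suppFn_le (hne.image _) ?_) ?_
  · rintro _ ⟨y, hy, rfl⟩
    rw [inner_add_left, real_inner_smul_left]
    have := mul_le_mul_of_nonneg_left (inner_le_suppFn hK hy X) ha.le
    linarith
  · rw [← le_sub_iff_add_le', ← le_div_iff₀' ha]
    refine suppFn_le hne fun y hy => ?_
    rw [le_div_iff₀' ha]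
    have := inner_le_suppFn hK' ⟨y, hy, rfl⟩ X
    rw [inner_add_left, real_inner_smul_left] at this
    linarith

lemma suppFn_continuous {K : Set (Euc n)} (hK : IsBounded K) (hne : K.Nonempty) :
    Continuous (suppFn K) := by
  obtain ⟨R, hR⟩ := isBounded_iff_forall_norm_le.1 hK
  obtain ⟨y, hy⟩ := hne
  have hR0 : 0 ≤ R := (norm_nonneg y).trans (hR y hy)
  refine (LipschitzWith.of_le_add_mul ⟨R, hR0⟩ fun X Y => ?_).continuous
  have := suppFn_sub_le ⟨y, hy⟩ hR X Y
  rw [dist_eq_norm]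
  change suppFn K X ≤ suppFn K Y + R * ‖X - Y‖
  linarith

/-- Blaschke selection, in terms of mutual approximation. -/
lemma exists_subseq_hausdorff {C : Set (Euc n)} (hC : IsCompact C) {K : ℕ → Set (Euc n)}
    (hK : ∀ j, IsCompact (K j)) (hne : ∀ j, (K j).Nonempty) (hKC : ∀ j, K j ⊆ C) :
    ∃ L : Set (Euc n), IsCompact L ∧ L.Nonempty ∧ ∃ φ : ℕ → ℕ, StrictMono φ ∧ ∀ δ > 0,
      ∀ᶠ j in atTop, (∀ x ∈ K (φ j), ∃ y ∈ L, dist x y < δ) ∧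
        (∀ y ∈ L, ∃ x ∈ K (φ j), dist x y < δ) := by
  obtain ⟨L, -, φ, hφ, hlim⟩ := (TopologicalSpace.NonemptyCompacts.isCompact_subsets_of_isCompact
    hC).tendsto_subseq (x := fun j => (⟨⟨K j, hK j⟩, hne j⟩ : TopologicalSpace.NonemptyCompacts _))
    hKC
  refine ⟨L, L.isCompact, L.nonempty, φ, hφ, fun δ hδ => ?_⟩
  filter_upwards [Metric.tendsto_nhds.1 hlim δ hδ] with j hj
  rw [NonemptyCompacts.dist_eq] at hj
  have hfin : hausdorffEDist (K (φ j)) (L : Set (Euc n)) ≠ ⊤ :=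
    hausdorffEDist_ne_top_of_nonempty_of_bounded (hne _) L.nonempty (hK _).isBounded
      L.isCompact.isBounded
  refine ⟨fun x hx => exists_dist_lt_of_hausdorffDist_lt hx hj hfin, fun y hy => ?_⟩
  obtain ⟨x, hx, h⟩ := exists_dist_lt_of_hausdorffDist_lt' hy hj hfin
  exact ⟨x, hx, h⟩

lemma tor_le_of_near (hn : 0 < n) {K L : Set (Euc n)} (hL : IsCompact L) (hLc : Convex ℝ L)
    {p : Euc n} {ρ δ : ℝ} (hρ : 0 < ρ) (hδ : 0 < δ) (hp : closedBall p ρ ⊆ L)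
    (h : ∀ x ∈ K, ∃ y ∈ L, dist x y < δ) : tor K ≤ (1 + δ / ρ) ^ (n + 2) * tor L := by
  have ha : 0 < 1 + δ / ρ := by positivity
  rw [← tor_affine hn hL.isBounded ha (-((δ / ρ) • p))]
  refine tor_mono hn (fun x hx => ?_)
    (((LipschitzWith.const _).add (lipschitzWith_smul _)).isBounded_image hL.isBounded)
  obtain ⟨y, hy, hxy⟩ := h x hx
  rw [dist_eq_norm] at hxy
  have hq : p + (ρ / δ) • (x - y) ∈ L := by
    refine hp ?_
    rw [mem_closedBall, dist_eq_norm, add_sub_cancel_left, norm_smul,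
      Real.norm_of_nonneg (by positivity), div_mul_eq_mul_div, div_le_iff₀ hδ]
    exact mul_le_mul_of_nonneg_left hxy.le hρ.le
  refine ⟨(1 + δ / ρ)⁻¹ • y + ((1 + δ / ρ)⁻¹ * (δ / ρ)) • (p + (ρ / δ) • (x - y)),
    hLc hy hq (by positivity) (by positivity) ?_, ?_⟩
  · field_simp
  · change -((δ / ρ) • p) + (1 + δ / ρ) • _ = x
    rw [smul_add, smul_smul, smul_smul, ← mul_assoc, mul_inv_cancel₀ ha.ne', one_smul, one_mul,
      smul_add, smul_smul, div_mul_div_cancel₀ hρ.ne', div_self hδ.ne', one_smul]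
    abel

/-- A convex set with empty interior containing the origin lies in a hyperplane. -/
lemma exists_normal_of_interior_empty {L : Set (Euc n)} (hLc : Convex ℝ L)
    (h0 : (0 : Euc n) ∈ L) (hi : interior L = ∅) : ∃ X : Euc n, ‖X‖ = 1 ∧ ∀ x ∈ L, ⟪x, X⟫ = 0 := by
  have hspan : Submodule.span ℝ L ≠ ⊤ := by
    intro htop
    have h1 : affineSpan ℝ L = ⊤ := by
      rw [AffineSubspace.affineSpan_eq_top_iff_vectorSpan_eq_top_of_nonempty ℝ (Euc n) (Euc n)
        ⟨0, h0⟩,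
        vectorSpan_eq_span_vsub_set_right ℝ h0]
      simpa using htop
    rw [← hLc.interior_nonempty_iff_affineSpan_eq_top, hi] at h1
    exact not_nonempty_empty h1
  obtain ⟨v, hv, hv0⟩ : ∃ v ∈ (Submodule.span ℝ L)ᗮ, v ≠ 0 :=
    Submodule.exists_mem_ne_zero_of_ne_bot fun hb => hspan (Submodule.orthogonal_eq_bot_iff.1 hb)
  refine ⟨‖v‖⁻¹ • v,
    by rw [norm_smul, norm_inv, norm_norm, inv_mul_cancel₀ (norm_ne_zero_iff.2 hv0)],
    fun x hx => ?_⟩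
  rw [real_inner_smul_right, (Submodule.mem_orthogonal _ _).1 hv x (Submodule.subset_span hx),
    mul_zero]

section
variable {μ : Measure (Euc n)} [IsFiniteMeasure μ]

/-- The total mass of the support function of `K` with respect to `μ`. -/
def meanSupp (μ : Measure (Euc n)) (K : Set (Euc n)) : ℝ := ∫ X, suppFn K X ∂μ

lemma integrable_of_ae_sphere (hs : ∀ᵐ X ∂μ, ‖X‖ = 1) {f : Euc n → ℝ} (hf : Continuous f) :
    Integrable f μ := by
  obtain ⟨F, hF⟩ := (isCompact_sphere (0 : Euc n) 1).exists_bound_of_continuousOn hf.continuousOn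
  exact Integrable.of_bound hf.aestronglyMeasurable F
    (hs.mono fun X hX => hF X (by simpa using hX))

lemma integral_inner_eq_zero (hs : ∀ᵐ X ∂μ, ‖X‖ = 1) (hbar : ∫ X, X ∂μ = 0) (z : Euc n) :
    ∫ X, ⟪z, X⟫ ∂μ = 0 := by
  have hi : Integrable (fun X : Euc n => X) μ :=
    Integrable.of_bound continuous_id.aestronglyMeasurable 1 (hs.mono fun X hX => hX.le)
  rw [integral_inner hi, hbar, inner_zero_right]

lemma meanSupp_affine (hs : ∀ᵐ X ∂μ, ‖X‖ = 1) (hbar : ∫ X, X ∂μ = 0) {K : Set (Euc n)}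
    (hK : IsBounded K) (hne : K.Nonempty) {a : ℝ} (ha : 0 < a) (z : Euc n) :
    meanSupp μ ((fun x => z + a • x) '' K) = a * meanSupp μ K := by
  unfold meanSupp
  simp_rw [suppFn_affine hK hne ha]
  rw [integral_add (f := fun X => ⟪z, X⟫)
    (integrable_of_ae_sphere hs (continuous_const.inner continuous_id))
    ((integrable_of_ae_sphere hs (suppFn_continuous hK hne)).const_mul a),
    integral_inner_eq_zero hs hbar, integral_const_mul, zero_add]

lemma exists_coercive (hn : 0 < n) (hs : ∀ᵐ X ∂μ, ‖X‖ = 1) (hbar : ∫ X, X ∂μ = 0)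
    (hgreat : ∀ v : Euc n, v ≠ 0 → μ {X | ⟪X, v⟫ ≠ 0} ≠ 0) :
    ∃ c > 0, ∀ v : Euc n, c * ‖v‖ ≤ ∫ X, max ⟪v, X⟫ 0 ∂μ := by
  have hcX : ∀ v : Euc n, Continuous fun X : Euc n => max ⟪v, X⟫ 0 := fun v =>
    (continuous_const.inner continuous_id).max continuous_const
  have hc : Continuous fun v : Euc n => ∫ X, max ⟪v, X⟫ 0 ∂μ := by
    rw [continuous_iff_continuousAt]
    intro v₀
    refine continuousAt_of_dominated (bound := fun _ => ‖v₀‖ + 1)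
      (Eventually.of_forall fun v => (hcX v).aestronglyMeasurable) ?_ (integrable_const _)
      (Eventually.of_forall fun X =>
        ((continuous_id.inner continuous_const).max continuous_const).continuousAt)
    filter_upwards [ball_mem_nhds v₀ one_pos] with v hv
    filter_upwards [hs] with X hX
    have h1 : ‖v‖ ≤ ‖v₀‖ + 1 := by
      rw [mem_ball, dist_eq_norm] at hv
      have := norm_add_le v₀ (v - v₀)
      rw [add_sub_cancel] at this
      linarith
    rw [Real.norm_of_nonneg (le_max_right _ _)]
    have h2 := real_inner_le_norm v X
    rw [hX, mul_one] at h2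
    exact max_le (h2.trans h1) (by positivity)
  have : Nonempty (Fin n) := ⟨⟨0, hn⟩⟩
  obtain ⟨v₀, hv₀, hmin⟩ := (isCompact_sphere (0 : Euc n) 1).exists_isMinOn
    (NormedSpace.sphere_nonempty.2 zero_le_one) hc.continuousOn
  have hv1 : ‖v₀‖ = 1 := by simpa using hv₀
  have hv0 : v₀ ≠ 0 := norm_ne_zero_iff.1 (by rw [hv1]; exact one_ne_zero)
  have hpos : 0 < ∫ X, max ⟪v₀, X⟫ 0 ∂μ := by
    refine lt_of_le_of_ne (integral_nonneg fun X => le_max_right _ _) fun h => hgreat v₀ hv0 ?_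
    have h1 := (integral_eq_zero_iff_of_nonneg (fun X => le_max_right _ _)
      (integrable_of_ae_sphere hs (hcX v₀))).1 h.symm
    have h2 : 0 ≤ᵐ[μ] fun X => -⟪v₀, X⟫ := by
      filter_upwards [h1] with X hX
      have := le_max_left ⟪v₀, X⟫ 0
      exact neg_nonneg.2 (this.trans_eq hX)
    have h3 := (integral_eq_zero_iff_of_nonneg_ae h2 (integrable_of_ae_sphere hs
      (continuous_const.inner continuous_id).neg)).1 (by
        rw [integral_neg, integral_inner_eq_zero hs hbar, neg_zero])
    refine measure_mono_null ?_ (ae_iff.1 h3)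
    intro X hX
    change ¬ (-⟪v₀, X⟫ = 0)
    rw [neg_eq_zero, real_inner_comm]
    exact hX
  refine ⟨_, hpos, fun v => ?_⟩
  by_cases hv : v = 0
  · simp [hv]
  have hvn : 0 < ‖v‖ := norm_pos_iff.2 hv
  have h1 := hmin (show ‖v‖⁻¹ • v ∈ sphere (0 : Euc n) 1 by
    rw [mem_sphere_zero_iff_norm, norm_smul, norm_inv, norm_norm, inv_mul_cancel₀ hvn.ne'])
  have h2 : ∫ X, max ⟪v, X⟫ 0 ∂μ = ‖v‖ * ∫ X, max ⟪‖v‖⁻¹ • v, X⟫ 0 ∂μ := by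
    rw [← integral_const_mul]
    congr 1; ext X
    rw [mul_max_of_nonneg _ _ hvn.le, real_inner_smul_left, mul_zero, mul_inv_cancel_left₀ hvn.ne']
  rw [h2, mul_comm]
  exact mul_le_mul_of_nonneg_left h1 hvn.le

lemma norm_le_of_meanSupp (hs : ∀ᵐ X ∂μ, ‖X‖ = 1) {c : ℝ}
    (hc : ∀ v : Euc n, c * ‖v‖ ≤ ∫ X, max ⟪v, X⟫ 0 ∂μ) {K : Set (Euc n)} (hK : IsBounded K)
    (h0 : (0 : Euc n) ∈ K) {x : Euc n} (hx : x ∈ K) : c * ‖x‖ ≤ meanSupp μ K := by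
  refine (hc x).trans (integral_mono (integrable_of_ae_sphere hs
    ((continuous_const.inner continuous_id).max continuous_const))
    (integrable_of_ae_sphere hs (suppFn_continuous hK ⟨x, hx⟩)) fun X => ?_)
  have := inner_le_suppFn hK h0 X
  rw [inner_zero_left] at this
  exact max_le (inner_le_suppFn hK hx X) this


lemma meanSupp_closedBall_pos_le (hs : ∀ᵐ X ∂μ, ‖X‖ = 1) {r : ℝ} (hr : 0 ≤ r) :
    meanSupp μ (closedBall (0 : Euc n) r) ≤ r * μ.real univ := by
  have hne : (closedBall (0 : Euc n) r).Nonempty := ⟨0, mem_closedBall_self hr⟩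
  have h : meanSupp μ (closedBall (0 : Euc n) r) ≤ ∫ _, r ∂μ := by
    refine integral_mono_ae (integrable_of_ae_sphere hs
      (suppFn_continuous isBounded_closedBall hne)) (integrable_const _) ?_
    filter_upwards [hs] with X hX
    refine suppFn_le hne fun y hy => (real_inner_le_norm y X).trans ?_
    rw [hX, mul_one]
    simpa using hy
  rwa [integral_const, smul_eq_mul, mul_comm] at h

/-- Existence of a maximiser of the torsional rigidity with bounded mean support. -/
lemma exists_maximiser (hn : 0 < n) (hs : ∀ᵐ X ∂μ, ‖X‖ = 1) (hbar : ∫ X, X ∂μ = 0)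
    (hgreat : ∀ v : Euc n, v ≠ 0 → μ {X | ⟪X, v⟫ ≠ 0} ≠ 0) :
    ∃ L : Set (Euc n), IsCompact L ∧ Convex ℝ L ∧ (0 : Euc n) ∈ L ∧ (interior L).Nonempty ∧
      meanSupp μ L ≤ 1 ∧ ∀ K : Set (Euc n), IsCompact K → Convex ℝ K → (0 : Euc n) ∈ K →
        meanSupp μ K ≤ 1 → tor K ≤ tor L := by
  obtain ⟨c, hc0, hc⟩ := exists_coercive hn hs hbar hgreat
  obtain ⟨𝒦, h𝒦⟩ : ∃ 𝒦 : Set (Set (Euc n)), ∀ K, K ∈ 𝒦 ↔ IsCompact K ∧ Convex ℝ K ∧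
      (0 : Euc n) ∈ K ∧ meanSupp μ K ≤ 1 := ⟨{K | _}, fun K => Iff.rfl⟩
  have hball : ∀ K ∈ 𝒦, K ⊆ closedBall (0 : Euc n) c⁻¹ := fun K hK x hx => by
    rw [h𝒦] at hK
    have := (norm_le_of_meanSupp hs hc hK.1.isBounded hK.2.2.1 hx).trans hK.2.2.2
    rw [mem_closedBall_zero_iff, ← one_div, le_div_iff₀ hc0]
    linarith
  have hbdd : BddAbove (tor '' 𝒦) := by
    refine ⟨tor (closedBall (0 : Euc n) c⁻¹), ?_⟩
    rintro _ ⟨K, hK, rfl⟩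
    exact tor_mono hn (hball K hK) isBounded_closedBall
  obtain ⟨r, hr, hrm⟩ : ∃ r > 0, r * μ.real univ ≤ 1 :=
    ⟨(μ.real univ + 1)⁻¹, by positivity, by
      rw [inv_mul_le_iff₀ (by positivity)]; linarith⟩
  have hB : closedBall (0 : Euc n) r ∈ 𝒦 := (h𝒦 _).2 ⟨isCompact_closedBall _ _,
    convex_closedBall _ _, mem_closedBall_self hr.le,
    (meanSupp_closedBall_pos_le hs hr.le).trans hrm⟩
  have hS : 0 < sSup (tor '' 𝒦) := by
    refine (tor_pos hn isBounded_closedBall ?_).trans_le (le_csSup hbdd ⟨_, hB, rfl⟩)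
    exact ⟨0, ball_subset_interior_closedBall (mem_ball_self hr)⟩
  obtain ⟨s, -, hs1, hs2⟩ := exists_seq_tendsto_sSup (Nonempty.image tor ⟨_, hB⟩) hbdd
  choose K hK hKs using hs2
  have hK' := fun j => (h𝒦 _).1 (hK j)
  obtain ⟨L, hL, hLne, φ, hφ, hnear⟩ := exists_subseq_hausdorff
    (isCompact_closedBall (0 : Euc n) c⁻¹) (fun j => (hK' j).1) (fun j => ⟨0, (hK' j).2.2.1⟩)
    fun j => hball _ (hK j)
  have hLmem : ∀ z, (∀ δ > 0, ∃ y ∈ L, dist z y < δ) → z ∈ L := fun z hz =>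
    hL.isClosed.closure_subset (Metric.mem_closure_iff.2 hz)
  have hL0 : (0 : Euc n) ∈ L := hLmem 0 fun δ hδ => by
    obtain ⟨j, h1, -⟩ := (hnear δ hδ).exists
    exact h1 0 (hK' _).2.2.1
  have hLc : Convex ℝ L := by
    intro x hx y hy a b ha hb hab
    refine hLmem _ fun δ hδ => ?_
    obtain ⟨j, h1, h2⟩ := (hnear (δ / 2) (by positivity)).exists
    obtain ⟨x', hx', hxd⟩ := h2 x hx
    obtain ⟨y', hy', hyd⟩ := h2 y hy
    obtain ⟨z, hz, hzd⟩ := h1 _ ((hK' (φ j)).2.1 hx' hy' ha hb hab)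
    refine ⟨z, hz, (dist_triangle _ (a • x' + b • y') _).trans_lt ?_⟩
    have : dist (a • x + b • y) (a • x' + b • y') ≤ δ / 2 := by
      refine (dist_add_add_le _ _ _ _).trans ?_
      rw [dist_smul₀, dist_smul₀, Real.norm_of_nonneg ha, Real.norm_of_nonneg hb, dist_comm x,
        dist_comm y]
      have h3 := mul_le_mul_of_nonneg_left hxd.le ha
      have h4 := mul_le_mul_of_nonneg_left hyd.le hb
      have h5 : a * (δ / 2) + b * (δ / 2) = δ / 2 := by rw [← add_mul, hab, one_mul]
      linarith
    linarith
  have hLm : meanSupp μ L ≤ 1 := by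
    refine le_of_forall_pos_le_add fun ε hε => ?_
    obtain ⟨δ, hδ, hδε⟩ : ∃ δ > 0, δ * μ.real univ ≤ ε :=
      ⟨ε * (μ.real univ + 1)⁻¹, by positivity, by
        rw [mul_assoc, inv_mul_eq_div]
        exact mul_le_of_le_one_right hε.le (div_le_one_of_le₀ (by linarith) (by positivity))⟩
    obtain ⟨j, -, h2⟩ := (hnear δ hδ).exists
    have hb := (hK' (φ j)).1.isBounded
    have i1 := integrable_of_ae_sphere hs (suppFn_continuous hb ⟨0, (hK' (φ j)).2.2.1⟩)
    have h3 : meanSupp μ L ≤ ∫ X, (suppFn (K (φ j)) X + δ) ∂μ := by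
      refine integral_mono_ae (integrable_of_ae_sphere hs (suppFn_continuous hL.isBounded hLne))
        (i1.add (integrable_const _)) ?_
      filter_upwards [hs] with X hX
      refine suppFn_le hLne fun y hy => ?_
      obtain ⟨x, hx, hxy⟩ := h2 y hy
      have h4 := inner_le_suppFn hb hx X
      have h5 := real_inner_le_norm (y - x) X
      rw [hX, mul_one, ← dist_eq_norm, dist_comm, inner_sub_left] at h5
      linarith
    rw [integral_add i1 (integrable_const _), integral_const, smul_eq_mul, mul_comm] at h3
    have := (hK' (φ j)).2.2.2
    unfold meanSupp at this
    linarith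
  have hlim : Tendsto (fun j => tor (K (φ j))) atTop (𝓝 (sSup (tor '' 𝒦))) := by
    simp_rw [hKs]
    exact hs1.comp hφ.tendsto_atTop
  have hintg : (interior L).Nonempty := by
    by_contra hempty
    rw [not_nonempty_iff_eq_empty] at hempty
    obtain ⟨X, hX, hLX⟩ := exists_normal_of_interior_empty hLc hL0 hempty
    have hle : ∀ ε : ℝ, 0 < ε → sSup (tor '' 𝒦) ≤
        8 * ε ^ 2 * (volume (ball (0 : Euc n) (c⁻¹ + 1))).toReal := by
      intro ε hε
      refine le_of_tendsto hlim ?_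
      filter_upwards [hnear ε hε] with j hj
      refine (tor_mono hn (fun x hx => ?_)
        ((isBounded_ball (x := (0 : Euc n)) (r := c⁻¹ + 1)).subset fun x hx => ?_)).trans
        (tor_thin_le hn (R := c⁻¹ + 1) (by positivity) hε hX)
      · obtain ⟨y, hy, hxy⟩ := hj.1 x hx
        have h1 := abs_real_inner_le_norm (x - y) X
        rw [inner_sub_left, hLX y hy, sub_zero, hX, mul_one, ← dist_eq_norm] at h1
        have h2 := hball _ (hK _) hx
        rw [mem_closedBall_zero_iff] at h2
        exact ⟨h1.trans_lt hxy, by linarith⟩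
      · exact mem_ball_zero_iff.2 hx.2
    have h0 : Tendsto (fun ε : ℝ => 8 * ε ^ 2 * (volume (ball (0 : Euc n) (c⁻¹ + 1))).toReal)
        (𝓝[>] 0) (𝓝 0) := by
      have : Continuous fun ε : ℝ => 8 * ε ^ 2 * (volume (ball (0 : Euc n) (c⁻¹ + 1))).toReal := by
        fun_prop
      have := this.tendsto 0
      simp only [ne_eq, OfNat.ofNat_ne_zero, not_false_eq_true, zero_pow, mul_zero,
        zero_mul] at this
      exact this.mono_left nhdsWithin_le_nhds
    have := ge_of_tendsto h0 (eventually_mem_nhdsWithin.mono hle)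
    linarith
  refine ⟨L, hL, hLc, hL0, hintg, hLm, fun K' h1 h2 h3 h4 =>
    (le_csSup hbdd ⟨K', (h𝒦 _).2 ⟨h1, h2, h3, h4⟩, rfl⟩).trans ?_⟩
  obtain ⟨p, hp⟩ := hintg
  obtain ⟨ρ, hρ, hpρ⟩ := Metric.nhds_basis_closedBall.mem_iff.1 (isOpen_interior.mem_nhds hp)
  have hle : ∀ δ : ℝ, 0 < δ → sSup (tor '' 𝒦) ≤ (1 + δ / ρ) ^ (n + 2) * tor L := by
    intro δ hδ
    refine le_of_tendsto hlim ?_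
    filter_upwards [hnear δ hδ] with j hj
    exact tor_le_of_near hn hL hLc hρ hδ (hpρ.trans interior_subset) hj.1
  have h0 : Tendsto (fun δ : ℝ => (1 + δ / ρ) ^ (n + 2) * tor L) (𝓝[>] 0) (𝓝 (tor L)) := by
    have : Continuous fun δ : ℝ => (1 + δ / ρ) ^ (n + 2) * tor L := by fun_prop
    have := this.tendsto 0
    simp only [zero_div, add_zero, one_pow, one_mul] at this
    exact this.mono_left nhdsWithin_le_nhds
  exact ge_of_tendsto h0 (eventually_mem_nhdsWithin.mono hle)

/-- A convex body maximising the scale-invariant ratio, with a prescribed value of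
`tor K / meanSupp μ K`. -/
theorem exists_extremal_body (hn : 0 < n) (hs : ∀ᵐ X ∂μ, ‖X‖ = 1) (hbar : ∫ X, X ∂μ = 0)
    (hgreat : ∀ v : Euc n, v ≠ 0 → μ {X | ⟪X, v⟫ ≠ 0} ≠ 0) {κ : ℝ} (hκ : 0 < κ) :
    ∃ L : Set (Euc n), IsCompact L ∧ Convex ℝ L ∧ (0 : Euc n) ∈ interior L ∧ 0 < meanSupp μ L ∧
      tor L = κ * meanSupp μ L ∧ ∀ K : Set (Euc n), IsCompact K → Convex ℝ K → K.Nonempty →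
        0 < meanSupp μ K → tor K * meanSupp μ L ^ (n + 2) ≤ tor L * meanSupp μ K ^ (n + 2) := by
  obtain ⟨c, hc0, hc⟩ := exists_coercive hn hs hbar hgreat
  obtain ⟨L, hL, hLc, hL0, ⟨p, hp⟩, hLm, hmax⟩ := exists_maximiser hn hs hbar hgreat
  have hcomp : ∀ (a : ℝ) (z : Euc n) {K : Set (Euc n)}, IsCompact K →
      IsCompact ((fun x => z + a • x) '' K) := fun a z K hK =>
    hK.image (continuous_const.add (continuous_const_smul a))
  have hconv : ∀ (a : ℝ) (z : Euc n) {K : Set (Euc n)}, Convex ℝ K →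
      Convex ℝ ((fun x => z + a • x) '' K) := fun a z K hK => by
    have := (hK.smul a).translate z
    rwa [← image_smul, image_image] at this
  have hall : ∀ K : Set (Euc n), IsCompact K → Convex ℝ K → K.Nonempty → 0 < meanSupp μ K →
      tor K ≤ tor L * meanSupp μ K ^ (n + 2) := by
    rintro K hK hKc ⟨q, hq⟩ hF
    have hF' := inv_pos.2 hF
    have h1 := hmax _ (hcomp (meanSupp μ K)⁻¹ (-((meanSupp μ K)⁻¹ • q)) hK) (hconv _ _ hKc)
      ⟨q, hq, neg_add_cancel _⟩ (by
        rw [meanSupp_affine hs hbar hK.isBounded ⟨q, hq⟩ hF', inv_mul_cancel₀ hF.ne'])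
    rwa [tor_affine hn hK.isBounded hF', inv_pow, inv_mul_le_iff₀ (by positivity), mul_comm] at h1
  have hT : 0 < tor L := tor_pos hn hL.isBounded ⟨p, hp⟩
  have hFL : 0 < meanSupp μ L := by
    have hnt : Nontrivial (Euc n) := by
      have : Nonempty (Fin n) := ⟨⟨0, hn⟩⟩
      infer_instance
    obtain ⟨q, hq, hq0⟩ : ∃ q ∈ L, q ≠ 0 := by
      by_contra hcon
      push Not at hcon
      have : L ⊆ {0} := fun x hx => hcon x hx
      have h2 := interior_mono this hp
      rw [interior_singleton] at h2
      exact h2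
    exact (mul_pos hc0 (norm_pos_iff.2 hq0)).trans_le
      (norm_le_of_meanSupp hs hc hL.isBounded hL0 hq)
  have hF1 : meanSupp μ L = 1 := by
    refine le_antisymm hLm ?_
    have h1 := hall L hL hLc ⟨0, hL0⟩ hFL
    by_contra hlt
    have h2 : meanSupp μ L ^ (n + 2) < 1 := pow_lt_one₀ hFL.le (not_le.1 hlt) (by omega)
    nlinarith
  obtain ⟨a, ha, hae⟩ : ∃ a > 0, a ^ (n + 1) * tor L = κ := by
    refine ⟨(κ / tor L) ^ (((n + 1 : ℕ) : ℝ)⁻¹), Real.rpow_pos_of_pos (div_pos hκ hT) _, ?_⟩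
    rw [Real.rpow_inv_natCast_pow (div_pos hκ hT).le (by omega), div_mul_cancel₀ _ hT.ne']
  have e1 : meanSupp μ ((fun x => -(a • p) + a • x) '' L) = a := by
    rw [meanSupp_affine hs hbar hL.isBounded ⟨0, hL0⟩ ha, hF1, mul_one]
  have e2 : tor ((fun x => -(a • p) + a • x) '' L) = a ^ (n + 2) * tor L :=
    tor_affine hn hL.isBounded ha _
  refine ⟨(fun x => -(a • p) + a • x) '' L, hcomp _ _ hL, hconv _ _ hLc, ?_, by rw [e1]; exact ha,
    ?_, fun K h1 h2 h3 h4 => ?_⟩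
  · have hcl : (fun x => -(a • p) + a • x) '' interior L ⊆
        interior ((fun x => -(a • p) + a • x) '' L) := by
      refine interior_maximal (image_mono interior_subset) ?_
      have h1 := (isOpen_interior (s := L)).smul₀ ha.ne'
      have h2 := (Homeomorph.addLeft (-(a • p))).isOpenMap _ h1
      rw [← image_smul, image_image] at h2
      exact h2
    exact hcl ⟨p, hp, neg_add_cancel _⟩
  · rw [e1, e2, ← hae]; ring
  · rw [e1, e2]
    have := mul_le_mul_of_nonneg_left (hall K h1 h2 h3 h4) (pow_pos ha (n + 2)).le
    linarith
end

/-! ### The Euler–Lagrange equation of the extremal body -/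

section EulerLagrange

variable {Ω : Set (Euc n)} {u : Euc n → ℝ} {μ : Measure (Euc n)} [IsFiniteMeasure μ]

lemma TorsionData.exists_le_suppFn (T : TorsionData Ω u) :
    ∃ ρ > 0, ∀ X : Euc n, ‖X‖ = 1 → ρ ≤ suppFn (closure Ω) X := by
  obtain ⟨ρ, hρ, hb⟩ := Metric.nhds_basis_closedBall.mem_iff.1 T.nhds_zero
  refine ⟨ρ, hρ, fun X hX => ?_⟩
  have h := inner_le_suppFn T.bdd.closure (y := ρ • X) (subset_closure (hb (by
    rw [mem_closedBall_zero_iff, norm_smul, hX, mul_one, Real.norm_of_nonneg hρ.le]))) X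
  rwa [real_inner_smul_left, real_inner_self_eq_norm_sq, hX, one_pow, mul_one] at h

lemma TorsionData.isCompact_shrink (T : TorsionData Ω u) (f : Euc n → ℝ) (t : ℝ) :
    IsCompact (shrink Ω f t) := by
  have h : shrink Ω f t = closure Ω ∩ ⋂ X : Euc n, ⋂ _ : ‖X‖ = 1,
      {x | ⟪x, X⟫ ≤ suppFn (closure Ω) X - t * f X} := by
    ext x; simp [shrink]
  rw [h]
  exact T.bdd.isCompact_closure.inter_right (isClosed_iInter fun X => isClosed_iInter fun _ =>
    isClosed_le (continuous_id.inner continuous_const) continuous_const)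

lemma TorsionData.convex_shrink (T : TorsionData Ω u) (f : Euc n → ℝ) (t : ℝ) :
    Convex ℝ (shrink Ω f t) := by
  intro x hx y hy a b ha hb hab
  refine ⟨T.conv.closure hx.1 hy.1 ha hb hab, fun X hX => ?_⟩
  have h1 := mul_le_mul_of_nonneg_left (hx.2 X hX) ha
  have h2 := mul_le_mul_of_nonneg_left (hy.2 X hX) hb
  rw [inner_add_left, real_inner_smul_left, real_inner_smul_left]
  have h3 : (a + b) * (suppFn (closure Ω) X - t * f X) = suppFn (closure Ω) X - t * f X := by
    rw [hab, one_mul]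
  linarith

lemma TorsionData.le_of_extremal (T : TorsionData Ω u) (hs : ∀ᵐ X ∂μ, ‖X‖ = 1) {c κ : ℝ}
    (hc0 : 0 < c) (hc : ∀ v : Euc n, c * ‖v‖ ≤ ∫ X, max ⟪v, X⟫ 0 ∂μ)
    (hF : 0 < meanSupp μ (closure Ω)) (hτ : _root_.tor Ω = κ * meanSupp μ (closure Ω))
    (hmax : ∀ K : Set (Euc n), IsCompact K → Convex ℝ K → K.Nonempty → 0 < meanSupp μ K →
      _root_.tor K * meanSupp μ (closure Ω) ^ (n + 2) ≤ _root_.tor Ω * meanSupp μ K ^ (n + 2))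
    {f : Euc n → ℝ} (hf : Continuous f) (hf0 : ∀ X, 0 ≤ f X) :
    (n + 2) * κ * ∫ X, f X ∂μ ≤ n * ∫ y in Ω, ntSlope Ω u (rad Ω y) ^ 2 *
      f (gaussMap (closure Ω) (rad Ω y)) * invSupp Ω (rad Ω y) := by
  obtain ⟨m, hm⟩ : ∃ m, m = ∫ X, f X ∂μ := ⟨_, rfl⟩
  obtain ⟨F, hFe⟩ : ∃ F, F = meanSupp μ (closure Ω) := ⟨_, rfl⟩
  rw [← hm]
  rw [← hFe] at hF hτ hmax
  refine le_of_forall_lt fun D hD => ?_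
  obtain ⟨D', hD1, hD2⟩ := exists_between hD
  refine hD1.trans_le (T.deriv_le hf hf0 ?_)
  obtain ⟨ρ, hρ, hρs⟩ := T.exists_le_suppFn
  obtain ⟨B, hB⟩ := (isCompact_sphere (0 : Euc n) 1).exists_bound_of_continuousOn hf.continuousOn
  have hB' : ∀ X : Euc n, ‖X‖ = 1 → f X ≤ |B| := fun X hX =>
    (le_abs_self _).trans ((hB X (by simpa using hX)).trans (le_abs_self _))
  have hd : HasDerivAt (fun t : ℝ => κ * F * (1 - (1 - t * (m / F)) ^ (n + 2)))
      ((n + 2) * κ * m) 0 := by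
    have h1 : HasDerivAt (fun t : ℝ => 1 - t * (m / F)) (-(1 * (m / F))) 0 :=
      ((hasDerivAt_id (0 : ℝ)).mul_const _).const_sub 1
    have h2 := ((h1.pow (n + 2)).const_sub 1).const_mul (κ * F)
    refine h2.congr_deriv ?_
    push_cast
    simp only [zero_mul, sub_zero, one_pow]
    field_simp
  have hslope := hd.tendsto_slope_zero_right.eventually (lt_mem_nhds hD2)
  have hsmall : ∀ᶠ t in 𝓝[>] (0 : ℝ), t * |B| < ρ / 2 := by
    have h : Continuous fun t : ℝ => t * |B| := by fun_prop
    have h' := h.tendsto 0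
    rw [zero_mul] at h'
    exact (h'.mono_left nhdsWithin_le_nhds).eventually (gt_mem_nhds (by positivity))
  filter_upwards [hslope, hsmall, eventually_mem_nhdsWithin] with t h1 h2 ht
  have ht : 0 < t := ht
  simp only [zero_add, zero_mul, sub_zero, one_pow, sub_self, mul_zero, smul_eq_mul] at h1
  rw [← div_eq_inv_mul, lt_div_iff₀ ht] at h1
  have hball : closedBall (0 : Euc n) (ρ / 2) ⊆ shrink Ω f t := by
    have hin : ∀ y ∈ closedBall (0 : Euc n) (ρ / 2), ∀ X : Euc n, ‖X‖ = 1 →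
        ⟪y, X⟫ ≤ suppFn (closure Ω) X - t * f X := fun y hy X hX => by
      have e1 := real_inner_le_norm y X
      rw [hX, mul_one] at e1
      rw [mem_closedBall_zero_iff] at hy
      have e2 := hρs X hX
      have e3 := mul_le_mul_of_nonneg_left (hB' X hX) ht.le
      linarith
    intro y hy
    refine ⟨?_, hin y hy⟩
    by_contra hyc
    have hy0 : y ≠ 0 := fun h => hyc (h ▸ subset_closure T.zero_mem)
    obtain ⟨X, hX⟩ := T.exists_isOuterNormalAt (T.rad_mem hy0)
    have e1 := hin y hy X hX.1
    have e2 := hX.suppFn_eq (frontier_subset_closure (T.rad_mem hy0))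
    have e3 := T.inner_normal_pos hX
    have e4 : ⟪rad Ω y, X⟫ * gauge Ω y = ⟪y, X⟫ := by
      rw [mul_comm, ← real_inner_smul_left, T.gauge_smul_rad]
    have e5 : 0 ≤ t * f X := mul_nonneg ht.le (hf0 X)
    have e6 : gauge Ω y ≤ 1 := by
      by_contra hcon
      rw [not_le] at hcon
      nlinarith
    refine hyc ?_
    rw [← T.gauge_smul_rad y]
    have := T.conv.closure (subset_closure T.zero_mem) (frontier_subset_closure (T.rad_mem hy0))
      (sub_nonneg.2 e6) (gauge_nonneg y) (sub_add_cancel _ _)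
    simpa using this
  have hK := T.isCompact_shrink f t
  have h0K : (0 : Euc n) ∈ shrink Ω f t := hball (mem_closedBall_self (by positivity))
  have hKpos : 0 < meanSupp μ (shrink Ω f t) := by
    have : Nontrivial (Euc n) := by
      have : Nonempty (Fin n) := ⟨⟨0, T.dim⟩⟩
      infer_instance
    obtain ⟨p, hp⟩ := exists_norm_eq (Euc n) (half_pos hρ).le
    have h := norm_le_of_meanSupp hs hc hK.isBounded h0K
      (hball (mem_closedBall_zero_iff.2 hp.le))
    rw [hp] at h
    exact (by positivity : 0 < c * (ρ / 2)).trans_le h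
  have hKle : meanSupp μ (shrink Ω f t) ≤ F - t * m := by
    have hi := integrable_of_ae_sphere hs
      (suppFn_continuous T.bdd.closure ⟨0, subset_closure T.zero_mem⟩)
    have hi2 := integrable_of_ae_sphere hs hf
    rw [hFe, hm, meanSupp, meanSupp, ← integral_const_mul, ← integral_sub hi (hi2.const_mul t)]
    refine integral_mono_ae (integrable_of_ae_sphere hs (suppFn_continuous hK.isBounded ⟨0, h0K⟩))
      (hi.sub (hi2.const_mul t)) ?_
    filter_upwards [hs] with X hX
    exact suppFn_le ⟨0, h0K⟩ fun y hy => hy.2 X hX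
  have h3 := hmax _ hK (T.convex_shrink f t) ⟨0, h0K⟩ hKpos
  have hτ0 : 0 ≤ κ * F := hτ ▸ tor_nonneg T.dim T.bdd
  have h4 : _root_.tor (shrink Ω f t) ≤ κ * F * (1 - t * (m / F)) ^ (n + 2) := by
    have e1 : (1 - t * (m / F)) = (F - t * m) / F := by field_simp
    rw [e1, div_pow, ← mul_div_assoc, le_div_iff₀ (pow_pos hF _), ← hτ]
    refine h3.trans (mul_le_mul_of_nonneg_left ?_ (hτ ▸ hτ0))
    exact pow_le_pow_left₀ hKpos.le hKle _
  rw [hτ]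
  linarith

lemma TorsionData.integrableOn_density (T : TorsionData Ω u) {f : Euc n → ℝ} (hf : Continuous f) :
    IntegrableOn (fun y => ntSlope Ω u (rad Ω y) ^ 2 * f (gaussMap (closure Ω) (rad Ω y)) *
      invSupp Ω (rad Ω y)) Ω := by
  obtain ⟨L, hL⟩ := T.exists_lipschitz
  obtain ⟨B, hB⟩ := T.exists_invSupp_le
  obtain ⟨C, hC⟩ := (isCompact_sphere (0 : Euc n) 1).exists_bound_of_continuousOn hf.continuousOn
  have := T.isFiniteMeasure_restrict
  refine Integrable.of_bound (((T.aemeasurable_ntSlope_rad.pow_const 2).mul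
    (hf.measurable.comp_aemeasurable T.aemeasurable_gaussMap_rad)).mul
    T.aemeasurable_invSupp_rad).aestronglyMeasurable.restrict (L ^ 2 * C * B) ?_
  filter_upwards [ae_restrict_of_ae T.ae_reg] with y hy
  have h1 := hC _ (mem_sphere_zero_iff_norm.2 hy.2.1.gaussMap_spec.1)
  have h2 := T.ntSlope_le hL (T.rad_mem hy.1)
  rw [norm_mul, norm_mul, norm_pow, Real.norm_of_nonneg (ntSlope_nonneg _),
    Real.norm_of_nonneg (T.invSupp_pos hy.2.1).le]
  have h0 : 0 ≤ C := (norm_nonneg _).trans h1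
  have h3 := hB _ hy.2.1
  have h4 := (T.invSupp_pos hy.2.1).le
  have h5 := ntSlope_nonneg (Ω := Ω) (u := u) (rad Ω y)
  gcongr

/-- An extremal body solves the Minkowski problem, tested against continuous functions. -/
lemma TorsionData.eq_of_extremal (T : TorsionData Ω u) (hs : ∀ᵐ X ∂μ, ‖X‖ = 1) {c κ : ℝ}
    (hc0 : 0 < c) (hc : ∀ v : Euc n, c * ‖v‖ ≤ ∫ X, max ⟪v, X⟫ 0 ∂μ)
    (hF : 0 < meanSupp μ (closure Ω)) (hτ : _root_.tor Ω = κ * meanSupp μ (closure Ω))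
    (hmax : ∀ K : Set (Euc n), IsCompact K → Convex ℝ K → K.Nonempty → 0 < meanSupp μ K →
      _root_.tor K * meanSupp μ (closure Ω) ^ (n + 2) ≤ _root_.tor Ω * meanSupp μ K ^ (n + 2))
    {f : Euc n → ℝ} (hf : Continuous f) (hf0 : ∀ X, 0 ≤ f X) :
    (n + 2) * κ * ∫ X, f X ∂μ = n * ∫ y in Ω, ntSlope Ω u (rad Ω y) ^ 2 *
      f (gaussMap (closure Ω) (rad Ω y)) * invSupp Ω (rad Ω y) := by
  refine le_antisymm (T.le_of_extremal hs hc0 hc hF hτ hmax hf hf0) ?_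
  obtain ⟨ρ, hρ, hρs⟩ := T.exists_le_suppFn
  obtain ⟨B, hB⟩ := (isCompact_sphere (0 : Euc n) 1).exists_bound_of_continuousOn hf.continuousOn
  have hh := suppFn_continuous T.bdd.closure ⟨0, subset_closure T.zero_mem⟩
  obtain ⟨M, hM⟩ : ∃ M, M = |B| / ρ := ⟨_, rfl⟩
  have hfM : ∀ X : Euc n, ‖X‖ = 1 → max (M * suppFn (closure Ω) X - f X) 0 =
      M * suppFn (closure Ω) X - f X := fun X hX => by
    refine max_eq_left ?_
    have h1 : f X ≤ |B| := (le_abs_self _).trans ((hB X (by simpa using hX)).trans (le_abs_self _))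
    have h2 := mul_le_mul_of_nonneg_left (hρs X hX) (by positivity : 0 ≤ |B| / ρ)
    rw [div_mul_cancel₀ _ hρ.ne', ← hM] at h2
    linarith
  have h := T.le_of_extremal hs hc0 hc hF hτ hmax (f := fun X =>
    max (M * suppFn (closure Ω) X - f X) 0) (((hh.const_mul M).sub hf).max continuous_const)
    fun X => le_max_right _ _
  have e1 : ∫ X, max (M * suppFn (closure Ω) X - f X) 0 ∂μ =
      M * meanSupp μ (closure Ω) - ∫ X, f X ∂μ := by
    rw [integral_congr_ae (hs.mono hfM), integral_sub ((integrable_of_ae_sphere hs hh).const_mul M)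
      (integrable_of_ae_sphere hs hf), integral_const_mul, meanSupp]
  have e2 : ∫ y in Ω, ntSlope Ω u (rad Ω y) ^ 2 *
      max (M * suppFn (closure Ω) (gaussMap (closure Ω) (rad Ω y)) -
        f (gaussMap (closure Ω) (rad Ω y))) 0 * invSupp Ω (rad Ω y) =
      M * (∫ y in Ω, ntSlope Ω u (rad Ω y) ^ 2) - ∫ y in Ω, ntSlope Ω u (rad Ω y) ^ 2 *
        f (gaussMap (closure Ω) (rad Ω y)) * invSupp Ω (rad Ω y) := by
    have hae : ∀ᵐ y ∂volume.restrict Ω, ntSlope Ω u (rad Ω y) ^ 2 *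
        suppFn (closure Ω) (gaussMap (closure Ω) (rad Ω y)) * invSupp Ω (rad Ω y) =
        ntSlope Ω u (rad Ω y) ^ 2 := by
      filter_upwards [ae_restrict_of_ae T.ae_reg] with y hy
      rw [hy.2.1.gaussMap_spec.suppFn_eq (frontier_subset_closure (T.rad_mem hy.1)), mul_assoc,
        invSupp, mul_inv_cancel₀ (T.inner_normal_pos hy.2.1.gaussMap_spec).ne', mul_one]
    rw [← integral_congr_ae hae, ← integral_const_mul,
      ← integral_sub ((T.integrableOn_density hh).const_mul M) (T.integrableOn_density hf)]
    refine integral_congr_ae ?_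
    filter_upwards [ae_restrict_of_ae T.ae_reg] with y hy
    rw [hfM _ hy.2.1.gaussMap_spec.1]
    ring
  rw [e1, e2] at h
  have hp := T.pohozaev
  rw [hτ] at hp
  have hp' : M * ((n + 2) * (κ * meanSupp μ (closure Ω))) =
      M * (n * ∫ y in Ω, ntSlope Ω u (rad Ω y) ^ 2) := by rw [hp]
  linarith

/-- Existence of a convex domain whose torsion measure, read off in polar coordinates,
is a prescribed multiple of `μ`. -/
theorem exists_polar_solution (hn : 0 < n) (hs : ∀ᵐ X ∂μ, ‖X‖ = 1) (hbar : ∫ X, X ∂μ = 0)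
    (hgreat : ∀ v : Euc n, v ≠ 0 → μ {X | ⟪X, v⟫ ≠ 0} ≠ 0) {κ : ℝ} (hκ : 0 < κ) :
    ∃ (Ω : Set (Euc n)) (u : Euc n → ℝ), TorsionData Ω u ∧ ∀ f : Euc n → ℝ, Continuous f →
      (∀ X, 0 ≤ f X) → (n + 2) * κ * ∫ X, f X ∂μ = n * ∫ y in Ω, ntSlope Ω u (rad Ω y) ^ 2 *
        f (gaussMap (closure Ω) (rad Ω y)) * invSupp Ω (rad Ω y) := by
  obtain ⟨c, hc0, hc⟩ := exists_coercive hn hs hbar hgreat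
  obtain ⟨L, hL, hLc, hL0, hF, hτ, hmax⟩ := exists_extremal_body hn hs hbar hgreat hκ
  obtain ⟨u, hu⟩ := exists_isTorsion hn isOpen_interior (hL.isBounded.subset interior_subset)
  have hcl : closure (interior L) = L := by
    rw [hLc.closure_interior_eq_closure_of_nonempty_interior ⟨0, hL0⟩, hL.isClosed.closure_eq]
  have T : TorsionData (interior L) u := ⟨hn, isOpen_interior,
    hL.isBounded.subset interior_subset, hLc.interior, hL0, hu⟩
  refine ⟨_, u, T, fun f hf hf0 => T.eq_of_extremal hs hc0 hc ?_ ?_ ?_ hf hf0⟩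
  · rwa [hcl]
  · rwa [hcl, tor_interior]
  · rwa [hcl, tor_interior]

end EulerLagrange

/-! ### Cones over hyperplane sections -/

section PlanarCone

/-- Orthonormal coordinates `(s, w) ↦ s e₀ + w`. -/
def consEuc {m : ℕ} (p : ℝ × Euc m) : Euc (m + 1) :=
  WithLp.toLp 2 (Fin.cons p.1 p.2 : Fin (m + 1) → ℝ)

lemma measurePreserving_consEuc (m : ℕ) : MeasurePreserving (consEuc (m := m)) := by
  have h1 : MeasurePreserving (Prod.map id (WithLp.ofLp (p := 2)) : ℝ × Euc m → ℝ × (Fin m → ℝ)) :=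
    (MeasurePreserving.id (volume : Measure ℝ)).prod (PiLp.volume_preserving_ofLp (Fin m))
  have h2 := (volume_preserving_piFinSuccAbove (fun _ : Fin (m + 1) => ℝ) 0).symm
  have h3 := (PiLp.volume_preserving_toLp (Fin (m + 1))).comp (h2.comp h1)
  convert! h3 using 1
  funext p
  simp [consEuc, MeasurableEquiv.piFinSuccAbove, Fin.insertNthEquiv]

lemma consEuc_smul {m : ℕ} (r : ℝ) (p : ℝ × Euc m) : consEuc (r • p) = r • consEuc p := by
  ext i
  refine Fin.cases ?_ (fun j => ?_) i <;> simp [consEuc]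

lemma isometry_consEuc {m : ℕ} (s : ℝ) : Isometry fun w : Euc m => consEuc (s, w) := by
  refine Isometry.of_dist_eq fun w w' => ?_
  rw [EuclideanSpace.dist_eq, EuclideanSpace.dist_eq, Fin.sum_univ_succ]
  simp [consEuc]

lemma inner_consEuc {m : ℕ} (p : ℝ × Euc m) :
    ⟪consEuc p, EuclideanSpace.single (0 : Fin (m + 1)) (1 : ℝ)⟫ = p.1 := by
  rw [EuclideanSpace.inner_single_right]
  simp [consEuc]

lemma consEuc_surj {m : ℕ} (z : Euc (m + 1)) : ∃ p : ℝ × Euc m, consEuc p = z := by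
  refine ⟨(z 0, WithLp.toLp 2 fun j => z j.succ), ?_⟩
  ext i
  refine Fin.cases ?_ (fun j => ?_) i <;> simp [consEuc]

lemma lintegral_pow_div (m : ℕ) {h : ℝ} (hh : 0 < h) :
    ∫⁻ s in Ioo 0 h, ENNReal.ofReal ((s / h) ^ m) = ENNReal.ofReal (h / (m + 1)) := by
  have hc : Continuous fun s : ℝ => (s / h) ^ m := by fun_prop
  rw [← ofReal_integral_eq_lintegral_ofReal, ← integral_Ioc_eq_integral_Ioo,
    ← intervalIntegral.integral_of_le hh.le]
  · congr 1
    simp_rw [div_pow]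
    rw [intervalIntegral.integral_div, integral_pow]
    simp
    field_simp
    ring
  · exact (hc.integrableOn_Icc (a := 0) (b := h)).mono_set Ioo_subset_Icc_self
  · filter_upwards [ae_restrict_mem measurableSet_Ioo] with s hs
    exact pow_nonneg (div_nonneg hs.1.le hh.le) _

/-- The volume of a cone over a subset of a hyperplane is proportional to height times base. -/
theorem exists_planar_cone_const (hn : 0 < n) : ∃ c : ℝ≥0∞, c ≠ 0 ∧ c ≠ ⊤ ∧
    ∀ (X : Euc n) (h : ℝ) (B : Set (Euc n)), ‖X‖ = 1 → 0 < h → MeasurableSet B →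
      (∀ z ∈ B, ⟪z, X⟫ = h) →
      ENNReal.ofReal h * μH[(n : ℝ) - 1] B =
        c * volume {y : Euc n | (0 < ⟪y, X⟫ ∧ ⟪y, X⟫ < h) ∧ (h / ⟪y, X⟫) • y ∈ B} := by
  obtain ⟨m, rfl⟩ : ∃ m, n = m + 1 := ⟨n - 1, by omega⟩
  have hdim : ((m + 1 : ℕ) : ℝ) - 1 = (m : ℝ) := by push_cast; ring
  rw [hdim]
  have hHaar : (μH[(m : ℝ)] : Measure (Euc m)).IsAddHaarMeasure := by
    have := isAddHaarMeasure_hausdorffMeasure (E := Euc m)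
    rwa [finrank_euclideanSpace_fin] at this
  obtain ⟨c, hc⟩ : ∃ c, c = (μH[(m : ℝ)] : Measure (Euc m)).addHaarScalarFactor volume := ⟨_, rfl⟩
  have hcpos : 0 < c := hc ▸ Measure.addHaarScalarFactor_pos_of_isAddHaarMeasure _ _
  have hμ : (μH[(m : ℝ)] : Measure (Euc m)) = c • volume := by
    rw [hc]; exact Measure.isAddLeftInvariant_eq_smul _ _
  refine ⟨c * (m + 1 : ℕ), mul_ne_zero (by exact_mod_cast hcpos.ne') (by simp),
    ENNReal.mul_ne_top ENNReal.coe_ne_top (ENNReal.natCast_ne_top _), fun X h B hX hh hB hBX => ?_⟩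
  obtain ⟨Φ, hΦ⟩ : ∃ Φ : Euc (m + 1) ≃ₗᵢ[ℝ] Euc (m + 1), Φ X = EuclideanSpace.single 0 (1 : ℝ) :=
    ⟨_, Submodule.reflection_sub (by rw [hX]; simp)⟩
  obtain ⟨Ψ, hΨ⟩ : ∃ Ψ : ℝ × Euc m → Euc (m + 1), ∀ p, Ψ p = Φ.symm (consEuc p) :=
    ⟨_, fun _ => rfl⟩
  have hΨm : MeasurePreserving Ψ := by
    rw [funext hΨ]
    exact Φ.symm.measurePreserving.comp (measurePreserving_consEuc m)
  have hΨi : ∀ p, ⟪Ψ p, X⟫ = p.1 := fun p => by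
    rw [hΨ, ← Φ.inner_map_map, Φ.apply_symm_apply, hΦ, inner_consEuc]
  have hΨs : ∀ (r : ℝ) p, Ψ (r • p) = r • Ψ p := fun r p => by
    rw [hΨ, hΨ, consEuc_smul, map_smul]
  have hΨiso : Isometry fun w : Euc m => Ψ (h, w) := by
    simp_rw [hΨ]
    exact Φ.symm.isometry.comp (isometry_consEuc h)
  obtain ⟨B', hB'⟩ : ∃ B' : Set (Euc m), B' = (fun w => Ψ (h, w)) ⁻¹' B := ⟨_, rfl⟩
  have hB'm : MeasurableSet B' := hB' ▸ hΨiso.continuous.measurable hB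
  have himg : (fun w => Ψ (h, w)) '' B' = B := by
    rw [hB']
    refine image_preimage_eq_of_subset fun z hz => ?_
    obtain ⟨p, hp⟩ := consEuc_surj (Φ z)
    have hpz : Ψ p = z := by rw [hΨ, hp, Φ.symm_apply_apply]
    have h1 : p.1 = h := by rw [← hΨi, hpz, hBX z hz]
    exact ⟨p.2, by rw [← hpz, ← h1]⟩
  have hbase : μH[(m : ℝ)] B = c * volume B' := by
    rw [← himg, hΨiso.hausdorffMeasure_image (Or.inl (by positivity)), hμ]
    rfl
  obtain ⟨E, hE⟩ : ∃ E : Set (Euc (m + 1)),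
    E = {y | (0 < ⟪y, X⟫ ∧ ⟪y, X⟫ < h) ∧ (h / ⟪y, X⟫) • y ∈ B} := ⟨_, rfl⟩
  have hEm : MeasurableSet E := by
    have hi : Measurable fun y : Euc (m + 1) => ⟪y, X⟫ :=
      (continuous_id.inner continuous_const).measurable
    rw [hE]
    refine MeasurableSet.inter ((measurableSet_lt measurable_const hi).inter
      (measurableSet_lt hi measurable_const)) ?_
    exact ((measurable_const.div hi).smul measurable_id) hB
  have hvol : volume E = ENNReal.ofReal (h / (m + 1)) * volume B' := by
    rw [← hΨm.measure_preimage hEm.nullMeasurableSet, Measure.volume_eq_prod,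
      Measure.prod_apply (hΨm.measurable hEm), ← lintegral_pow_div m hh,
      ← lintegral_mul_const _ (by fun_prop), ← lintegral_indicator measurableSet_Ioo]
    refine lintegral_congr fun s => ?_
    by_cases hs : s ∈ Ioo 0 h
    · rw [indicator_of_mem hs]
      have hsh : s / h ≠ 0 := (div_pos hs.1 hh).ne'
      have h1 : Prod.mk s ⁻¹' (Ψ ⁻¹' E) = (s / h) • B' := by
        ext w
        rw [mem_smul_set_iff_inv_smul_mem₀ hsh, hE, hB']
        simp only [mem_preimage, mem_ofPred_eq, hΨi]
        have h2 : Ψ (h, (s / h)⁻¹ • w) = (h / s) • Ψ (s, w) := by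
          rw [← hΨs, inv_div, Prod.smul_mk, smul_eq_mul, div_mul_cancel₀ _ hs.1.ne']
        rw [h2]
        exact ⟨fun h => h.2, fun h => ⟨hs, h⟩⟩
      rw [h1, Measure.addHaar_smul, finrank_euclideanSpace_fin,
        abs_of_nonneg (pow_nonneg (div_nonneg hs.1.le hh.le) _)]
    · rw [indicator_of_notMem hs]
      convert measure_empty (μ := (volume : Measure (Euc m)))
      rw [eq_empty_iff_forall_notMem]
      intro w hw
      rw [hE] at hw
      simp only [mem_preimage, mem_ofPred_eq, hΨi] at hw
      exact hs hw.1
  rw [← hE, hvol, hbase]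
  have h3 : ENNReal.ofReal h = (m + 1 : ℕ) * ENNReal.ofReal (h / (m + 1)) := by
    rw [← ENNReal.ofReal_natCast, ← ENNReal.ofReal_mul (by positivity)]
    congr 1
    push_cast
    field_simp
  rw [h3]
  ring

end PlanarCone

/-! ### Comparison of the surface measure with the cone measure near a regular point -/

section LocalComparison

variable {Ω : Set (Euc n)} {u : Euc n → ℝ}

/-- The radial projection onto the hyperplane `⟨z, X⟩ = h`. -/
def planeProj (X : Euc n) (h : ℝ) (x : Euc n) : Euc n := (h / ⟪x, X⟫) • x

lemma TorsionData.exists_inner_estimates (T : TorsionData Ω u) {x₀ : Euc n} (hr : IsReg Ω x₀)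
    {h q ε : ℝ} (hh : h = ⟪x₀, gaussMap (closure Ω) x₀⟫) (hq : 1 < q) (hε : 0 < ε) :
    ∃ δ > 0, δ ≤ 1 ∧ ∀ x ∈ frontier Ω, dist x x₀ < δ →
      (h / q ≤ ⟪x, gaussMap (closure Ω) x₀⟫ ∧ ⟪x, gaussMap (closure Ω) x₀⟫ ≤ q * h) ∧
      (IsReg Ω x → invSupp Ω x ≤ q / h ∧ (q * h)⁻¹ ≤ invSupp Ω x) ∧
      ∀ y ∈ frontier Ω, dist y x₀ < δ → |⟪x - y, gaussMap (closure Ω) x₀⟫| ≤ ε * ‖x - y‖ := by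
  have hs := hr.gaussMap_spec
  have hhpos : 0 < h := hh ▸ T.inner_normal_pos hs
  obtain ⟨X₀, hX₀⟩ : ∃ X₀, X₀ = gaussMap (closure Ω) x₀ := ⟨_, rfl⟩
  rw [← hX₀] at hs hh ⊢
  have hq0 : 0 < q := by linarith
  obtain ⟨τ, hτ⟩ : ∃ τ, τ = h - h / q := ⟨_, rfl⟩
  have hτ0 : 0 < τ := by rw [hτ, sub_pos]; exact div_lt_self hhpos hq
  have hτ1 : h + τ ≤ q * h := by
    have e : q * h - (h + τ) = h / q * (q - 1) ^ 2 := by rw [hτ]; field_simp; ring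
    have : 0 ≤ h / q * (q - 1) ^ 2 := by positivity
    linarith
  obtain ⟨M, hM⟩ : ∃ M, M = ‖x₀‖ + 1 := ⟨_, rfl⟩
  have hM0 : 0 < M := by rw [hM]; positivity
  obtain ⟨δ, hδ, hnear⟩ := hr.exists_near (r := min ε (τ / (2 * M))) (lt_min hε (by positivity))
  rw [← hX₀] at hnear
  refine ⟨min δ (min 1 (τ / 2)), lt_min hδ (lt_min one_pos (by positivity)),
    (min_le_right _ _).trans (min_le_left _ _), fun x hx hxd => ?_⟩
  have hd1 := hxd.trans_le (min_le_left _ _)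
  have hd2 := hxd.trans_le ((min_le_right _ _).trans (min_le_right _ _))
  have hkey : ∀ X : Euc n, ‖X‖ = 1 → |⟪x - x₀, X⟫| ≤ τ / 2 := fun X hX => by
    have h1 := abs_real_inner_le_norm (x - x₀) X
    rw [hX, mul_one, ← dist_eq_norm] at h1
    linarith
  refine ⟨?_, fun hreg => ?_, fun y hy hyd => ?_⟩
  · have h1 := abs_le.1 (hkey X₀ hs.1)
    rw [inner_sub_left, ← hh] at h1
    constructor <;> linarith
  · have hsx := hreg.gaussMap_spec
    have h1 := abs_le.1 (hkey _ hsx.1)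
    have h2 := hnear x hd1 _ hsx
    have h3 := abs_real_inner_le_norm x₀ (gaussMap (closure Ω) x - X₀)
    have h4 : ‖x₀‖ * ‖gaussMap (closure Ω) x - X₀‖ ≤ M * (τ / (2 * M)) :=
      mul_le_mul (by linarith) (h2.le.trans (min_le_right _ _)) (norm_nonneg _) hM0.le
    have h5 : M * (τ / (2 * M)) = τ / 2 := by field_simp
    have h6 := abs_le.1 (h3.trans (h4.trans_eq h5))
    rw [inner_sub_left] at h1
    rw [inner_sub_right, ← hh] at h6
    have h7 : h / q ≤ ⟪x, gaussMap (closure Ω) x⟫ := by linarith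
    have h8 : ⟪x, gaussMap (closure Ω) x⟫ ≤ q * h := by linarith
    refine ⟨?_, ?_⟩
    · rw [invSupp, ← inv_div]
      exact inv_anti₀ (by positivity) h7
    · exact inv_anti₀ (T.inner_normal_pos hsx) h8
  · obtain ⟨X, hX⟩ := T.exists_isOuterNormalAt hx
    obtain ⟨Y, hY⟩ := T.exists_isOuterNormalAt hy
    have h1 := (hnear x hd1 X hX).le.trans (min_le_left _ _)
    have h2 := (hnear y (hyd.trans_le (min_le_left _ _)) Y hY).le.trans (min_le_left _ _)
    have h3 := hX.2 y (frontier_subset_closure hy)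
    have h4 := hY.2 x (frontier_subset_closure hx)
    have h5 := abs_le.1 ((abs_real_inner_le_norm (x - y) (X - X₀)).trans
      (mul_le_mul_of_nonneg_left h1 (norm_nonneg _)))
    have h6 := abs_le.1 ((abs_real_inner_le_norm (x - y) (Y - X₀)).trans
      (mul_le_mul_of_nonneg_left h2 (norm_nonneg _)))
    simp only [inner_sub_left, inner_sub_right] at h5 h6 ⊢
    rw [abs_le]
    constructor <;> linarith

lemma planeProj_bilipschitz {X x y : Euc n} {h q M : ℝ} (hq : 1 < q) (hh : 0 < h) (hM : 0 < M)
    (hx : h / q ≤ ⟪x, X⟫ ∧ ⟪x, X⟫ ≤ q * h) (hy : h / q ≤ ⟪y, X⟫) (hyM : ‖y‖ ≤ M)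
    (hxy : |⟪x - y, X⟫| ≤ (q - 1) * h / (q ^ 4 * M) * ‖x - y‖) :
    ‖planeProj X h x - planeProj X h y‖ ≤ q ^ 2 * ‖x - y‖ ∧
      ‖x - y‖ ≤ q ^ 2 * ‖planeProj X h x - planeProj X h y‖ := by
  have hq0 : 0 < q := by linarith
  have hx0 : 0 < ⟪x, X⟫ := (by positivity : 0 < h / q).trans_le hx.1
  have hy0 : 0 < ⟪y, X⟫ := (by positivity : 0 < h / q).trans_le hy
  obtain ⟨a, ha⟩ : ∃ a, a = h / ⟪x, X⟫ := ⟨_, rfl⟩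
  have ha1 : a ≤ q := by
    rw [ha, div_le_iff₀ hx0, ← div_le_iff₀' hq0]; exact hx.1
  have ha2 : 1 / q ≤ a := by
    rw [ha, div_le_div_iff₀ hq0 hx0]; linarith [hx.2]
  have e1 : planeProj X h x - planeProj X h y =
      a • (x - y) + (a - h / ⟪y, X⟫) • y := by
    rw [planeProj, planeProj, ← ha, smul_sub, sub_smul]; abel
  have e2 : ‖(a - h / ⟪y, X⟫) • y‖ ≤ (q - 1) / q ^ 2 * ‖x - y‖ := by
    have e3 : a - h / ⟪y, X⟫ = -(h * ⟪x - y, X⟫ / (⟪x, X⟫ * ⟪y, X⟫)) := by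
      rw [ha, inner_sub_left]; field_simp; ring
    rw [norm_smul, e3, norm_neg, Real.norm_eq_abs, abs_div, abs_mul, abs_of_pos hh,
      abs_of_pos (mul_pos hx0 hy0)]
    have e4 : h / q * (h / q) ≤ ⟪x, X⟫ * ⟪y, X⟫ :=
      mul_le_mul hx.1 hy (by positivity) hx0.le
    have e5 : h * |⟪x - y, X⟫| / (⟪x, X⟫ * ⟪y, X⟫) ≤
        h * ((q - 1) * h / (q ^ 4 * M) * ‖x - y‖) / (h / q * (h / q)) := by
      gcongr
    refine (mul_le_mul e5 hyM (norm_nonneg _) (le_trans (by positivity) e5)).trans_eq ?_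
    field_simp
  have e6 : ‖a • (x - y)‖ = a * ‖x - y‖ := by
    rw [norm_smul, Real.norm_of_nonneg (le_trans (by positivity) ha2)]
  have hN := norm_nonneg (x - y)
  have hz : (q - 1) / q ^ 2 ≤ q ^ 2 - q := by
    rw [div_le_iff₀ (by positivity)]
    have h1 : 1 ≤ q ^ 3 := one_le_pow₀ hq.le
    nlinarith
  refine ⟨?_, ?_⟩
  · rw [e1]
    refine (norm_add_le _ _).trans ?_
    rw [e6]
    nlinarith
  · have e7 : a * ‖x - y‖ - (q - 1) / q ^ 2 * ‖x - y‖ ≤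
        ‖planeProj X h x - planeProj X h y‖ := by
      have := norm_sub_le (a • (x - y) + (a - h / ⟪y, X⟫) • y) ((a - h / ⟪y, X⟫) • y)
      rw [add_sub_cancel_right, e6, ← e1] at this
      linarith
    have e8 : 1 / q * ‖x - y‖ ≤ a * ‖x - y‖ := mul_le_mul_of_nonneg_right ha2 hN
    have e9 : 1 / q - (q - 1) / q ^ 2 = 1 / q ^ 2 := by field_simp; ring
    have e10 : 1 / q ^ 2 * ‖x - y‖ ≤ ‖planeProj X h x - planeProj X h y‖ := by
      rw [← e9, sub_mul]; linarith
    rw [div_mul_eq_mul_div, one_mul, div_le_iff₀ (by positivity)] at e10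
    linarith

end LocalComparison

section LocalMeasure

variable {Ω : Set (Euc n)} {u : Euc n → ℝ}

/-- The surface measure of the part `A` of the boundary, up to a constant, read off from the
cone over `A`. -/
def coneMeas (Ω A : Set (Euc n)) : ℝ≥0∞ :=
  ∫⁻ y in Ω ∩ rad Ω ⁻¹' A, ENNReal.ofReal (invSupp Ω (rad Ω y))

lemma TorsionData.rad_of_mem_frontier (T : TorsionData Ω u) {x : Euc n} (hx : x ∈ frontier Ω) :
    rad Ω x = x := by
  rw [rad, T.gauge_eq_one hx, inv_one, one_smul]

lemma hausdorff_image_le (hn : 0 < n) {f : Euc n → Euc n} {A : Set (Euc n)} {Q : ℝ≥0} (hQ : 1 ≤ Q)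
    (hf : ∀ x ∈ A, ∀ y ∈ A, ‖f x - f y‖ ≤ (Q : ℝ) ^ 2 * ‖x - y‖) :
    μH[(n : ℝ) - 1] (f '' A) ≤ (Q : ℝ≥0∞) ^ (2 * n) * μH[(n : ℝ) - 1] A := by
  have hn1 : (1 : ℝ) ≤ n := by exact_mod_cast hn
  have hL : LipschitzOnWith (Q ^ 2) f A := LipschitzOnWith.of_dist_le_mul fun x hx y hy => by
    rw [dist_eq_norm, dist_eq_norm]
    exact_mod_cast hf x hx y hy
  refine (hL.hausdorffMeasure_image_le (sub_nonneg.2 hn1)).trans (mul_le_mul_left ?_ _)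
  have h1 : (1 : ℝ≥0∞) ≤ ((Q ^ 2 : ℝ≥0) : ℝ≥0∞) := by
    exact_mod_cast one_le_pow₀ hQ
  refine (ENNReal.rpow_le_rpow_of_exponent_le h1 (by linarith : (n : ℝ) - 1 ≤ n)).trans_eq ?_
  rw [ENNReal.rpow_natCast, ENNReal.coe_pow, pow_mul]

lemma volume_le_of_subset_smul {A B : Set (Euc n)} {Q : ℝ≥0} (h : A ⊆ (Q : ℝ) • B) :
    volume A ≤ (Q : ℝ≥0∞) ^ n * volume B := by
  refine (measure_mono h).trans_eq ?_
  rw [Measure.addHaar_smul_of_nonneg (volume : Measure (Euc n)) Q.coe_nonneg,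
    finrank_euclideanSpace_fin,
    ENNReal.ofReal_pow Q.coe_nonneg, ENNReal.ofReal_coe_nnreal]

lemma TorsionData.local_comparison (T : TorsionData Ω u) {c : ℝ≥0∞}
    (hc : ∀ (X : Euc n) (h : ℝ) (B : Set (Euc n)), ‖X‖ = 1 → 0 < h → MeasurableSet B →
      (∀ z ∈ B, ⟪z, X⟫ = h) → ENNReal.ofReal h * μH[(n : ℝ) - 1] B =
        c * volume {y : Euc n | (0 < ⟪y, X⟫ ∧ ⟪y, X⟫ < h) ∧ (h / ⟪y, X⟫) • y ∈ B})
    {x₀ : Euc n} (hr : IsReg Ω x₀) {Q : ℝ≥0} (hQ : 1 < Q) :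
    ∃ δ > 0, ∀ A : Set (Euc n), MeasurableSet A → A ⊆ frontier Ω → A ⊆ ball x₀ δ →
      (∀ x ∈ A, IsReg Ω x) →
      μH[(n : ℝ) - 1] A ≤ (Q : ℝ≥0∞) ^ (3 * n + 1) * (c * coneMeas Ω A) ∧
        c * coneMeas Ω A ≤ (Q : ℝ≥0∞) ^ (3 * n + 1) * μH[(n : ℝ) - 1] A := by
  have hs := hr.gaussMap_spec
  obtain ⟨h, hh⟩ : ∃ h, h = ⟪x₀, gaussMap (closure Ω) x₀⟫ := ⟨_, rfl⟩
  have hh0 : 0 < h := hh ▸ T.inner_normal_pos hs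
  have hq : (1 : ℝ) < Q := by exact_mod_cast hQ
  have hq0 : (0 : ℝ) < Q := by linarith
  obtain ⟨M, hM⟩ : ∃ M, M = ‖x₀‖ + 1 := ⟨_, rfl⟩
  have hM0 : 0 < M := by rw [hM]; positivity
  obtain ⟨δ, hδ, hδ1, hest⟩ := T.exists_inner_estimates hr hh hq
    (ε := (Q - 1) * h / (Q ^ 4 * M)) (by have := sub_pos.2 hq; positivity)
  obtain ⟨X, hXe⟩ : ∃ X, X = gaussMap (closure Ω) x₀ := ⟨_, rfl⟩
  rw [← hXe] at hs hh hest
  refine ⟨δ, hδ, fun A hA hAf hAb hAr => ?_⟩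
  have hpos : ∀ x ∈ A, 0 < ⟪x, X⟫ := fun x hx =>
    (div_pos hh0 hq0).trans_le (hest x (hAf hx) (hAb hx)).1.1
  have hbi : ∀ x ∈ A, ∀ y ∈ A, ‖planeProj X h x - planeProj X h y‖ ≤ (Q : ℝ) ^ 2 * ‖x - y‖ ∧
      ‖x - y‖ ≤ (Q : ℝ) ^ 2 * ‖planeProj X h x - planeProj X h y‖ := fun x hx y hy => by
    have h1 := hest x (hAf hx) (hAb hx)
    refine planeProj_bilipschitz hq hh0 hM0 h1.1 (hest y (hAf hy) (hAb hy)).1.1 ?_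
      (h1.2.2 y (hAf hy) (hAb hy))
    have h2 : dist y x₀ < δ := hAb hy
    rw [dist_eq_norm] at h2
    have h3 := norm_sub_norm_le y x₀
    linarith
  obtain ⟨B, hB⟩ : ∃ B : Set (Euc n), B = {z | ⟪z, X⟫ = h} ∩ rad Ω ⁻¹' A := ⟨_, rfl⟩
  have hBm : MeasurableSet B := by
    rw [hB]
    exact (measurableSet_eq_fun (continuous_id.inner continuous_const).measurable
      measurable_const).inter (T.measurable_rad hA)
  have hradp : ∀ x ∈ A, rad Ω (planeProj X h x) = x := fun x hx => by
    rw [planeProj, rad_smul Ω (div_pos hh0 (hpos x hx)), T.rad_of_mem_frontier (hAf hx)]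
  have himg : planeProj X h '' A = B := by
    rw [hB]
    refine Subset.antisymm ?_ ?_
    · rintro _ ⟨x, hx, rfl⟩
      refine ⟨?_, ?_⟩
      · change ⟪planeProj X h x, X⟫ = h
        rw [planeProj, real_inner_smul_left, div_mul_cancel₀ _ (hpos x hx).ne']
      · rw [mem_preimage, hradp x hx]; exact hx
    · rintro z ⟨hz, hzA⟩
      have hz : ⟪z, X⟫ = h := hz
      have hz0 : z ≠ 0 := fun h0 => by
        rw [h0, inner_zero_left] at hz; exact hh0.ne hz
      have hg := T.gauge_pos hz0
      refine ⟨rad Ω z, hzA, ?_⟩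
      rw [planeProj, rad, real_inner_smul_left, hz, smul_smul]
      have : h / ((gauge Ω z)⁻¹ * h) * (gauge Ω z)⁻¹ = 1 := by field_simp
      rw [this, one_smul]
  have himg' : rad Ω '' B = A := by
    rw [← himg, image_image]
    exact (image_congr hradp).trans (image_id' A)
  have hBA : μH[(n : ℝ) - 1] B ≤ (Q : ℝ≥0∞) ^ (2 * n) * μH[(n : ℝ) - 1] A := by
    rw [← himg]
    exact hausdorff_image_le T.dim hQ.le fun x hx y hy => (hbi x hx y hy).1
  have hAB : μH[(n : ℝ) - 1] A ≤ (Q : ℝ≥0∞) ^ (2 * n) * μH[(n : ℝ) - 1] B := by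
    conv_lhs => rw [← himg']
    refine hausdorff_image_le T.dim hQ.le fun z hz w hw => ?_
    rw [← himg] at hz hw
    obtain ⟨x, hx, rfl⟩ := hz
    obtain ⟨y, hy, rfl⟩ := hw
    rw [hradp x hx, hradp y hy]
    exact (hbi x hx y hy).2
  obtain ⟨E, hE⟩ : ∃ E : Set (Euc n), E = {y | (0 < ⟪y, X⟫ ∧ ⟪y, X⟫ < h) ∧ rad Ω y ∈ A} :=
    ⟨_, rfl⟩
  have hplane : ENNReal.ofReal h * μH[(n : ℝ) - 1] B = c * volume E := by
    rw [hc X h B hs.1 hh0 hBm (fun z hz => by rw [hB] at hz; exact hz.1)]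
    congr 2
    rw [hE, hB]
    ext y
    refine and_congr_right fun hy => ?_
    have hy0 := div_pos hh0 hy.1
    change (⟪(h / ⟪y, X⟫) • y, X⟫ = h ∧ rad Ω ((h / ⟪y, X⟫) • y) ∈ A) ↔ _
    rw [rad_smul Ω hy0, real_inner_smul_left, div_mul_cancel₀ _ hy.1.ne']
    exact ⟨fun h => h.2, fun h => ⟨rfl, h⟩⟩
  obtain ⟨C, hC⟩ : ∃ C : Set (Euc n), C = Ω ∩ rad Ω ⁻¹' A := ⟨_, rfl⟩
  have hCm : MeasurableSet C := hC ▸ T.isOpen.measurableSet.inter (T.measurable_rad hA)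
  have hne : ∀ y, rad Ω y ∈ A → y ≠ 0 := by
    rintro _ hy rfl
    have := hpos _ hy
    rw [rad, smul_zero, inner_zero_left] at this
    exact lt_irrefl _ this
  have hinner : ∀ y, ⟪y, X⟫ = gauge Ω y * ⟪rad Ω y, X⟫ := fun y => by
    rw [← real_inner_smul_left, T.gauge_smul_rad]
  have hQi : (0 : ℝ) < (Q : ℝ)⁻¹ := inv_pos.2 hq0
  have hCE : volume C ≤ (Q : ℝ≥0∞) ^ n * volume E := by
    refine volume_le_of_subset_smul fun y hy => ?_
    rw [hC] at hy
    rw [mem_smul_set_iff_inv_smul_mem₀ hq0.ne', hE]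
    have hg := T.gauge_pos (hne y hy.2)
    have hg1 := T.gauge_lt_one.2 hy.1
    have hp := hpos _ hy.2
    have hle := (hest _ (hAf hy.2) (hAb hy.2)).1.2
    refine ⟨⟨?_, ?_⟩, ?_⟩
    · rw [real_inner_smul_left, hinner]; positivity
    · rw [real_inner_smul_left, hinner, inv_mul_lt_iff₀ hq0]
      nlinarith
    · rw [rad_smul Ω hQi]; exact hy.2
  have hEC : volume E ≤ (Q : ℝ≥0∞) ^ n * volume C := by
    refine volume_le_of_subset_smul fun y hy => ?_
    rw [hE] at hy
    rw [mem_smul_set_iff_inv_smul_mem₀ hq0.ne', hC]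
    have hy2 := hy.2
    have hp := hpos _ hy2
    have hle := (hest _ (hAf hy2) (hAb hy2)).1.1
    have h1 := hy.1.2
    rw [hinner] at h1
    refine ⟨?_, ?_⟩
    · rw [← T.gauge_lt_one, gauge_smul' Ω hQi.le, inv_mul_lt_iff₀ hq0, mul_one]
      rw [div_le_iff₀ hq0] at hle
      by_contra hcon
      rw [not_lt] at hcon
      nlinarith
    · rw [mem_preimage, rad_smul Ω hQi]; exact hy2
  have hcm1 : coneMeas Ω A ≤ ENNReal.ofReal (Q / h) * volume C := by
    rw [coneMeas, ← hC, ← setLIntegral_const]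
    refine setLIntegral_mono' hCm fun y hy => ENNReal.ofReal_le_ofReal ?_
    rw [hC] at hy
    exact ((hest _ (hAf hy.2) (hAb hy.2)).2.1 (hAr _ hy.2)).1
  have hcm2 : ENNReal.ofReal ((Q * h)⁻¹) * volume C ≤ coneMeas Ω A := by
    rw [coneMeas, ← hC, ← setLIntegral_const]
    refine setLIntegral_mono' hCm fun y hy => ENNReal.ofReal_le_ofReal ?_
    rw [hC] at hy
    exact ((hest _ (hAf hy.2) (hAb hy.2)).2.1 (hAr _ hy.2)).2
  have hH0 : ENNReal.ofReal h ≠ 0 := (ENNReal.ofReal_pos.2 hh0).ne'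
  have hHt : ENNReal.ofReal h ≠ ⊤ := ENNReal.ofReal_ne_top
  have hQe : ENNReal.ofReal (Q : ℝ) = Q := ENNReal.ofReal_coe_nnreal
  have hvolC : volume C ≤ Q * ENNReal.ofReal h * coneMeas Ω A := by
    calc volume C = ENNReal.ofReal (Q * h) * (ENNReal.ofReal ((Q * h)⁻¹) * volume C) := by
          rw [← mul_assoc, ← ENNReal.ofReal_mul (by positivity), mul_inv_cancel₀ (by positivity),
            ENNReal.ofReal_one, one_mul]
      _ ≤ ENNReal.ofReal (Q * h) * coneMeas Ω A := by gcongr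
      _ = _ := by rw [ENNReal.ofReal_mul hq0.le, hQe]
  have hcone : ENNReal.ofReal h * coneMeas Ω A ≤ Q * volume C := by
    calc ENNReal.ofReal h * coneMeas Ω A
        ≤ ENNReal.ofReal h * (ENNReal.ofReal (Q / h) * volume C) := by gcongr
      _ = _ := by
          rw [← mul_assoc, ← ENNReal.ofReal_mul hh0.le, mul_div_cancel₀ _ hh0.ne', hQe]
  constructor
  · rw [← ENNReal.mul_le_mul_iff_right hH0 hHt]
    calc ENNReal.ofReal h * μH[(n : ℝ) - 1] A
        ≤ ENNReal.ofReal h * ((Q : ℝ≥0∞) ^ (2 * n) * μH[(n : ℝ) - 1] B) := by gcongr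
      _ = (Q : ℝ≥0∞) ^ (2 * n) * (c * volume E) := by rw [← hplane]; ring
      _ ≤ (Q : ℝ≥0∞) ^ (2 * n) * (c * ((Q : ℝ≥0∞) ^ n *
            (Q * ENNReal.ofReal h * coneMeas Ω A))) := by gcongr; exact hEC.trans (by gcongr)
      _ = _ := by ring
  · rw [← ENNReal.mul_le_mul_iff_right hH0 hHt]
    calc ENNReal.ofReal h * (c * coneMeas Ω A)
        = c * (ENNReal.ofReal h * coneMeas Ω A) := by ring
      _ ≤ c * (Q * volume C) := by gcongr
      _ ≤ c * (Q * ((Q : ℝ≥0∞) ^ n * volume E)) := by gcongr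
      _ = (Q : ℝ≥0∞) ^ (n + 1) * (ENNReal.ofReal h * μH[(n : ℝ) - 1] B) := by rw [hplane]; ring
      _ ≤ (Q : ℝ≥0∞) ^ (n + 1) * (ENNReal.ofReal h *
            ((Q : ℝ≥0∞) ^ (2 * n) * μH[(n : ℝ) - 1] A)) := by gcongr
      _ = _ := by ring

end LocalMeasure

section BoundaryMeasure

variable {Ω : Set (Euc n)} {u : Euc n → ℝ}

/-- The regular part of the boundary, where the outer unit normal is unique. -/
def regBdry (Ω : Set (Euc n)) : Set (Euc n) := {x ∈ frontier Ω | IsReg Ω x}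

lemma TorsionData.measurableSet_regBdry (T : TorsionData Ω u) : MeasurableSet (regBdry Ω) := by
  obtain ⟨S, hS⟩ : ∃ S : ℕ → Set (Euc n), S = fun k : ℕ => {x | x ∈ frontier Ω ∧ ∃ X Y,
    IsOuterNormalAt (closure Ω) x X ∧ IsOuterNormalAt (closure Ω) x Y ∧
      1 / ((k : ℝ) + 1) ≤ dist X Y} := ⟨_, rfl⟩
  have hcl : ∀ k, IsClosed (S k) := fun k => by
    refine IsSeqClosed.isClosed fun z x hz hzx => ?_
    rw [hS] at hz ⊢
    choose hzf X Y hX hY hXY using hz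
    obtain ⟨X₀, -, φ, hφ, hφX⟩ := (isCompact_sphere (0 : Euc n) 1).tendsto_subseq
      (x := X) fun j => by simpa using (hX j).1
    obtain ⟨Y₀, -, ψ, hψ, hψY⟩ := (isCompact_sphere (0 : Euc n) 1).tendsto_subseq
      (x := Y ∘ φ) fun j => by simpa using (hY _).1
    have hz' : Tendsto (fun j => z (φ (ψ j))) atTop (𝓝 x) :=
      hzx.comp (hφ.tendsto_atTop.comp hψ.tendsto_atTop)
    have hX' : Tendsto (fun j => X (φ (ψ j))) atTop (𝓝 X₀) := hφX.comp hψ.tendsto_atTop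
    have hY' : Tendsto (fun j => Y (φ (ψ j))) atTop (𝓝 Y₀) := hψY
    exact ⟨isClosed_frontier.mem_of_tendsto hzx (Eventually.of_forall hzf), X₀, Y₀,
      isOuterNormalAt_of_tendsto hz' hX' fun _ => hX _,
      isOuterNormalAt_of_tendsto hz' hY' fun _ => hY _,
      ge_of_tendsto' (hX'.dist hY') fun _ => hXY _⟩
  have : regBdry Ω = frontier Ω \ ⋃ k, S k := by
    ext x
    refine and_congr_right fun hx => ?_
    rw [mem_iUnion, not_exists]
    constructor
    · rintro ⟨X, hX, hu⟩ k hk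
      rw [hS] at hk
      obtain ⟨-, Y, Z, hY, hZ, hd⟩ := hk
      rw [hu Y hY, hu Z hZ, dist_self] at hd
      exact absurd hd (not_le.2 (by positivity))
    · intro h
      obtain ⟨X, hX⟩ := T.exists_isOuterNormalAt hx
      refine ⟨X, hX, fun Y hY => ?_⟩
      by_contra hne
      obtain ⟨k, hk⟩ := exists_nat_one_div_lt (dist_pos.2 hne)
      exact h k (by rw [hS]; exact ⟨hx, Y, X, hY, hX, hk.le⟩)
  rw [this]
  exact isClosed_frontier.measurableSet.diff (MeasurableSet.iUnion fun k => (hcl k).measurableSet)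

lemma continuousOn_gaussMap : ContinuousOn (gaussMap (closure Ω)) (regBdry Ω) := by
  intro x hx
  rw [Metric.continuousWithinAt_iff]
  intro ε hε
  obtain ⟨δ, hδ, h⟩ := hx.2.exists_near hε
  exact ⟨δ, hδ, fun z hz hzx => by
    rw [dist_eq_norm]
    exact h z hzx _ hz.2.gaussMap_spec⟩

lemma TorsionData.measurableSet_gaussMap (T : TorsionData Ω u) {η : Set (Euc n)}
    (hη : MeasurableSet η) : MeasurableSet (regBdry Ω ∩ gaussMap (closure Ω) ⁻¹' η) := by
  have h := (continuousOn_gaussMap (Ω := Ω)).measurable_piecewise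
    (continuousOn_const (c := (0 : Euc n))) T.measurableSet_regBdry
  convert! T.measurableSet_regBdry.inter (h hη) using 1
  ext x
  refine and_congr_right fun hx => ?_
  rw [mem_preimage, mem_preimage, piecewise_eq_of_mem _ _ _ hx]

lemma gaussMap_of_not_isReg {x : Euc n} (h : ¬ IsReg Ω x) : gaussMap (closure Ω) x = 0 := by
  have h' : ¬ ∃! X, IsOuterNormalAt (closure Ω) x X := h
  rw [gaussMap, dif_neg h']

lemma TorsionData.measurableSet_frontier_gaussMap (T : TorsionData Ω u) {η : Set (Euc n)}
    (hη : MeasurableSet η) : MeasurableSet (frontier Ω ∩ gaussMap (closure Ω) ⁻¹' η) := by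
  have : frontier Ω ∩ gaussMap (closure Ω) ⁻¹' η =
      (regBdry Ω ∩ gaussMap (closure Ω) ⁻¹' η) ∪ ((frontier Ω \ regBdry Ω) ∩ {_x | 0 ∈ η}) := by
    ext x
    by_cases hx : IsReg Ω x
    · simp [regBdry, hx]
    · simp [regBdry, hx, gaussMap_of_not_isReg hx]
  rw [this]
  exact (T.measurableSet_gaussMap hη).union
    ((isClosed_frontier.measurableSet.diff T.measurableSet_regBdry).inter (MeasurableSet.const _))

lemma TorsionData.measurable_ntSlope (T : TorsionData Ω u) :
    Measurable ((regBdry Ω).indicator (ntSlope Ω u)) := by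
  refine measurable_of_Iio fun a => ?_
  rcases le_or_gt a 0 with ha | ha
  · convert! MeasurableSet.empty using 1
    refine eq_empty_of_forall_notMem fun x hx => ?_
    have h0 : 0 ≤ (regBdry Ω).indicator (ntSlope Ω u) x :=
      indicator_nonneg (fun _ _ => norm_nonneg _) x
    exact absurd (h0.trans_lt hx) (not_lt.2 ha)
  · obtain ⟨V, hV⟩ : ∃ V : Set (Euc n), V = {x | ∃ δ > 0, ∃ y, dist x y < δ ∧
      ∀ z ∈ frontier Ω, dist z y < δ → ntSlope Ω u z < a} := ⟨_, rfl⟩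
    have hVo : IsOpen V := by
      rw [Metric.isOpen_iff]
      intro x hx
      rw [hV] at hx ⊢
      obtain ⟨δ, hδ, y, hxy, hy⟩ := hx
      refine ⟨δ - dist x y, sub_pos.2 hxy, fun w hw => ⟨δ, hδ, y, ?_, hy⟩⟩
      rw [mem_ball] at hw
      linarith [dist_triangle w x y]
    convert! T.measurableSet_regBdry.compl.union hVo.measurableSet using 1
    ext x
    by_cases hx : x ∈ regBdry Ω
    · rw [mem_preimage, indicator_of_mem hx, mem_union, mem_compl_iff, hV]
      constructor
      · intro h
        have h' : ntSlope Ω u x < a := h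
        obtain ⟨δ, hδ, hz⟩ := T.ntSlope_usc hx.1 hx.2 (half_pos (sub_pos.2 h'))
        exact Or.inr ⟨δ, hδ, x, by rwa [dist_self], fun z hz1 hz2 => by
          linarith [hz z hz1 hz2]⟩
      · rintro (h | ⟨δ, hδ, y, hxy, hy⟩)
        · exact absurd hx h
        · exact hy x hx.1 hxy
    · rw [mem_preimage, indicator_of_notMem hx]
      exact ⟨fun _ => Or.inl hx, fun _ => ha⟩

lemma measure_le_mul_of_local {α β : Measure (Euc n)} {N : Set (Euc n)} {K : ℝ≥0∞}
    (h : ∀ x ∈ N, ∃ δ > 0, ∀ A, MeasurableSet A → A ⊆ N → A ⊆ ball x δ → α A ≤ K * β A)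
    {A : Set (Euc n)} (hA : MeasurableSet A) (hAN : A ⊆ N) : α A ≤ K * β A := by
  rcases A.eq_empty_or_nonempty with rfl | hne
  · simp
  choose! δ hδ hd using h
  obtain ⟨t, htA, htc, htu⟩ := TopologicalSpace.countable_cover_nhdsWithin
    (f := fun x => ball x (δ x)) (s := A)
    fun x hx => mem_nhdsWithin_of_mem_nhds (ball_mem_nhds x (hδ x (hAN hx)))
  have htne : t.Nonempty := by
    rw [nonempty_iff_ne_empty]
    rintro rfl
    simp only [mem_empty_iff_false, iUnion_false, iUnion_empty, subset_empty_iff] at htu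
    exact hne.ne_empty htu
  obtain ⟨f, hf⟩ := htc.exists_eq_range htne
  have hfA : ∀ k, f k ∈ A := fun k => htA (hf ▸ mem_range_self k)
  obtain ⟨D, hD⟩ : ∃ D : ℕ → Set (Euc n),
    D = disjointed fun k => ball (f k) (δ (f k)) ∩ A := ⟨_, rfl⟩
  have hDs : ∀ k, D k ⊆ ball (f k) (δ (f k)) ∩ A := fun k => by
    rw [hD]; exact disjointed_subset _ k
  have hDm : ∀ k, MeasurableSet (D k) := fun k => by
    rw [hD]; exact MeasurableSet.disjointed (fun k => measurableSet_ball.inter hA) k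
  have hDd : Pairwise (Function.onFun Disjoint D) := by rw [hD]; exact disjoint_disjointed _
  have hDu : ⋃ k, D k = A := by
    rw [hD, iUnion_disjointed, ← iUnion_inter, inter_eq_right]
    refine htu.trans ?_
    rw [hf, biUnion_range]
  rw [← hDu, measure_iUnion hDd hDm, measure_iUnion hDd hDm, ← ENNReal.tsum_mul_left]
  exact ENNReal.tsum_le_tsum fun k => hd _ (hAN (hfA k)) _ (hDm k)
    (((hDs k).trans inter_subset_right).trans hAN) ((hDs k).trans inter_subset_left)

lemma le_of_forall_one_lt_pow_mul {a b : ℝ≥0∞} (m : ℕ)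
    (h : ∀ Q : ℝ≥0, 1 < Q → a ≤ (Q : ℝ≥0∞) ^ m * b) : a ≤ b := by
  have h1 : Tendsto (fun Q : ℝ≥0 => (Q : ℝ≥0∞) ^ m * b) (𝓝[>] 1) (𝓝 b) := by
    have h2 : Tendsto (fun Q : ℝ≥0 => (Q : ℝ≥0∞)) (𝓝[>] 1) (𝓝 1) :=
      (ENNReal.tendsto_coe.2 (tendsto_id.mono_left nhdsWithin_le_nhds))
    simpa using ENNReal.Tendsto.mul_const ((ENNReal.continuous_pow m).tendsto 1 |>.comp h2)
      (Or.inl (by simp)) (b := b)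
  exact ge_of_tendsto h1 (eventually_mem_nhdsWithin.mono fun Q hQ => h Q hQ)

/-- The cone measure of `Ω`, carried by its boundary. -/
def coneMeasure (Ω : Set (Euc n)) : Measure (Euc n) :=
  ((volume.restrict Ω).withDensity fun y => ENNReal.ofReal (invSupp Ω (rad Ω y))).map (rad Ω)

lemma TorsionData.coneMeasure_apply (T : TorsionData Ω u) {A : Set (Euc n)}
    (hA : MeasurableSet A) : coneMeasure Ω A = coneMeas Ω A := by
  rw [coneMeasure, Measure.map_apply T.measurable_rad hA,
    withDensity_apply _ (T.measurable_rad hA), Measure.restrict_restrict (T.measurable_rad hA),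
    coneMeas, inter_comm]

lemma TorsionData.restrict_hausdorff (T : TorsionData Ω u) {c : ℝ≥0∞}
    (hc : ∀ (X : Euc n) (h : ℝ) (B : Set (Euc n)), ‖X‖ = 1 → 0 < h → MeasurableSet B →
      (∀ z ∈ B, ⟪z, X⟫ = h) → ENNReal.ofReal h * μH[(n : ℝ) - 1] B =
        c * volume {y : Euc n | (0 < ⟪y, X⟫ ∧ ⟪y, X⟫ < h) ∧ (h / ⟪y, X⟫) • y ∈ B}) :
    (μH[(n : ℝ) - 1] : Measure (Euc n)).restrict (regBdry Ω) = c • coneMeasure Ω := by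
  have hnull : coneMeasure Ω (regBdry Ω)ᶜ = 0 := by
    rw [T.coneMeasure_apply T.measurableSet_regBdry.compl, coneMeas]
    have : volume (Ω ∩ rad Ω ⁻¹' (regBdry Ω)ᶜ) = 0 := by
      refine measure_mono_null ?_ (ae_iff.1 T.ae_reg)
      intro y hy hcon
      exact hy.2 ⟨T.rad_mem hcon.1, hcon.2.1⟩
    rw [Measure.restrict_eq_zero.2 this, lintegral_zero_measure]
  ext A hA
  have hAm := hA.inter T.measurableSet_regBdry
  have hkey : ∀ B, MeasurableSet B → B ⊆ regBdry Ω →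
      (μH[(n : ℝ) - 1] : Measure (Euc n)) B = (c • coneMeasure Ω) B := by
    intro B hB hBs
    refine le_antisymm (le_of_forall_one_lt_pow_mul (3 * n + 1) fun Q hQ =>
      measure_le_mul_of_local (N := regBdry Ω) (fun x hx => ?_) hB hBs)
      (le_of_forall_one_lt_pow_mul (3 * n + 1) fun Q hQ =>
      measure_le_mul_of_local (N := regBdry Ω) (fun x hx => ?_) hB hBs)
    · obtain ⟨δ, hδ, h⟩ := T.local_comparison hc hx.2 hQ
      refine ⟨δ, hδ, fun A hA hAN hAb => ?_⟩
      rw [Measure.smul_apply, T.coneMeasure_apply hA, smul_eq_mul]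
      exact (h A hA (fun x hx => (hAN hx).1) hAb fun x hx => (hAN hx).2).1
    · obtain ⟨δ, hδ, h⟩ := T.local_comparison hc hx.2 hQ
      refine ⟨δ, hδ, fun A hA hAN hAb => ?_⟩
      rw [Measure.smul_apply, T.coneMeasure_apply hA, smul_eq_mul]
      exact (h A hA (fun x hx => (hAN hx).1) hAb fun x hx => (hAN hx).2).2
  rw [Measure.restrict_apply hA, hkey _ hAm inter_subset_right, Measure.smul_apply,
    Measure.smul_apply, measure_inter_conull hnull]

/-- The torsion measure in polar coordinates. -/
def polarTorsion (Ω : Set (Euc n)) (u : Euc n → ℝ) : Measure (Euc n) :=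
  ((volume.restrict Ω).withDensity fun y => ENNReal.ofReal
    (ntSlope Ω u (rad Ω y) ^ 2 * invSupp Ω (rad Ω y))).map
      fun y => gaussMap (closure Ω) (rad Ω y)

lemma TorsionData.torsionMeasure_eq (T : TorsionData Ω u) {c : ℝ≥0∞}
    (hc : ∀ (X : Euc n) (h : ℝ) (B : Set (Euc n)), ‖X‖ = 1 → 0 < h → MeasurableSet B →
      (∀ z ∈ B, ⟪z, X⟫ = h) → ENNReal.ofReal h * μH[(n : ℝ) - 1] B =
        c * volume {y : Euc n | (0 < ⟪y, X⟫ ∧ ⟪y, X⟫ < h) ∧ (h / ⟪y, X⟫) • y ∈ B})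
    {η : Set (Euc n)} (hη : MeasurableSet η) :
    torsionMeasure Ω u η = c * polarTorsion Ω u η := by
  obtain ⟨G, hG⟩ : ∃ G : Euc n → ℝ≥0∞, G = (regBdry Ω ∩ gaussMap (closure Ω) ⁻¹' η).indicator
    fun x => ENNReal.ofReal ((regBdry Ω).indicator (ntSlope Ω u) x ^ 2) := ⟨_, rfl⟩
  have hGm : Measurable G := by
    rw [hG]
    exact (ENNReal.measurable_ofReal.comp (T.measurable_ntSlope.pow_const 2)).indicator
      (T.measurableSet_gaussMap hη)
  have h1 : torsionMeasure Ω u η = ∫⁻ x, G x ∂μH[(n : ℝ) - 1] := by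
    rw [torsionMeasure, ← lintegral_indicator (T.measurableSet_frontier_gaussMap hη)]
    congr 1
    ext x
    rw [hG]
    by_cases hx : x ∈ frontier Ω ∩ gaussMap (closure Ω) ⁻¹' η
    · rw [indicator_of_mem hx]
      by_cases hr : IsReg Ω x
      · have hxr : x ∈ regBdry Ω := ⟨hx.1, hr⟩
        have hxη : x ∈ regBdry Ω ∩ gaussMap (closure Ω) ⁻¹' η := ⟨hxr, hx.2⟩
        rw [indicator_of_mem hxη, indicator_of_mem hxr, ntSlope]
      · rw [indicator_of_notMem fun h => hr h.1.2]
        have := T.ntSlope_of_not_isReg hx.1 hr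
        rw [ntSlope] at this
        simp [this]
    · rw [indicator_of_notMem hx, indicator_of_notMem fun h => hx ⟨h.1.1, h.2⟩]
  have h2 : ∫⁻ x, G x ∂μH[(n : ℝ) - 1] = ∫⁻ x in regBdry Ω, G x ∂μH[(n : ℝ) - 1] := by
    rw [← lintegral_indicator T.measurableSet_regBdry]
    congr 1
    ext x
    by_cases hx : x ∈ regBdry Ω
    · rw [indicator_of_mem hx]
    · rw [indicator_of_notMem hx, hG, indicator_of_notMem fun h => hx h.1]
  have hd := (T.aemeasurable_invSupp_rad.restrict (s := Ω)).ennreal_ofReal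
  have hg := T.aemeasurable_gaussMap_rad.restrict (s := Ω)
  rw [h1, h2, T.restrict_hausdorff hc, lintegral_smul_measure, smul_eq_mul]
  congr 1
  rw [coneMeasure, lintegral_map hGm T.measurable_rad]
  refine (lintegral_withDensity_eq_lintegral_mul₀ hd
    (hGm.comp T.measurable_rad).aemeasurable).trans ?_
  rw [polarTorsion, Measure.map_apply_of_aemeasurable
      (hg.mono_ac (withDensity_absolutelyContinuous _ _)) hη, withDensity_apply',
    ← lintegral_indicator₀ (hg.nullMeasurable hη)]
  refine lintegral_congr_ae ?_
  filter_upwards [ae_restrict_of_ae T.ae_reg] with y hy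
  have hyr : rad Ω y ∈ regBdry Ω := ⟨T.rad_mem hy.1, hy.2.1⟩
  rw [Pi.mul_apply, Function.comp_apply, hG]
  by_cases hyη : gaussMap (closure Ω) (rad Ω y) ∈ η
  · have hyη' : rad Ω y ∈ regBdry Ω ∩ gaussMap (closure Ω) ⁻¹' η := ⟨hyr, hyη⟩
    have hyη'' : y ∈ (fun y => gaussMap (closure Ω) (rad Ω y)) ⁻¹' η := hyη
    rw [indicator_of_mem hyη', indicator_of_mem hyr, indicator_of_mem hyη'',
      ← ENNReal.ofReal_mul (T.invSupp_pos hy.2.1).le, mul_comm]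
  · have hyη' : y ∉ (fun y => gaussMap (closure Ω) (rad Ω y)) ⁻¹' η := hyη
    rw [indicator_of_notMem fun h => hyη h.2, indicator_of_notMem hyη', mul_zero]

lemma TorsionData.eq_smul_polarTorsion {μ : Measure (Euc n)} [IsFiniteMeasure μ]
    (T : TorsionData Ω u) (hs : ∀ᵐ X ∂μ, ‖X‖ = 1) {a : ℝ} (ha : 0 ≤ a)
    (h : ∀ f : Euc n → ℝ, Continuous f → (∀ X, 0 ≤ f X) → ∫ X, f X ∂μ =
      a * ∫ y in Ω, ntSlope Ω u (rad Ω y) ^ 2 * f (gaussMap (closure Ω) (rad Ω y)) *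
        invSupp Ω (rad Ω y)) :
    μ = ENNReal.ofReal a • polarTorsion Ω u := by
  have hg := T.aemeasurable_gaussMap_rad.restrict (s := Ω)
  have hd2 := ((T.aemeasurable_ntSlope_rad.pow_const 2).mul T.aemeasurable_invSupp_rad).restrict
    (s := Ω)
  have hfin : IsFiniteMeasure (polarTorsion Ω u) := by
    have hi : Integrable (fun y => ntSlope Ω u (rad Ω y) ^ 2 * invSupp Ω (rad Ω y))
        (volume.restrict Ω) := by
      have := T.integrableOn_density (f := fun _ => 1) continuous_const
      simp only [mul_one] at this
      exact this
    have := isFiniteMeasure_withDensity_ofReal hi.2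
    unfold polarTorsion
    infer_instance
  have := Measure.smul_finite (polarTorsion Ω u) (c := ENNReal.ofReal a) ENNReal.ofReal_ne_top
  refine ext_of_forall_lintegral_eq_of_IsFiniteMeasure fun f => ?_
  have hfc : Continuous fun X => ((f X : ℝ≥0) : ℝ) := NNReal.continuous_coe.comp f.continuous
  have e1 : ∫⁻ X, (f X : ℝ≥0∞) ∂μ = ENNReal.ofReal (∫ X, (f X : ℝ) ∂μ) := by
    rw [ofReal_integral_eq_lintegral_ofReal (integrable_of_ae_sphere hs hfc)
      (Eventually.of_forall fun X => (f X).coe_nonneg)]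
    simp
  have hfm : Measurable fun X => (f X : ℝ≥0∞) := f.continuous.measurable.coe_nnreal_ennreal
  have hfg := hfm.comp_aemeasurable hg
  have hac := hg.mono_ac (withDensity_absolutelyContinuous (volume.restrict Ω) fun y =>
    ENNReal.ofReal (ntSlope Ω u (rad Ω y) ^ 2 * invSupp Ω (rad Ω y)))
  rw [e1, h _ hfc fun X => (f X).coe_nonneg, ENNReal.ofReal_mul ha, lintegral_smul_measure,
    smul_eq_mul, polarTorsion, lintegral_map' hfm.aemeasurable hac]
  congr 1
  rw [ofReal_integral_eq_lintegral_ofReal (T.integrableOn_density hfc) ?_]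
  · refine Eq.trans ?_ (lintegral_withDensity_eq_lintegral_mul₀ hd2.ennreal_ofReal hfg).symm
    refine lintegral_congr_ae ?_
    filter_upwards [ae_restrict_of_ae T.ae_reg] with y hy
    have h0 := (T.invSupp_pos hy.2.1).le
    rw [Pi.mul_apply, mul_right_comm, ENNReal.ofReal_mul (by positivity),
      ENNReal.ofReal_coe_nnreal]
    rfl
  · filter_upwards [ae_restrict_of_ae T.ae_reg] with y hy
    have h0 := (T.invSupp_pos hy.2.1).le
    change (0 : ℝ) ≤ _
    positivity

end BoundaryMeasure

/-- **The Minkowski problem for the torsional rigidity: existence.**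
Given `n ≥ 2` and a non-negative Borel measure `μ` on the unit sphere `S^{n-1} ⊆ ℝⁿ`
whose barycenter is at the origin and whose support is not contained in any great
subsphere, there is an open bounded convex set `Ω ⊆ ℝⁿ` with `μ = μ_{τ,Ω}`. -/
theorem torsion_minkowski_existence (hn : 2 ≤ n)
    (μ : Measure (Euc n)) [IsFiniteMeasure μ]
    (hsphere : μ (sphere (0 : Euc n) 1)ᶜ = 0)
    (hbar : ∫ X, X ∂μ = 0)
    (hgreat : ∀ v : Euc n, v ≠ 0 → μ {X | ⟪X, v⟫ ≠ 0} ≠ 0) :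
    ∃ Ω : Set (Euc n), IsOpen Ω ∧ IsBounded Ω ∧ Convex ℝ Ω ∧ Ω.Nonempty ∧
      ∃ u : Euc n → ℝ, IsTorsionFunction Ω u ∧
        ∀ η : Set (Euc n), MeasurableSet η → μ η = torsionMeasure Ω u η := by
  have hn0 : 0 < n := by omega
  have hnr : (0 : ℝ) < n := by exact_mod_cast hn0
  have hs : ∀ᵐ X ∂μ, ‖X‖ = 1 := by
    rw [ae_iff]
    convert! hsphere using 2
    ext X
    simp
  obtain ⟨c, hc0, hct, hc⟩ := exists_planar_cone_const hn0
  have hcr : 0 < c.toReal := ENNReal.toReal_pos hc0 hct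
  obtain ⟨Ω, u, T, h⟩ := exists_polar_solution hn0 hs hbar hgreat
    (κ := n / ((n + 2) * c.toReal)) (by positivity)
  have hμ := T.eq_smul_polarTorsion hs hcr.le fun f hf hf0 => by
    have h1 := h f hf hf0
    rw [show ((n : ℝ) + 2) * (n / ((n + 2) * c.toReal)) = n * c.toReal⁻¹ by field_simp,
      mul_assoc] at h1
    have h2 := mul_left_cancel₀ hnr.ne' h1
    rw [← h2, mul_inv_cancel_left₀ hcr.ne']
  refine ⟨Ω, T.isOpen, T.bdd, T.conv, ⟨0, T.zero_mem⟩, u,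
    T.tor.isTorsionFunction T.isOpen T.bdd T.conv, fun η hη => ?_⟩
  rw [ENNReal.ofReal_toReal hct] at hμ
  rw [T.torsionMeasure_eq hc hη]
  exact (congrArg (fun m : Measure (Euc n) => m η) hμ).trans (by
    rw [Measure.smul_apply, smul_eq_mul])

end
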